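/- (Existence and uniqueness of hermitian intrinsic volumes.) Let n ≥ 1 and let k, q be integers with 0 ≤ k ≤ 2n and max(0, k−n) ≤ q ≤ ⌊k/2⌋. Then there exists a unique continuous, translation-invariant, U(n)-invariant valuation μ_{k,q} on ℂⁿ, homogeneous of degree k, with the following property: for every integer q' with max(0, k−n) ≤ q' ≤ ⌊k/2⌋, every real k-dimensional subspace E ⊆ ℂⁿ of type (k,q'), and every nonempty compact convex K ⊆ E, one has μ_{k,q}(K) = ℋ^k(K) if q' = q and μ_{k,q}(K) = 0 if q' ≠ q. -/

import Mathlib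

open MeasureTheory Pointwise
open scoped NNReal ENNReal

noncomputable section

/-- Euclidean `n`-space `ℝⁿ`. -/
abbrev Eucl (n : ℕ) : Type := EuclideanSpace ℝ (Fin n)

section Generic

variable {V : Type*} [NormedAddCommGroup V] [NormedSpace ℝ V]

/-- `μ` is a valuation: whenever the union of two convex bodies `K`, `L` is again a convex
body `M` (with intersection the convex body `I`), one has `μ M + μ I = μ K + μ L`. -/
def IsValuation (μ : ConvexBody V → ℝ) : Prop :=
  ∀ K L M I : ConvexBody V,
    (M : Set V) = (K : Set V) ∪ (L : Set V) → (I : Set V) = (K : Set V) ∩ (L : Set V) →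
      μ M + μ I = μ K + μ L

/-- The translate `K + x` of a convex body. -/
def ConvexBody.translate (K : ConvexBody V) (x : V) : ConvexBody V :=
  ⟨(K : Set V) + {x}, K.convex.add (convex_singleton x),
    K.isCompact.add isCompact_singleton, K.nonempty.add (Set.singleton_nonempty x)⟩

/-- Translation invariance of a valuation. -/
def TransInv (μ : ConvexBody V → ℝ) : Prop :=
  ∀ (K : ConvexBody V) (x : V), μ (K.translate x) = μ K

/-- The dilate `t • K` of a convex body. -/
def ConvexBody.dilate (t : ℝ) (K : ConvexBody V) : ConvexBody V :=
  ⟨t • (K : Set V), K.convex.smul t, K.isCompact.smul t, K.nonempty.smul_set⟩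

/-- Homogeneity of degree `k` of a valuation: `μ (t • K) = t ^ k * μ K` for `t > 0`. -/
def Homog (k : ℕ) (μ : ConvexBody V → ℝ) : Prop :=
  ∀ (K : ConvexBody V) (t : ℝ), 0 < t → μ (ConvexBody.dilate t K) = t ^ k * μ K

/-- The reflection `-K` of a convex body. -/
def ConvexBody.reflect (K : ConvexBody V) : ConvexBody V :=
  ⟨-(K : Set V), K.convex.neg, K.isCompact.neg, K.nonempty.neg⟩

/-- Even valuations: `μ (-K) = μ K`. -/
def EvenVal (μ : ConvexBody V → ℝ) : Prop := ∀ K : ConvexBody V, μ K.reflect = μ K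

/-- Odd valuations: `μ (-K) = -μ K`. -/
def OddVal (μ : ConvexBody V → ℝ) : Prop := ∀ K : ConvexBody V, μ K.reflect = -μ K

end Generic

/-- Hermitian `n`-space `ℂⁿ`, viewed with its underlying real Euclidean structure coming
from the real inner product `⟨z,w⟩ = Re ⟪z,w⟫`. -/
abbrev Ecl (n : ℕ) : Type := EuclideanSpace ℂ (Fin n)

instance (n : ℕ) : MeasurableSpace (Ecl n) := borel _
instance (n : ℕ) : BorelSpace (Ecl n) := ⟨rfl⟩

/-- The image of a convex body in `ℂⁿ` under the `ℂ`-linear map given by a complex matrix. -/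
def matBodyC {n : ℕ} (A : Matrix (Fin n) (Fin n) ℂ) (K : ConvexBody (Ecl n)) :
    ConvexBody (Ecl n) :=
  ⟨Matrix.toEuclideanLin A '' (K : Set (Ecl n)),
    K.convex.linear_image ((Matrix.toEuclideanLin A).restrictScalars ℝ),
    K.isCompact.image (Matrix.toEuclideanLin A).continuous_of_finiteDimensional,
    K.nonempty.image _⟩

/-- Invariance of a valuation on `ℂⁿ` under the unitary group `U(n)`. -/
def UInv {n : ℕ} (μ : ConvexBody (Ecl n) → ℝ) : Prop :=
  ∀ A : Matrix (Fin n) (Fin n) ℂ, A ∈ Matrix.unitaryGroup (Fin n) ℂ →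
    ∀ K : ConvexBody (Ecl n), μ (matBodyC A K) = μ K

/-- A real subspace of `ℂⁿ` which is complex (closed under multiplication by `i`). -/
def IsComplexSubspace {n : ℕ} (F : Submodule ℝ (Ecl n)) : Prop :=
  ∀ v ∈ F, Complex.I • v ∈ F

/-- A real subspace `W` of `ℂⁿ` is isotropic if `⟨iv, w⟩ = 0` for all `v, w ∈ W`, where
`⟨·,·⟩` is the real inner product. -/
def IsIsotropicSubspace {n : ℕ} (W : Submodule ℝ (Ecl n)) : Prop :=
  ∀ v ∈ W, ∀ w ∈ W, @inner ℝ _ _ (Complex.I • v) w = 0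

/-- A real `k`-dimensional subspace `E ⊆ ℂⁿ` is of type `(k,q)` if it is the orthogonal
direct sum of a complex subspace of complex dimension `q` and an isotropic real subspace of
dimension `k − 2q`. -/
def IsTypeSubspace {n : ℕ} (k q : ℕ) (E : Submodule ℝ (Ecl n)) : Prop :=
  Module.finrank ℝ E = k ∧
    ∃ F W : Submodule ℝ (Ecl n), IsComplexSubspace F ∧ Module.finrank ℝ F = 2 * q ∧
      IsIsotropicSubspace W ∧ Module.finrank ℝ W = k - 2 * q ∧
      (∀ v ∈ F, ∀ w ∈ W, @inner ℝ _ _ v w = 0) ∧ E = F ⊔ W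

/-- The Klain-type normalization of the hermitian intrinsic volume `μ_{k,q}`: on convex
bodies inside a subspace of type `(k,q')` it equals `δ_{qq'}` times the `k`-dimensional
Hausdorff measure. -/
def HermKlainCond {n : ℕ} (k q : ℕ) (μ : ConvexBody (Ecl n) → ℝ) : Prop :=
  ∀ q' : ℕ, k - n ≤ q' → q' ≤ k / 2 →
    ∀ E : Submodule ℝ (Ecl n), IsTypeSubspace k q' E →
      ∀ K : ConvexBody (Ecl n), (K : Set (Ecl n)) ⊆ (E : Set (Ecl n)) →
        μ K = if q' = q then (μH[(k : ℝ)] (K : Set (Ecl n))).toReal else 0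

set_option linter.unusedSectionVars false
set_option linter.unusedVariables false

section SupportFunctions

variable {V : Type*} [NormedAddCommGroup V] [InnerProductSpace ℝ V]

/-- The support function of a convex body. -/
def suppFn (K : ConvexBody V) (u : V) : ℝ := sSup ((fun x => inner ℝ x u) '' (K : Set V))

theorem suppFn_isLUB (K : ConvexBody V) (u : V) :
    IsLUB ((fun x => inner ℝ x u) '' (K : Set V)) (suppFn K u) :=
  isLUB_csSup (K.nonempty.image _)
    (K.isCompact.image (by fun_prop : Continuous fun x : V => inner ℝ x u)).bddAbove

theorem inner_le_suppFn {K : ConvexBody V} {x : V} (hx : x ∈ K) (u : V) :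
    inner ℝ x u ≤ suppFn K u :=
  (suppFn_isLUB K u).1 ⟨x, hx, rfl⟩

theorem suppFn_le {K : ConvexBody V} {u : V} {c : ℝ} (h : ∀ x ∈ K, inner ℝ x u ≤ c) :
    suppFn K u ≤ c :=
  (suppFn_isLUB K u).2 (by rintro _ ⟨x, hx, rfl⟩; exact h x hx)

theorem exists_inner_eq_suppFn (K : ConvexBody V) (u : V) :
    ∃ x ∈ K, inner ℝ x u = suppFn K u := by
  obtain ⟨x, hx, h⟩ := K.isCompact.exists_isMaxOn K.nonempty
    (by fun_prop : Continuous fun x : V => inner ℝ x u).continuousOn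
  exact ⟨x, hx, le_antisymm (inner_le_suppFn hx u) (suppFn_le fun y hy => h hy)⟩

/-- Sublinear functions. -/
structure Sublin (h : V → ℝ) : Prop where
  add_le : ∀ x y, h (x + y) ≤ h x + h y
  smul : ∀ (t : ℝ), 0 ≤ t → ∀ x, h (t • x) = t * h x

theorem suppFn_sublin (K : ConvexBody V) : Sublin (suppFn K) where
  add_le x y := suppFn_le fun z hz => by
    rw [inner_add_right]
    exact add_le_add (inner_le_suppFn hz x) (inner_le_suppFn hz y)
  smul t ht x := by
    apply le_antisymm
    · exact suppFn_le fun z hz => by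
        rw [real_inner_smul_right]
        exact mul_le_mul_of_nonneg_left (inner_le_suppFn hz x) ht
    · obtain ⟨z, hz, h⟩ := exists_inner_eq_suppFn K x
      rw [← h, ← real_inner_smul_right]
      exact inner_le_suppFn hz _

theorem suppFn_add (K L : ConvexBody V) (u : V) : suppFn (K + L) u = suppFn K u + suppFn L u := by
  apply le_antisymm
  · refine suppFn_le ?_
    rintro _ ⟨x, hx, y, hy, rfl⟩
    simp only [inner_add_left]
    exact add_le_add (inner_le_suppFn hx u) (inner_le_suppFn hy u)
  · obtain ⟨x, hx, h⟩ := exists_inner_eq_suppFn K u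
    obtain ⟨y, hy, h'⟩ := exists_inner_eq_suppFn L u
    rw [← h, ← h', ← inner_add_left]
    exact inner_le_suppFn (show x + y ∈ K + L from Set.add_mem_add hx hy) u

theorem suppFn_dilate {t : ℝ} (ht : 0 ≤ t) (K : ConvexBody V) (u : V) :
    suppFn (ConvexBody.dilate t K) u = t * suppFn K u := by
  apply le_antisymm
  · refine suppFn_le ?_
    rintro _ ⟨x, hx, rfl⟩
    simp only [real_inner_smul_left]
    exact mul_le_mul_of_nonneg_left (inner_le_suppFn hx u) ht
  · obtain ⟨x, hx, h⟩ := exists_inner_eq_suppFn K u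
    rw [← h, ← real_inner_smul_left]
    exact inner_le_suppFn (show t • x ∈ ConvexBody.dilate t K from ⟨x, hx, rfl⟩) u

theorem suppFn_reflect (K : ConvexBody V) (u : V) : suppFn K.reflect u = suppFn K (-u) := by
  apply le_antisymm
  · refine suppFn_le fun x hx => ?_
    have : -x ∈ K := hx
    simpa using inner_le_suppFn this (-u)
  · refine suppFn_le fun x hx => ?_
    have : -x ∈ K.reflect := by
      change - -x ∈ K
      simpa using hx
    simpa using inner_le_suppFn this u

theorem suppFn_translate (K : ConvexBody V) (a u : V) :
    suppFn (K.translate a) u = suppFn K u + inner ℝ a u := by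
  apply le_antisymm
  · refine suppFn_le ?_
    rintro _ ⟨x, hx, y, rfl, rfl⟩
    simp only [inner_add_left]
    have := inner_le_suppFn hx u
    linarith
  · obtain ⟨x, hx, h⟩ := exists_inner_eq_suppFn K u
    rw [← h, ← inner_add_left]
    exact inner_le_suppFn (show x + a ∈ K.translate a from Set.add_mem_add hx rfl) u

theorem suppFn_zero (u : V) : suppFn (0 : ConvexBody V) u = 0 := by
  apply le_antisymm
  · refine suppFn_le fun x hx => ?_
    obtain rfl : x = 0 := hx
    simp
  · simpa using inner_le_suppFn (show (0 : V) ∈ (0 : ConvexBody V) from rfl) u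

/-- The segment from `-v` to `v`. -/
def segBody (v : V) : ConvexBody V :=
  ⟨segment ℝ (-v) v, convex_segment _ _, by
    rw [segment_eq_image]
    exact isCompact_Icc.image (by fun_prop), ⟨v, right_mem_segment ℝ _ _⟩⟩

theorem suppFn_segBody (v u : V) : suppFn (segBody v) u = |inner ℝ v u| := by
  apply le_antisymm
  · refine suppFn_le ?_
    rintro _ ⟨a, b, ha, hb, hab, rfl⟩
    rw [inner_add_left, real_inner_smul_left, real_inner_smul_left, inner_neg_left]
    have h1 := le_abs_self (inner ℝ v u)
    have h2 := neg_abs_le (inner ℝ v u)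
    obtain rfl : b = 1 - a := by linarith
    nlinarith
  · rcases abs_choice (inner ℝ v u) with h | h <;> rw [h]
    · exact inner_le_suppFn (K := segBody v) (right_mem_segment ℝ _ _) u
    · rw [← inner_neg_left]
      exact inner_le_suppFn (K := segBody v) (left_mem_segment ℝ _ _) u

variable [FiniteDimensional ℝ V]

/-- The closed ball of radius `r` as a convex body. -/
def ballBody (V : Type*) [NormedAddCommGroup V] [InnerProductSpace ℝ V] [FiniteDimensional ℝ V]
    (r : ℝ) (hr : 0 ≤ r) : ConvexBody V :=
  ⟨Metric.closedBall 0 r, convex_closedBall 0 r, isCompact_closedBall 0 r,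
    ⟨0, by simpa using hr⟩⟩

theorem suppFn_ballBody (r : ℝ) (hr : 0 ≤ r) (u : V) : suppFn (ballBody V r hr) u = r * ‖u‖ := by
  apply le_antisymm
  · refine suppFn_le fun x hx => ?_
    have : ‖x‖ ≤ r := by simpa using (show x ∈ Metric.closedBall (0 : V) r from hx)
    exact (real_inner_le_norm x u).trans (mul_le_mul_of_nonneg_right this (norm_nonneg _))
  · by_cases hu : u = 0
    · subst hu
      simpa using inner_le_suppFn (K := ballBody V r hr) (x := 0)
        (by change (0 : V) ∈ Metric.closedBall (0 : V) r; simpa using hr) 0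
    · have h0 : ‖u‖ ≠ 0 := norm_ne_zero_iff.2 hu
      have hm : (r / ‖u‖) • u ∈ ballBody V r hr := by
        change (r / ‖u‖) • u ∈ Metric.closedBall (0 : V) r
        simp [norm_smul, abs_of_nonneg hr, h0]
      have := inner_le_suppFn hm u
      rw [real_inner_smul_left, real_inner_self_eq_norm_sq] at this
      calc r * ‖u‖ = r / ‖u‖ * ‖u‖ ^ 2 := by field_simp
        _ ≤ _ := this

theorem Sublin.zero {h : V → ℝ} (hs : Sublin h) : h 0 = 0 := by
  simpa using hs.smul 0 le_rfl 0

theorem Sublin.neg_le {h : V → ℝ} (hs : Sublin h) (x : V) : -h (-x) ≤ h x := by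
  have := hs.add_le x (-x)
  rw [add_neg_cancel, hs.zero] at this
  linarith

theorem Sublin.exists_bound {h : V → ℝ} (hs : Sublin h) : ∃ C, 0 ≤ C ∧ ∀ x, h x ≤ C * ‖x‖ := by
  let b := stdOrthonormalBasis ℝ V
  refine ⟨∑ i, (|h (b i)| + |h (-b i)|), by positivity, fun x => ?_⟩
  have hsum : ∀ s : Finset (Fin (Module.finrank ℝ V)), ∀ f : Fin (Module.finrank ℝ V) → V,
      h (∑ i ∈ s, f i) ≤ ∑ i ∈ s, h (f i) := by
    intro s f
    induction s using Finset.cons_induction with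
    | empty => simp [hs.zero]
    | cons a s ha ih =>
      rw [Finset.sum_cons, Finset.sum_cons]
      exact (hs.add_le _ _).trans (by linarith)
  conv_lhs => rw [← b.sum_repr x]
  refine (hsum _ _).trans ?_
  rw [Finset.sum_mul]
  refine Finset.sum_le_sum fun i _ => ?_
  have hc : |b.repr x i| ≤ ‖x‖ := by
    rw [b.repr_apply_apply]
    simpa using abs_real_inner_le_norm (b i) x
  have e1 := le_abs_self (h (b i))
  have e2 := le_abs_self (h (-b i))
  have p1 := abs_nonneg (h (b i))
  have p2 := abs_nonneg (h (-b i))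
  rcases le_total 0 (b.repr x i) with h0 | h0
  · rw [hs.smul _ h0]
    rw [abs_of_nonneg h0] at hc
    nlinarith [norm_nonneg x]
  · have : (b.repr x i) • b i = (-(b.repr x i)) • (-b i) := by simp
    rw [this, hs.smul _ (by linarith)]
    rw [abs_of_nonpos h0] at hc
    nlinarith [norm_nonneg x]

theorem Sublin.exists_support {h : V → ℝ} (hs : Sublin h) (u : V) :
    ∃ x : V, (∀ w, inner ℝ x w ≤ h w) ∧ inner ℝ x u = h u := by
  obtain ⟨g, hg, hle⟩ : ∃ g : V →ₗ[ℝ] ℝ, g u = h u ∧ ∀ w, g w ≤ h w := by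
    have H : ∀ c : ℝ, c • u = 0 → (RingHom.id ℝ) c • h u = 0 := fun c hc => by
      rcases smul_eq_zero.1 hc with rfl | rfl
      · simp
      · simp [hs.zero]
    obtain ⟨g, hg, hle⟩ := exists_extension_of_le_sublinear (LinearPMap.mkSpanSingleton' u (h u) H)
      h (fun c hc x => hs.smul c hc.le x) hs.add_le (by
        rintro ⟨x, hx⟩
        obtain ⟨c, rfl⟩ := Submodule.mem_span_singleton.1 hx
        rw [LinearPMap.mkSpanSingleton'_apply]
        rcases le_total 0 c with hc | hc
        · exact (hs.smul c hc u).ge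
        · have h1 := hs.smul (-c) (by linarith) u
          have h2 := hs.neg_le (c • u)
          rw [← neg_smul, h1] at h2
          simpa using h2)
    refine ⟨g, ?_, hle⟩
    exact (hg ⟨u, Submodule.mem_span_singleton_self u⟩).trans
      (LinearPMap.mkSpanSingleton'_apply_self u (h u) H _)
  refine ⟨(InnerProductSpace.toDual ℝ V).symm (LinearMap.toContinuousLinearMap g), ?_, ?_⟩ <;>
    simp [hg, hle]

/-- The convex body with a given sublinear support function. -/
def ofSublin (h : V → ℝ) (hs : Sublin h) : ConvexBody V :=
  ⟨{x | ∀ u, inner ℝ x u ≤ h u}, by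
    intro x hx y hy a b ha hb hab u
    rw [inner_add_left, real_inner_smul_left, real_inner_smul_left]
    have := hx u
    have := hy u
    obtain rfl : b = 1 - a := by linarith
    nlinarith, by
    refine Metric.isCompact_of_isClosed_isBounded ?_ ?_
    · simp only [Set.ofPred_forall]
      exact isClosed_iInter fun u => isClosed_le (by fun_prop) continuous_const
    · obtain ⟨C, hC, hb⟩ := hs.exists_bound
      refine (Metric.isBounded_closedBall (x := (0 : V)) (r := C)).subset fun x hx => ?_
      have h1 := (hx x).trans (hb x)
      rw [real_inner_self_eq_norm_sq] at h1
      simp only [Metric.mem_closedBall, dist_zero_right]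
      by_contra hlt
      nlinarith [norm_nonneg x], by
    obtain ⟨x, hx, -⟩ := hs.exists_support 0
    exact ⟨x, hx⟩⟩

@[simp]
theorem suppFn_ofSublin (h : V → ℝ) (hs : Sublin h) (u : V) : suppFn (ofSublin h hs) u = h u := by
  apply le_antisymm
  · exact suppFn_le fun x hx => hx u
  · obtain ⟨x, hx, h⟩ := hs.exists_support u
    rw [← h]
    exact inner_le_suppFn (K := ofSublin _ hs) hx u

theorem mem_iff_le_suppFn {K : ConvexBody V} {x : V} :
    x ∈ K ↔ ∀ u, inner ℝ x u ≤ suppFn K u := by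
  refine ⟨fun h u => inner_le_suppFn h u, fun h => ?_⟩
  by_contra hx
  obtain ⟨f, c, hf, hc⟩ := geometric_hahn_banach_closed_point K.convex K.isClosed hx
  have e : ∀ y, f y = inner ℝ y ((InnerProductSpace.toDual ℝ V).symm f) := fun y => by
    rw [real_inner_comm]; simp
  have h1 := h ((InnerProductSpace.toDual ℝ V).symm f)
  have h2 : suppFn K ((InnerProductSpace.toDual ℝ V).symm f) ≤ c :=
    suppFn_le fun y hy => by rw [← e]; exact (hf y hy).le
  rw [← e] at h1
  linarith

theorem body_ext {K L : ConvexBody V} (h : ∀ u, suppFn K u = suppFn L u) : K = L :=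
  SetLike.ext fun x => by simp [mem_iff_le_suppFn, h]

theorem body_le {K L : ConvexBody V} (h : ∀ u, suppFn K u ≤ suppFn L u) :
    (K : Set V) ⊆ L := fun x hx =>
  mem_iff_le_suppFn.2 fun u => (inner_le_suppFn hx u).trans (h u)

theorem dist_le_of_suppFn {K L : ConvexBody V} {ε : ℝ} (hε : 0 ≤ ε)
    (h : ∀ u, |suppFn K u - suppFn L u| ≤ ε * ‖u‖) : dist K L ≤ ε := by
  have key : ∀ {K L : ConvexBody V}, (∀ u, |suppFn K u - suppFn L u| ≤ ε * ‖u‖) →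
      ∀ x ∈ (K : Set V), ∃ y ∈ (L : Set V), dist x y ≤ ε := by
    intro K L h x hx
    have hx' : x ∈ L + ballBody V ε hε := by
      refine mem_iff_le_suppFn.2 fun u => (inner_le_suppFn hx u).trans ?_
      rw [suppFn_add, suppFn_ballBody]
      linarith [(abs_le.1 (h u)).2]
    obtain ⟨y, hy, z, hz, rfl⟩ := hx'
    refine ⟨y, hy, ?_⟩
    have : z ∈ Metric.closedBall (0 : V) ε := hz
    simpa [dist_eq_norm] using this
  rw [← ConvexBody.hausdorffDist_coe]
  exact Metric.hausdorffDist_le_of_mem_dist hε (key h) (key fun u => by rw [abs_sub_comm]; exact h u)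

theorem abs_suppFn_sub_le (K L : ConvexBody V) (u : V) :
    |suppFn K u - suppFn L u| ≤ dist K L * ‖u‖ := by
  have key : ∀ K L : ConvexBody V, suppFn K u - suppFn L u ≤ dist K L * ‖u‖ := by
    intro K L
    obtain ⟨x, hx, h⟩ := exists_inner_eq_suppFn K u
    obtain ⟨y, hy, hxy⟩ := L.isCompact.exists_infDist_eq_dist L.nonempty x
    have h1 : dist x y ≤ dist K L := by
      rw [← hxy, ← ConvexBody.hausdorffDist_coe]
      exact Metric.infDist_le_hausdorffDist_of_mem hx ConvexBody.hausdorffEDist_ne_top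
    have h2 := inner_le_suppFn hy u
    have h3 := real_inner_le_norm (x - y) u
    rw [inner_sub_left, h] at h3
    rw [dist_eq_norm] at h1
    have := mul_le_mul_of_nonneg_right h1 (norm_nonneg u)
    linarith
  rw [abs_le]
  have := key K L
  have := key L K
  rw [dist_comm] at this
  constructor <;> linarith

theorem dist_add_right_le (K L S : ConvexBody V) : dist (K + S) (L + S) ≤ dist K L :=
  dist_le_of_suppFn dist_nonneg fun u => by
    rw [suppFn_add, suppFn_add, add_sub_add_right_eq_sub]
    exact abs_suppFn_sub_le K L u

theorem suppFn_continuous (K : ConvexBody V) : Continuous (suppFn K) := by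
  obtain ⟨C, hC⟩ := K.isBounded.exists_norm_le
  have key : ∀ u w, suppFn K u - suppFn K w ≤ C * dist u w := by
    intro u w
    obtain ⟨x, hx, h⟩ := exists_inner_eq_suppFn K u
    have h2 := inner_le_suppFn hx w
    have h3 := real_inner_le_norm x (u - w)
    rw [inner_sub_right, h] at h3
    have := mul_le_mul_of_nonneg_right (hC x hx) (norm_nonneg (u - w))
    rw [dist_eq_norm]
    linarith
  have hC0 : 0 ≤ C := by
    obtain ⟨x, hx⟩ := K.nonempty
    exact (norm_nonneg x).trans (hC x hx)
  refine (LipschitzWith.of_dist_le_mul (K := ⟨C, hC0⟩) fun u w => ?_).continuous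
  rw [Real.dist_eq, abs_le]
  have := key u w
  have := key w u
  rw [dist_comm] at this
  constructor
  · change -(C * dist u w) ≤ _
    linarith
  · change _ ≤ C * dist u w
    linarith

theorem Sublin.continuous {h : V → ℝ} (hs : Sublin h) : Continuous h := by
  have : h = suppFn (ofSublin h hs) := funext fun u => (suppFn_ofSublin h hs u).symm
  rw [this]
  exact suppFn_continuous _

theorem Sublin.max {f g : V → ℝ} (hf : Sublin f) (hg : Sublin g) :
    Sublin fun x => max (f x) (g x) where
  add_le x y := by
    have := hf.add_le x y
    have := hg.add_le x y
    refine max_le ?_ ?_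
    · linarith [le_max_left (f x) (g x), le_max_left (f y) (g y)]
    · linarith [le_max_right (f x) (g x), le_max_right (f y) (g y)]
  smul t ht x := by
    rw [hf.smul t ht, hg.smul t ht, mul_max_of_nonneg _ _ ht]

theorem Sublin.add {f g : V → ℝ} (hf : Sublin f) (hg : Sublin g) :
    Sublin fun x => f x + g x where
  add_le x y := by
    linarith [hf.add_le x y, hg.add_le x y]
  smul t ht x := by rw [hf.smul t ht, hg.smul t ht, mul_add]

/-- If the minimum of two support functions is a support function, the union of the bodies is
convex, its support function is the maximum, and the minimum is that of the intersection. -/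
theorem union_inter_of_min {K L M I : ConvexBody V}
    (hM : ∀ u, suppFn M u = max (suppFn K u) (suppFn L u))
    (hI : ∀ u, suppFn I u = min (suppFn K u) (suppFn L u)) :
    (M : Set V) = (K : Set V) ∪ L ∧ (I : Set V) = (K : Set V) ∩ L := by
  constructor
  · apply Set.Subset.antisymm
    · intro x hx
      by_contra hn
      simp only [Set.mem_union, not_or, SetLike.mem_coe, mem_iff_le_suppFn, not_forall,
        not_le] at hn
      obtain ⟨⟨u₁, h₁⟩, ⟨u₂, h₂⟩⟩ := hn
      let U : Set V := {u | suppFn K u < inner ℝ x u}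
      let W : Set V := {u | suppFn L u < inner ℝ x u}
      have hU : IsOpen U := isOpen_lt (suppFn_continuous K) (by fun_prop)
      have hW : IsOpen W := isOpen_lt (suppFn_continuous L) (by fun_prop)
      have hpre : IsPreconnected (segment ℝ u₁ u₂) := (convex_segment u₁ u₂).isPreconnected
      obtain ⟨w, -, hw1, hw2⟩ := hpre U W hU hW (by
        rintro _ ⟨a, b, ha, hb, hab, rfl⟩
        have e1 : suppFn I u₁ < inner ℝ x u₁ := by rw [hI]; exact (min_le_left _ _).trans_lt h₁
        have e2 : suppFn I u₂ < inner ℝ x u₂ := by rw [hI]; exact (min_le_right _ _).trans_lt h₂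
        have hs := suppFn_sublin I
        have e3 : suppFn I (a • u₁ + b • u₂) < inner ℝ x (a • u₁ + b • u₂) := by
          refine (hs.add_le _ _).trans_lt ?_
          rw [hs.smul a ha, hs.smul b hb, inner_add_right, real_inner_smul_right,
            real_inner_smul_right]
          rcases ha.eq_or_lt with rfl | ha'
          · obtain rfl : b = 1 := by linarith
            linarith
          · nlinarith
        rw [hI, min_lt_iff] at e3
        exact e3) ⟨u₁, left_mem_segment ℝ _ _, h₁⟩ ⟨u₂, right_mem_segment ℝ _ _, h₂⟩
      have := inner_le_suppFn hx w
      rw [hM] at this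
      exact absurd this (not_le.2 (max_lt hw1 hw2))
    · refine Set.union_subset (body_le fun u => ?_) (body_le fun u => ?_) <;> rw [hM]
      exacts [le_max_left _ _, le_max_right _ _]
  · ext x
    simp only [SetLike.mem_coe, Set.mem_inter_iff, mem_iff_le_suppFn, hI, le_min_iff, forall_and]

end SupportFunctions

section Calculus

variable {V : Type*} [NormedAddCommGroup V] [InnerProductSpace ℝ V] [FiniteDimensional ℝ V]

/-- Continuous translation invariant valuations. -/
structure CVal (ψ : ConvexBody V → ℝ) : Prop where
  val : IsValuation ψ
  cont : Continuous ψ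
  trans : TransInv ψ

theorem exists_mem_inter_segment {K L M : ConvexBody V} (h : (M : Set V) = (K : Set V) ∪ L)
    {x y : V} (hx : x ∈ K) (hy : y ∈ L) : ∃ z ∈ segment ℝ x y, z ∈ K ∧ z ∈ L := by
  have hpre : IsPreconnected (segment ℝ x y) := (convex_segment x y).isPreconnected
  have hsub : segment ℝ x y ⊆ (K : Set V) ∪ L := by
    rw [← h]
    refine M.convex.segment_subset ?_ ?_ <;> rw [h]
    exacts [Or.inl hx, Or.inr hy]
  obtain ⟨z, hz, hz1, hz2⟩ := isPreconnected_closed_iff.1 hpre K L K.isClosed L.isClosed hsub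
    ⟨x, left_mem_segment ℝ _ _, hx⟩ ⟨y, right_mem_segment ℝ _ _, hy⟩
  exact ⟨z, hz, hz1, hz2⟩

theorem coe_add_union {K L M : ConvexBody V} (h : (M : Set V) = (K : Set V) ∪ L)
    (S : ConvexBody V) : ((M + S : ConvexBody V) : Set V) = ((K + S : ConvexBody V) : Set V) ∪
      (L + S : ConvexBody V) := by
  simp only [ConvexBody.coe_add, h, Set.union_add]

theorem coe_add_inter {K L M I : ConvexBody V} (h : (M : Set V) = (K : Set V) ∪ L)
    (hI : (I : Set V) = (K : Set V) ∩ L)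
    (S : ConvexBody V) : ((I + S : ConvexBody V) : Set V) = ((K + S : ConvexBody V) : Set V) ∩
      (L + S : ConvexBody V) := by
  simp only [ConvexBody.coe_add, hI]
  apply Set.Subset.antisymm Set.inter_add_subset
  rintro w ⟨⟨x, hx, s, hs, rfl⟩, ⟨y, hy, t, ht, hst⟩⟩
  obtain ⟨z, ⟨a, b, ha, hb, hab, rfl⟩, hz1, hz2⟩ := exists_mem_inter_segment h hx hy
  refine ⟨_, ⟨hz1, hz2⟩, a • s + b • t, S.convex hs ht ha hb hab, ?_⟩
  simp only at hst ⊢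
  have : a • x + b • y + (a • s + b • t) = a • (x + s) + b • (y + t) := by
    simp only [smul_add]; abel
  rw [this, hst, ← add_smul, hab, one_smul]

theorem CVal.sub {φ ψ : ConvexBody V → ℝ} (hφ : CVal φ) (hψ : CVal ψ) :
    CVal fun K => φ K - ψ K where
  val K L M I hM hI := by
    have := hφ.val K L M I hM hI
    have := hψ.val K L M I hM hI
    linarith
  cont := hφ.cont.sub hψ.cont
  trans K x := by simp only [hφ.trans K x, hψ.trans K x]

theorem CVal.add {φ ψ : ConvexBody V → ℝ} (hφ : CVal φ) (hψ : CVal ψ) :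
    CVal fun K => φ K + ψ K where
  val K L M I hM hI := by
    have := hφ.val K L M I hM hI
    have := hψ.val K L M I hM hI
    linarith
  cont := hφ.cont.add hψ.cont
  trans K x := by simp only [hφ.trans K x, hψ.trans K x]

theorem CVal.const_mul {φ : ConvexBody V → ℝ} (hφ : CVal φ) (c : ℝ) :
    CVal fun K => c * φ K where
  val K L M I hM hI := by
    have := hφ.val K L M I hM hI
    rw [← mul_add, this, mul_add]
  cont := hφ.cont.const_mul c
  trans K x := by simp only [hφ.trans K x]

theorem body_translate_add (K S : ConvexBody V) (x : V) :
    K.translate x + S = (K + S).translate x :=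
  body_ext fun u => by simp only [suppFn_add, suppFn_translate]; ring

theorem continuous_add_body (S : ConvexBody V) : Continuous fun K : ConvexBody V => K + S :=
  (LipschitzWith.of_dist_le_mul (K := 1) fun K L => by
    simpa using dist_add_right_le K L S).continuous

theorem CVal.add_body {ψ : ConvexBody V → ℝ} (hψ : CVal ψ) (S : ConvexBody V) :
    CVal fun K => ψ (K + S) where
  val K L M I hM hI := hψ.val _ _ _ _ (coe_add_union hM S) (coe_add_inter hM hI S)
  cont := hψ.cont.comp (continuous_add_body S)
  trans K x := by simp only [body_translate_add, hψ.trans (K + S) x]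

/-- The difference operator in the direction of a segment. -/
def diffOp (v : V) (ψ : ConvexBody V → ℝ) (K : ConvexBody V) : ℝ := ψ (K + segBody v) - ψ K

theorem CVal.diffOp {ψ : ConvexBody V → ℝ} (hψ : CVal ψ) (v : V) : CVal (diffOp v ψ) :=
  (hψ.add_body _).sub hψ

theorem CVal.of_min {ψ : ConvexBody V → ℝ} (hψ : IsValuation ψ) {K L M I : ConvexBody V}
    (hM : ∀ u, suppFn M u = max (suppFn K u) (suppFn L u))
    (hI : ∀ u, suppFn I u = min (suppFn K u) (suppFn L u)) : ψ M + ψ I = ψ K + ψ L := by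
  obtain ⟨h1, h2⟩ := union_inter_of_min hM hI
  exact hψ K L M I h1 h2

theorem diffOp_comm (v w : V) (ψ : ConvexBody V → ℝ) :
    diffOp v (diffOp w ψ) = diffOp w (diffOp v ψ) := by
  funext K
  simp only [diffOp, add_right_comm K (segBody v) (segBody w)]
  ring

theorem segBody_abs_smul (c : ℝ) (v : V) : segBody (|c| • v) = segBody (c • v) :=
  body_ext fun u => by simp [suppFn_segBody, real_inner_smul_left, abs_mul]

theorem segBody_zero : segBody (0 : V) = 0 :=
  body_ext fun u => by simp [suppFn_segBody, suppFn_zero]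

theorem dist_segBody_le (v w : V) : dist (segBody v) (segBody w) ≤ ‖v - w‖ :=
  dist_le_of_suppFn (norm_nonneg _) fun u => by
    rw [suppFn_segBody, suppFn_segBody]
    refine (abs_abs_sub_abs_le _ _).trans ?_
    rw [← inner_sub_left]
    exact abs_real_inner_le_norm _ _

theorem continuous_segBody : Continuous (segBody : V → ConvexBody V) :=
  (LipschitzWith.of_dist_le_mul (K := 1) fun v w => by
    simpa [dist_eq_norm] using dist_segBody_le v w).continuous

theorem continuous_body_add (K : ConvexBody V) : Continuous fun S : ConvexBody V => K + S := by
  simpa only [add_comm] using continuous_add_body K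

theorem linear_of_additive_nonneg {f : ℝ → ℝ} (hc : Continuous f)
    (ha : ∀ s t, 0 ≤ s → 0 ≤ t → f (s + t) = f s + f t) {s : ℝ} (hs : 0 ≤ s) :
    f s = s * f 1 := by
  have h0 : f 0 = 0 := by have := ha 0 0 le_rfl le_rfl; simp at this; exact this
  let F : ℝ →+ ℝ :=
    { toFun := fun s => f (max s 0) - f (max (-s) 0)
      map_zero' := by simp
      map_add' := fun s t => by
        have e1 : max (s + t) 0 + (max (-s) 0 + max (-t) 0)
            = max (-(s + t)) 0 + (max s 0 + max t 0) := by
          have h : ∀ x : ℝ, max x 0 - max (-x) 0 = x := fun x => by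
            rcases le_total 0 x with h | h
            · rw [max_eq_left h, max_eq_right (by linarith)]; ring
            · rw [max_eq_right h, max_eq_left (by linarith)]; ring
          linarith [h s, h t, h (s + t)]
        have e2 := congrArg f e1
        rw [ha _ _ (le_max_right _ _) (add_nonneg (le_max_right _ _) (le_max_right _ _)),
          ha _ _ (le_max_right _ _) (le_max_right _ _),
          ha _ _ (le_max_right _ _) (add_nonneg (le_max_right _ _) (le_max_right _ _)),
          ha _ _ (le_max_right _ _) (le_max_right _ _)] at e2
        linarith }
  have hF : Continuous F := by
    change Continuous fun s => f (max s 0) - f (max (-s) 0)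
    fun_prop
  have h1 := map_real_smul F hF s 1
  have e : ∀ x, 0 ≤ x → F x = f x := fun x hx => by
    change f (max x 0) - f (max (-x) 0) = f x
    rw [max_eq_left hx, max_eq_right (by linarith), h0, sub_zero]
  simpa [e s hs, e 1 zero_le_one] using h1

theorem CVal.add_segBody {ψ : ConvexBody V → ℝ} (hψ : CVal ψ) (v : V) {s : ℝ} (hs : 0 ≤ s)
    (K : ConvexBody V) : ψ (K + segBody (s • v)) = ψ K + s * _root_.diffOp v ψ K := by
  have h := linear_of_additive_nonneg (f := fun s : ℝ => ψ (K + segBody (s • v)) - ψ K)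
    ((hψ.cont.comp ((continuous_body_add K).comp (continuous_segBody.comp (by fun_prop)))).sub
      continuous_const) (fun s t hs ht => by
      have key := CVal.of_min hψ.val (K := (K + segBody (s • v)).translate (t • v))
        (L := (K + segBody (t • v)).translate (-(s • v))) (M := K + segBody ((s + t) • v))
        (I := K.translate ((t - s) • v))
        (fun u => by
          simp only [suppFn_add, suppFn_translate, suppFn_segBody, real_inner_smul_left,
            inner_neg_left, abs_mul, abs_of_nonneg hs, abs_of_nonneg ht,
            abs_of_nonneg (add_nonneg hs ht)]
          rcases le_total 0 (inner ℝ v u) with h | h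
          · rw [abs_of_nonneg h, max_eq_left (by nlinarith)]; ring
          · rw [abs_of_nonpos h, max_eq_right (by nlinarith)]; ring)
        (fun u => by
          simp only [suppFn_add, suppFn_translate, suppFn_segBody, real_inner_smul_left,
            inner_neg_left, abs_mul, abs_of_nonneg hs, abs_of_nonneg ht]
          rcases le_total 0 (inner ℝ v u) with h | h
          · rw [abs_of_nonneg h, min_eq_right (by nlinarith)]; ring
          · rw [abs_of_nonpos h, min_eq_left (by nlinarith)]; ring)
      rw [hψ.trans, hψ.trans, hψ.trans] at key
      linarith) hs
  simp only [one_smul] at h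
  rw [_root_.diffOp]
  linarith

theorem CVal.diffOp_smul {ψ : ConvexBody V → ℝ} (hψ : CVal ψ) (c : ℝ) (v : V)
    (K : ConvexBody V) : _root_.diffOp (c • v) ψ K = |c| * _root_.diffOp v ψ K := by
  have := hψ.add_segBody v (abs_nonneg c) K
  rw [segBody_abs_smul] at this
  rw [_root_.diffOp, this]
  ring

theorem dilate_add {t : ℝ} (ht : 0 ≤ t) (K L : ConvexBody V) :
    ConvexBody.dilate t (K + L) = ConvexBody.dilate t K + ConvexBody.dilate t L :=
  body_ext fun u => by simp only [suppFn_add, suppFn_dilate ht]; ring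

theorem dilate_segBody {t : ℝ} (ht : 0 ≤ t) (v : V) :
    ConvexBody.dilate t (segBody v) = segBody (t • v) :=
  body_ext fun u => by
    simp only [suppFn_segBody, suppFn_dilate ht, real_inner_smul_left, abs_mul, abs_of_nonneg ht]

theorem CVal.homog_diffOp {ψ : ConvexBody V → ℝ} (hψ : CVal ψ) {r : ℕ} (h : Homog (r + 1) ψ)
    (v : V) : Homog r (_root_.diffOp v ψ) := by
  intro K t ht
  have e : ConvexBody.dilate t K + segBody v = ConvexBody.dilate t (K + segBody (t⁻¹ • v)) := by
    rw [dilate_add ht.le, dilate_segBody ht.le, smul_smul, mul_inv_cancel₀ ht.ne', one_smul]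
  rw [_root_.diffOp, e, h _ t ht, h _ t ht, hψ.add_segBody v (inv_nonneg.2 ht.le)]
  field_simp
  ring

theorem homog_zero_eq {ψ : ConvexBody V → ℝ} (hc : Continuous ψ) (h : Homog 0 ψ)
    (K : ConvexBody V) : ψ K = ψ 0 := by
  obtain ⟨C, hC, hb⟩ := K.isBounded.exists_pos_norm_le
  have hlim : Filter.Tendsto (fun t : ℝ => ConvexBody.dilate t K) (nhdsWithin 0 (Set.Ioi 0))
      (nhds 0) := by
    rw [tendsto_iff_dist_tendsto_zero]
    refine squeeze_zero' (g := fun t : ℝ => t * C) (Filter.Eventually.of_forall fun _ => dist_nonneg)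
      ?_ ?_
    · filter_upwards [self_mem_nhdsWithin] with t ht
      have ht : 0 < t := ht
      refine dist_le_of_suppFn (by positivity) fun u => ?_
      rw [suppFn_dilate ht.le, suppFn_zero, sub_zero, abs_mul, abs_of_pos ht, mul_assoc]
      refine mul_le_mul_of_nonneg_left ?_ ht.le
      rw [abs_le]
      constructor
      · obtain ⟨x, hx⟩ := K.nonempty
        have h1 := inner_le_suppFn hx u
        have h2 := (abs_le.1 (abs_real_inner_le_norm x u)).1
        nlinarith [hb x hx, norm_nonneg u]
      · exact suppFn_le fun x hx => (real_inner_le_norm x u).trans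
          (mul_le_mul_of_nonneg_right (hb x hx) (norm_nonneg _))
    · have : Filter.Tendsto (fun t : ℝ => t * C) (nhds 0) (nhds 0) := by
        have : Continuous fun t : ℝ => t * C := by fun_prop
        simpa using this.tendsto 0
      exact this.mono_left nhdsWithin_le_nhds
  have h1 := (hc.tendsto 0).comp hlim
  refine tendsto_nhds_unique (tendsto_const_nhds.congr' ?_) h1
  filter_upwards [self_mem_nhdsWithin] with t ht
  rw [Function.comp_apply, h K t ht, pow_zero, one_mul]

theorem dilate_zero_body (t : ℝ) (ht : 0 ≤ t) : ConvexBody.dilate t (0 : ConvexBody V) = 0 :=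
  body_ext fun u => by simp [suppFn_dilate ht, suppFn_zero]

theorem homog_succ_zero {ψ : ConvexBody V → ℝ} {r : ℕ} (h : Homog (r + 1) ψ) : ψ 0 = 0 := by
  have := h 0 2 two_pos
  rw [dilate_zero_body 2 zero_le_two] at this
  have h2 : (1 : ℝ) < 2 ^ (r + 1) := one_lt_pow₀ one_lt_two (by omega)
  nlinarith

theorem reflect_add (K L : ConvexBody V) : (K + L).reflect = K.reflect + L.reflect :=
  body_ext fun u => by simp only [suppFn_add, suppFn_reflect]

theorem reflect_segBody (v : V) : (segBody v).reflect = segBody v :=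
  body_ext fun u => by simp [suppFn_segBody, suppFn_reflect]

theorem EvenVal.diffOp {ψ : ConvexBody V → ℝ} (h : EvenVal ψ) (v : V) :
    EvenVal (diffOp v ψ) := fun K => by
  rw [_root_.diffOp, _root_.diffOp, h K, ← h (K + segBody v), reflect_add, reflect_segBody]

/-- The image of a convex body under a continuous linear map. -/
def mapBody {W : Type*} [NormedAddCommGroup W] [InnerProductSpace ℝ W]
    (f : V →L[ℝ] W) (K : ConvexBody V) : ConvexBody W :=
  ⟨f '' K, K.convex.linear_image f.toLinearMap, K.isCompact.image f.continuous, K.nonempty.image _⟩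

theorem suppFn_mapBody {f g : V →L[ℝ] V} (h : ∀ x y, inner ℝ (f x) y = inner ℝ x (g y))
    (K : ConvexBody V) (u : V) : suppFn (mapBody f K) u = suppFn K (g u) := by
  apply le_antisymm
  · refine suppFn_le ?_
    rintro _ ⟨x, hx, rfl⟩
    rw [h]
    exact inner_le_suppFn hx _
  · refine suppFn_le fun x hx => ?_
    rw [← h]
    exact inner_le_suppFn (show f x ∈ mapBody f K from ⟨x, hx, rfl⟩) u

/-- The intersection of a convex body with a closed convex set. -/
def cutBody (K : ConvexBody V) (A : Set V) (hA : Convex ℝ A) (hc : IsClosed A)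
    (hne : ((K : Set V) ∩ A).Nonempty) : ConvexBody V :=
  ⟨(K : Set V) ∩ A, K.convex.inter hA, K.isCompact.inter_right hc, hne⟩

/-- Orthogonal projection along `v`. -/
def projAlong (v : V) : V →L[ℝ] V :=
  ContinuousLinearMap.id ℝ V - (‖v‖ ^ 2)⁻¹ • ((innerSL ℝ v).smulRight v)

theorem projAlong_apply (v x : V) : projAlong v x = x - ((‖v‖ ^ 2)⁻¹ * inner ℝ v x) • v := by
  simp [projAlong, smul_smul]

theorem projAlong_symm (v x y : V) : inner ℝ (projAlong v x) y = inner ℝ x (projAlong v y) := by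
  simp only [projAlong_apply, inner_sub_left, inner_sub_right, real_inner_smul_left,
    real_inner_smul_right]
  rw [real_inner_comm v x]
  ring

theorem inner_projAlong (v x : V) : inner ℝ v (projAlong v x) = 0 := by
  rcases eq_or_ne v 0 with rfl | hv
  · simp
  · rw [projAlong_apply, inner_sub_right, real_inner_smul_right, real_inner_self_eq_norm_sq]
    have : ‖v‖ ≠ 0 := norm_ne_zero_iff.2 hv
    field_simp
    ring

end Calculus

section Slab

variable {V : Type*} [NormedAddCommGroup V] [InnerProductSpace ℝ V] [FiniteDimensional ℝ V]

theorem mem_add_segBody {K : ConvexBody V} {v x : V} {c : ℝ} (hc : 0 ≤ c) :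
    x ∈ K + segBody (c • v) ↔ ∃ k ∈ K, ∃ t : ℝ, |t| ≤ c ∧ x = k + t • v := by
  constructor
  · rintro ⟨k, hk, _, ⟨a, b, ha, hb, hab, rfl⟩, rfl⟩
    refine ⟨k, hk, (b - a) * c, ?_, ?_⟩
    · rw [abs_le]; constructor <;> nlinarith
    · simp only [smul_neg, smul_smul, sub_mul, sub_smul]; abel
  · rintro ⟨k, hk, t, ht, rfl⟩
    refine Set.add_mem_add hk ?_
    rw [abs_le] at ht
    rcases hc.eq_or_lt with rfl | hc
    · have : t = 0 := by linarith
      subst this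
      rw [zero_smul, segBody_zero]
      rfl
    · refine ⟨(c - t) / (2 * c), (c + t) / (2 * c), div_nonneg (by linarith) (by linarith),
        div_nonneg (by linarith) (by linarith), by field_simp; ring, ?_⟩
      rw [smul_neg, smul_smul, smul_smul, ← neg_smul, ← add_smul]
      congr 1
      field_simp
      ring

theorem mem_translate {K : ConvexBody V} {x y : V} : x ∈ K.translate y ↔ x - y ∈ K := by
  constructor
  · rintro ⟨k, hk, _, rfl, rfl⟩
    simpa using hk
  · intro h
    exact ⟨x - y, h, y, rfl, by simp⟩

theorem CVal.diffOp_proj_of_bound {ψ : ConvexBody V → ℝ} (hψ : CVal ψ) {v : V} (hv : v ≠ 0)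
    (K : ConvexBody V) (hK : ∀ x ∈ K, |(‖v‖ ^ 2)⁻¹ * inner ℝ v x| ≤ 1) :
    _root_.diffOp v ψ K = _root_.diffOp v ψ (mapBody (projAlong v) K) := by
  obtain ⟨s, hs⟩ : ∃ s : V →L[ℝ] ℝ, ∀ x, s x = (‖v‖ ^ 2)⁻¹ * inner ℝ v x :=
    ⟨(‖v‖ ^ 2)⁻¹ • innerSL ℝ v, fun x => by simp⟩
  have hsv : s v = 1 := by
    have : ‖v‖ ≠ 0 := norm_ne_zero_iff.2 hv
    rw [hs, real_inner_self_eq_norm_sq]; field_simp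
  simp only [← hs] at hK
  have hP : ∀ x, x ∈ mapBody (projAlong v) K ↔ ∃ k ∈ K, x = k - s k • v := fun x => by
    constructor
    · rintro ⟨k, hk, rfl⟩
      exact ⟨k, hk, by rw [projAlong_apply, hs]⟩
    · rintro ⟨k, hk, rfl⟩
      exact ⟨k, hk, by rw [projAlong_apply, hs]⟩
  obtain ⟨k₀, hk₀⟩ := K.nonempty
  have hk₀' := abs_le.1 (hK k₀ hk₀)
  let P := mapBody (projAlong v) K
  let M := K + segBody ((2 : ℝ) • v)
  have hM : ∀ x, x ∈ M ↔ ∃ k ∈ K, ∃ t : ℝ, |t| ≤ 2 ∧ x = k + t • v := fun x =>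
    mem_add_segBody zero_le_two
  have h1 : ∀ (L : ConvexBody V) x, x ∈ L + segBody v ↔
      ∃ k ∈ L, ∃ t : ℝ, |t| ≤ 1 ∧ x = k + t • v := fun L x => by
    have := mem_add_segBody (K := L) (v := v) (x := x) zero_le_one
    rwa [one_smul] at this
  have sadd : ∀ x (t : ℝ), s (x + t • v) = s x + t := fun x t => by simp [hsv]
  have ssub : ∀ x (t : ℝ), s (x - t • v) = s x - t := fun x t => by simp [hsv]
  let U := cutBody M {x | 1 ≤ s x} (convex_halfSpace_ge s.isLinear 1)
    (isClosed_le continuous_const s.continuous)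
    ⟨k₀ + (2 : ℝ) • v, (hM _).2 ⟨k₀, hk₀, 2, by norm_num, rfl⟩, by
      change 1 ≤ s _; rw [sadd]; linarith⟩
  let D := cutBody M {x | s x ≤ -1} (convex_halfSpace_le s.isLinear (-1))
    (isClosed_le s.continuous continuous_const)
    ⟨k₀ + (-2 : ℝ) • v, (hM _).2 ⟨k₀, hk₀, -2, by norm_num, rfl⟩, by
      change s _ ≤ -1; rw [sadd]; linarith⟩
  let L := cutBody M {x | s x ≤ 1} (convex_halfSpace_le s.isLinear 1)
    (isClosed_le s.continuous continuous_const)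
    ⟨k₀ + (-2 : ℝ) • v, (hM _).2 ⟨k₀, hk₀, -2, by norm_num, rfl⟩, by
      change s _ ≤ 1; rw [sadd]; linarith⟩
  have hU : ∀ x, x ∈ U ↔ x ∈ M ∧ 1 ≤ s x := fun x => Iff.rfl
  have hD : ∀ x, x ∈ D ↔ x ∈ M ∧ s x ≤ -1 := fun x => Iff.rfl
  have hL : ∀ x, x ∈ L ↔ x ∈ M ∧ s x ≤ 1 := fun x => Iff.rfl
  have e1 := hψ.val U L M (P.translate v) (by
      ext x
      simp only [SetLike.mem_coe, Set.mem_union, hU, hL]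
      have := le_total 1 (s x)
      tauto) (by
      ext x
      simp only [SetLike.mem_coe, Set.mem_inter_iff, hU, hL, mem_translate, P, hP, hM]
      constructor
      · rintro ⟨k, hk, h⟩
        have := abs_le.1 (hK k hk)
        obtain rfl : x = k + (1 - s k) • v := by
          rw [sub_eq_iff_eq_add] at h; rw [h, sub_smul, one_smul]; abel
        refine ⟨⟨⟨k, hk, _, ?_, rfl⟩, ?_⟩, ⟨⟨k, hk, _, ?_, rfl⟩, ?_⟩⟩
        any_goals rw [abs_le]; constructor <;> linarith
        all_goals rw [sadd]; linarith
      · rintro ⟨⟨⟨k, hk, t, ht, rfl⟩, h2⟩, ⟨-, h3⟩⟩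
        rw [sadd] at h2 h3
        refine ⟨k, hk, ?_⟩
        obtain rfl : t = 1 - s k := by linarith
        rw [sub_smul, one_smul]; abel)
  have e2 := hψ.val D (P + segBody v) L (P.translate (-v)) (by
      ext x
      simp only [SetLike.mem_coe, Set.mem_union, hD, hL, h1, P, hP, hM]
      constructor
      · rintro ⟨⟨k, hk, t, ht, rfl⟩, h2⟩
        rcases le_total (s (k + t • v)) (-1) with h3 | h3
        · exact Or.inl ⟨⟨k, hk, t, ht, rfl⟩, h3⟩
        · refine Or.inr ⟨_, ⟨k, hk, rfl⟩, s k + t, ?_, ?_⟩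
          · rw [sadd] at h2 h3; rw [abs_le]; constructor <;> linarith
          · rw [add_smul]; abel
      · rintro (⟨h2, h3⟩ | ⟨_, ⟨k, hk, rfl⟩, t, ht, rfl⟩)
        · exact ⟨h2, by linarith⟩
        · have := abs_le.1 (hK k hk)
          have := abs_le.1 ht
          refine ⟨⟨k, hk, t - s k, ?_, ?_⟩, ?_⟩
          · rw [abs_le]; constructor <;> linarith
          · rw [sub_smul]; abel
          · rw [sadd, ssub]; linarith) (by
      ext x
      simp only [SetLike.mem_coe, Set.mem_inter_iff, hD, h1, mem_translate, P, hP, hM]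
      constructor
      · rintro ⟨k, hk, h⟩
        have := abs_le.1 (hK k hk)
        obtain rfl : x = k + (-1 - s k) • v := by
          rw [sub_eq_iff_eq_add] at h; rw [h, sub_smul, neg_one_smul]; abel
        refine ⟨⟨⟨k, hk, _, ?_, rfl⟩, ?_⟩, ⟨_, ⟨k, hk, rfl⟩, -1, by norm_num, ?_⟩⟩
        · rw [abs_le]; constructor <;> linarith
        · rw [sadd]; linarith
        · rw [sub_smul]; abel
      · rintro ⟨⟨-, h2⟩, ⟨_, ⟨k, hk, rfl⟩, t, ht, rfl⟩⟩
        refine ⟨k, hk, ?_⟩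
        have := abs_le.1 ht
        rw [sadd, ssub] at h2
        obtain rfl : t = -1 := by linarith
        rw [neg_one_smul]; abel)
  have e3 := hψ.val (U.translate (-v)) (D.translate v) (K + segBody v) P (by
      ext x
      have ea : s (x - -v) = s x + 1 := by simp [hsv]
      have eb : s (x - v) = s x - 1 := by simp [hsv]
      simp only [SetLike.mem_coe, Set.mem_union, mem_translate, hU, hD, h1, hM, ea, eb]
      constructor
      · rintro ⟨k, hk, t, ht, rfl⟩
        have := abs_le.1 (hK k hk)
        have := abs_le.1 ht
        rw [sadd]
        rcases le_total 0 (s k + t) with h | h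
        · refine Or.inl ⟨⟨k, hk, t + 1, ?_, ?_⟩, by linarith⟩
          · rw [abs_le]; constructor <;> linarith
          · rw [add_smul, one_smul]; abel
        · refine Or.inr ⟨⟨k, hk, t - 1, ?_, ?_⟩, by linarith⟩
          · rw [abs_le]; constructor <;> linarith
          · rw [sub_smul, one_smul]; abel
      · rintro (⟨⟨k, hk, t, ht, h⟩, h2⟩ | ⟨⟨k, hk, t, ht, h⟩, h2⟩)
        · obtain rfl : x = k + (t - 1) • v := by
            rw [sub_eq_iff_eq_add] at h; rw [h, sub_smul, one_smul]; abel
          have := abs_le.1 (hK k hk)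
          have := abs_le.1 ht
          rw [sadd] at h2
          refine ⟨k, hk, t - 1, ?_, rfl⟩
          rw [abs_le]; constructor <;> linarith
        · obtain rfl : x = k + (t + 1) • v := by
            rw [sub_eq_iff_eq_add] at h; rw [h, add_smul, one_smul]; abel
          have := abs_le.1 (hK k hk)
          have := abs_le.1 ht
          rw [sadd] at h2
          refine ⟨k, hk, t + 1, ?_, rfl⟩
          rw [abs_le]; constructor <;> linarith) (by
      ext x
      have ea : s (x - -v) = s x + 1 := by simp [hsv]
      have eb : s (x - v) = s x - 1 := by simp [hsv]
      simp only [SetLike.mem_coe, Set.mem_inter_iff, mem_translate, hU, hD, hP, hM, ea, eb, P]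
      constructor
      · rintro ⟨k, hk, rfl⟩
        have := abs_le.1 (hK k hk)
        rw [ssub]
        refine ⟨⟨⟨k, hk, 1 - s k, ?_, ?_⟩, by linarith⟩, ⟨⟨k, hk, -1 - s k, ?_, ?_⟩, by linarith⟩⟩
        · rw [abs_le]; constructor <;> linarith
        · rw [sub_smul, one_smul]; abel
        · rw [abs_le]; constructor <;> linarith
        · rw [sub_smul, neg_one_smul]; abel
      · rintro ⟨⟨⟨k, hk, t, ht, h⟩, h2⟩, ⟨-, h3⟩⟩
        obtain rfl : x = k + (t - 1) • v := by
          rw [sub_eq_iff_eq_add] at h; rw [h, sub_smul, one_smul]; abel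
        rw [sadd] at h2 h3
        refine ⟨k, hk, ?_⟩
        obtain rfl : t = 1 - s k := by linarith
        simp only [sub_smul, one_smul]; abel)
  have e4 := hψ.add_segBody v zero_le_two K
  simp only [hψ.trans _ _] at e1 e2 e3
  change ψ M = _ at e4
  simp only [_root_.diffOp] at e4 ⊢
  change _ = ψ (P + segBody v) - ψ P
  linarith

theorem CVal.diffOp_proj {ψ : ConvexBody V → ℝ} (hψ : CVal ψ) (v : V)
    (K : ConvexBody V) : _root_.diffOp v ψ K = _root_.diffOp v ψ (mapBody (projAlong v) K) := by
  rcases eq_or_ne v 0 with rfl | hv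
  · simp [_root_.diffOp, segBody_zero]
  obtain ⟨C, hC, hb⟩ := K.isBounded.exists_pos_norm_le
  have hv0 : 0 < ‖v‖ := norm_pos_iff.2 hv
  have hc0 : 0 < C / ‖v‖ := by positivity
  have h := hψ.diffOp_proj_of_bound (v := (C / ‖v‖) • v) (smul_ne_zero hc0.ne' hv) K (by
    intro x hx
    rw [norm_smul, Real.norm_eq_abs, abs_of_pos hc0, div_mul_cancel₀ _ hv0.ne', abs_mul,
      abs_of_pos (by positivity), real_inner_smul_left, abs_mul, abs_of_pos hc0]
    have h1 := abs_real_inner_le_norm v x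
    have h2 := hb x hx
    rw [inv_mul_le_iff₀ (by positivity), mul_one]
    calc C / ‖v‖ * |inner ℝ v x| ≤ C / ‖v‖ * (‖v‖ * C) := by gcongr; exact h1.trans (by gcongr)
      _ = C ^ 2 := by field_simp)
  have hp : projAlong ((C / ‖v‖) • v) = projAlong v := by
    ext x
    rw [projAlong_apply, projAlong_apply, norm_smul, Real.norm_eq_abs, abs_of_pos hc0,
      real_inner_smul_left, smul_smul]
    congr 2
    field_simp
  rw [hp, hψ.diffOp_smul, hψ.diffOp_smul] at h
  exact mul_left_cancel₀ (abs_pos.2 hc0.ne').ne' h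

theorem mapBody_add {W : Type*} [NormedAddCommGroup W] [InnerProductSpace ℝ W] (f : V →L[ℝ] W)
    (K L : ConvexBody V) : mapBody f (K + L) = mapBody f K + mapBody f L :=
  SetLike.ext' (Set.image_add f)

theorem mapBody_segBody (f : V →L[ℝ] V) (v : V) : mapBody f (segBody v) = segBody (f v) :=
  SetLike.ext' (by
    change f '' segment ℝ (-v) v = segment ℝ (-f v) (f v)
    have := image_segment ℝ f.toLinearMap.toAffineMap (-v) v
    simpa using this)

theorem projAlong_self (v : V) : projAlong v v = 0 := by
  rcases eq_or_ne v 0 with rfl | hv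
  · simp
  · have : ‖v‖ ≠ 0 := norm_ne_zero_iff.2 hv
    rw [projAlong_apply, real_inner_self_eq_norm_sq, inv_mul_cancel₀ (by positivity), one_smul,
      sub_self]

theorem CVal.diffOp_congr_proj {ψ : ConvexBody V → ℝ} (hψ : CVal ψ) (v : V) {K L : ConvexBody V}
    (h : mapBody (projAlong v) K = mapBody (projAlong v) L) :
    _root_.diffOp v ψ K = _root_.diffOp v ψ L := by
  rw [hψ.diffOp_proj, h, ← hψ.diffOp_proj]

theorem CVal.diffOp_shear {ψ : ConvexBody V → ℝ} (hψ : CVal ψ) (v w : V) (c : ℝ) :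
    _root_.diffOp (w + c • v) (_root_.diffOp v ψ) = _root_.diffOp w (_root_.diffOp v ψ) := by
  funext K
  change _root_.diffOp v ψ _ - _ = _root_.diffOp v ψ _ - _
  congr 1
  apply hψ.diffOp_congr_proj
  rw [mapBody_add, mapBody_add, mapBody_segBody, mapBody_segBody, map_add, map_smul,
    projAlong_self, smul_zero, add_zero]

end Slab

section Smooth

variable {V : Type*} [NormedAddCommGroup V] [InnerProductSpace ℝ V] [FiniteDimensional ℝ V]

theorem taylor_bound {χ : V → ℝ} (h : ContDiff ℝ 2 χ) (hs : HasCompactSupport χ) :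
    ∃ C, 0 ≤ C ∧ ∀ z, |χ z| ≤ C ∧ ‖fderiv ℝ χ z‖ ≤ C ∧
      ∀ y, |χ y - χ z - fderiv ℝ χ z (y - z)| ≤ C * ‖y - z‖ ^ 2 := by
  obtain ⟨A, hA⟩ := h.continuous.bounded_above_of_compact_support hs
  have hd : ContDiff ℝ 1 (fderiv ℝ χ) := h.fderiv_right (by norm_num)
  obtain ⟨B, hB⟩ := hd.continuous.bounded_above_of_compact_support (hs.fderiv ℝ)
  obtain ⟨L, hL⟩ := hd.lipschitzWith_of_hasCompactSupport (hs.fderiv ℝ) one_ne_zero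
  refine ⟨max (max A B) L, le_max_of_le_right L.2, fun z => ⟨?_, ?_, fun y => ?_⟩⟩
  · exact (hA z).trans ((le_max_left _ _).trans (le_max_left _ _))
  · exact (hB z).trans ((le_max_right _ _).trans (le_max_left _ _))
  · have key := (convex_segment z y).norm_image_sub_le_of_norm_fderiv_le' (𝕜 := ℝ) (f := χ)
      (φ := fderiv ℝ χ z) (C := L * ‖y - z‖)
      (fun x _ => (h.differentiable (by norm_num)) x) (fun x hx => by
        rw [← dist_eq_norm]
        refine (hL.dist_le_mul x z).trans ?_
        rw [dist_eq_norm]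
        refine mul_le_mul_of_nonneg_left ?_ L.2
        obtain ⟨a, b, ha, hb, hab, rfl⟩ := hx
        have : a • z + b • y - z = b • (y - z) := by
          obtain rfl : a = 1 - b := by linarith
          rw [sub_smul, one_smul, smul_sub]; abel
        rw [this, norm_smul, Real.norm_eq_abs, abs_of_nonneg hb]
        exact mul_le_of_le_one_left (norm_nonneg _) (by linarith))
      (left_mem_segment ℝ z y) (right_mem_segment ℝ z y)
    rw [Real.norm_eq_abs] at key
    refine key.trans ?_
    rw [mul_assoc, ← sq]
    exact mul_le_mul_of_nonneg_right (le_max_right _ _) (sq_nonneg _)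

/-- A lower second order bound on the unit sphere. -/
def SemiCvx (b : V → ℝ) (C : ℝ) : Prop :=
  ∀ z, ‖z‖ = 1 → |b z| ≤ C ∧ ∃ l : V, ‖l‖ ≤ C ∧
    ∀ y, ‖y‖ = 1 → b z + inner ℝ l (y - z) - C * ‖y - z‖ ^ 2 ≤ b y

theorem SemiCvx.sublin {b : V → ℝ} {C : ℝ} (hb : SemiCvx b C)
    (hom : ∀ t, 0 ≤ t → ∀ x, b (t • x) = t * b x) {R : ℝ} (hR : 4 * C ≤ R) :
    Sublin fun x => R * ‖x‖ + b x := by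
  have hom' : ∀ (t : ℝ), 0 ≤ t → ∀ x : V, R * ‖t • x‖ + b (t • x) = t * (R * ‖x‖ + b x) := by
    intro t ht x
    rw [hom t ht, norm_smul, Real.norm_eq_abs, abs_of_nonneg ht]; ring
  have b0 : b 0 = 0 := by simpa using hom 0 le_rfl 0
  refine ⟨fun x y => ?_, hom'⟩
  by_cases hxy : x + y = 0
  · rw [hxy]
    obtain rfl : y = -x := (neg_eq_of_add_eq_zero_right hxy).symm
    simp only [norm_zero, mul_zero, b0, norm_neg, add_zero]
    by_cases hx : x = 0
    · simp [hx, b0]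
    have hn : ‖x‖ ≠ 0 := norm_ne_zero_iff.2 hx
    have hu : ‖‖x‖⁻¹ • x‖ = 1 := by rw [norm_smul, norm_inv, norm_norm, inv_mul_cancel₀ hn]
    have h1 := (hb _ hu).1
    have h2 := (hb (-(‖x‖⁻¹ • x)) (by rw [norm_neg, hu])).1
    have e1 : b x = ‖x‖ * b (‖x‖⁻¹ • x) := by
      rw [← hom _ (norm_nonneg x), smul_smul, mul_inv_cancel₀ hn, one_smul]
    have e2 : b (-x) = ‖x‖ * b (-(‖x‖⁻¹ • x)) := by
      rw [← hom _ (norm_nonneg x), smul_neg, smul_smul, mul_inv_cancel₀ hn, one_smul]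
    rw [e1, e2]
    have := abs_le.1 h1
    have := abs_le.1 h2
    have hp : 0 < ‖x‖ := norm_pos_iff.2 hx
    have : 0 ≤ ‖x‖ * (2 * R + b (‖x‖⁻¹ • x) + b (-(‖x‖⁻¹ • x))) :=
      mul_nonneg hp.le (by have := abs_nonneg (b (‖x‖⁻¹ • x)); linarith)
    linarith
  have key : ∀ z, ‖z‖ = 1 → ∃ m : V, inner ℝ m z = R + b z ∧
      ∀ y, inner ℝ m y ≤ R * ‖y‖ + b y := by
    intro z hz
    obtain ⟨h1, l, hl, h2⟩ := hb z hz
    have hlz := abs_real_inner_le_norm l z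
    rw [hz, mul_one] at hlz
    have hzz : inner ℝ z z = 1 := by rw [real_inner_self_eq_norm_sq, hz, one_pow]
    refine ⟨l + (R + (b z - inner ℝ l z)) • z, ?_, fun y => ?_⟩
    · rw [inner_add_left, real_inner_smul_left, hzz]; ring
    · by_cases hy : y = 0
      · simp [hy, b0]
      have hn : ‖y‖ ≠ 0 := norm_ne_zero_iff.2 hy
      have hu : ‖‖y‖⁻¹ • y‖ = 1 := by rw [norm_smul, norm_inv, norm_norm, inv_mul_cancel₀ hn]
      obtain ⟨w, hw⟩ : ∃ w, w = ‖y‖⁻¹ • y := ⟨_, rfl⟩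
      rw [← hw] at hu
      have ey : y = ‖y‖ • w := by rw [hw, smul_smul, mul_inv_cancel₀ hn, one_smul]
      have main : inner ℝ (l + (R + (b z - inner ℝ l z)) • z) w ≤ R + b w := by
        have h3 := h2 w hu
        rw [norm_sub_sq_real, hz, hu, inner_sub_right] at h3
        rw [inner_add_left, real_inner_smul_left]
        have h4 := real_inner_le_norm z w
        rw [hz, hu, mul_one] at h4
        rw [real_inner_comm z w] at h3
        have := abs_le.1 h1
        have := abs_le.1 (hlz.trans hl)
        have hC : 0 ≤ C := (abs_nonneg _).trans h1
        nlinarith [mul_nonneg (sub_nonneg.2 h4)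
          (show 0 ≤ R - 2 * C + (b z - inner ℝ l z) by linarith)]
      have e := mul_le_mul_of_nonneg_left main (norm_nonneg y)
      have e2 := hom' ‖y‖ (norm_nonneg y) w
      rw [hu, mul_one] at e2
      rw [← e2, ← real_inner_smul_right, ← ey] at e
      exact e
  have hn : ‖x + y‖ ≠ 0 := norm_ne_zero_iff.2 hxy
  obtain ⟨m, hm1, hm2⟩ := key (‖x + y‖⁻¹ • (x + y))
    (by rw [norm_smul, norm_inv, norm_norm, inv_mul_cancel₀ hn])
  have e1 : R * ‖x + y‖ + b (x + y) = inner ℝ m (x + y) := by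
    have h3 : ‖x + y‖ * inner ℝ m (‖x + y‖⁻¹ • (x + y)) =
        ‖x + y‖ * (R + b (‖x + y‖⁻¹ • (x + y))) := by rw [hm1]
    rw [← real_inner_smul_right, mul_add, ← hom _ (norm_nonneg _), smul_smul,
      mul_inv_cancel₀ hn, one_smul] at h3
    linarith
  rw [e1, inner_add_right]
  have := hm2 x
  have := hm2 y
  linarith

/-- Positively homogeneous functions which are smooth away from the origin. -/
structure SmHom (f : V → ℝ) : Prop where
  hom : ∀ t, 0 ≤ t → ∀ x, f (t • x) = t * f x
  smooth : ∀ x, x ≠ 0 → ContDiffAt ℝ (⊤ : ℕ∞) f x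

/-- A smooth radial cutoff, equal to `1` near the unit sphere and vanishing near the origin. -/
theorem exists_radial_cutoff (V : Type*) [NormedAddCommGroup V] [InnerProductSpace ℝ V]
    [FiniteDimensional ℝ V] : ∃ ω : ℝ → ℝ, ContDiff ℝ (⊤ : ℕ∞) ω ∧ (∀ t, 0 ≤ ω t) ∧
      (∀ t, ω t ≤ 1) ∧ ω 1 = 1 ∧ (∀ t, ω t ≠ 0 → 1 / 2 < t ∧ t < 2) := by
  let B : ContDiffBump (1 : ℝ) := ⟨1 / 4, 1 / 3, by norm_num, by norm_num⟩
  refine ⟨B, B.contDiff, fun t => B.nonneg, fun t => B.le_one, B.one_of_mem_closedBall ?_,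
    fun t ht => ?_⟩
  · simp [B.rIn_pos.le]
  · have : t ∈ Function.support B := ht
    rw [B.support_eq, Metric.mem_ball, Real.dist_eq] at this
    have := abs_lt.1 this
    simp only [B] at this
    constructor <;> linarith

theorem contDiff_cutoff {f : V → ℝ} (hf : ∀ x, x ≠ 0 → ContDiffAt ℝ (⊤ : ℕ∞) f x) {ω : ℝ → ℝ}
    (hω : ContDiff ℝ (⊤ : ℕ∞) ω) (h : ∀ t, ω t ≠ 0 → 1 / 2 < t ∧ t < 2) :
    ContDiff ℝ (⊤ : ℕ∞) (fun x => ω ‖x‖ * f x) ∧ HasCompactSupport fun x => ω ‖x‖ * f x := by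
  constructor
  · rw [contDiff_iff_contDiffAt]
    intro x
    by_cases hx : x = 0
    · have : (fun x : V => ω ‖x‖ * f x) =ᶠ[nhds x] fun _ => 0 := by
        filter_upwards [Metric.ball_mem_nhds x (show (0 : ℝ) < 1 / 2 by norm_num)] with y hy
        rw [hx, mem_ball_zero_iff] at hy
        have : ω ‖y‖ = 0 := by
          by_contra hne
          linarith [(h _ hne).1]
        rw [this, zero_mul]
      exact contDiffAt_const.congr_of_eventuallyEq this
    · exact (hω.contDiffAt.comp x (contDiffAt_norm ℝ hx)).mul (hf x hx)
  · refine HasCompactSupport.intro (isCompact_closedBall (0 : V) 2) fun x hx => ?_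
    have : ω ‖x‖ = 0 := by
      by_contra hne
      exact hx (by simpa using (h _ hne).2.le)
    rw [this, zero_mul]

theorem SmHom.semiCvx {f : V → ℝ} (hf : SmHom f) : ∃ C, SemiCvx f C := by
  obtain ⟨ω, h1, -, -, h4, h5⟩ := exists_radial_cutoff V
  obtain ⟨hc, hs⟩ := contDiff_cutoff hf.smooth h1 h5
  obtain ⟨C, hC, hT⟩ := taylor_bound (hc.of_le (WithTop.coe_le_coe.2 (le_top : (2 : ℕ∞) ≤ ⊤))) hs
  refine ⟨C, fun z hz => ?_⟩
  obtain ⟨e1, e2, e3⟩ := hT z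
  have ez : ∀ y : V, ‖y‖ = 1 → ω ‖y‖ * f y = f y := fun y hy => by rw [hy, h4, one_mul]
  rw [ez z hz] at e1
  refine ⟨e1, (InnerProductSpace.toDual ℝ V).symm (fderiv ℝ (fun x => ω ‖x‖ * f x) z), ?_,
    fun y hy => ?_⟩
  · rwa [LinearIsometryEquiv.norm_map]
  · rw [InnerProductSpace.toDual_symm_apply]
    have := (abs_le.1 (e3 y)).1
    rw [ez z hz, ez y hy] at this
    linarith

theorem SmHom.exists_sublin {f : V → ℝ} (hf : SmHom f) :
    ∃ R₀, 0 ≤ R₀ ∧ ∀ R, R₀ ≤ R → Sublin fun x => R * ‖x‖ + f x := by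
  obtain ⟨C, hC⟩ := hf.semiCvx
  exact ⟨max 0 (4 * C), le_max_left _ _,
    fun R hR => hC.sublin hf.hom ((le_max_right _ _).trans hR)⟩

theorem Sublin.lipschitz {h : V → ℝ} (hs : Sublin h) :
    ∃ C, 0 ≤ C ∧ ∀ x y, |h x - h y| ≤ C * ‖x - y‖ := by
  obtain ⟨C, hC, hb⟩ := hs.exists_bound
  have key : ∀ x y, h x - h y ≤ C * ‖x - y‖ := fun x y => by
    have h1 := hs.add_le (x - y) y
    rw [sub_add_cancel] at h1
    linarith [hb (x - y)]
  refine ⟨C, hC, fun x y => abs_le.2 ⟨?_, key x y⟩⟩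
  have := key y x
  rw [norm_sub_rev] at this
  linarith

variable [MeasurableSpace V] [BorelSpace V]

theorem Sublin.exists_smooth_approx {h : V → ℝ} (hs : Sublin h) {ε : ℝ} (hε : 0 < ε) :
    ∃ f : V → ℝ, SmHom f ∧ Sublin f ∧ (∀ x, |f x - h x| ≤ ε * ‖x‖) ∧
      ((∀ x, h (-x) = h x) → ∀ x, f (-x) = f x) := by
  obtain ⟨C, hC, hlip⟩ := hs.lipschitz
  have hcont : Continuous h := hs.continuous
  obtain ⟨δ, hδ, hCδ⟩ : ∃ δ : ℝ, 0 < δ ∧ C * δ ≤ ε :=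
    ⟨ε / (C + 1), by positivity, by
      rw [← mul_div_assoc, div_le_iff₀ (by positivity)]; nlinarith⟩
  let B : ContDiffBump (0 : V) := ⟨δ / 2, δ, by positivity, by linarith⟩
  let γ : V → ℝ := B.normed volume
  have γ0 : ∀ y, 0 ≤ γ y := B.nonneg_normed
  have γneg : ∀ y, γ (-y) = γ y := B.normed_neg
  have γint : ∫ y, γ y = 1 := B.integral_normed
  have γcont : Continuous γ := B.continuous_normed
  have γcs : HasCompactSupport γ := B.hasCompactSupport_normed
  have γsupp : ∀ y, γ y ≠ 0 → ‖y‖ ≤ δ := fun y hy => by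
    have : y ∈ Function.support γ := hy
    rw [show Function.support γ = _ from B.support_normed_eq, mem_ball_zero_iff] at this
    exact this.le
  have γi : Integrable γ := γcont.integrable_of_hasCompactSupport γcs
  have int : ∀ g : V → ℝ, Continuous g → Integrable fun y => γ y * g y := fun g hg =>
    (γcont.mul hg).integrable_of_hasCompactSupport γcs.mul_right
  let f : V → ℝ := fun x => ∫ y, γ y * h (x - ‖x‖ • y)
  have fi : ∀ x (c : ℝ), Integrable fun y => γ y * h (x - c • y) := fun x c => int _ (by fun_prop)
  have fsymm : ∀ x (c : ℝ), ∫ y, γ y * h (x - c • y) = ∫ y, γ y * h (x + c • y) := fun x c => by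
    rw [← integral_neg_eq_self]
    simp [γneg]
  have mono : ∀ (x y : V) (a b : ℝ), 0 ≤ a → a ≤ b →
      h (x - a • y) + h (x + a • y) ≤ h (x - b • y) + h (x + b • y) := by
    intro x y a b ha hab
    rcases ha.eq_or_lt with rfl | ha'
    · have := hs.add_le (x - b • y) (x + b • y)
      have e : x - b • y + (x + b • y) = (2 : ℝ) • x := by rw [two_smul]; abel
      rw [e, hs.smul 2 zero_le_two] at this
      simp only [zero_smul, sub_zero, add_zero]
      linarith
    have hb : 0 < b := ha'.trans_le hab
    have hl : ∀ s : ℝ, |s| ≤ b → h (x + s • y) ≤ ((b - s) / (2 * b)) * h (x - b • y) +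
        ((b + s) / (2 * b)) * h (x + b • y) := by
      intro s hs'
      rw [abs_le] at hs'
      have n1 : 0 ≤ (b - s) / (2 * b) := div_nonneg (by linarith) (by linarith)
      have n2 : 0 ≤ (b + s) / (2 * b) := div_nonneg (by linarith) (by linarith)
      rw [← hs.smul _ n1, ← hs.smul _ n2]
      refine le_trans (le_of_eq ?_) (hs.add_le _ _)
      congr 1
      rw [smul_sub, smul_add, smul_smul, smul_smul]
      have e1 : (b - s) / (2 * b) * b = (b - s) / 2 := by field_simp
      have e2 : (b + s) / (2 * b) * b = (b + s) / 2 := by field_simp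
      rw [e1, e2]
      have e3 : (b - s) / (2 * b) = 1 - (b + s) / (2 * b) := by field_simp; ring
      rw [e3]
      module
    have h1 := hl a (by rw [abs_of_nonneg ha]; exact hab)
    have h2 := hl (-a) (by rw [abs_neg, abs_of_nonneg ha]; exact hab)
    rw [neg_smul, ← sub_eq_add_neg] at h2
    have e3 : (b - a) / (2 * b) = 1 - (b + a) / (2 * b) := by field_simp; ring
    have e4 : (b - -a) / (2 * b) = (b + a) / (2 * b) := by ring
    have e5 : (b + -a) / (2 * b) = 1 - (b + a) / (2 * b) := by field_simp; ring
    rw [e3] at h1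
    rw [e4, e5] at h2
    linarith
  have fmono : ∀ (x : V) (a b : ℝ), 0 ≤ a → a ≤ b →
      ∫ y, γ y * h (x - a • y) ≤ ∫ y, γ y * h (x - b • y) := by
    intro x a b ha hab
    have h1 : ∫ y, (γ y * h (x - a • y) + γ y * h (x + a • y)) ≤
        ∫ y, (γ y * h (x - b • y) + γ y * h (x + b • y)) := by
      refine integral_mono ((fi x a).add (int _ (by fun_prop))) ((fi x b).add (int _ (by fun_prop)))
        fun y => ?_
      simp only
      rw [← mul_add, ← mul_add]
      exact mul_le_mul_of_nonneg_left (mono x y a b ha hab) (γ0 y)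
    rw [integral_add (fi x a) (int _ (by fun_prop)), integral_add (fi x b) (int _ (by fun_prop)),
      ← fsymm, ← fsymm] at h1
    linarith
  have fhom : ∀ t, 0 ≤ t → ∀ x, f (t • x) = t * f x := by
    intro t ht x
    simp only [f]
    rw [← integral_const_mul]
    congr 1
    ext y
    have : t • x - ‖t • x‖ • y = t • (x - ‖x‖ • y) := by
      rw [norm_smul, Real.norm_eq_abs, abs_of_nonneg ht, smul_sub, smul_smul]
    rw [this, hs.smul t ht]
    ring
  refine ⟨f, ⟨fhom, fun x hx => ?_⟩, ⟨fun x y => ?_, fhom⟩, fun x => ?_, fun hev x => ?_⟩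
  · have hF : ContDiff ℝ (⊤ : ℕ∞) (fun z => ∫ y, γ y * h (z - y)) :=
      γcs.contDiff_convolution_left (ContinuousLinearMap.mul ℝ ℝ) B.contDiff_normed
        hcont.locallyIntegrable (μ := volume)
    have he : f =ᶠ[nhds x] fun x => ‖x‖ * ((fun z => ∫ y, γ y * h (z - y)) (‖x‖⁻¹ • x)) := by
      filter_upwards [isOpen_ne.mem_nhds hx] with w hw
      have hn : ‖w‖ ≠ 0 := norm_ne_zero_iff.2 hw
      have e : w = ‖w‖ • (‖w‖⁻¹ • w) := by rw [smul_smul, mul_inv_cancel₀ hn, one_smul]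
      conv_lhs => rw [e, fhom _ (norm_nonneg _)]
      simp only [f]
      rw [norm_smul, norm_inv, norm_norm, inv_mul_cancel₀ hn]
      simp
    refine ContDiffAt.congr_of_eventuallyEq ?_ he
    have hn := contDiffAt_norm (n := ((⊤ : ℕ∞) : WithTop ℕ∞)) ℝ hx
    refine hn.mul (hF.contDiffAt.comp x ?_)
    exact (hn.inv (norm_ne_zero_iff.2 hx)).smul contDiffAt_id
  · calc f (x + y) ≤ ∫ z, γ z * h (x + y - (‖x‖ + ‖y‖) • z) :=
        fmono _ _ _ (norm_nonneg _) (norm_add_le _ _)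
      _ ≤ ∫ z, (γ z * h (x - ‖x‖ • z) + γ z * h (y - ‖y‖ • z)) := by
        refine integral_mono (fi _ _) ((fi _ _).add (fi _ _)) fun z => ?_
        simp only
        rw [← mul_add]
        refine mul_le_mul_of_nonneg_left ?_ (γ0 z)
        have := hs.add_le (x - ‖x‖ • z) (y - ‖y‖ • z)
        have e : x - ‖x‖ • z + (y - ‖y‖ • z) = x + y - (‖x‖ + ‖y‖) • z := by
          rw [add_smul]; abel
        rwa [e] at this
      _ = f x + f y := integral_add (fi _ _) (fi _ _)
  · have e : h x = ∫ y, γ y * h x := by rw [integral_mul_const, γint, one_mul]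
    rw [e, ← integral_sub (fi _ _) (int _ continuous_const)]
    calc |∫ y, (γ y * h (x - ‖x‖ • y) - γ y * h x)| ≤ ∫ y, γ y * (ε * ‖x‖) := by
          rw [← Real.norm_eq_abs]
          refine norm_integral_le_of_norm_le (int _ continuous_const) (Filter.Eventually.of_forall
            fun y => ?_)
          rw [← mul_sub, norm_mul, Real.norm_eq_abs, Real.norm_eq_abs, abs_of_nonneg (γ0 y)]
          by_cases hy : γ y = 0
          · simp [hy]
          refine mul_le_mul_of_nonneg_left ((hlip _ _).trans ?_) (γ0 y)
          have : x - ‖x‖ • y - x = -(‖x‖ • y) := by abel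
          rw [this, norm_neg, norm_smul, norm_norm]
          calc C * (‖x‖ * ‖y‖) ≤ C * (‖x‖ * δ) := by gcongr; exact γsupp y hy
            _ = (C * δ) * ‖x‖ := by ring
            _ ≤ ε * ‖x‖ := by gcongr
      _ = ε * ‖x‖ := by rw [integral_mul_const, γint, one_mul]
  · simp only [f]
    rw [norm_neg, fsymm x]
    congr 1
    ext y
    rw [← hev]
    congr 2
    abel

end Smooth

section Zonoid

variable {V : Type*} [NormedAddCommGroup V] [InnerProductSpace ℝ V] [FiniteDimensional ℝ V]
  [MeasurableSpace V] [BorelSpace V]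

theorem suppFn_sum {ι : Type*} (s : Finset ι) (f : ι → ConvexBody V) (u : V) :
    suppFn (∑ i ∈ s, f i) u = ∑ i ∈ s, suppFn (f i) u := by
  classical
  induction s using Finset.induction_on with
  | empty => simp [suppFn_zero]
  | insert a s ha ih => rw [Finset.sum_insert ha, Finset.sum_insert ha, suppFn_add, ih]

/-- Absolutely homogeneous functions of degree one. -/
def AbsHom (θ : V → ℝ) : Prop := ∀ (c : ℝ) (v : V), θ (c • v) = |c| * θ v

theorem AbsHom.zero {θ : V → ℝ} (h : AbsHom θ) : θ 0 = 0 := by simpa using h 0 0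

theorem AbsHom.bound {θ : V → ℝ} (h : AbsHom θ) (hc : Continuous θ) :
    ∃ C, 0 ≤ C ∧ ∀ v, |θ v| ≤ C * ‖v‖ := by
  obtain ⟨C, hC⟩ := (isCompact_sphere (0 : V) 1).exists_bound_of_continuousOn hc.continuousOn
  refine ⟨max C 0, le_max_right _ _, fun v => ?_⟩
  rcases eq_or_ne v 0 with rfl | hv
  · simp [h.zero]
  · have hn : ‖v‖ ≠ 0 := norm_ne_zero_iff.2 hv
    have e : v = ‖v‖ • (‖v‖⁻¹ • v) := by rw [smul_smul, mul_inv_cancel₀ hn, one_smul]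
    have h2 := hC (‖v‖⁻¹ • v) (by simp [norm_smul, hn])
    rw [e, h, abs_mul, ← e, abs_abs, abs_norm, mul_comm]
    exact mul_le_mul_of_nonneg_right (h2.trans (le_max_left _ _)) (norm_nonneg v)

theorem AbsHom.integrable {θ : V → ℝ} (h : AbsHom θ) (hc : Continuous θ) {Ω : Type*}
    [MeasurableSpace Ω] {ν : Measure Ω} {X : Ω → V} (hX : Integrable X ν) :
    Integrable (fun ω => θ (X ω)) ν := by
  obtain ⟨C, hC, hb⟩ := h.bound hc
  exact (hX.norm.const_mul C).mono' (hc.comp_aestronglyMeasurable hX.1)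
    (Filter.Eventually.of_forall fun ω => hb _)

theorem absHom_inner (u : V) : AbsHom fun v : V => |inner ℝ v u| := fun c v => by
  simp [real_inner_smul_left, abs_mul]

/-- Zonoids as limits of zonotopes. -/
theorem exists_zonoid {Ω : Type*} [MeasurableSpace Ω] {ν : Measure Ω} {X : Ω → V}
    (hm : Measurable X) (hX : Integrable X ν) : ∃ Z : ConvexBody V,
      (∀ u, suppFn Z u = ∫ ω, |inner ℝ (X ω) u| ∂ν) ∧
      ∀ (G : ConvexBody V → ℝ) (θ : V → ℝ), Continuous G → Continuous θ → AbsHom θ →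
        (∀ (s : Finset V) (f : V → V),
          G (∑ y ∈ s, segBody (f y)) = G 0 + ∑ y ∈ s, θ (f y)) →
        G Z = G 0 + ∫ ω, θ (X ω) ∂ν := by
  have hi : ∀ u, Integrable (fun ω => |inner ℝ (X ω) u|) ν := fun u =>
    (absHom_inner u).integrable (by fun_prop) hX
  have hs : Sublin fun u => ∫ ω, |inner ℝ (X ω) u| ∂ν := by
    constructor
    · intro u w
      rw [← integral_add (hi u) (hi w)]
      refine integral_mono (hi _) ((hi u).add (hi w)) fun ω => ?_
      simp only [inner_add_right]
      exact abs_add_le _ _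
    · intro t ht u
      rw [← integral_const_mul]
      simp only [real_inner_smul_right, abs_mul, abs_of_nonneg ht]
  refine ⟨ofSublin _ hs, fun u => by simp, fun G θ hG hθ hθh hGs => ?_⟩
  let A : ℕ → SimpleFunc Ω V := SimpleFunc.approxOn X hm Set.univ 0 trivial
  have hAi : ∀ N, Integrable (A N) ν := fun N =>
    SimpleFunc.integrable_approxOn hm hX (Set.mem_univ 0) (integrable_zero _ _ _) N
  have hlim : ∀ ω, Filter.Tendsto (fun N => A N ω) Filter.atTop (nhds (X ω)) := fun ω =>
    SimpleFunc.tendsto_approxOn hm (Set.mem_univ 0) (by simp)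
  have hAn : ∀ N ω, ‖A N ω‖ ≤ 2 * ‖X ω‖ := fun N ω => by
    have := SimpleFunc.norm_approxOn_zero_le hm (s := Set.univ) trivial ω N
    linarith
  let Z : ℕ → ConvexBody V := fun N => ∑ y ∈ (A N).range, segBody (ν.real (A N ⁻¹' {y}) • y)
  have hint : ∀ {θ : V → ℝ}, Continuous θ → AbsHom θ → ∀ N,
      ∑ y ∈ (A N).range, θ (ν.real (A N ⁻¹' {y}) • y) = ∫ ω, θ (A N ω) ∂ν := by
    intro θ hc h N
    have h1 := SimpleFunc.map_integral (A N) θ (hAi N) h.zero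
    rw [SimpleFunc.integral_eq_integral _ (by
      simpa [SimpleFunc.coe_map, Function.comp_def] using h.integrable hc (hAi N))] at h1
    simp only [SimpleFunc.coe_map, Function.comp_def] at h1
    rw [h1]
    refine Finset.sum_congr rfl fun y _ => ?_
    rw [h, abs_of_nonneg measureReal_nonneg, smul_eq_mul]
  have hconv : ∀ {θ : V → ℝ}, Continuous θ → AbsHom θ →
      Filter.Tendsto (fun N => ∫ ω, θ (A N ω) ∂ν) Filter.atTop (nhds (∫ ω, θ (X ω) ∂ν)) := by
    intro θ hc h
    obtain ⟨C, hC, hb⟩ := h.bound hc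
    refine tendsto_integral_of_dominated_convergence (fun ω => C * (2 * ‖X ω‖))
      (fun N => (h.integrable hc (hAi N)).1) ((hX.norm.const_mul 2).const_mul C) (fun N =>
      Filter.Eventually.of_forall fun ω => (hb _).trans
        (mul_le_mul_of_nonneg_left (hAn N ω) hC))
      (Filter.Eventually.of_forall fun ω => (hc.tendsto _).comp (hlim ω))
  have hnorm : Filter.Tendsto (fun N => ∫ ω, ‖A N ω - X ω‖ ∂ν) Filter.atTop (nhds 0) := by
    have := tendsto_integral_of_dominated_convergence (μ := ν) (F := fun N ω => ‖A N ω - X ω‖)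
      (f := fun _ => (0 : ℝ)) (fun ω => 3 * ‖X ω‖)
      (fun N => ((hAi N).sub hX).norm.1) (hX.norm.const_mul 3) (fun N =>
      Filter.Eventually.of_forall fun ω => by
        rw [norm_norm]
        refine (norm_sub_le _ _).trans ?_
        linarith [hAn N ω])
      (Filter.Eventually.of_forall fun ω => by
        have := ((hlim ω).sub_const (X ω)).norm
        simpa using this)
    simpa using this
  have hZ : Filter.Tendsto Z Filter.atTop (nhds (ofSublin _ hs)) := by
    rw [tendsto_iff_dist_tendsto_zero]
    refine squeeze_zero (fun _ => dist_nonneg) (fun N => ?_) hnorm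
    refine dist_le_of_suppFn (integral_nonneg fun ω => norm_nonneg _) fun u => ?_
    rw [suppFn_ofSublin]
    simp only [Z, suppFn_sum, suppFn_segBody]
    rw [hint (θ := fun v => |inner ℝ v u|) (by fun_prop) (absHom_inner u) N,
      ← integral_sub ((absHom_inner u).integrable (by fun_prop) (hAi N)) (hi u),
      ← integral_mul_const]
    refine (abs_integral_le_integral_abs).trans (integral_mono_of_nonneg
      (Filter.Eventually.of_forall fun ω => abs_nonneg _)
      (((hAi N).sub hX).norm.mul_const _) (Filter.Eventually.of_forall fun ω => ?_))
    refine (abs_abs_sub_abs_le _ _).trans ?_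
    rw [← inner_sub_left]
    exact abs_real_inner_le_norm _ _
  have h1 := (hG.tendsto _).comp hZ
  have h2 : Filter.Tendsto (G ∘ Z) Filter.atTop (nhds (G 0 + ∫ ω, θ (X ω) ∂ν)) := by
    have : G ∘ Z = fun N => G 0 + ∫ ω, θ (A N ω) ∂ν := funext fun N => by
      rw [← hint hθ hθh N]
      exact hGs (A N).range fun y => ν.real (A N ⁻¹' {y}) • y
    rw [this]
    exact (hconv hθ hθh).const_add _
  exact tendsto_nhds_unique h1 h2

end Zonoid

section Cosine

variable {V : Type*} [NormedAddCommGroup V] [InnerProductSpace ℝ V] [FiniteDimensional ℝ V]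
  [MeasurableSpace V] [BorelSpace V]

open Real in
/-- The cosine transform (the real part of the Fourier transform). -/
def cosFT (χ : V → ℝ) (ξ : V) : ℝ := ∫ x, cos (2 * π * inner ℝ x ξ) * χ x

open Real FourierTransform in
theorem cosFT_eq_re {χ : V → ℝ} (h : Integrable χ) (ξ : V) :
    cosFT χ ξ = (𝓕 (fun x => (χ x : ℂ)) ξ).re := by
  rw [Real.fourier_eq']
  have hi : Integrable (fun v : V => Complex.exp (↑(-2 * π * inner ℝ v ξ) * Complex.I) •
      (χ v : ℂ)) := by
    have h1 : Integrable (fun v : V => (χ v : ℂ)) := h.ofReal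
    have hc : Continuous fun v : V => Complex.exp (↑(-2 * π * inner ℝ v ξ) * Complex.I) := by
      fun_prop
    refine h1.mono (hc.aestronglyMeasurable.smul h1.1) (Filter.Eventually.of_forall fun v => ?_)
    rw [norm_smul, Complex.norm_exp_ofReal_mul_I, one_mul]
  rw [cosFT, ← Complex.reCLM_apply, ← ContinuousLinearMap.integral_comp_comm _ hi]
  refine integral_congr_ae (Filter.Eventually.of_forall fun v => ?_)
  simp only [Complex.reCLM_apply, smul_eq_mul, Complex.re_mul_ofReal, Complex.exp_ofReal_mul_I_re]
  rw [show -2 * π * inner ℝ v ξ = -(2 * π * inner ℝ v ξ) by ring, cos_neg]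

open Real FourierTransform SchwartzMap in
theorem exists_schwartz {χ : V → ℝ} (h : ContDiff ℝ (⊤ : ℕ∞) χ) (hs : HasCompactSupport χ) :
    ∃ f : 𝓢(V, ℂ), (∀ x, f x = χ x) ∧ ∀ x, cosFT χ x = ((𝓕 f) x).re := by
  have h1 : HasCompactSupport (fun x => (χ x : ℂ)) :=
    hs.comp_left (g := fun r : ℝ => (r : ℂ)) Complex.ofReal_zero
  have h2 : ContDiff ℝ (⊤ : ℕ∞) (fun x => (χ x : ℂ)) := Complex.ofRealCLM.contDiff.comp h
  refine ⟨h1.toSchwartzMap h2, fun x => rfl, fun x => ?_⟩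
  rw [cosFT_eq_re (h.continuous.integrable_of_hasCompactSupport hs), SchwartzMap.fourier_coe]
  rfl

theorem cosFT_continuous {χ : V → ℝ} (h : ContDiff ℝ (⊤ : ℕ∞) χ) (hs : HasCompactSupport χ) :
    Continuous (cosFT χ) := by
  obtain ⟨f, h1, h2⟩ := exists_schwartz h hs
  rw [funext h2]
  exact Complex.continuous_re.comp (SchwartzMap.continuous _)

theorem cosFT_integrable_pow {χ : V → ℝ} (h : ContDiff ℝ (⊤ : ℕ∞) χ) (hs : HasCompactSupport χ)
    (m : ℕ) : Integrable fun ξ => ‖ξ‖ ^ m * cosFT χ ξ := by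
  obtain ⟨f, h1, h2⟩ := exists_schwartz h hs
  refine ((FourierTransform.fourier f).integrable_pow_mul volume m).mono'
    (by exact ((continuous_norm.pow m).mul (cosFT_continuous h hs)).aestronglyMeasurable)
    (Filter.Eventually.of_forall fun ξ => ?_)
  rw [norm_mul, norm_pow, norm_norm, h2]
  exact mul_le_mul_of_nonneg_left (Complex.abs_re_le_norm _) (by positivity)

theorem cosFT_integrable {χ : V → ℝ} (h : ContDiff ℝ (⊤ : ℕ∞) χ) (hs : HasCompactSupport χ) :
    Integrable (cosFT χ) := by simpa using cosFT_integrable_pow h hs 0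

theorem cosFT_even (χ : V → ℝ) (ξ : V) : cosFT χ (-ξ) = cosFT χ ξ := by
  simp only [cosFT, inner_neg_right, mul_neg, Real.cos_neg]

open Real FourierTransform in
theorem cosFT_cosFT {χ : V → ℝ} (h : ContDiff ℝ (⊤ : ℕ∞) χ) (hs : HasCompactSupport χ)
    (he : ∀ x, χ (-x) = χ x) (x : V) : cosFT (cosFT χ) x = χ x := by
  obtain ⟨f, h1, h2⟩ := exists_schwartz h hs
  have key : ∀ x, χ x = ∫ ξ, (cos (2 * π * inner ℝ ξ x) * ((𝓕 f) ξ).re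
      - sin (2 * π * inner ℝ ξ x) * ((𝓕 f) ξ).im) := by
    intro x
    have h3 : 𝓕⁻ (𝓕 f) x = χ x := by rw [FourierTransform.fourierInv_fourier_eq, h1]
    rw [SchwartzMap.fourierInv_coe, Real.fourierInv_eq'] at h3
    have hi : Integrable (fun v : V => Complex.exp (↑(2 * π * inner ℝ v x) * Complex.I) •
        ((𝓕 f) v)) := by
      have h1 : Integrable (fun v : V => (𝓕 f) v) := (𝓕 f).integrable
      have hc : Continuous fun v : V => Complex.exp (↑(2 * π * inner ℝ v x) * Complex.I) := by
        fun_prop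
      refine h1.mono (hc.aestronglyMeasurable.smul h1.1) (Filter.Eventually.of_forall fun v => ?_)
      rw [norm_smul, Complex.norm_exp_ofReal_mul_I, one_mul]
    have h4 := congrArg Complex.re h3
    rw [Complex.ofReal_re, ← Complex.reCLM_apply, ← ContinuousLinearMap.integral_comp_comm _ hi]
      at h4
    rw [← h4]
    refine integral_congr_ae (Filter.Eventually.of_forall fun v => ?_)
    simp only [Complex.reCLM_apply, smul_eq_mul, Complex.mul_re, Complex.exp_ofReal_mul_I_re,
      Complex.exp_ofReal_mul_I_im]
  have hre : Integrable (fun ξ => ((𝓕 f) ξ).re) := (𝓕 f).integrable.re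
  have him : Integrable (fun ξ => ((𝓕 f) ξ).im) := (𝓕 f).integrable.im
  have i1 : Integrable (fun ξ => cos (2 * π * inner ℝ ξ x) * ((𝓕 f) ξ).re) :=
    hre.bdd_mul (c := 1) (Continuous.aestronglyMeasurable (by fun_prop))
      (Filter.Eventually.of_forall fun ξ => by simpa using abs_cos_le_one _)
  have i2 : Integrable (fun ξ => sin (2 * π * inner ℝ ξ x) * ((𝓕 f) ξ).im) :=
    him.bdd_mul (c := 1) (Continuous.aestronglyMeasurable (by fun_prop))
      (Filter.Eventually.of_forall fun ξ => by simpa using abs_sin_le_one _)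
  have k1 := key x
  have k2 := key (-x)
  simp only [inner_neg_right, mul_neg, cos_neg, sin_neg, neg_mul, sub_neg_eq_add] at k2
  rw [integral_sub i1 i2] at k1
  rw [integral_add i1 i2, he] at k2
  rw [cosFT]
  simp only [h2]
  linarith

open Real in
theorem integrable_one_sub_cos : Integrable fun τ : ℝ => (1 - cos (2 * π * τ)) / τ ^ 2 := by
  have hm : AEStronglyMeasurable (fun τ : ℝ => (1 - cos (2 * π * τ)) / τ ^ 2) :=
    (Measurable.aestronglyMeasurable (by fun_prop))
  refine (integrable_inv_one_add_sq.const_mul (2 * π ^ 2 + 2)).mono' hm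
    (Filter.Eventually.of_forall fun τ => ?_)
  have h1 := one_sub_sq_div_two_le_cos (x := 2 * π * τ)
  have h2 := cos_le_one (2 * π * τ)
  have h3 := neg_one_le_cos (2 * π * τ)
  rw [norm_eq_abs, abs_of_nonneg (div_nonneg (by linarith) (sq_nonneg _))]
  rcases eq_or_ne τ 0 with rfl | hτ
  · simp; positivity
  · rw [← div_eq_mul_inv, div_le_div_iff₀ (by positivity) (by positivity)]
    nlinarith [sq_nonneg τ]

open Real in
/-- The constant in the representation of the absolute value as a superposition of cosines. -/
def cosConst : ℝ := ∫ τ : ℝ, (1 - cos (2 * π * τ)) / τ ^ 2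

open Real in
theorem cosConst_pos : 0 < cosConst := by
  rw [cosConst, integral_pos_iff_support_of_nonneg (fun τ => div_nonneg
    (by simpa using cos_le_one _) (sq_nonneg _)) integrable_one_sub_cos]
  have : Set.Ioo (0 : ℝ) 1 ⊆ Function.support fun τ : ℝ => (1 - cos (2 * π * τ)) / τ ^ 2 := by
    intro τ hτ
    refine div_ne_zero (fun h => ?_) (pow_ne_zero _ hτ.1.ne')
    have h1 : cos (2 * π * τ) = 1 := by linarith
    rw [cos_eq_one_iff] at h1
    obtain ⟨m, hm⟩ := h1
    have : (m : ℝ) = τ := by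
      have : 2 * π * (m - τ) = 0 := by linarith
      have := (mul_eq_zero.1 this).resolve_left (by positivity)
      linarith
    have h3 : (0 : ℝ) < m := this ▸ hτ.1
    have h4 : (m : ℝ) < 1 := this ▸ hτ.2
    have h5 : 0 < m := by exact_mod_cast h3
    have h6 : m < 1 := by exact_mod_cast h4
    omega
  exact lt_of_lt_of_le (by simp) (measure_mono this)

open Real in
theorem integral_one_sub_cos_mul (a : ℝ) :
    Integrable (fun τ : ℝ => (1 - cos (2 * π * (τ * a))) / τ ^ 2) ∧
    ∫ τ : ℝ, (1 - cos (2 * π * (τ * a))) / τ ^ 2 = cosConst * |a| := by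
  rcases eq_or_ne a 0 with rfl | ha
  · simp
  · have e : (fun τ : ℝ => (1 - cos (2 * π * (τ * a))) / τ ^ 2) = fun τ =>
        a ^ 2 * ((1 - cos (2 * π * (τ * a))) / (τ * a) ^ 2) := by
      funext τ
      rcases eq_or_ne τ 0 with rfl | hτ
      · simp
      · field_simp
    constructor
    · rw [e]
      exact (integrable_one_sub_cos.comp_mul_right' ha).const_mul _
    · rw [e, integral_const_mul,
        Measure.integral_comp_mul_right (fun τ : ℝ => (1 - cos (2 * π * τ)) / τ ^ 2) a,
        ← cosConst, smul_eq_mul, abs_inv, ← sq_abs]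
      have := abs_pos.2 ha
      field_simp

open Real in
theorem integral_abs_inner_mul {Ω : Type*} [MeasurableSpace Ω] {ν : Measure Ω} [SFinite ν]
    {X : Ω → V} {q : Ω → ℝ} (hX : Measurable X) (hqm : Measurable q)
    (hq : Integrable (fun ω => ‖X ω‖ * q ω) ν) (hq0 : Integrable q ν) (x : V) :
    Integrable (fun τ : ℝ => ((∫ ω, q ω ∂ν) -
      ∫ ω, cos (2 * π * inner ℝ (X ω) (τ • x)) * q ω ∂ν) / τ ^ 2) ∧
    ∫ τ : ℝ, ((∫ ω, q ω ∂ν) - ∫ ω, cos (2 * π * inner ℝ (X ω) (τ • x)) * q ω ∂ν) / τ ^ 2 =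
      cosConst * ∫ ω, |inner ℝ (X ω) x| * q ω ∂ν := by
  let F : Ω × ℝ → ℝ := fun p => (1 - cos (2 * π * (p.2 * inner ℝ (X p.1) x))) / p.2 ^ 2 * q p.1
  have hFm : Measurable F := by
    have : Measurable fun p : Ω × ℝ => inner ℝ (X p.1) x :=
      (hX.comp measurable_fst).inner measurable_const
    fun_prop
  have hFi : Integrable F (ν.prod volume) := by
    rw [integrable_prod_iff hFm.aestronglyMeasurable]
    refine ⟨Filter.Eventually.of_forall fun ω =>
      (integral_one_sub_cos_mul (inner ℝ (X ω) x)).1.mul_const (q ω), ?_⟩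
    have e : (fun ω => ∫ τ, ‖F (ω, τ)‖) = fun ω => cosConst * |inner ℝ (X ω) x| * ‖q ω‖ := by
      funext ω
      rw [← (integral_one_sub_cos_mul (inner ℝ (X ω) x)).2, ← integral_mul_const]
      refine integral_congr_ae (Filter.Eventually.of_forall fun τ => ?_)
      simp only [F, norm_mul]
      rw [norm_of_nonneg (div_nonneg (by simpa using cos_le_one _) (sq_nonneg _))]
    rw [e]
    refine (hq.norm.const_mul (cosConst * ‖x‖)).mono' (Measurable.aestronglyMeasurable
      (by have : Measurable fun ω => inner ℝ (X ω) x := hX.inner measurable_const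
          fun_prop)) (Filter.Eventually.of_forall fun ω => ?_)
    rw [norm_mul, norm_mul, norm_mul, norm_norm, norm_norm, norm_of_nonneg cosConst_pos.le]
    have := abs_real_inner_le_norm (X ω) x
    have h2 : 0 ≤ cosConst * ‖q ω‖ := mul_nonneg cosConst_pos.le (norm_nonneg _)
    rw [norm_eq_abs (|_|), abs_abs]
    nlinarith
  have h1 : ∀ τ : ℝ, ∫ ω, F (ω, τ) ∂ν = ((∫ ω, q ω ∂ν) -
      ∫ ω, cos (2 * π * inner ℝ (X ω) (τ • x)) * q ω ∂ν) / τ ^ 2 := by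
    intro τ
    have i1 : Integrable (fun ω => cos (2 * π * inner ℝ (X ω) (τ • x)) * q ω) ν :=
      hq0.bdd_mul (c := 1) (Measurable.aestronglyMeasurable (by
        have : Measurable fun ω => inner ℝ (X ω) (τ • x) := hX.inner measurable_const
        fun_prop)) (Filter.Eventually.of_forall fun ξ => by simpa using abs_cos_le_one _)
    rw [← integral_sub hq0 i1, ← integral_div]
    refine integral_congr_ae (Filter.Eventually.of_forall fun ω => ?_)
    simp only [F, real_inner_smul_right]
    ring
  have h2 : ∀ ω, ∫ τ, F (ω, τ) = cosConst * |inner ℝ (X ω) x| * q ω := fun ω => by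
    simp only [F]
    rw [integral_mul_const, (integral_one_sub_cos_mul _).2]
  refine ⟨?_, ?_⟩
  · simp only [← h1]
    exact hFi.integral_prod_right
  · simp only [← h1]
    rw [integral_integral_swap (f := fun τ ω => F (ω, τ)) hFi.swap]
    simp only [h2, mul_assoc]
    rw [integral_const_mul]

end Cosine

section GeneralizedZonoid

variable {V : Type*} [NormedAddCommGroup V] [InnerProductSpace ℝ V] [FiniteDimensional ℝ V]
  [MeasurableSpace V] [BorelSpace V]

theorem max_zero_sub_max_neg_zero (a : ℝ) : max a 0 - max (-a) 0 = a := by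
  rcases le_total a 0 with h | h
  · rw [max_eq_right h, max_eq_left (by linarith)]; ring
  · rw [max_eq_left h, max_eq_right (by linarith)]; ring

theorem exists_zonoid_pair {Ω : Type*} [MeasurableSpace Ω] {ν : Measure Ω}
    {X : Ω → V} {q : Ω → ℝ} (hX : Measurable X) (hqm : Measurable q)
    (hq : Integrable (fun ω => ‖X ω‖ * q ω) ν) : ∃ Zp Zm : ConvexBody V,
      (∀ u, suppFn Zp u - suppFn Zm u = ∫ ω, |inner ℝ (X ω) u| * q ω ∂ν) ∧
      ∀ (G : ConvexBody V → ℝ) (θ : V → ℝ), Continuous G → Continuous θ → AbsHom θ →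
        (∀ (s : Finset V) (f : V → V),
          G (∑ y ∈ s, segBody (f y)) = G 0 + ∑ y ∈ s, θ (f y)) →
        G Zp - G Zm = ∫ ω, θ (X ω) * q ω ∂ν ∧
          G Zm = G 0 + ∫ ω, θ (max (-q ω) 0 • X ω) ∂ν := by
  have hqa : Integrable (fun ω => ‖X ω‖ * |q ω|) ν := by
    simpa [abs_mul] using hq.abs
  have hint : ∀ r : Ω → ℝ, Measurable r → (∀ ω, |r ω| ≤ |q ω|) →
      Integrable (fun ω => r ω • X ω) ν := fun r hr hrq =>
    hqa.mono' (hr.smul hX).aestronglyMeasurable (Filter.Eventually.of_forall fun ω => by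
      rw [norm_smul, Real.norm_eq_abs, mul_comm]
      exact mul_le_mul_of_nonneg_left (hrq ω) (norm_nonneg _))
  have mp : Measurable fun ω => max (q ω) 0 := by fun_prop
  have mm : Measurable fun ω => max (-q ω) 0 := by fun_prop
  have ip := hint _ mp (fun ω => by
    rw [abs_of_nonneg (le_max_right _ _)]; exact max_le (le_abs_self _) (abs_nonneg _))
  have im := hint _ mm (fun ω => by
    rw [abs_of_nonneg (le_max_right _ _)]; exact max_le (neg_le_abs _) (abs_nonneg _))
  obtain ⟨Zp, hp1, hp2⟩ := exists_zonoid (mp.smul hX) ip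
  obtain ⟨Zm, hm1, hm2⟩ := exists_zonoid (mm.smul hX) im
  have comb : ∀ θ : V → ℝ, Continuous θ → AbsHom θ →
      (∫ ω, θ (max (q ω) 0 • X ω) ∂ν) - ∫ ω, θ (max (-q ω) 0 • X ω) ∂ν =
        ∫ ω, θ (X ω) * q ω ∂ν := by
    intro θ hc h
    rw [← integral_sub (h.integrable hc ip) (h.integrable hc im)]
    refine integral_congr_ae (Filter.Eventually.of_forall fun ω => ?_)
    simp only [h _ (X ω)]
    rw [abs_of_nonneg (le_max_right _ _), abs_of_nonneg (le_max_right _ _), ← sub_mul,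
      max_zero_sub_max_neg_zero, mul_comm]
  refine ⟨Zp, Zm, fun u => ?_, fun G θ hG hθ hh hs => ?_⟩
  · rw [hp1, hm1, ← comb (fun v => |inner ℝ v u|) (by fun_prop) (absHom_inner u)]
    rfl
  · refine ⟨?_, hm2 G θ hG hθ hh hs⟩
    rw [hp2 G θ hG hθ hh hs, hm2 G θ hG hθ hh hs, ← comb θ hθ hh]
    simp only [Pi.smul_apply']
    ring

/-- The constant produced by a radial cutoff. -/
def radialConst (ω : ℝ → ℝ) : ℝ := ∫ τ : ℝ, ω |τ| * |τ| / τ ^ 2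

theorem radialConst_pos {ω : ℝ → ℝ} (h : Continuous ω) (h0 : ∀ t, 0 ≤ ω t) (h1 : ω 1 = 1)
    (hs : ∀ t, ω t ≠ 0 → 1 / 2 < t ∧ t < 2) : 0 < radialConst ω := by
  have hc : Continuous fun τ : ℝ => ω |τ| * |τ| / τ ^ 2 := by
    rw [continuous_iff_continuousAt]
    intro τ
    rcases eq_or_ne τ 0 with rfl | hτ
    · have : (fun τ : ℝ => ω |τ| * |τ| / τ ^ 2) =ᶠ[nhds 0] fun _ => 0 := by
        filter_upwards [Metric.ball_mem_nhds (0 : ℝ) (show (0 : ℝ) < 1 / 2 by norm_num)] with y hy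
        rw [mem_ball_zero_iff, Real.norm_eq_abs] at hy
        have : ω |y| = 0 := by
          by_contra hne
          linarith [(hs _ hne).1]
        simp [this]
      exact continuousAt_const.congr this.symm
    · exact ContinuousAt.div (by fun_prop) (by fun_prop) (pow_ne_zero _ hτ)
  have hcs : HasCompactSupport fun τ : ℝ => ω |τ| * |τ| / τ ^ 2 := by
    refine HasCompactSupport.intro (isCompact_closedBall (0 : ℝ) 2) fun x hx => ?_
    have : ω |x| = 0 := by
      by_contra hne
      exact hx (by simpa using (hs _ hne).2.le)
    rw [this, zero_mul, zero_div]
  have hn : ∀ τ : ℝ, 0 ≤ ω |τ| * |τ| / τ ^ 2 := fun τ =>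
    div_nonneg (mul_nonneg (h0 _) (abs_nonneg _)) (sq_nonneg _)
  rw [radialConst]
  exact hc.integral_pos_of_hasCompactSupport_nonneg_nonzero hcs hn (x := 1) (by simp [h1])

theorem integral_radial {ω : ℝ → ℝ} {f : V → ℝ} (hf : SmHom f) (he : ∀ x, f (-x) = f x) (x : V) :
    ∫ τ : ℝ, ω ‖τ • x‖ * f (τ • x) / τ ^ 2 = radialConst ω * f x := by
  have hh : ∀ τ : ℝ, f (τ • x) = |τ| * f x := fun τ => by
    rcases le_total 0 τ with h | h
    · rw [hf.hom _ h, abs_of_nonneg h]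
    · rw [← he, ← neg_smul, hf.hom _ (by linarith), abs_of_nonpos h]
  rcases eq_or_ne x 0 with rfl | hx
  · have : f 0 = 0 := by simpa using hf.hom 0 le_rfl 0
    simp [this]
  have hn : 0 < ‖x‖ := norm_pos_iff.2 hx
  have e : (fun τ : ℝ => ω ‖τ • x‖ * f (τ • x) / τ ^ 2) = fun τ =>
      ‖x‖ * f x * (ω |τ * ‖x‖| * |τ * ‖x‖| / (τ * ‖x‖) ^ 2) := by
    funext τ
    rw [hh, norm_smul, Real.norm_eq_abs, abs_mul, abs_norm]
    rcases eq_or_ne τ 0 with rfl | hτ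
    · simp
    · field_simp
  rw [e, integral_const_mul,
    Measure.integral_comp_mul_right (fun τ : ℝ => ω |τ| * |τ| / τ ^ 2), ← radialConst, smul_eq_mul,
    abs_inv, abs_norm]
  field_simp

/-- Smooth even homogeneous functions are differences of support functions of zonoids. -/
theorem SmHom.exists_zonoid_pair {f : V → ℝ} (hf : SmHom f) (he : ∀ x, f (-x) = f x) :
    ∃ Zp Zm : ConvexBody V, (∀ u, suppFn Zp u - suppFn Zm u = f u) ∧
      ∀ G : ConvexBody V → ℝ, Continuous G →
        (∀ K v, G (K + segBody v) = G K) → G Zp = G 0 ∧ G Zm = G 0 := by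
  obtain ⟨ω, h1, h2, h3, h4, h5⟩ := exists_radial_cutoff V
  obtain ⟨hc, hs⟩ := contDiff_cutoff hf.smooth h1 h5
  set χ : V → ℝ := fun x => ω ‖x‖ * f x with hχ
  have hχe : ∀ x, χ (-x) = χ x := fun x => by simp only [hχ, norm_neg, he]
  have hcc := cosFT_continuous hc hs
  have hω := radialConst_pos h1.continuous h2 h4 h5
  have hinv := cosFT_cosFT hc hs hχe
  have hq1 : Integrable (fun ξ => ‖ξ‖ * cosFT χ ξ) := by simpa using cosFT_integrable_pow hc hs 1
  have hf0 : f 0 = 0 := by simpa using hf.hom 0 le_rfl 0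
  have h0 : ∫ ξ, cosFT χ ξ = 0 := by
    have := hinv 0
    simpa [cosFT, hχ, hf0] using this
  have key : ∀ x, -(radialConst ω * f x) = cosConst * ∫ ξ, |inner ℝ ξ x| * cosFT χ ξ := by
    intro x
    rw [← (integral_abs_inner_mul (X := fun ξ : V => ξ) measurable_id hcc.measurable hq1 (cosFT_integrable hc hs) x).2,
      ← integral_radial hf he, ← integral_neg]
    refine integral_congr_ae (Filter.Eventually.of_forall fun τ => ?_)
    have := hinv (τ • x)
    rw [cosFT] at this
    simp only [h0, this]
    simp only [hχ]
    ring
  obtain ⟨Zp, Zm, hZ1, hZ2⟩ := _root_.exists_zonoid_pair (ν := volume) (X := fun ξ : V => ξ)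
    (q := fun ξ => -(cosConst / radialConst ω) * cosFT χ ξ) measurable_id
    (hcc.measurable.const_mul _) (by
      have := hq1.const_mul (-(cosConst / radialConst ω))
      refine this.congr (Filter.Eventually.of_forall fun ξ => ?_)
      simp only
      ring)
  refine ⟨Zp, Zm, fun u => ?_, fun G hG hGs => ?_⟩
  · rw [hZ1]
    have : ∀ ξ : V, |inner ℝ ξ u| * (-(cosConst / radialConst ω) * cosFT χ ξ) =
        -(cosConst / radialConst ω) * (|inner ℝ ξ u| * cosFT χ ξ) := fun ξ => by ring
    simp only [this]
    rw [integral_const_mul]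
    have := key u
    have hne := hω.ne'
    field_simp
    linarith
  · have := hZ2 G (fun _ => 0) hG continuous_const (fun _ _ => by simp) fun s f => by
      classical
      induction s using Finset.induction_on with
      | empty => simp
      | insert a s ha ih =>
        rw [Finset.sum_insert ha, add_comm (segBody _), hGs, ih]
        simp
    simp only [zero_mul, integral_zero] at this
    constructor <;> linarith

/-- A continuous function on convex bodies which is unchanged by adding segments is unchanged
by adding symmetric bodies. -/
theorem add_symmetric_eq {φ : ConvexBody V → ℝ} (hc : Continuous φ)
    (h : ∀ K v, φ (K + segBody v) = φ K) (K S : ConvexBody V)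
    (hS : ∀ u, suppFn S (-u) = suppFn S u) : φ (K + S) = φ K := by
  have smooth : ∀ S : ConvexBody V, SmHom (suppFn S) → (∀ u, suppFn S (-u) = suppFn S u) →
      φ (K + S) = φ K := by
    intro S hs hS
    obtain ⟨Zp, Zm, h1, h2⟩ := hs.exists_zonoid_pair hS
    have e : S + Zm = Zp := body_ext fun u => by rw [suppFn_add, ← h1]; ring
    have inv := fun L : ConvexBody V => h2 (fun Z => φ (L + Z))
      (hc.comp (continuous_body_add L)) fun K v => by rw [← add_assoc, h]
    have i1 := (inv (K + S)).2
    have i2 := (inv K).1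
    simp only [add_zero] at i1 i2
    rw [← i1, add_assoc, e, i2]
  refine eq_of_abs_sub_nonpos ?_
  refine le_of_forall_pos_le_add fun δ hδ => ?_
  have hcont := hc.comp (continuous_body_add K)
  obtain ⟨ε, hε, hb⟩ := Metric.continuous_iff.1 hcont S δ hδ
  obtain ⟨f, hf1, hf2, hf3, hf4⟩ := (suppFn_sublin S).exists_smooth_approx (half_pos hε)
  have hd : dist (ofSublin f hf2) S ≤ ε / 2 := dist_le_of_suppFn (half_pos hε).le fun u => by
    rw [suppFn_ofSublin]; exact hf3 u
  have hsf : suppFn (ofSublin f hf2) = f := funext fun u => by simp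
  have h3 := hb _ (lt_of_le_of_lt hd (half_lt_self hε))
  simp only [Function.comp_def] at h3
  rw [smooth _ (by rwa [hsf]) (by rw [hsf]; exact hf4 hS), Real.dist_eq, abs_sub_comm] at h3
  linarith

end GeneralizedZonoid

section EvenUniqueness

variable {V : Type*} [NormedAddCommGroup V] [InnerProductSpace ℝ V] [FiniteDimensional ℝ V]

/-- The odd part of a function (up to a factor of two). -/
def oddOf (f : V → ℝ) (u : V) : ℝ := f u - f (-u)

theorem oddOf_add (f g : V → ℝ) : oddOf (f + g) = oddOf f + oddOf g := by
  funext u; simp only [oddOf, Pi.add_apply]; ring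

theorem oddOf_reflect (f : V → ℝ) : oddOf (fun u => f (-u)) = -oddOf f := by
  funext u; simp only [oddOf, Pi.neg_apply, neg_neg]; ring

theorem oddOf_norm_add (R : ℝ) (f : V → ℝ) : oddOf (fun u => R * ‖u‖ + f u) = oddOf f := by
  funext u; simp only [oddOf, norm_neg]; ring

theorem SmHom.zero {f : V → ℝ} (hf : SmHom f) : f 0 = 0 := by simpa using hf.hom 0 le_rfl 0

theorem SmHom.add {f g : V → ℝ} (hf : SmHom f) (hg : SmHom g) : SmHom (f + g) where
  hom t ht x := by simp only [Pi.add_apply, hf.hom t ht, hg.hom t ht]; ring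
  smooth x hx := (hf.smooth x hx).add (hg.smooth x hx)

theorem SmHom.reflect {f : V → ℝ} (hf : SmHom f) : SmHom fun u => f (-u) where
  hom t ht x := by rw [← smul_neg, hf.hom t ht]
  smooth x hx := (hf.smooth (-x) (neg_ne_zero.2 hx)).comp x contDiffAt_id.neg

theorem Sublin.add_norm_smHom {h g : V → ℝ} (hh : Sublin h) (hg : SmHom g) :
    ∃ R₀, 0 ≤ R₀ ∧ ∀ R, R₀ ≤ R → Sublin fun x => R * ‖x‖ + (h x + g x) := by
  obtain ⟨R₀, h0, h1⟩ := hg.exists_sublin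
  refine ⟨R₀, h0, fun R hR => ?_⟩
  have := (h1 R hR).add hh
  convert this using 2
  ring

theorem exists_even_factor {φ : ConvexBody V → ℝ}
    (sym : ∀ K S : ConvexBody V, (∀ u, suppFn S (-u) = suppFn S u) → φ (K + S) = φ K) :
    ∃ Φ : (V → ℝ) → ℝ, ∀ K, Φ (oddOf (suppFn K)) = φ K := by
  have hfac : Function.FactorsThrough φ fun K : ConvexBody V => oddOf (suppFn K) := by
    intro K L hKL
    have h1 := sym K (L + L.reflect) fun u => by
      simp only [suppFn_add, suppFn_reflect, neg_neg]; ring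
    have h2 := sym L (K + L.reflect) fun u => by
      have := congrFun hKL u
      simp only [oddOf] at this
      simp only [suppFn_add, suppFn_reflect, neg_neg]; linarith
    rw [← h1, ← h2]
    congr 1
    abel
  exact ⟨_, fun K => hfac.extend_apply 0 K⟩

/-- Nonnegative functions whose support does not meet its reflection. -/
structure OneSided (g : V → ℝ) : Prop where
  sm : SmHom g
  nonneg : ∀ u, 0 ≤ g u
  disj : ∀ u, g u = 0 ∨ g (-u) = 0

theorem OneSided.reflect {g : V → ℝ} (h : OneSided g) : OneSided fun u => g (-u) :=
  ⟨h.sm.reflect, fun u => h.nonneg _, fun u => by rw [neg_neg]; exact (h.disj u).symm⟩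

/-- Odd parts of support functions. -/
def IsOddPart (a : V → ℝ) : Prop := ∃ K : ConvexBody V, oddOf (suppFn K) = a

theorem IsOddPart.zero : IsOddPart (0 : V → ℝ) :=
  ⟨0, funext fun u => by simp [oddOf, suppFn_zero]⟩

theorem IsOddPart.add {a g : V → ℝ} (h : IsOddPart a) (hg : SmHom g) :
    IsOddPart (a + oddOf g) := by
  obtain ⟨K, rfl⟩ := h
  obtain ⟨R, -, hR⟩ := (suppFn_sublin K).add_norm_smHom hg
  refine ⟨ofSublin _ (hR R le_rfl), ?_⟩
  rw [← oddOf_add, ← oddOf_norm_add R (suppFn K + g)]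
  congr 1
  funext u
  simp

theorem IsOddPart.sub {a g : V → ℝ} (h : IsOddPart a) (hg : SmHom g) :
    IsOddPart (a - oddOf g) := by
  rw [sub_eq_add_neg, ← oddOf_reflect]
  exact h.add hg.reflect

variable {φ : ConvexBody V → ℝ} {Φ : (V → ℝ) → ℝ}

theorem oddFactor_neg (he : EvenVal φ) (hΦ : ∀ K, Φ (oddOf (suppFn K)) = φ K) {a : V → ℝ}
    (h : IsOddPart a) : Φ (-a) = Φ a := by
  obtain ⟨K, rfl⟩ := h
  rw [hΦ, ← he K, ← hΦ, ← oddOf_reflect]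
  congr 2
  funext u
  rw [suppFn_reflect]

theorem oddFactor_midpoint (hφ : IsValuation φ) (hΦ : ∀ K, Φ (oddOf (suppFn K)) = φ K)
    {a g : V → ℝ} (h : IsOddPart a) (hg : OneSided g) :
    Φ (a + oddOf g) + Φ (a - oddOf g) = 2 * Φ a := by
  obtain ⟨K, rfl⟩ := h
  obtain ⟨R₁, h1, hR₁⟩ := (suppFn_sublin K).add_norm_smHom hg.sm
  obtain ⟨R₂, h2, hR₂⟩ := (suppFn_sublin K).add_norm_smHom hg.reflect.sm
  set R := max R₁ R₂
  have hs1 := hR₁ R (le_max_left _ _)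
  have hs2 := hR₂ R (le_max_right _ _)
  have s0 : Sublin fun x : V => R * ‖x‖ + suppFn K x := by
    have := (suppFn_sublin (ballBody V R (h1.trans (le_max_left _ _)))).add (suppFn_sublin K)
    simpa only [suppFn_ballBody] using this
  have s3 : Sublin fun x : V => R * ‖x‖ + (suppFn K x + (g x + g (-x))) := by
    have := hs1.max hs2
    convert this using 2 with x
    have := hg.nonneg x
    have := hg.nonneg (-x)
    rcases hg.disj x with h | h
    · rw [max_eq_right (by linarith), h]; ring
    · rw [max_eq_left (by linarith), h]; ring
  have key := CVal.of_min hφ (K := ofSublin _ hs1) (L := ofSublin _ hs2) (M := ofSublin _ s3)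
    (I := ofSublin _ s0) (fun x => by
      simp only [suppFn_ofSublin]
      have := hg.nonneg x
      have := hg.nonneg (-x)
      rcases hg.disj x with h | h
      · rw [max_eq_right (by linarith), h]; ring
      · rw [max_eq_left (by linarith), h]; ring) (fun x => by
      simp only [suppFn_ofSublin]
      have := hg.nonneg x
      have := hg.nonneg (-x)
      rcases hg.disj x with h | h
      · rw [min_eq_left (by linarith), h]; ring
      · rw [min_eq_right (by linarith), h]; ring)
  have o0 : oddOf (suppFn (ofSublin _ s0)) = oddOf (suppFn K) := by
    funext u; simp only [oddOf, suppFn_ofSublin, norm_neg]; ring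
  have o3 : oddOf (suppFn (ofSublin _ s3)) = oddOf (suppFn K) := by
    funext u; simp only [oddOf, suppFn_ofSublin, norm_neg, neg_neg]; ring
  have o1 : oddOf (suppFn (ofSublin _ hs1)) = oddOf (suppFn K) + oddOf g := by
    funext u; simp only [oddOf, suppFn_ofSublin, norm_neg, Pi.add_apply]; ring
  have o2 : oddOf (suppFn (ofSublin _ hs2)) = oddOf (suppFn K) - oddOf g := by
    funext u; simp only [oddOf, suppFn_ofSublin, norm_neg, neg_neg, Pi.sub_apply]; ring
  rw [← hΦ, ← hΦ, ← hΦ, ← hΦ, o0, o1, o2, o3] at key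
  linarith

theorem oddFactor_add_of_oneSided (hφ : IsValuation φ) (hΦ : ∀ K, Φ (oddOf (suppFn K)) = φ K)
    {a g₁ g₂ : V → ℝ} (h : IsOddPart a) (h₁ : OneSided g₁) (h₂ : OneSided g₂)
    (h₁₂ : OneSided (g₁ + g₂)) :
    Φ (a + oddOf g₁ + oddOf g₂) = Φ (a + oddOf g₁) + Φ (a + oddOf g₂) - Φ a := by
  have j1 := oddFactor_midpoint hφ hΦ (h.add h₂.sm) h₁
  have j2 := oddFactor_midpoint hφ hΦ (h.sub h₁.sm) h₂
  have j3 := oddFactor_midpoint hφ hΦ h h₁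
  have j4 := oddFactor_midpoint hφ hΦ h h₁₂
  rw [oddOf_add] at j4
  rw [add_right_comm, show a + oddOf g₂ - oddOf g₁ = a - oddOf g₁ + oddOf g₂ by abel] at j1
  rw [show a - oddOf g₁ - oddOf g₂ = a - (oddOf g₁ + oddOf g₂) by abel] at j2
  rw [← add_assoc] at j4
  linarith

theorem oddFactor_add (hφ : IsValuation φ) (hΦ : ∀ K, Φ (oddOf (suppFn K)) = φ K)
    {a g₁ g₂ : V → ℝ} (h : IsOddPart a) (h₁ : OneSided g₁) (h₂ : OneSided g₂)
    (h₁₂ : OneSided (g₁ + g₂) ∨ OneSided (g₁ + fun u => g₂ (-u))) :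
    Φ (a + oddOf g₁ + oddOf g₂) = Φ (a + oddOf g₁) + Φ (a + oddOf g₂) - Φ a := by
  rcases h₁₂ with h₁₂ | h₁₂
  · exact oddFactor_add_of_oneSided hφ hΦ h h₁ h₂ h₁₂
  · have k := oddFactor_add_of_oneSided hφ hΦ h h₁ h₂.reflect h₁₂
    rw [oddOf_reflect, ← sub_eq_add_neg, ← sub_eq_add_neg] at k
    have j1 := oddFactor_midpoint hφ hΦ (h.add h₁.sm) h₂
    have j2 := oddFactor_midpoint hφ hΦ h h₂
    linarith

theorem oddFactor_sum {ι : Type*} (hφ : IsValuation φ) (he : EvenVal φ)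
    (hΦ : ∀ K, Φ (oddOf (suppFn K)) = φ K) (g : ι → V → ℝ) (s : Finset ι)
    (hg : ∀ i ∈ s, OneSided (g i)) (hgg : ∀ i ∈ s, ∀ j ∈ s,
      OneSided (g i + g j) ∨ OneSided (g i + fun u => g j (-u))) :
    Φ (∑ i ∈ s, oddOf (g i)) = Φ 0 := by
  classical
  have hodd : ∀ t ⊆ s, IsOddPart (∑ i ∈ t, oddOf (g i)) := by
    intro t
    induction t using Finset.induction_on with
    | empty => intro _; simpa using IsOddPart.zero
    | insert i t hi ih =>
      intro ht
      rw [Finset.sum_insert hi, add_comm]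
      exact (ih ((Finset.subset_insert _ _).trans ht)).add
        (hg i (ht (Finset.mem_insert_self _ _))).sm
  have main : ∀ m : ℕ, ∀ t ⊆ s, t.card ≤ m → Φ (∑ i ∈ t, oddOf (g i)) = Φ 0 := by
    intro m
    induction m with
    | zero =>
      intro t _ hc
      rw [Finset.card_eq_zero.1 (Nat.le_zero.1 hc), Finset.sum_empty]
    | succ m ih =>
      intro t ht hc
      rcases t.eq_empty_or_nonempty with rfl | ⟨i, hi⟩
      · simp
      rcases (t.erase i).eq_empty_or_nonempty with h0 | ⟨j, hj⟩
      · rw [← Finset.insert_erase hi, h0]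
        have h1 := oddFactor_midpoint hφ hΦ IsOddPart.zero (hg i (ht hi))
        have h2 := oddFactor_neg he hΦ (IsOddPart.zero.add (hg i (ht hi)).sm)
        rw [zero_add] at h1 h2
        rw [zero_sub, h2] at h1
        simp only [insert_empty_eq, Finset.sum_singleton]
        linarith
      · set r := (t.erase i).erase j with hr
        have hjr : j ∉ r := Finset.notMem_erase _ _
        have hir : i ∉ r := fun h => Finset.notMem_erase i t (Finset.mem_of_mem_erase h)
        have e1 : insert j r = t.erase i := Finset.insert_erase hj
        have hir' : i ∉ insert j r := by rw [e1]; exact Finset.notMem_erase _ _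
        have e2 : insert i (insert j r) = t := by rw [e1, Finset.insert_erase hi]
        have hrt : r ⊆ t := (Finset.erase_subset _ _).trans (Finset.erase_subset _ _)
        have hjt : j ∈ t := Finset.mem_of_mem_erase hj
        have ct : t.card = r.card + 2 := by
          rw [← e2, Finset.card_insert_of_notMem hir', Finset.card_insert_of_notMem hjr]
        have k := oddFactor_add hφ hΦ (hodd r (hrt.trans ht)) (hg j (ht hjt)) (hg i (ht hi))
          (hgg j (ht hjt) i (ht hi))
        have i0 := ih r (hrt.trans ht) (by omega)
        have i1 := ih (insert j r) (Finset.insert_subset (ht hjt) (hrt.trans ht))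
          (by rw [Finset.card_insert_of_notMem hjr]; omega)
        have i2 := ih (insert i r) (Finset.insert_subset (ht hi) (hrt.trans ht))
          (by rw [Finset.card_insert_of_notMem hir]; omega)
        rw [Finset.sum_insert hjr, add_comm] at i1
        rw [Finset.sum_insert hir, add_comm] at i2
        rw [← e2, Finset.sum_insert hir', Finset.sum_insert hjr, add_comm,
          add_comm (oddOf (g j)), k]
        linarith
  exact main s.card s subset_rfl le_rfl

/-- Nonnegative smooth homogeneous functions supported in a narrow cone around `z`. -/
structure CapFn (z : V) (g : V → ℝ) : Prop where
  sm : SmHom g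
  nonneg : ∀ u, 0 ≤ g u
  cap : ∀ u, g u ≠ 0 → 4 / 5 * ‖u‖ ≤ inner ℝ u z

theorem CapFn.reflect {z : V} {g : V → ℝ} (h : CapFn z g) : CapFn (-z) fun u => g (-u) :=
  ⟨h.sm.reflect, fun u => h.nonneg _, fun u hu => by
    have := h.cap _ hu
    rwa [norm_neg, inner_neg_left, ← inner_neg_right] at this⟩

theorem CapFn.oneSided_add {z w : V} {g₁ g₂ : V → ℝ} (hz : ‖z‖ = 1) (hw : ‖w‖ = 1)
    (h₁ : CapFn z g₁) (h₂ : CapFn w g₂) (hzw : 0 ≤ inner ℝ z w) : OneSided (g₁ + g₂) := by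
  refine ⟨h₁.sm.add h₂.sm, fun u => add_nonneg (h₁.nonneg u) (h₂.nonneg u), fun u => ?_⟩
  have bad : ∀ {z w : V} {g₁ g₂ : V → ℝ}, ‖z‖ = 1 → ‖w‖ = 1 → CapFn z g₁ → CapFn w g₂ →
      0 ≤ inner ℝ z w → g₁ u ≠ 0 → g₂ (-u) = 0 := by
    intro z w g₁ g₂ hz hw h₁ h₂ hzw hu
    by_contra hne
    have hu0 : u ≠ 0 := by rintro rfl; exact hu h₁.sm.zero
    have e1 := h₁.cap u hu
    have e2 := h₂.cap (-u) hne
    rw [norm_neg, inner_neg_left] at e2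
    have e3 : inner ℝ u (z - w) ≤ ‖u‖ * ‖z - w‖ := real_inner_le_norm _ _
    rw [inner_sub_right] at e3
    have e4 : ‖z - w‖ ^ 2 ≤ 2 := by
      rw [norm_sub_sq_real, hz, hw]; linarith
    have hp := norm_pos_iff.2 hu0
    have e5 : 8 / 5 ≤ ‖z - w‖ := by
      by_contra hlt
      push Not at hlt
      nlinarith
    nlinarith
  by_cases hu : (g₁ + g₂) u = 0
  · exact Or.inl hu
  right
  have hself : ∀ v : V, ‖v‖ = 1 → 0 ≤ inner ℝ v v := fun v _ => real_inner_self_nonneg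
  simp only [Pi.add_apply] at hu ⊢
  by_cases hu1 : g₁ u = 0
  · have hu2 : g₂ u ≠ 0 := fun h => hu (by rw [hu1, h, add_zero])
    rw [bad hw hw h₂ h₂ (hself w hw) hu2, bad hw hz h₂ h₁ (by rwa [real_inner_comm]) hu2,
      add_zero]
  · rw [bad hz hz h₁ h₁ (hself z hz) hu1, bad hz hw h₁ h₂ hzw hu1, add_zero]

theorem CapFn.oneSided {z : V} {g : V → ℝ} (hz : ‖z‖ = 1) (h : CapFn z g) : OneSided g := by
  have h0 : CapFn z (0 : V → ℝ) := ⟨⟨fun t _ x => by simp, fun x _ => contDiffAt_const⟩,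
    fun _ => le_rfl, fun u hu => absurd rfl hu⟩
  simpa using h.oneSided_add hz hz h0 real_inner_self_nonneg

theorem CapFn.oneSided_or {z w : V} {g₁ g₂ : V → ℝ} (hz : ‖z‖ = 1) (hw : ‖w‖ = 1)
    (h₁ : CapFn z g₁) (h₂ : CapFn w g₂) :
    OneSided (g₁ + g₂) ∨ OneSided (g₁ + fun u => g₂ (-u)) := by
  rcases le_total 0 (inner ℝ z w) with h | h
  · exact Or.inl (h₁.oneSided_add hz hw h₂ h)
  · exact Or.inr (h₁.oneSided_add hz (by rwa [norm_neg]) h₂.reflect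
      (by rw [inner_neg_right]; linarith))

theorem exists_cap_cutoff (z : V) : ∃ η : V → ℝ, (∀ x, x ≠ 0 → ContDiffAt ℝ (⊤ : ℕ∞) η x) ∧
    (∀ t : ℝ, 0 < t → ∀ x, η (t • x) = η x) ∧ (∀ x, 0 ≤ η x) ∧ (∀ x, η x ≤ 1) ∧
    (∀ x, η x ≠ 0 → 4 / 5 * ‖x‖ ≤ inner ℝ x z) ∧
    (∀ x, x ≠ 0 → 9 / 10 * ‖x‖ < inner ℝ x z → η x = 1) := by
  classical
  refine ⟨fun x => if x = 0 then 0 else Real.smoothTransition (10 * (inner ℝ x z / ‖x‖) - 8),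
    fun x hx => ?_, fun t ht x => ?_, fun x => ?_, fun x => ?_, fun x hx => ?_, fun x hx h => ?_⟩
  · have : ContDiffAt ℝ (⊤ : ℕ∞)
        (fun x => Real.smoothTransition (10 * (inner ℝ x z / ‖x‖) - 8)) x := by
      have h1 : ContDiffAt ℝ (⊤ : ℕ∞) (fun x : V => 10 * (inner ℝ x z / ‖x‖) - 8) x :=
        (contDiffAt_const.mul ((contDiffAt_id.inner ℝ contDiffAt_const).div (contDiffAt_norm ℝ hx)
          (norm_ne_zero_iff.2 hx))).sub contDiffAt_const
      exact Real.smoothTransition.contDiffAt.comp x h1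
    refine this.congr_of_eventuallyEq ?_
    filter_upwards [isOpen_ne.mem_nhds hx] with y hy
    have hy' : y ≠ 0 := hy
    simp [hy']
  · by_cases hx : x = 0
    · simp [hx]
    · simp only [hx, smul_eq_zero, ht.ne', or_self, if_false, norm_smul, real_inner_smul_left,
        Real.norm_eq_abs, abs_of_pos ht]
      rw [mul_div_mul_left _ _ ht.ne']
  · dsimp only
    split_ifs
    · exact le_rfl
    · exact Real.smoothTransition.nonneg _
  · dsimp only
    split_ifs
    · exact zero_le_one
    · exact Real.smoothTransition.le_one _
  · dsimp only at hx
    split_ifs at hx with h0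
    · exact absurd rfl hx
    · have : 0 < 10 * (inner ℝ x z / ‖x‖) - 8 := by
        by_contra hle
        exact hx (Real.smoothTransition.zero_of_nonpos (not_lt.1 hle))
      have h2 : 4 / 5 < inner ℝ x z / ‖x‖ := by linarith
      rw [lt_div_iff₀ (norm_pos_iff.2 h0)] at h2
      exact h2.le
  · simp only [hx, if_false]
    refine Real.smoothTransition.one_of_one_le ?_
    have : 9 / 10 < inner ℝ x z / ‖x‖ := by rwa [lt_div_iff₀ (norm_pos_iff.2 hx)]
    linarith

theorem exists_cap_partition (t : Finset V) : ∀ f : V → ℝ, SmHom f → (∀ u, 0 ≤ f u) →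
    (∀ u, f u ≠ 0 → ∃ z ∈ t, 9 / 10 * ‖u‖ < inner ℝ u z) →
    ∃ g : V → V → ℝ, (∀ z ∈ t, CapFn z (g z)) ∧ f = ∑ z ∈ t, g z := by
  classical
  induction t using Finset.induction_on with
  | empty =>
    intro f _ _ h
    refine ⟨fun _ => 0, by simp, funext fun u => ?_⟩
    by_contra hu
    obtain ⟨z, hz, -⟩ := h u (by simpa using hu)
    simp at hz
  | insert z t hz ih =>
    intro f hf hn h
    obtain ⟨η, e1, e2, e3, e4, e5, e6⟩ := exists_cap_cutoff z
    have hom : ∀ r : ℝ, 0 ≤ r → ∀ x, f (r • x) * η (r • x) = r * (f x * η x) := by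
      intro r hr x
      rcases hr.eq_or_lt with rfl | hr'
      · simp [hf.zero]
      · rw [hf.hom r hr, e2 r hr']; ring
    have s1 : SmHom fun u => f u * η u :=
      ⟨hom, fun x hx => (hf.smooth x hx).mul (e1 x hx)⟩
    have s2 : SmHom fun u => f u * (1 - η u) := by
      refine ⟨fun r hr x => ?_, fun x hx => (hf.smooth x hx).mul (contDiffAt_const.sub (e1 x hx))⟩
      have := hom r hr x
      rw [mul_sub, this, hf.hom r hr]; ring
    obtain ⟨g, hg1, hg2⟩ := ih _ s2 (fun u => mul_nonneg (hn u) (by linarith [e4 u])) (by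
      intro u hu
      obtain ⟨w, hw, hwu⟩ := h u (left_ne_zero_of_mul hu)
      rcases Finset.mem_insert.1 hw with rfl | hw
      · refine absurd (e6 u ?_ hwu) fun h1 => hu (by rw [h1]; simp)
        rintro rfl
        exact hu (by rw [hf.zero, zero_mul])
      · exact ⟨w, hw, hwu⟩)
    refine ⟨Function.update g z fun u => f u * η u, fun w hw => ?_, ?_⟩
    · rcases Finset.mem_insert.1 hw with rfl | hw
      · rw [Function.update_self]
        exact ⟨s1, fun u => mul_nonneg (hn u) (e3 u), fun u hu => e5 u (right_ne_zero_of_mul hu)⟩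
      · rw [Function.update_of_ne (ne_of_mem_of_not_mem hw hz)]
        exact hg1 w hw
    · rw [Finset.sum_insert hz, Function.update_self,
        Finset.sum_congr rfl fun w hw => Function.update_of_ne (ne_of_mem_of_not_mem hw hz) _ _,
        ← hg2]
      funext u
      simp only [Pi.add_apply]
      ring

theorem exists_cap_cover (V : Type*) [NormedAddCommGroup V] [InnerProductSpace ℝ V]
    [FiniteDimensional ℝ V] : ∃ t : Finset V, (∀ z ∈ t, ‖z‖ = 1) ∧
      ∀ u : V, u ≠ 0 → ∃ z ∈ t, 9 / 10 * ‖u‖ < inner ℝ u z := by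
  obtain ⟨t, ht1, ht2⟩ := (isCompact_sphere (0 : V) 1).elim_nhds_subcover
    (fun z => {x | 9 / 10 < inner ℝ x z}) fun z hz => by
      have hz' : ‖z‖ = 1 := by simpa using hz
      refine (isOpen_lt continuous_const (by fun_prop)).mem_nhds ?_
      simp only [Set.mem_ofPred_eq, real_inner_self_eq_norm_sq, hz']
      norm_num
  refine ⟨t, fun z hz => by simpa using ht1 z hz, fun u hu => ?_⟩
  have hn : ‖u‖ ≠ 0 := norm_ne_zero_iff.2 hu
  have : ‖u‖⁻¹ • u ∈ Metric.sphere (0 : V) 1 := by simp [norm_smul, hn]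
  obtain ⟨z, hz, hzu⟩ := Set.mem_iUnion₂.1 (ht2 this)
  refine ⟨z, hz, ?_⟩
  rw [Set.mem_ofPred_eq, real_inner_smul_left, inv_mul_eq_div,
    lt_div_iff₀ (norm_pos_iff.2 hu)] at hzu
  exact hzu

variable [MeasurableSpace V] [BorelSpace V]

/-- An even valuation unchanged by adding segments is constant. -/
theorem CVal.eq_zero_body_of_diffOp (hφ : CVal φ) (he : EvenVal φ)
    (hD : ∀ v, _root_.diffOp v φ = 0) (K : ConvexBody V) : φ K = φ 0 := by
  have hseg : ∀ K v, φ (K + segBody v) = φ K := fun K v => by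
    have := congrFun (hD v) K
    simp only [_root_.diffOp, Pi.zero_apply] at this
    linarith
  obtain ⟨Φ, hΦ⟩ := exists_even_factor (φ := φ) fun K S hS => add_symmetric_eq hφ.cont hseg K S hS
  have hΦ0 : Φ 0 = φ 0 := by
    rw [← hΦ 0]
    congr 1
    funext u
    simp [oddOf, suppFn_zero]
  obtain ⟨t, ht1, ht2⟩ := exists_cap_cover V
  have smooth : ∀ K : ConvexBody V, SmHom (suppFn K) → φ K = φ 0 := by
    intro K hK
    obtain ⟨C, hC, hb⟩ := (suppFn_sublin K).exists_bound
    have hsm : SmHom fun u => C * ‖u‖ + suppFn K u :=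
      ⟨fun r hr x => by rw [norm_smul, hK.hom r hr, Real.norm_eq_abs, abs_of_nonneg hr]; ring,
        fun x hx => (contDiffAt_const.mul (contDiffAt_norm ℝ hx)).add (hK.smooth x hx)⟩
    obtain ⟨g, hg1, hg2⟩ := exists_cap_partition t _ hsm (fun u => by
      have h1 := (suppFn_sublin K).neg_le u
      have h2 := hb (-u)
      rw [norm_neg] at h2
      linarith) (fun u hu => ht2 u (by rintro rfl; exact hu hsm.zero))
    have hsum : ∑ z ∈ t, oddOf (g z) = oddOf (suppFn K) := by
      rw [← oddOf_norm_add C (suppFn K), hg2]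
      funext u
      simp only [oddOf, Finset.sum_apply, Finset.sum_sub_distrib]
    have := oddFactor_sum hφ.val he hΦ g t (fun z hz => (hg1 z hz).oneSided (ht1 z hz))
      fun z hz w hw => (hg1 z hz).oneSided_or (ht1 z hz) (ht1 w hw) (hg1 w hw)
    rw [← hΦ, ← hsum, this, hΦ0]
  refine eq_of_abs_sub_nonpos (le_of_forall_pos_le_add fun δ hδ => ?_)
  obtain ⟨ε, hε, hb⟩ := Metric.continuous_iff.1 hφ.cont K δ hδ
  obtain ⟨f, hf1, hf2, hf3, -⟩ := (suppFn_sublin K).exists_smooth_approx (half_pos hε)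
  have hd : dist (ofSublin f hf2) K ≤ ε / 2 := dist_le_of_suppFn (half_pos hε).le fun u => by
    rw [suppFn_ofSublin]; exact hf3 u
  have hsf : suppFn (ofSublin f hf2) = f := funext fun u => by simp
  have h3 := hb _ (lt_of_le_of_lt hd (half_lt_self hε))
  rw [smooth _ (by rwa [hsf]), Real.dist_eq, abs_sub_comm] at h3
  linarith

/-- Even homogeneous valuations are determined by their mixed segment derivatives. -/
theorem CVal.eq_zero_of_foldr (k : ℕ) : ∀ μ : ConvexBody V → ℝ, CVal μ → EvenVal μ → Homog k μ →
    (∀ l : List V, l.length = k → l.foldr _root_.diffOp μ 0 = 0) → μ = 0 := by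
  induction k with
  | zero =>
    intro μ hμ he hh h
    funext K
    rw [homog_zero_eq hμ.cont hh K]
    exact h [] rfl
  | succ k ih =>
    intro μ hμ he hh h
    have hD : ∀ v, _root_.diffOp v μ = 0 := fun v =>
      ih _ (hμ.diffOp v) (he.diffOp v) (hμ.homog_diffOp hh v) fun l hl => by
        have := h (l ++ [v]) (by simp [hl])
        rwa [List.foldr_append] at this
    funext K
    rw [hμ.eq_zero_body_of_diffOp he hD, homog_succ_zero hh]
    rfl

end EvenUniqueness

section Spike

variable {V : Type*} [NormedAddCommGroup V] [InnerProductSpace ℝ V] [FiniteDimensional ℝ V]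

theorem CVal.diffOp_congr_of_suppFn {ψ : ConvexBody V → ℝ} (hψ : CVal ψ) (v : V)
    {K L : ConvexBody V} (h : ∀ u, inner ℝ v u = 0 → suppFn K u = suppFn L u) :
    _root_.diffOp v ψ K = _root_.diffOp v ψ L := by
  refine hψ.diffOp_congr_proj v (body_ext fun u => ?_)
  rw [suppFn_mapBody (projAlong_symm v), suppFn_mapBody (projAlong_symm v)]
  exact h _ (inner_projAlong v u)

/-- The convex hull of the unit ball and the points `w`, `-w`. -/
def spikeBody (w : V) : ConvexBody V :=
  ofSublin (fun x => max (suppFn (ballBody V 1 zero_le_one) x) (suppFn (segBody w) x))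
    ((suppFn_sublin _).max (suppFn_sublin _))

theorem suppFn_spikeBody (w u : V) : suppFn (spikeBody w) u = max ‖u‖ |inner ℝ w u| := by
  rw [spikeBody, suppFn_ofSublin, suppFn_ballBody, suppFn_segBody, one_mul]

theorem continuous_spikeBody : Continuous (spikeBody : V → ConvexBody V) := by
  refine (LipschitzWith.of_dist_le_mul (K := 1) fun v w => ?_).continuous
  rw [NNReal.coe_one, one_mul]
  refine dist_le_of_suppFn dist_nonneg fun u => ?_
  rw [suppFn_spikeBody, suppFn_spikeBody, dist_eq_norm]
  refine (abs_max_sub_max_le_max _ _ _ _).trans (max_le (by simp; positivity) ?_)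
  refine (abs_abs_sub_abs_le _ _).trans ?_
  rw [← inner_sub_left]
  exact abs_real_inner_le_norm _ _

/-- The change of the first variation of `ψ` when a spike is added to the unit ball. -/
def spikeDiff (ψ : ConvexBody V → ℝ) (w ξ : V) : ℝ :=
  diffOp ξ ψ (spikeBody w) - diffOp ξ ψ (spikeBody 0)

variable {ψ : ConvexBody V → ℝ}

theorem CVal.continuous_spikeDiff (hψ : CVal ψ) :
    Continuous fun x : V × V => spikeDiff ψ x.1 x.2 := by
  have h0 : Continuous fun x : V × V => spikeBody x.1 := continuous_spikeBody.comp continuous_fst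
  have h1 : Continuous fun x : V × V => segBody x.2 := continuous_segBody.comp continuous_snd
  have hadd : Continuous fun x : ConvexBody V × ConvexBody V => x.1 + x.2 := by
    rw [continuous_iff_continuousAt]
    rintro ⟨A, B⟩
    rw [ContinuousAt, tendsto_iff_dist_tendsto_zero]
    have hz : Filter.Tendsto (fun x : ConvexBody V × ConvexBody V => dist x.1 A + dist x.2 B)
        (nhds (A, B)) (nhds 0) := by
      have : Continuous fun x : ConvexBody V × ConvexBody V => dist x.1 A + dist x.2 B := by
        fun_prop
      simpa using this.tendsto (A, B)
    refine squeeze_zero (fun _ => dist_nonneg) (fun x => ?_) hz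
    refine (dist_triangle _ (A + x.2) _).trans (add_le_add (dist_add_right_le _ _ _) ?_)
    rw [add_comm A, add_comm A]
    exact dist_add_right_le _ _ _
  have h2 : Continuous fun x : V × V => spikeBody x.1 + segBody x.2 := hadd.comp (h0.prodMk h1)
  have h3 : Continuous fun x : V × V => spikeBody (0 : V) + segBody x.2 :=
    hadd.comp (continuous_const.prodMk h1)
  unfold spikeDiff _root_.diffOp
  exact ((hψ.cont.comp h2).sub (hψ.cont.comp h0)).sub ((hψ.cont.comp h3).sub continuous_const)

theorem CVal.continuous_spikeDiff_right (hψ : CVal ψ) (w : V) : Continuous (spikeDiff ψ w) := by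
  have h : Continuous fun ξ : V => (w, ξ) := Continuous.prodMk_right w
  have := hψ.continuous_spikeDiff.comp h
  simpa only [Function.comp_def] using this

theorem CVal.absHom_spikeDiff (hψ : CVal ψ) (w : V) : AbsHom (spikeDiff ψ w) := fun c v => by
  rw [spikeDiff, hψ.diffOp_smul, hψ.diffOp_smul, spikeDiff, mul_sub]

theorem CVal.spikeDiff_eq_zero (hψ : CVal ψ) {w ξ : V}
    (h : ∀ u, inner ℝ ξ u = 0 → |inner ℝ w u| ≤ ‖u‖) : spikeDiff ψ w ξ = 0 := by
  rw [spikeDiff, sub_eq_zero]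
  refine hψ.diffOp_congr_of_suppFn ξ fun u hu => ?_
  rw [suppFn_spikeBody, suppFn_spikeBody, max_eq_left (h u hu)]
  simp

theorem CVal.add_sum_segBody (hψ : CVal ψ) (h2 : Homog 2 ψ) (A B : ConvexBody V) (s : Finset V)
    (f : V → V) : ψ (A + ∑ y ∈ s, segBody (f y)) - ψ (B + ∑ y ∈ s, segBody (f y)) =
      ψ A - ψ B + ∑ y ∈ s, (_root_.diffOp (f y) ψ A - _root_.diffOp (f y) ψ B) := by
  classical
  have key : ∀ (g : V) (s : Finset V), _root_.diffOp g ψ (A + ∑ y ∈ s, segBody (f y)) -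
      _root_.diffOp g ψ (B + ∑ y ∈ s, segBody (f y)) =
      _root_.diffOp g ψ A - _root_.diffOp g ψ B := by
    intro g s
    induction s using Finset.induction_on with
    | empty => simp
    | insert y s hy ih =>
      rw [← ih, Finset.sum_insert hy, add_comm (segBody (f y)), ← add_assoc, ← add_assoc]
      have hc : ∀ K, _root_.diffOp (f y) (_root_.diffOp g ψ) K =
          _root_.diffOp (f y) (_root_.diffOp g ψ) 0 := fun K =>
        homog_zero_eq ((hψ.diffOp g).diffOp _).cont
          ((hψ.diffOp g).homog_diffOp (hψ.homog_diffOp h2 g) _) K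
      have e1 := (hc (A + ∑ y ∈ s, segBody (f y))).trans
        (hc (B + ∑ y ∈ s, segBody (f y))).symm
      change _root_.diffOp g ψ _ - _ = _root_.diffOp g ψ _ - _ at e1
      linarith
  induction s using Finset.induction_on with
  | empty => simp
  | insert y s hy ih =>
    rw [Finset.sum_insert hy, Finset.sum_insert hy, add_comm (segBody (f y)), ← add_assoc,
      ← add_assoc]
    have := key (f y) s
    simp only [_root_.diffOp] at this ih ⊢
    linarith

variable [MeasurableSpace V] [BorelSpace V]

theorem CVal.integral_spikeDiff_eq_zero (hψ : CVal ψ) (h2 : Homog 2 ψ) (w : V) {Ω : Type*}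
    [MeasurableSpace Ω] {ν : Measure Ω} {X : Ω → V} {q : Ω → ℝ} (hX : Measurable X)
    (hqm : Measurable q) (hq : Integrable (fun ω => ‖X ω‖ * q ω) ν) {C : ℝ}
    (h0 : ∀ x, 0 ≤ ∫ ω, |inner ℝ (X ω) x| * q ω ∂ν)
    (hC : SemiCvx (fun x => ∫ ω, |inner ℝ (X ω) x| * q ω ∂ν) C)
    (hw : ∀ x, ‖x‖ < |inner ℝ w x| → ∫ ω, |inner ℝ (X ω) x| * q ω ∂ν = 0) :
    ∫ ω, spikeDiff ψ w (X ω) * q ω ∂ν = 0 := by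
  set b : V → ℝ := fun x => ∫ ω, |inner ℝ (X ω) x| * q ω ∂ν with hb
  obtain ⟨δ, hδ, hδC⟩ : ∃ δ : ℝ, 0 < δ ∧ 4 * C * δ ≤ 1 := by
    refine ⟨1 / (4 * |C| + 1), by positivity, ?_⟩
    rw [mul_one_div, div_le_one (by positivity)]
    linarith [le_abs_self C]
  have hom : ∀ t, 0 ≤ t → ∀ x, b (t • x) = t * b x := by
    intro t ht x
    simp only [hb]
    rw [← integral_const_mul]
    refine integral_congr_ae (Filter.Eventually.of_forall fun ω => ?_)
    simp only [real_inner_smul_right, abs_mul, abs_of_nonneg ht]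
    ring
  have hsub : Sublin fun x => ‖x‖ + δ * b x := by
    have h1 := hC.sublin hom (R := δ⁻¹) (by
      rw [← one_div, le_div_iff₀ hδ]; exact hδC)
    refine ⟨fun x y => ?_, fun t ht x => ?_⟩
    · have := mul_le_mul_of_nonneg_left (h1.add_le x y) hδ.le
      simp only [mul_add, ← mul_assoc, mul_inv_cancel₀ hδ.ne', one_mul] at this
      linarith
    · rw [norm_smul, hom t ht, Real.norm_eq_abs, abs_of_nonneg ht]; ring
  obtain ⟨Zp, Zm, hZ, hG⟩ := exists_zonoid_pair (q := fun ω => δ * q ω) hX (hqm.const_mul δ)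
    ((hq.const_mul δ).congr (Filter.Eventually.of_forall fun ω => by dsimp only; ring))
  have hZ' : ∀ u, suppFn Zp u - suppFn Zm u = δ * b u := fun u => by
    rw [hZ, hb, ← integral_const_mul]
    congr 1
    funext ω
    ring
  obtain ⟨K₁, hK₁⟩ : ∃ K, K = spikeBody w := ⟨_, rfl⟩
  obtain ⟨I, hI0⟩ : ∃ K, K = spikeBody (0 : V) := ⟨_, rfl⟩
  have hI : ∀ u, suppFn I u = ‖u‖ := fun u => by simp [hI0, suppFn_spikeBody]
  obtain ⟨K₂, hK₂⟩ : ∃ K : ConvexBody V, ∀ u, suppFn K u = ‖u‖ + δ * b u :=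
    ⟨ofSublin _ hsub, fun u => suppFn_ofSublin _ hsub u⟩
  obtain ⟨M, hM⟩ : ∃ M : ConvexBody V, ∀ u, suppFn M u = max (suppFn K₁ u) (suppFn K₂ u) :=
    ⟨ofSublin _ ((suppFn_sublin _).max (suppFn_sublin _)), fun u => suppFn_ofSublin _ _ u⟩
  have cases : ∀ u, (suppFn K₁ u = ‖u‖) ∨ (‖u‖ ≤ suppFn K₁ u ∧ b u = 0) := fun u => by
    rw [hK₁, suppFn_spikeBody]
    rcases le_or_gt |inner ℝ w u| ‖u‖ with h | h
    · exact Or.inl (max_eq_left h)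
    · exact Or.inr ⟨le_max_left _ _, hw u h⟩
  have hb0 : ∀ u, 0 ≤ δ * b u := fun u => mul_nonneg hδ.le (h0 u)
  have hmax : ∀ u, max (suppFn K₁ u) (suppFn K₂ u) = suppFn K₁ u + δ * b u := fun u => by
    rw [hK₂]
    rcases cases u with h | ⟨h, h'⟩
    · rw [h, max_eq_right (by linarith [hb0 u])]
    · rw [h', mul_zero, add_zero, add_zero, max_eq_left h]
  have hmin : ∀ u, suppFn I u = min (suppFn K₁ u) (suppFn K₂ u) := fun u => by
    rw [hK₂, hI]
    rcases cases u with h | ⟨h, h'⟩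
    · rw [h, min_eq_left (by linarith [hb0 u])]
    · rw [h', mul_zero, add_zero, min_eq_right h]
  have val : ψ (M + Zm) + ψ (I + Zm) = ψ (K₁ + Zm) + ψ (K₂ + Zm) :=
    CVal.of_min (hψ.add_body Zm).val hM hmin
  have e1 : M + Zm = K₁ + Zp := body_ext fun u => by
    rw [suppFn_add, suppFn_add, hM, hmax]; linarith [hZ' u]
  have e2 : K₂ + Zm = I + Zp := body_ext fun u => by
    rw [suppFn_add, suppFn_add, hK₂, hI]; linarith [hZ' u]
  rw [e1, e2] at val
  obtain ⟨G, hGdef⟩ : ∃ G : ConvexBody V → ℝ, ∀ Z, G Z = ψ (K₁ + Z) - ψ (I + Z) :=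
    ⟨_, fun _ => rfl⟩
  have hGc : Continuous G := by
    rw [funext hGdef]
    exact (hψ.cont.comp (continuous_body_add K₁)).sub (hψ.cont.comp (continuous_body_add I))
  have hθc := hψ.continuous_spikeDiff_right w
  have hGs : ∀ (s : Finset V) (f : V → V),
      G (∑ y ∈ s, segBody (f y)) = G 0 + ∑ y ∈ s, spikeDiff ψ w (f y) := fun s f => by
    have := hψ.add_sum_segBody h2 K₁ I s f
    rw [hGdef, hGdef, add_zero, add_zero, this, hK₁, hI0]
    simp only [spikeDiff]
  have h3 := (hG G (spikeDiff ψ w) hGc hθc (hψ.absHom_spikeDiff w) hGs).1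
  have h4 : ∫ ω, spikeDiff ψ w (X ω) * (δ * q ω) ∂ν = δ * ∫ ω, spikeDiff ψ w (X ω) * q ω ∂ν := by
    rw [← integral_const_mul]
    exact integral_congr_ae (Filter.Eventually.of_forall fun ω => by ring)
  rw [h4, hGdef, hGdef] at h3
  have h5 : δ * ∫ ω, spikeDiff ψ w (X ω) * q ω ∂ν = 0 := by
    rw [← h3]
    linarith
  exact (mul_eq_zero.1 h5).resolve_left hδ.ne'

end Spike

section ConeTest

variable {V : Type*} [NormedAddCommGroup V] [InnerProductSpace ℝ V] [FiniteDimensional ℝ V]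
  [MeasurableSpace V] [BorelSpace V]

theorem semiCvx_radial_integral {χ : V → ℝ} (h : ContDiff ℝ 2 χ) (hs : HasCompactSupport χ) {r : ℝ}
    (hr : 0 < r) (h0 : ∀ x, ‖x‖ < r → χ x = 0) (c : ℝ) (hc : 0 ≤ c) :
    ∃ C, SemiCvx (fun x => c * ∫ τ : ℝ, χ (τ • x) / τ ^ 2) C := by
  obtain ⟨A, hA, hT⟩ := taylor_bound h hs
  obtain ⟨R, hR⟩ := hs.isCompact.isBounded.subset_closedBall (0 : V)
  have hR' : ∀ x, R < ‖x‖ → χ x = 0 := fun x hx => by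
    by_contra hne
    have := hR (subset_tsupport _ hne)
    simp at this
    linarith
  set S : Set ℝ := Metric.closedBall 0 R ∩ {τ | r ≤ |τ|} with hS
  have hSc : IsCompact S := (isCompact_closedBall _ _).inter_right
    (isClosed_le continuous_const continuous_abs)
  have hS0 : ∀ τ ∈ S, τ ≠ 0 := by
    rintro τ ⟨-, hτ⟩ rfl
    have : r ≤ |(0 : ℝ)| := hτ
    simp at this
    linarith
  have hres : ∀ x : V, ‖x‖ = 1 → ∫ τ : ℝ, χ (τ • x) / τ ^ 2 = ∫ τ in S, χ (τ • x) / τ ^ 2 := by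
    intro x hx
    refine (setIntegral_eq_integral_of_forall_compl_eq_zero fun τ hτ => ?_).symm
    have : χ (τ • x) = 0 := by
      rcases lt_or_ge |τ| r with h1 | h1
      · exact h0 _ (by rw [norm_smul, hx, mul_one]; exact h1)
      · refine hR' _ ?_
        rw [norm_smul, hx, mul_one]
        by_contra h2
        exact hτ ⟨by simpa using not_lt.1 h2, h1⟩
    rw [this, zero_div]
  have hcont : ∀ x : V, Continuous fun τ : ℝ => χ (τ • x) := fun x =>
    h.continuous.comp (by fun_prop)
  have hcd : ∀ x : V, Continuous fun τ : ℝ => fderiv ℝ χ (τ • x) := fun x =>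
    (h.continuous_fderiv (by norm_num)).comp (by fun_prop)
  have i1 : ∀ x : V, IntegrableOn (fun τ : ℝ => χ (τ • x) / τ ^ 2) S := fun x =>
    (((hcont x).continuousOn).div (by fun_prop)
      fun τ hτ => pow_ne_zero _ (hS0 τ hτ)).integrableOn_compact hSc
  have i2 : ∀ x : V, IntegrableOn (fun τ : ℝ => τ⁻¹ • fderiv ℝ χ (τ • x)) S := fun x =>
    ((continuousOn_id.inv₀ hS0).smul (hcd x).continuousOn).integrableOn_compact hSc
  have hfin : volume S < ⊤ := hSc.measure_lt_top
  have b1 : ∀ τ ∈ S, |τ|⁻¹ ≤ r⁻¹ := fun τ hτ => inv_anti₀ hr hτ.2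
  set m := volume.real S
  have hm : 0 ≤ m := measureReal_nonneg
  have hrinv : 0 ≤ r⁻¹ := (inv_pos.2 hr).le
  set D := c * (A * (r⁻¹ ^ 2 + r⁻¹ + 1) * m) with hD
  have e1 : c * (A * r⁻¹ ^ 2 * m) ≤ D := by
    rw [hD]; gcongr; nlinarith
  have e2 : c * (A * r⁻¹ * m) ≤ D := by
    rw [hD]; gcongr; nlinarith [sq_nonneg r⁻¹]
  have e3 : c * (A * m) ≤ D := by
    rw [hD]; gcongr
    exact le_mul_of_one_le_right hA (by nlinarith [sq_nonneg r⁻¹])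
  refine ⟨D, fun z hz => ⟨?_, c • (InnerProductSpace.toDual ℝ V).symm
    (∫ τ in S, τ⁻¹ • fderiv ℝ χ (τ • z)), ?_, fun y hy => ?_⟩⟩
  · dsimp only
    rw [hres z hz, abs_mul, abs_of_nonneg hc]
    refine le_trans (mul_le_mul_of_nonneg_left ?_ hc) e1
    refine norm_setIntegral_le_of_norm_le_const (f := fun τ => χ (τ • z) / τ ^ 2) hfin
      fun τ hτ => ?_
    rw [norm_div, norm_pow, Real.norm_eq_abs, Real.norm_eq_abs, div_eq_mul_inv, ← inv_pow]
    exact mul_le_mul (hT _).1 (pow_le_pow_left₀ (by positivity) (b1 τ hτ) 2) (by positivity) hA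
  · rw [norm_smul c, Real.norm_eq_abs, abs_of_nonneg hc, LinearIsometryEquiv.norm_map]
    refine le_trans (mul_le_mul_of_nonneg_left ?_ hc) e2
    refine norm_setIntegral_le_of_norm_le_const (f := fun τ => τ⁻¹ • fderiv ℝ χ (τ • z)) hfin
      fun τ hτ => ?_
    rw [norm_smul, norm_inv, Real.norm_eq_abs, mul_comm]
    exact mul_le_mul (hT _).2.1 (b1 τ hτ) (by positivity) hA
  · dsimp only
    rw [hres z hz, hres y hy, real_inner_smul_left, InnerProductSpace.toDual_symm_apply,
      ContinuousLinearMap.integral_apply (i2 z)]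
    have key : -(A * ‖y - z‖ ^ 2 * m) ≤ ∫ τ in S, (χ (τ • y) / τ ^ 2 - χ (τ • z) / τ ^ 2 -
        (τ⁻¹ • fderiv ℝ χ (τ • z)) (y - z)) := by
      refine (abs_le.1 ((Real.norm_eq_abs _).symm.trans_le
        (norm_setIntegral_le_of_norm_le_const hfin fun τ hτ => ?_))).1
      have hτ0 := hS0 τ hτ
      have := (hT (τ • z)).2.2 (τ • y)
      rw [← smul_sub, map_smul, norm_smul, mul_pow, smul_eq_mul] at this
      have e : χ (τ • y) / τ ^ 2 - χ (τ • z) / τ ^ 2 - (τ⁻¹ • fderiv ℝ χ (τ • z)) (y - z) =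
          (τ ^ 2)⁻¹ * (χ (τ • y) - χ (τ • z) - τ * fderiv ℝ χ (τ • z) (y - z)) := by
        rw [_root_.smul_apply, smul_eq_mul]
        field_simp
      rw [e, norm_mul, norm_inv, norm_pow, Real.norm_eq_abs, Real.norm_eq_abs]
      refine (mul_le_mul_of_nonneg_left this (by positivity)).trans (le_of_eq ?_)
      rw [Real.norm_eq_abs]
      have : |τ| ≠ 0 := abs_ne_zero.2 hτ0
      field_simp
    have i3 : IntegrableOn (fun τ : ℝ => (τ⁻¹ • fderiv ℝ χ (τ • z)) (y - z)) S :=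
      (i2 z).apply_continuousLinearMap _
    rw [integral_sub (f := fun τ => χ (τ • y) / τ ^ 2 - χ (τ • z) / τ ^ 2)
      (Integrable.sub (i1 y) (i1 z)) i3, integral_sub (i1 y) (i1 z)] at key
    have k1 := mul_le_mul_of_nonneg_left key hc
    have k2 := mul_le_mul_of_nonneg_right e3 (sq_nonneg ‖y - z‖)
    nlinarith

end ConeTest

section Slice

variable {V W : Type*} [NormedAddCommGroup V] [InnerProductSpace ℝ V] [FiniteDimensional ℝ V]
  [MeasurableSpace V] [BorelSpace V] [NormedAddCommGroup W] [InnerProductSpace ℝ W]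
  [FiniteDimensional ℝ W] [MeasurableSpace W] [BorelSpace W]

/-- The orthogonal decomposition `V = W ⊕ ℝ p` with `p` a unit vector. -/
structure OrthoSplit (p : V) (ι : W →L[ℝ] V) (P : V →L[ℝ] W) : Prop where
  norm_p : ‖p‖ = 1
  adj : ∀ k x, inner ℝ (ι k) x = inner ℝ k (P x)
  norm_ι : ∀ k, ‖ι k‖ = ‖k‖
  norm_sq : ∀ x, ‖x‖ ^ 2 = ‖P x‖ ^ 2 + inner ℝ x p ^ 2

variable {p : V} {ι : W →L[ℝ] V} {P : V →L[ℝ] W} {ψ : ConvexBody V → ℝ}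

theorem OrthoSplit.norm_P_le (S : OrthoSplit p ι P) (x : V) : ‖P x‖ ≤ ‖x‖ := by
  refine le_of_sq_le_sq ?_ (norm_nonneg x)
  rw [S.norm_sq x]
  exact le_add_of_nonneg_right (sq_nonneg _)

theorem OrthoSplit.norm_add_le (S : OrthoSplit p ι P) (k : W) (s : ℝ) :
    ‖ι k + s • p‖ ≤ ‖k‖ + |s| := by
  refine (_root_.norm_add_le _ _).trans ?_
  rw [S.norm_ι, norm_smul, S.norm_p, mul_one, Real.norm_eq_abs]

theorem OrthoSplit.spikeDiff_eq_zero (S : OrthoSplit p ι P) (hψ : CVal ψ) {ρ : ℝ} (hρ : 0 < ρ)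
    {k : W} {s : ℝ} (h : ρ * ‖k‖ ≤ |s|) : spikeDiff ψ (ρ • p) (ι k + s • p) = 0 := by
  rcases eq_or_ne s 0 with rfl | hs
  · have : ‖k‖ = 0 := by
      rw [abs_zero] at h
      nlinarith [norm_nonneg k]
    rw [norm_eq_zero.1 this, map_zero, zero_smul, add_zero]
    exact (hψ.absHom_spikeDiff _).zero
  · refine hψ.spikeDiff_eq_zero fun u hu => ?_
    rw [inner_add_left, S.adj, real_inner_smul_left] at hu
    rw [real_inner_smul_left, abs_mul, abs_of_pos hρ]
    have hs' : 0 < |s| := abs_pos.2 hs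
    have h1 : |s| * |inner ℝ p u| ≤ ‖k‖ * ‖u‖ := by
      rw [← abs_mul, show s * inner ℝ p u = -inner ℝ k (P u) by linarith, abs_neg]
      exact (abs_real_inner_le_norm _ _).trans
        (mul_le_mul_of_nonneg_left (S.norm_P_le u) (norm_nonneg _))
    have h2 : |s| * (ρ * |inner ℝ p u|) ≤ |s| * ‖u‖ := by
      nlinarith [mul_le_mul_of_nonneg_left h1 hρ.le,
        mul_le_mul_of_nonneg_right h (norm_nonneg u)]
    exact le_of_mul_le_mul_left h2 hs'

theorem OrthoSplit.exists_bound (S : OrthoSplit p ι P) (hψ : CVal ψ) {ρ : ℝ} (hρ : 0 < ρ) :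
    ∃ C, 0 ≤ C ∧ ∀ k s, |spikeDiff ψ (ρ • p) (ι k + s • p)| ≤
      (Set.Icc (-(ρ * ‖k‖)) (ρ * ‖k‖)).indicator (fun _ => C * ‖k‖) s := by
  obtain ⟨C, hC, hb⟩ := (hψ.absHom_spikeDiff (ρ • p)).bound (hψ.continuous_spikeDiff_right _)
  refine ⟨C * (1 + ρ), by positivity, fun k s => ?_⟩
  by_cases hs : s ∈ Set.Icc (-(ρ * ‖k‖)) (ρ * ‖k‖)
  · rw [Set.indicator_of_mem hs]
    have h1 : |s| ≤ ρ * ‖k‖ := abs_le.2 hs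
    calc _ ≤ C * ‖ι k + s • p‖ := hb _
      _ ≤ C * (‖k‖ + ρ * ‖k‖) := by
          gcongr; exact (S.norm_add_le k s).trans (by linarith)
      _ = _ := by ring
  · rw [Set.indicator_of_notMem hs, S.spikeDiff_eq_zero hψ hρ, abs_zero]
    by_contra! h
    exact hs (abs_le.1 h.le)

open Real in
theorem integral_cos_inner_prod {A : W → ℝ} {B : ℝ → ℝ} (hA : Integrable A) (hB : Integrable B)
    (hAc : Continuous A) (hBc : Continuous B)
    (hBe : ∀ s, B (-s) = B s) (y : W) (t : ℝ) :
    ∫ ω : W × ℝ, cos (2 * π * (inner ℝ ω.1 y + ω.2 * t)) * (A ω.1 * B ω.2) =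
      cosFT A y * cosFT B t := by
  have c1 : Integrable fun x : W => cos (2 * π * inner ℝ x y) * A x :=
    hA.bdd_mul (c := 1) (Continuous.aestronglyMeasurable (by fun_prop))
      (Filter.Eventually.of_forall fun x => abs_cos_le_one _)
  have c2 : Integrable fun x : ℝ => cos (2 * π * (x * t)) * B x :=
    hB.bdd_mul (c := 1) (Continuous.aestronglyMeasurable (by fun_prop))
      (Filter.Eventually.of_forall fun x => abs_cos_le_one _)
  have s1 : Integrable fun x : W => sin (2 * π * inner ℝ x y) * A x :=
    hA.bdd_mul (c := 1) (Continuous.aestronglyMeasurable (by fun_prop))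
      (Filter.Eventually.of_forall fun x => abs_sin_le_one _)
  have s2 : Integrable fun x : ℝ => sin (2 * π * (x * t)) * B x :=
    hB.bdd_mul (c := 1) (Continuous.aestronglyMeasurable (by fun_prop))
      (Filter.Eventually.of_forall fun x => abs_sin_le_one _)
  have e : (fun ω : W × ℝ => cos (2 * π * (inner ℝ ω.1 y + ω.2 * t)) * (A ω.1 * B ω.2)) =
      fun ω => (cos (2 * π * inner ℝ ω.1 y) * A ω.1) * (cos (2 * π * (ω.2 * t)) * B ω.2) -
        (sin (2 * π * inner ℝ ω.1 y) * A ω.1) * (sin (2 * π * (ω.2 * t)) * B ω.2) := by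
    funext ω
    rw [mul_add, cos_add]
    ring
  have odd : ∫ x : ℝ, sin (2 * π * (x * t)) * B x = 0 := by
    have := integral_neg_eq_self (fun x : ℝ => sin (2 * π * (x * t)) * B x) volume
    simp only [hBe, neg_mul, mul_neg, sin_neg] at this
    rw [integral_neg] at this
    linarith
  rw [e, Measure.volume_eq_prod, integral_sub (c1.mul_prod c2) (s1.mul_prod s2),
    integral_prod_mul (fun x : W => cos (2 * π * inner ℝ x y) * A x)
      (fun x : ℝ => cos (2 * π * (x * t)) * B x),
    integral_prod_mul (fun x : W => sin (2 * π * inner ℝ x y) * A x)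
      (fun x : ℝ => sin (2 * π * (x * t)) * B x), odd, mul_zero, sub_zero]
  simp only [cosFT]
  congr 2
  funext x
  simp [mul_comm]

open Real in
theorem OrthoSplit.integral_spikeDiff_mul (S : OrthoSplit p ι P) (hψ : CVal ψ) (h2 : Homog 2 ψ)
    {ρ : ℝ} (hρ : 0 < ρ) {χ : W → ℝ} (h : ContDiff ℝ (⊤ : ℕ∞) χ) (hs : HasCompactSupport χ)
    (he : ∀ x, χ (-x) = χ x) (hp : ∀ x, 0 ≤ χ x) {r : ℝ} (hr : 0 < r)
    (h0 : ∀ x, ‖x‖ < r → χ x = 0) {α : ℝ → ℝ} (hα : ContDiff ℝ (⊤ : ℕ∞) α)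
    (hαs : HasCompactSupport α) (hαe : ∀ x, α (-x) = α x) (hαp : ∀ x, 0 ≤ α x) {ε : ℝ}
    (hε : ρ * ε < r) (hα0 : ∀ t, ε < |t| → α t = 0) :
    Integrable (fun ω : W × ℝ => spikeDiff ψ (ρ • p) (ι ω.1 + ω.2 • p) *
      (cosFT χ ω.1 * cosFT α ω.2)) ∧
    ∫ ω : W × ℝ, spikeDiff ψ (ρ • p) (ι ω.1 + ω.2 • p) * (cosFT χ ω.1 * cosFT α ω.2) = 0 := by
  set A := cosFT χ with hA
  set B := cosFT α with hB
  have iA := cosFT_integrable h hs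
  have iB := cosFT_integrable hα hαs
  have cA := cosFT_continuous h hs
  have cB := cosFT_continuous hα hαs
  set X : W × ℝ → V := fun ω => ι ω.1 + ω.2 • p with hX
  have cX : Continuous X := by fun_prop
  set q : W × ℝ → ℝ := fun ω => -(A ω.1 * B ω.2) with hq
  have cq : Continuous q := by fun_prop
  have iq : Integrable q := (iA.mul_prod iB).neg
  have iXq : Integrable fun ω => ‖X ω‖ * q ω := by
    have i1 : Integrable fun ω : W × ℝ => (‖ω.1‖ * A ω.1) * B ω.2 := by
      have := cosFT_integrable_pow h hs 1
      simp only [pow_one] at this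
      exact this.mul_prod iB
    have i2 : Integrable fun ω : W × ℝ => A ω.1 * (‖ω.2‖ * B ω.2) := by
      have := cosFT_integrable_pow hα hαs 1
      simp only [pow_one] at this
      exact iA.mul_prod this
    have i3 := i1.norm.add i2.norm
    refine i3.mono' (by fun_prop) (Filter.Eventually.of_forall fun ω => ?_)
    simp only [hq, Pi.add_apply, norm_mul, norm_neg, norm_norm]
    have := S.norm_add_le ω.1 ω.2
    rw [← Real.norm_eq_abs] at this
    calc _ ≤ (‖ω.1‖ + ‖ω.2‖) * (‖A ω.1‖ * ‖B ω.2‖) := by gcongr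
      _ = _ := by ring
  have hinner : ∀ ω x, inner ℝ (X ω) x = inner ℝ ω.1 (P x) + ω.2 * inner ℝ x p := fun ω x => by
    rw [hX]
    dsimp only
    rw [inner_add_left, S.adj, real_inner_smul_left, real_inner_comm x p]
  have hQ : ∀ x, ∫ ω, cos (2 * π * inner ℝ (X ω) x) * q ω = -(χ (P x) * α (inner ℝ x p)) := by
    intro x
    simp only [hinner, hq, mul_neg]
    rw [integral_neg, integral_cos_inner_prod iA iB cA cB (cosFT_even α),
      cosFT_cosFT h hs he, cosFT_cosFT hα hαs hαe]
  have hχ0 : χ 0 = 0 := h0 0 (by simpa using hr)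
  have hq0 : ∫ ω, q ω = 0 := by
    have := hQ 0
    simpa [hχ0] using this
  set χ' : V → ℝ := fun x => χ (P x) * α (inner ℝ x p) with hχ'
  have hb : ∀ x, ∫ ω, |inner ℝ (X ω) x| * q ω = cosConst⁻¹ * ∫ τ : ℝ, χ' (τ • x) / τ ^ 2 := by
    intro x
    have := (integral_abs_inner_mul cX.measurable cq.measurable iXq iq x).2
    simp only [hQ, hq0, zero_sub, neg_neg] at this
    rw [← mul_right_inj' cosConst_pos.ne', ← this, mul_inv_cancel_left₀ cosConst_pos.ne']
  have hle : (2 : WithTop ℕ∞) ≤ ((⊤ : ℕ∞) : WithTop ℕ∞) :=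
    WithTop.coe_le_coe.2 (le_top (a := (2 : ℕ∞)))
  have hχ'c : ContDiff ℝ 2 χ' :=
    (((h.of_le hle).comp P.contDiff).mul
      ((hα.of_le hle).comp (contDiff_id.inner ℝ contDiff_const)))
  have hχ's : HasCompactSupport χ' := by
    obtain ⟨R₁, hR₁⟩ := hs.isCompact.isBounded.subset_closedBall (0 : W)
    obtain ⟨R₂, hR₂⟩ := hαs.isCompact.isBounded.subset_closedBall (0 : ℝ)
    refine HasCompactSupport.intro (isCompact_closedBall (0 : V) (|R₁| + |R₂|)) fun x hx => ?_
    by_contra hne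
    have h1 : P x ∈ Metric.closedBall 0 R₁ := hR₁ (subset_tsupport _ (left_ne_zero_of_mul hne))
    have h2 : inner ℝ x p ∈ Metric.closedBall 0 R₂ :=
      hR₂ (subset_tsupport _ (right_ne_zero_of_mul hne))
    rw [mem_closedBall_zero_iff] at h1 h2
    refine hx (mem_closedBall_zero_iff.2 (le_of_sq_le_sq ?_ (by positivity)))
    rw [S.norm_sq x, ← sq_abs (inner ℝ x p)]
    rw [Real.norm_eq_abs] at h2
    have h1' := h1.trans (le_abs_self R₁)
    have h2' := h2.trans (le_abs_self R₂)
    nlinarith [norm_nonneg (P x), abs_nonneg (inner ℝ x p), abs_nonneg R₁, abs_nonneg R₂]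
  obtain ⟨C, hC⟩ := semiCvx_radial_integral hχ'c hχ's hr (fun x hx => by
    rw [hχ']
    dsimp only
    rw [h0 _ ((S.norm_P_le x).trans_lt hx), zero_mul]) cosConst⁻¹ (inv_pos.2 cosConst_pos).le
  have hfin := hψ.integral_spikeDiff_eq_zero h2 (ρ • p) cX.measurable cq.measurable iXq
    (C := C) (fun x => ?_) ?_ fun x hx => ?_
  · refine ⟨?_, ?_⟩
    · obtain ⟨D, hD, hb⟩ := (hψ.absHom_spikeDiff (ρ • p)).bound (hψ.continuous_spikeDiff_right _)
      have hcs := (hψ.continuous_spikeDiff_right (ρ • p)).comp cX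
      simp only [Function.comp_def] at hcs
      refine (iXq.norm.const_mul D).mono' (hcs.mul (by fun_prop)).aestronglyMeasurable
        (Filter.Eventually.of_forall fun ω => ?_)
      have e : ‖‖X ω‖ * q ω‖ = ‖X ω‖ * ‖cosFT χ ω.1 * cosFT α ω.2‖ := by
        rw [norm_mul, norm_norm, hq, norm_neg]
      rw [norm_mul, e, ← mul_assoc]
      gcongr
      exact hb _
    · simp only [hq, mul_neg] at hfin
      rw [integral_neg, neg_eq_zero] at hfin
      exact hfin
  · rw [hb]
    exact mul_nonneg (inv_pos.2 cosConst_pos).le (integral_nonneg fun τ =>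
      div_nonneg (mul_nonneg (hp _) (hαp _)) (sq_nonneg _))
  · rw [funext hb]
    exact hC
  · rw [hb]
    have : ∀ τ : ℝ, χ' (τ • x) / τ ^ 2 = 0 := by
      intro τ
      rcases eq_or_ne τ 0 with rfl | hτ
      · simp
      rw [real_inner_smul_left, abs_mul, abs_of_pos hρ, real_inner_comm] at hx
      rw [hχ']
      dsimp only
      rw [div_eq_zero_iff, mul_eq_zero]
      left
      rw [real_inner_smul_left, map_smul]
      rcases lt_or_ge ε |τ * inner ℝ x p| with h1 | h1
      · exact Or.inr (hα0 _ h1)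
      · left
        refine h0 _ ?_
        rw [norm_smul, Real.norm_eq_abs]
        rw [abs_mul] at h1
        have hτ' : 0 < |τ| := abs_pos.2 hτ
        have := mul_le_mul_of_nonneg_left (S.norm_P_le x) hτ'.le
        nlinarith [mul_lt_mul_of_pos_left hx hτ', mul_le_mul_of_nonneg_left h1 hρ.le]
    simp [this]

end Slice

section SliceFn

open Real in
theorem cosFT_bump_bounds {α : ℝ → ℝ} (hα : Continuous α) (hαs : HasCompactSupport α)
    (hαp : ∀ x, 0 ≤ α x) (h1 : ∫ x, α x = 1) {ε : ℝ} (hε : 0 ≤ ε) (hα0 : ∀ t, ε < |t| → α t = 0)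
    (s : ℝ) : |cosFT α s| ≤ 1 ∧ |cosFT α s - 1| ≤ 2 * π * ε * |s| := by
  have i1 : Integrable α := hα.integrable_of_hasCompactSupport hαs
  have i2 : Integrable fun x => cos (2 * π * inner ℝ x s) * α x :=
    i1.bdd_mul (c := 1) (Continuous.aestronglyMeasurable (by fun_prop))
      (Filter.Eventually.of_forall fun x => abs_cos_le_one _)
  constructor
  · rw [← h1, cosFT, ← Real.norm_eq_abs]
    refine norm_integral_le_of_norm_le i1 (Filter.Eventually.of_forall fun x => ?_)
    rw [norm_mul, Real.norm_eq_abs, Real.norm_eq_abs, abs_of_nonneg (hαp x)]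
    exact mul_le_of_le_one_left (hαp x) (abs_cos_le_one _)
  · have e : cosFT α s - 1 = ∫ x, (cos (2 * π * inner ℝ x s) - 1) * α x := by
      simp only [sub_mul, one_mul]
      rw [integral_sub i2 i1, h1, cosFT]
    have e' : 2 * π * ε * |s| = ∫ x, 2 * π * ε * |s| * α x := by
      rw [integral_const_mul, h1, mul_one]
    rw [e, e', ← Real.norm_eq_abs]
    refine norm_integral_le_of_norm_le (i1.const_mul _) (Filter.Eventually.of_forall fun x => ?_)
    rw [norm_mul, Real.norm_eq_abs, Real.norm_eq_abs, abs_of_nonneg (hαp x)]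
    rcases lt_or_ge ε |x| with hx | hx
    · simp [hα0 x hx]
    · refine mul_le_mul_of_nonneg_right ?_ (hαp x)
      have h3 : |cos (2 * π * inner ℝ x s) - 1| ≤ |2 * π * inner ℝ x s| := by
        have := abs_cos_sub_cos_le (2 * π * inner ℝ x s) 0
        simpa using this
      refine h3.trans ?_
      simp only [RCLike.inner_apply, conj_trivial]
      rw [abs_mul (2 * π), abs_of_pos (by positivity : (0:ℝ) < 2 * π), abs_mul]
      have := mul_le_mul_of_nonneg_left hx (abs_nonneg s)
      have := mul_le_mul_of_nonneg_left this (by positivity : (0:ℝ) ≤ 2 * π)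
      linarith

variable {V W : Type*} [NormedAddCommGroup V] [InnerProductSpace ℝ V] [FiniteDimensional ℝ V]
  [MeasurableSpace V] [BorelSpace V] [NormedAddCommGroup W] [InnerProductSpace ℝ W]
  [FiniteDimensional ℝ W] [MeasurableSpace W] [BorelSpace W]

/-- The integral of the spike difference over a line parallel to `p`. -/
def sliceFn (ψ : ConvexBody V → ℝ) (ρ : ℝ) (p : V) (ι : W →L[ℝ] V) (k : W) : ℝ :=
  ∫ s : ℝ, spikeDiff ψ (ρ • p) (ι k + s • p)

variable {p : V} {ι : W →L[ℝ] V} {P : V →L[ℝ] W} {ψ : ConvexBody V → ℝ} {ρ : ℝ}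

theorem CVal.continuous_spikeDiff_line (hψ : CVal ψ) (ρ : ℝ) (p : V) (ι : W →L[ℝ] V) :
    Continuous fun ω : W × ℝ => spikeDiff ψ (ρ • p) (ι ω.1 + ω.2 • p) := by
  have h1 : Continuous fun ω : W × ℝ => ι ω.1 + ω.2 • p := by fun_prop
  have := (hψ.continuous_spikeDiff_right (ρ • p)).comp h1
  simpa only [Function.comp_def] using this

theorem integrable_indicator_Icc (a b c : ℝ) :
    Integrable ((Set.Icc a b).indicator fun _ => c) :=
  (integrable_indicator_iff measurableSet_Icc).2 (integrableOn_const (by simp))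

theorem integral_indicator_Icc (a c : ℝ) (ha : 0 ≤ a) :
    ∫ s, (Set.Icc (-a) a).indicator (fun _ => c) s = 2 * a * c := by
  rw [integral_indicator measurableSet_Icc, setIntegral_const, smul_eq_mul]
  simp only [Measure.real, Real.volume_Icc]
  rw [ENNReal.toReal_ofReal (by linarith)]
  ring

theorem OrthoSplit.integrable_slice (S : OrthoSplit p ι P) (hψ : CVal ψ) (hρ : 0 < ρ) (k : W) :
    Integrable fun s : ℝ => spikeDiff ψ (ρ • p) (ι k + s • p) := by
  obtain ⟨C, hC, hb⟩ := S.exists_bound hψ hρ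
  have hc : Continuous fun s : ℝ => spikeDiff ψ (ρ • p) (ι k + s • p) := by
    have := (hψ.continuous_spikeDiff_line ρ p ι).comp (Continuous.prodMk_right k)
    simpa only [Function.comp_def] using this
  exact (integrable_indicator_Icc _ _ _).mono' hc.aestronglyMeasurable
    (Filter.Eventually.of_forall fun s => hb k s)

theorem OrthoSplit.continuous_sliceFn (S : OrthoSplit p ι P) (hψ : CVal ψ) (hρ : 0 < ρ) :
    Continuous (sliceFn ψ ρ p ι) := by
  obtain ⟨C, hC, hb⟩ := S.exists_bound hψ hρ
  have hc := hψ.continuous_spikeDiff_line ρ p ι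
  refine continuous_iff_continuousAt.2 fun k₀ => ?_
  have hev : ∀ᶠ k in nhds k₀, ‖k‖ < ‖k₀‖ + 1 :=
    (continuous_norm.tendsto k₀).eventually (gt_mem_nhds (by linarith))
  refine continuousAt_of_dominated
    (bound := (Set.Icc (-(ρ * (‖k₀‖ + 1))) (ρ * (‖k₀‖ + 1))).indicator fun _ => C * (‖k₀‖ + 1))
    (Filter.Eventually.of_forall fun k => (S.integrable_slice hψ hρ k).1)
    (hev.mono fun k hk => Filter.Eventually.of_forall fun s => (hb k s).trans ?_)
    (integrable_indicator_Icc _ _ _) (Filter.Eventually.of_forall fun s => ?_)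
  · have h1 : ρ * ‖k‖ ≤ ρ * (‖k₀‖ + 1) := by gcongr
    refine (Set.indicator_le_indicator (g := fun _ => C * (‖k₀‖ + 1)) ?_).trans
      (Set.indicator_le_indicator_of_subset
        (Set.Icc_subset_Icc (neg_le_neg h1) h1) (fun _ => by positivity) s)
    gcongr
  · have := hc.comp (Continuous.prodMk_left s)
    simp only [Function.comp_def] at this
    exact this.continuousAt

theorem OrthoSplit.sliceFn_bound (S : OrthoSplit p ι P) (hψ : CVal ψ) (hρ : 0 < ρ) :
    ∃ C, 0 ≤ C ∧ ∀ k, ∫ s : ℝ, |spikeDiff ψ (ρ • p) (ι k + s • p)| ≤ C * ‖k‖ ^ 2 := by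
  obtain ⟨C, hC, hb⟩ := S.exists_bound hψ hρ
  refine ⟨2 * ρ * C, by positivity, fun k => ?_⟩
  refine (integral_mono (S.integrable_slice hψ hρ k).abs (integrable_indicator_Icc _ _ _)
    (hb k)).trans (le_of_eq ?_)
  rw [integral_indicator_Icc _ _ (by positivity)]
  ring

theorem OrthoSplit.sliceFn_smul (S : OrthoSplit p ι P) (hψ : CVal ψ) (hρ : 0 < ρ) (t : ℝ) (k : W) :
    sliceFn ψ ρ p ι (t • k) = t ^ 2 * sliceFn ψ ρ p ι k := by
  rcases eq_or_ne t 0 with rfl | ht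
  · obtain ⟨C, hC, hb⟩ := S.sliceFn_bound hψ hρ
    have h1 := (norm_integral_le_integral_norm
      fun s : ℝ => spikeDiff ψ (ρ • p) (ι ((0 : ℝ) • k) + s • p)).trans (hb _)
    rw [zero_smul, norm_zero] at h1
    have : ‖sliceFn ψ ρ p ι (0 : W)‖ ≤ 0 := h1.trans (by simp)
    rw [zero_smul, norm_le_zero_iff.1 this]
    simp
  · have h1 : ∀ s : ℝ, spikeDiff ψ (ρ • p) (ι (t • k) + s • p) =
        |t| * spikeDiff ψ (ρ • p) (ι k + (t⁻¹ * s) • p) := fun s => by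
      rw [← hψ.absHom_spikeDiff, smul_add, smul_smul, mul_inv_cancel_left₀ ht, map_smul]
    simp only [sliceFn, h1]
    rw [integral_const_mul, Measure.integral_comp_mul_left
      (fun s => spikeDiff ψ (ρ • p) (ι k + s • p)), inv_inv, smul_eq_mul, ← mul_assoc,
      ← sq, sq_abs]

open Real Filter Topology in
theorem OrthoSplit.integral_sliceFn_mul (S : OrthoSplit p ι P) (hψ : CVal ψ) (h2 : Homog 2 ψ)
    (hρ : 0 < ρ) {χ : W → ℝ} (h : ContDiff ℝ (⊤ : ℕ∞) χ) (hs : HasCompactSupport χ)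
    (he : ∀ x, χ (-x) = χ x) (hp : ∀ x, 0 ≤ χ x) {r : ℝ} (hr : 0 < r)
    (h0 : ∀ x, ‖x‖ < r → χ x = 0) : ∫ k, sliceFn ψ ρ p ι k * cosFT χ k = 0 := by
  set ε : ℕ → ℝ := fun j => r / (2 * ρ) * (1 / ((j : ℝ) + 1)) with hεdef
  have hε : ∀ j, 0 < ε j := fun j => by positivity
  have hε2 : ∀ j, ρ * ε j < r := fun j => by
    have : 1 / ((j : ℝ) + 1) ≤ 1 := by
      rw [div_le_one (by positivity)]; linarith [Nat.cast_nonneg (α := ℝ) j]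
    have h3 : ρ * ε j = r / 2 * (1 / ((j : ℝ) + 1)) := by
      rw [hεdef]; field_simp
    rw [h3]
    nlinarith
  have hεt : Tendsto ε atTop (𝓝 0) := by
    have := tendsto_one_div_add_atTop_nhds_zero_nat.const_mul (r / (2 * ρ))
    rw [mul_zero] at this
    exact this
  let bmp : ℕ → ContDiffBump (0 : ℝ) := fun j => ⟨ε j / 2, ε j, by linarith [hε j], by linarith [hε j]⟩
  set α : ℕ → ℝ → ℝ := fun j => (bmp j).normed volume with hα
  have a1 : ∀ j, ContDiff ℝ (⊤ : ℕ∞) (α j) := fun j => (bmp j).contDiff_normed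
  have a2 : ∀ j, HasCompactSupport (α j) := fun j => (bmp j).hasCompactSupport_normed
  have a3 : ∀ j x, α j (-x) = α j x := fun j x => (bmp j).normed_neg x
  have a4 : ∀ j x, 0 ≤ α j x := fun j x => (bmp j).nonneg_normed x
  have a5 : ∀ j, ∫ x, α j x = 1 := fun j => (bmp j).integral_normed
  have a6 : ∀ j t, ε j < |t| → α j t = 0 := fun j t ht => by
    by_contra hne
    have : t ∈ Function.support ((bmp j).normed volume) := hne
    rw [(bmp j).support_normed_eq, mem_ball_zero_iff, Real.norm_eq_abs] at this
    exact absurd this (not_lt.2 ht.le)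
  have hB := fun j s => cosFT_bump_bounds (a1 j).continuous (a2 j) (a4 j) (a5 j) (hε j).le (a6 j) s
  have hBt : ∀ s, Tendsto (fun j => cosFT (α j) s) atTop (𝓝 1) := fun s => by
    rw [tendsto_iff_norm_sub_tendsto_zero]
    refine squeeze_zero (fun j => norm_nonneg _) (fun j => (hB j s).2) ?_
    have := (hεt.const_mul (2 * π)).mul_const |s|
    simpa using this
  have hk := fun j => S.integral_spikeDiff_mul hψ h2 hρ h hs he hp hr h0 (a1 j) (a2 j) (a3 j) (a4 j)
    (hε2 j) (a6 j)
  set G : ℕ → W → ℝ := fun j k => ∫ s : ℝ, spikeDiff ψ (ρ • p) (ι k + s • p) * cosFT (α j) s with hG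
  have hpull : ∀ j k, ∫ s : ℝ, spikeDiff ψ (ρ • p) (ι k + s • p) * (cosFT χ k * cosFT (α j) s) =
      G j k * cosFT χ k := fun j k => by
    rw [hG, ← integral_mul_const]
    exact integral_congr_ae (Eventually.of_forall fun s => by dsimp only; ring)
  have hGi : ∀ j, Integrable fun k => G j k * cosFT χ k := fun j => by
    have := (hk j).1.integral_prod_left
    simpa only [hpull] using this
  have hG0 : ∀ j, ∫ k, G j k * cosFT χ k = 0 := fun j => by
    have h3 := (hk j).2
    rw [Measure.volume_eq_prod, integral_prod _ (hk j).1] at h3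
    simpa only [hpull] using h3
  obtain ⟨C, hC, hb⟩ := S.sliceFn_bound hψ hρ
  have hGle : ∀ j k, |G j k| ≤ C * ‖k‖ ^ 2 := fun j k => by
    rw [← Real.norm_eq_abs]
    refine le_trans (norm_integral_le_of_norm_le (S.integrable_slice hψ hρ k).abs
      (Eventually.of_forall fun s => ?_)) (hb k)
    rw [norm_mul]
    exact mul_le_of_le_one_right (norm_nonneg _) (hB j s).1
  have hGt : ∀ k, Tendsto (fun j => G j k) atTop (𝓝 (sliceFn ψ ρ p ι k)) := fun k => by
    refine tendsto_integral_of_dominated_convergence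
      (fun s => |spikeDiff ψ (ρ • p) (ι k + s • p)|) (fun j => ?_)
      (S.integrable_slice hψ hρ k).abs (fun j => Eventually.of_forall fun s => ?_)
      (Eventually.of_forall fun s => ?_)
    · exact (S.integrable_slice hψ hρ k).1.mul
        (cosFT_continuous (a1 j) (a2 j)).aestronglyMeasurable
    · rw [norm_mul]
      exact mul_le_of_le_one_right (norm_nonneg _) (hB j s).1
    · simpa using (hBt s).const_mul (spikeDiff ψ (ρ • p) (ι k + s • p))
  have hlim : Tendsto (fun j => ∫ k, G j k * cosFT χ k) atTop
      (𝓝 (∫ k, sliceFn ψ ρ p ι k * cosFT χ k)) := by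
    refine tendsto_integral_of_dominated_convergence (fun k => C * ‖‖k‖ ^ 2 * cosFT χ k‖)
      (fun j => (hGi j).1) ((cosFT_integrable_pow h hs 2).norm.const_mul C)
      (fun j => Eventually.of_forall fun k => ?_)
      (Eventually.of_forall fun k => (hGt k).mul_const _)
    rw [norm_mul, norm_mul, ← mul_assoc, norm_pow, norm_norm]
    exact mul_le_mul_of_nonneg_right (hGle j k) (norm_nonneg _)
  simp only [hG0] at hlim
  exact tendsto_nhds_unique hlim tendsto_const_nhds

end SliceFn

section Liouville

variable {W : Type*} [NormedAddCommGroup W] [InnerProductSpace ℝ W]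
  [FiniteDimensional ℝ W] [MeasurableSpace W] [BorelSpace W]

open SchwartzMap in
theorem schwartz_second_difference (F : 𝓢(W, ℂ)) (v : W) (N : ℕ) : ∃ C, 0 ≤ C ∧
    ∀ r : ℝ, 0 < r → r ≤ 1 → ∀ z,
      ‖F (z + r • v) + F (z - r • v) - 2 * F z‖ ≤ r ^ 2 * (C * ((1 + ‖z‖) ^ N)⁻¹) := by
  set F₁ := fderivCLM ℝ W ℂ F with hF₁
  set F₂ := fderivCLM ℝ W (W →L[ℝ] ℂ) F₁ with hF₂
  have d1 : ∀ x, HasFDerivAt F (F₁ x) x := fun x => F.differentiableAt.hasFDerivAt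
  have d2 : ∀ x, HasFDerivAt F₁ (F₂ x) x := fun x => F₁.differentiableAt.hasFDerivAt
  obtain ⟨C₀, hC₀⟩ : ∃ C₀, ∀ x, (1 + ‖x‖) ^ N * ‖F₂ x‖ ≤ C₀ := by
    refine ⟨2 ^ N * ((Finset.Iic (N, 0)).sup fun m : ℕ × ℕ => SchwartzMap.seminorm ℝ m.1 m.2) F₂,
      fun x => ?_⟩
    have := one_add_le_sup_seminorm_apply (𝕜 := ℝ) (m := (N, 0)) le_rfl le_rfl F₂ x
    rw [norm_iteratedFDeriv_zero] at this
    exact this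
  have hC₀p : 0 ≤ C₀ := le_trans (by positivity) (hC₀ 0)
  refine ⟨C₀ * (1 + 2 * ‖v‖) ^ N * ‖v‖ ^ 2, by positivity, fun r hr hr1 z => ?_⟩
  set w := r • v with hw
  have hwn : ‖w‖ = r * ‖v‖ := by rw [hw, norm_smul, Real.norm_eq_abs, abs_of_pos hr]
  have hwv : ‖w‖ ≤ ‖v‖ := by rw [hwn]; exact mul_le_of_le_one_left (norm_nonneg _) hr1
  set M := C₀ * (1 + 2 * ‖v‖) ^ N * ((1 + ‖z‖) ^ N)⁻¹ with hM
  have hMp : 0 ≤ M := by positivity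
  have b2 : ∀ y ∈ Metric.closedBall z (2 * ‖v‖), ‖F₂ y‖ ≤ M := by
    intro y hy
    rw [mem_closedBall_iff_norm] at hy
    have h1 : 1 + ‖z‖ ≤ (1 + ‖y‖) * (1 + 2 * ‖v‖) := by
      have := norm_sub_norm_le z y
      rw [norm_sub_rev] at this
      nlinarith [norm_nonneg y, norm_nonneg v]
    have h2 : (1 + ‖z‖) ^ N ≤ (1 + ‖y‖) ^ N * (1 + 2 * ‖v‖) ^ N := by
      rw [← mul_pow]; gcongr
    rw [hM, ← div_eq_mul_inv, le_div_iff₀ (by positivity)]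
    calc ‖F₂ y‖ * (1 + ‖z‖) ^ N ≤ ‖F₂ y‖ * ((1 + ‖y‖) ^ N * (1 + 2 * ‖v‖) ^ N) := by gcongr
      _ = ((1 + ‖y‖) ^ N * ‖F₂ y‖) * (1 + 2 * ‖v‖) ^ N := by ring
      _ ≤ _ := by gcongr; exact hC₀ y
  have l1 : ∀ x ∈ Metric.closedBall z ‖v‖, ‖F₁ (x + w) - F₁ x‖ ≤ M * ‖w‖ := by
    intro x hx
    rw [mem_closedBall_iff_norm] at hx
    have := (convex_closedBall z (2 * ‖v‖)).norm_image_sub_le_of_norm_hasFDerivWithin_le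
      (fun y _ => (d2 y).hasFDerivWithinAt) b2 (x := x) (y := x + w)
      (mem_closedBall_iff_norm.2 (by linarith [norm_nonneg v]))
      (mem_closedBall_iff_norm.2 (by
        rw [add_sub_right_comm]
        exact (norm_add_le _ _).trans (by linarith)))
    rwa [add_sub_cancel_left] at this
  have l2 := (convex_closedBall z ‖v‖).norm_image_sub_le_of_norm_hasFDerivWithin_le
    (f := fun x => F (x + w) - F x) (f' := fun x => F₁ (x + w) - F₁ x)
    (fun y _ => (((hasFDerivAt_comp_add_right w).2 (d1 (y + w))).sub (d1 y)).hasFDerivWithinAt) l1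
    (x := z - w) (y := z) (mem_closedBall_iff_norm.2 (by simpa using hwv))
    (mem_closedBall_iff_norm.2 (by simp))
  rw [sub_sub_cancel, sub_add_cancel] at l2
  have e : F (z + w) + F (z - w) - 2 * F z = F (z + w) - F z - (F z - F (z - w)) := by ring
  rw [e]
  refine l2.trans (le_of_eq ?_)
  rw [hwn, hM]
  ring

theorem integrable_one_add_norm_inv_pow (A : ℝ) :
    Integrable fun z : W => (1 + ‖z‖) ^ 2 * (A * ((1 + ‖z‖) ^ (Module.finrank ℝ W + 3))⁻¹) := by
  have := (integrable_one_add_norm (E := W) (μ := volume) (r := (Module.finrank ℝ W : ℝ) + 1)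
    (by linarith)).const_mul A
  refine this.congr (Filter.Eventually.of_forall fun z => ?_)
  have h : 0 < 1 + ‖z‖ := by positivity
  dsimp only
  rw [Real.rpow_neg h.le, show (Module.finrank ℝ W : ℝ) + 1 = ((Module.finrank ℝ W + 1 : ℕ) : ℝ) by
    push_cast; ring, Real.rpow_natCast]
  field_simp
  ring

/-- A rotation invariant plateau function. -/
def plateau (x : W) : ℝ := Real.smoothTransition (2 - ‖x‖ ^ 2)

theorem contDiff_plateau : ContDiff ℝ (⊤ : ℕ∞) (plateau : W → ℝ) :=
  Real.smoothTransition.contDiff.comp (contDiff_const.sub (contDiff_norm_sq ℝ))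

theorem plateau_one {x : W} (h : ‖x‖ ≤ 1) : plateau x = 1 :=
  Real.smoothTransition.one_of_one_le (by nlinarith [norm_nonneg x])

theorem plateau_zero {x : W} (h : 2 ≤ ‖x‖) : plateau x = 0 :=
  Real.smoothTransition.zero_of_nonpos (by nlinarith)

theorem hasCompactSupport_plateau : HasCompactSupport (plateau : W → ℝ) :=
  HasCompactSupport.intro (isCompact_closedBall (0 : W) 2) fun x hx => plateau_zero (by
    simp only [mem_closedBall_zero_iff, not_le] at hx
    exact hx.le)

theorem plateau_neg (x : W) : plateau (-x) = plateau x := by simp [plateau]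

theorem plateau_smul_le {R : ℝ} (hR : 1 ≤ R) (x : W) : plateau x ≤ plateau (R⁻¹ • x) := by
  refine Real.smoothTransition.monotone ?_
  have h1 : ‖R⁻¹ • x‖ ≤ ‖x‖ := by
    rw [norm_smul, norm_inv, Real.norm_eq_abs, abs_of_pos (by linarith)]
    exact mul_le_of_le_one_left (norm_nonneg _) (inv_le_one_of_one_le₀ hR)
  gcongr

open Real in
theorem integrable_cos_mul {χ : W → ℝ} (h : Integrable χ) (ξ : W) :
    Integrable fun x => cos (2 * π * inner ℝ x ξ) * χ x :=
  h.bdd_mul (c := 1) (Continuous.aestronglyMeasurable (by fun_prop))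
    (Filter.Eventually.of_forall fun x => abs_cos_le_one _)

open Real in
theorem cosFT_add {χ₁ χ₂ : W → ℝ} (h₁ : Integrable χ₁) (h₂ : Integrable χ₂) (ξ : W) :
    cosFT (fun x => χ₁ x + χ₂ x) ξ = cosFT χ₁ ξ + cosFT χ₂ ξ := by
  simp only [cosFT, mul_add]
  exact integral_add (integrable_cos_mul h₁ ξ) (integrable_cos_mul h₂ ξ)

open Real in
theorem cosFT_sub {χ₁ χ₂ : W → ℝ} (h₁ : Integrable χ₁) (h₂ : Integrable χ₂) (ξ : W) :
    cosFT (fun x => χ₁ x - χ₂ x) ξ = cosFT χ₁ ξ - cosFT χ₂ ξ := by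
  simp only [cosFT, mul_sub]
  exact integral_sub (integrable_cos_mul h₁ ξ) (integrable_cos_mul h₂ ξ)

open Real in
theorem cosFT_cos_mul {χ : W → ℝ} (h : Integrable χ) (η ξ : W) :
    cosFT (fun x => cos (2 * π * inner ℝ x η) * χ x) ξ =
      (cosFT χ (ξ + η) + cosFT χ (ξ - η)) / 2 := by
  simp only [cosFT]
  rw [← integral_add (integrable_cos_mul h _) (integrable_cos_mul h _), ← integral_div]
  congr 1
  funext x
  rw [inner_add_right, inner_sub_right, mul_add, mul_sub, cos_add, cos_sub]
  ring

theorem cosFT_inv_smul {R : ℝ} (hR : 0 < R) (χ : W → ℝ) (ξ : W) :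
    cosFT (fun x => χ (R⁻¹ • x)) ξ = R ^ Module.finrank ℝ W * cosFT χ (R • ξ) := by
  simp only [cosFT]
  have := Measure.integral_comp_inv_smul_of_nonneg volume
    (fun x : W => Real.cos (2 * Real.pi * inner ℝ x (R • ξ)) * χ x) hR.le
  rw [smul_eq_mul] at this
  rw [← this]
  congr 1
  funext x
  rw [real_inner_smul_left, real_inner_smul_right, inv_mul_cancel_left₀ hR.ne']

end Liouville

section Parallelogram

variable {W : Type*} [NormedAddCommGroup W] [InnerProductSpace ℝ W]
  [FiniteDimensional ℝ W] [MeasurableSpace W] [BorelSpace W]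

theorem exists_bound_of_homog_two {g : W → ℝ} (hc : Continuous g)
    (hom : ∀ (t : ℝ) k, g (t • k) = t ^ 2 * g k) : ∃ C, 0 ≤ C ∧ ∀ k, |g k| ≤ C * ‖k‖ ^ 2 := by
  obtain ⟨C, hC⟩ := (isCompact_sphere (0 : W) 1).exists_bound_of_continuousOn hc.continuousOn
  refine ⟨max C 0, le_max_right _ _, fun k => ?_⟩
  rcases eq_or_ne k 0 with rfl | hk
  · have h0 : g 0 = 0 := by simpa using hom 0 0
    simp [h0]
  · have hk' : ‖k‖ ≠ 0 := norm_ne_zero_iff.2 hk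
    have h1 := hC (‖k‖⁻¹ • k) (by simp [norm_smul, hk'])
    have h2 : g k = ‖k‖ ^ 2 * g (‖k‖⁻¹ • k) := by
      rw [← hom, smul_smul, mul_inv_cancel₀ hk', one_smul]
    rw [h2, abs_mul, abs_of_nonneg (sq_nonneg _), mul_comm]
    exact mul_le_mul_of_nonneg_right (h1.trans (le_max_left _ _)) (sq_nonneg _)

theorem integrable_mul_cosFT {χ : W → ℝ} (h : ContDiff ℝ (⊤ : ℕ∞) χ) (hs : HasCompactSupport χ)
    {G : W → ℝ} (hG : Continuous G) {A : ℝ} (hA : ∀ x, |G x| ≤ A * (‖x‖ ^ 2 + 1)) :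
    Integrable fun x => G x * cosFT χ x := by
  have i1 := (cosFT_integrable_pow h hs 2).norm.add (cosFT_integrable_pow h hs 0).norm
  refine (i1.const_mul A).mono' (hG.mul (cosFT_continuous h hs)).aestronglyMeasurable
    (Filter.Eventually.of_forall fun x => ?_)
  simp only [Pi.add_apply, norm_mul, norm_pow, norm_norm, pow_zero, one_mul]
  refine (mul_le_mul_of_nonneg_right (hA x) (norm_nonneg _)).trans (le_of_eq (by ring))

variable {g : W → ℝ}

theorem shift_bound {C : ℝ} (hC : 0 ≤ C) (hb : ∀ k, |g k| ≤ C * ‖k‖ ^ 2) (η x : W) :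
    |g (x + η)| ≤ 2 * C * (1 + ‖η‖ ^ 2) * (‖x‖ ^ 2 + 1) := by
  refine (hb _).trans ?_
  have h1 := norm_add_le x η
  have h2 : ‖x + η‖ ^ 2 ≤ 2 * (‖x‖ ^ 2 + ‖η‖ ^ 2) := by
    have := pow_le_pow_left₀ (norm_nonneg _) h1 2
    nlinarith [sq_nonneg (‖x‖ - ‖η‖)]
  have h3 : 2 * (‖x‖ ^ 2 + ‖η‖ ^ 2) ≤ 2 * (1 + ‖η‖ ^ 2) * (‖x‖ ^ 2 + 1) := by
    nlinarith [mul_nonneg (sq_nonneg ‖x‖) (sq_nonneg ‖η‖)]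
  nlinarith [mul_le_mul_of_nonneg_left (h2.trans h3) hC]

open Real Filter Topology in
/-- A continuous `2`-homogeneous function whose Fourier transform is supported at the origin is
reproduced by convolution with the Fourier transform of a plateau function. -/
theorem integral_shift_mul_cosFT_plateau (hc : Continuous g)
    (hom : ∀ (t : ℝ) k, g (t • k) = t ^ 2 * g k)
    (horth : ∀ χ : W → ℝ, ContDiff ℝ (⊤ : ℕ∞) χ → HasCompactSupport χ → (∀ x, χ (-x) = χ x) →
      (∀ x, 0 ≤ χ x) → ∀ r, 0 < r → (∀ x, ‖x‖ < r → χ x = 0) → ∫ k, g k * cosFT χ k = 0)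
    (η : W) : ∫ x, g (x + η) * cosFT plateau x = g η := by
  obtain ⟨C, hC, hb⟩ := exists_bound_of_homog_two hc hom
  have hge : ∀ x, g (-x) = g x := fun x => by simpa using hom (-1) x
  have hcs : ∀ η, Continuous fun x => g (x + η) := fun η => by fun_prop
  have key : ∀ (R : ℝ) (hR : 1 ≤ R) (η : W),
      ∫ x, g (x + η) * cosFT (fun y : W => plateau (R⁻¹ • y)) x =
        ∫ x, g (x + η) * cosFT plateau x := by
    intro R hR
    have hR0 : (0 : ℝ) < R := by linarith
    have s1 : ContDiff ℝ (⊤ : ℕ∞) fun y : W => plateau (R⁻¹ • y) :=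
      contDiff_plateau.comp (contDiff_const.smul contDiff_id)
    have c1 : HasCompactSupport fun y : W => plateau (R⁻¹ • y) :=
      hasCompactSupport_plateau.comp_smul (inv_ne_zero hR0.ne')
    have i1 := s1.continuous.integrable_of_hasCompactSupport (μ := volume) c1
    have i2 := (contDiff_plateau (W := W)).continuous.integrable_of_hasCompactSupport (μ := volume)
      hasCompactSupport_plateau
    set D : W → ℝ := fun y => plateau (R⁻¹ • y) - plateau y with hD
    have sD : ContDiff ℝ (⊤ : ℕ∞) D := s1.sub contDiff_plateau
    have cD : HasCompactSupport D := c1.sub hasCompactSupport_plateau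
    have iD : Integrable D := i1.sub i2
    have iK : ∀ η, Integrable fun x => g (x + η) * cosFT D x := fun η =>
      integrable_mul_cosFT sD cD (hcs η) (shift_bound hC hb η)
    have hK : ∀ η, (∫ x, g (x + 0) * cosFT D x) + ∫ x, g (x + η) * cosFT D x = 0 := by
      intro η
      have j1 : Integrable (fun x => g x * cosFT D (x - η)) ∧
          ∫ x, g x * cosFT D (x - η) = ∫ x, g (x + η) * cosFT D x := by
        have e : ∀ x, g x * cosFT D (x - η) =
            (fun x => g (x + η) * cosFT D x) (x - η) := fun x => by simp
        simp only [e]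
        exact ⟨(iK η).comp_sub_right η, integral_sub_right_eq_self (fun x => g (x + η) * cosFT D x) η⟩
      have e2 : ∀ x, g x * cosFT D (x + η) = (fun x => g x * cosFT D (x - η)) (-x) := fun x => by
        dsimp only
        rw [hge, ← cosFT_even D (-x - η)]
        congr 2
        abel
      have j2 : Integrable (fun x => g x * cosFT D (x + η)) ∧
          ∫ x, g x * cosFT D (x + η) = ∫ x, g (x + η) * cosFT D x := by
        rw [← j1.2]
        simp only [e2]
        exact ⟨j1.1.comp_neg, integral_neg_eq_self (fun x => g x * cosFT D (x - η)) volume⟩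
      set χ : W → ℝ := fun x => D x + cos (2 * π * inner ℝ x η) * D x with hχ
      have ccos : ContDiff ℝ (⊤ : ℕ∞) fun x : W => cos (2 * π * inner ℝ x η) :=
        Real.contDiff_cos.comp (contDiff_const.mul (contDiff_id.inner ℝ contDiff_const))
      have hDe : ∀ x, D (-x) = D x := fun x => by simp [hD, plateau_neg]
      have h0 := horth χ (sD.add (ccos.mul sD)) (cD.add cD.mul_left)
        (fun x => by simp only [hχ, hDe, inner_neg_left, mul_neg, Real.cos_neg])
        (fun x => by
          have h1 : 0 ≤ D x := sub_nonneg.2 (plateau_smul_le hR x)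
          have h2 := neg_one_le_cos (2 * π * inner ℝ x η)
          rw [hχ]
          dsimp only
          nlinarith) 1 one_pos
        (fun x hx => by
          have h1 : D x = 0 := by
            simp only [hD]
            rw [plateau_one hx.le, plateau_one, sub_self]
            rw [norm_smul, norm_inv, Real.norm_eq_abs, abs_of_pos hR0]
            exact mul_le_one₀ (inv_le_one_of_one_le₀ hR) (norm_nonneg _) hx.le
          simp [hχ, h1])
      have e3 : ∀ x, g x * cosFT χ x = g (x + 0) * cosFT D x + ((g x * cosFT D (x + η)) / 2
          + (g x * cosFT D (x - η)) / 2) := fun x => by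
        rw [hχ, cosFT_add iD (integrable_cos_mul iD η), cosFT_cos_mul iD, add_zero]
        ring
      simp only [e3] at h0
      rw [integral_add (g := fun x => g x * cosFT D (x + η) / 2 + g x * cosFT D (x - η) / 2)
          (iK 0) ((j2.1.div_const 2).add (j1.1.div_const 2)),
        integral_add (j2.1.div_const 2) (j1.1.div_const 2), integral_div, integral_div,
        j1.2, j2.2] at h0
      linarith
    intro η
    have h1 := hK 0
    have h2 := hK η
    have h3 : ∫ x, g (x + η) * cosFT D x = 0 := by linarith
    have e4 : ∀ x, g (x + η) * cosFT D x = g (x + η) * cosFT (fun y : W => plateau (R⁻¹ • y)) x -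
        g (x + η) * cosFT plateau x := fun x => by
      rw [hD, cosFT_sub i1 i2, mul_sub]
    simp only [e4] at h3
    rw [integral_sub (integrable_mul_cosFT s1 c1 (hcs η) (shift_bound hC hb η))
      (integrable_mul_cosFT contDiff_plateau hasCompactSupport_plateau (hcs η)
        (shift_bound hC hb η))] at h3
    linarith
  have key2 : ∀ R : ℝ, 1 ≤ R → ∫ x, g (R⁻¹ • x + η) * cosFT plateau x =
      ∫ x, g (x + η) * cosFT plateau x := fun R hR => by
    have hR0 : (0 : ℝ) < R := by linarith
    rw [← key R hR η]
    have h1 := Measure.integral_comp_smul_of_nonneg volume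
      (fun x : W => g (R⁻¹ • x + η) * cosFT plateau x) R (hR := hR0.le)
    simp only [smul_smul, inv_mul_cancel₀ hR0.ne', one_smul, smul_eq_mul] at h1
    simp only [cosFT_inv_smul hR0]
    rw [eq_inv_mul_iff_mul_eq₀ (pow_pos hR0 _).ne', ← integral_const_mul] at h1
    rw [← h1]
    exact integral_congr_ae (Eventually.of_forall fun x => by dsimp only; ring)
  have hone : ∫ x : W, cosFT plateau x = 1 := by
    have := cosFT_cosFT (contDiff_plateau (W := W)) hasCompactSupport_plateau plateau_neg 0
    rw [plateau_one (by simp)] at this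
    simpa [cosFT] using this
  have hlim : Tendsto (fun n : ℕ => ∫ x, g (((n : ℝ) + 1)⁻¹ • x + η) * cosFT plateau x) atTop
      (𝓝 (∫ x, g η * cosFT (plateau : W → ℝ) x)) := by
    refine tendsto_integral_of_dominated_convergence
      (fun x => ‖(2 * C * (1 + ‖η‖ ^ 2) * (‖x‖ ^ 2 + 1)) * cosFT plateau x‖) (fun n => ?_) ?_
      (fun n => Eventually.of_forall fun x => ?_) (Eventually.of_forall fun x => ?_)
    · exact ((hc.comp (by fun_prop)).mul
        (cosFT_continuous contDiff_plateau hasCompactSupport_plateau)).aestronglyMeasurable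
    · refine (integrable_mul_cosFT contDiff_plateau hasCompactSupport_plateau
        (A := 2 * C * (1 + ‖η‖ ^ 2)) (by fun_prop) fun x => ?_).norm
      rw [abs_of_nonneg (by positivity)]
    · rw [norm_mul, norm_mul]
      refine mul_le_mul_of_nonneg_right ?_ (norm_nonneg _)
      rw [Real.norm_eq_abs, Real.norm_eq_abs, abs_of_nonneg (by positivity : (0 : ℝ) ≤
        2 * C * (1 + ‖η‖ ^ 2) * (‖x‖ ^ 2 + 1))]
      refine (shift_bound hC hb η _).trans ?_
      have : ‖((n : ℝ) + 1)⁻¹ • x‖ ≤ ‖x‖ := by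
        rw [norm_smul, norm_inv, Real.norm_eq_abs, abs_of_pos (by positivity)]
        exact mul_le_of_le_one_left (norm_nonneg _)
          (inv_le_one_of_one_le₀ (by linarith [Nat.cast_nonneg (α := ℝ) n]))
      gcongr
    · have h1 : Tendsto (fun n : ℕ => ((n : ℝ) + 1)⁻¹) atTop (𝓝 0) := by
        simpa using tendsto_one_div_add_atTop_nhds_zero_nat (𝕜 := ℝ)
      have h2 : Tendsto (fun n : ℕ => ((n : ℝ) + 1)⁻¹ • x + η) atTop (𝓝 η) := by
        simpa using (h1.smul_const x).add_const η
      exact ((hc.tendsto η).comp h2).mul_const _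
  rw [integral_const_mul, hone, mul_one] at hlim
  have hconst : ∀ n : ℕ, ∫ x, g (((n : ℝ) + 1)⁻¹ • x + η) * cosFT plateau x =
      ∫ x, g (x + η) * cosFT plateau x := fun n =>
    key2 _ (by linarith [Nat.cast_nonneg (α := ℝ) n])
  simp only [hconst] at hlim
  exact tendsto_nhds_unique tendsto_const_nhds hlim

open Real Filter Topology in
theorem parallelogram_of_homog_two (hc : Continuous g)
    (hom : ∀ (t : ℝ) k, g (t • k) = t ^ 2 * g k)
    (horth : ∀ χ : W → ℝ, ContDiff ℝ (⊤ : ℕ∞) χ → HasCompactSupport χ → (∀ x, χ (-x) = χ x) →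
      (∀ x, 0 ≤ χ x) → ∀ r, 0 < r → (∀ x, ‖x‖ < r → χ x = 0) → ∫ k, g k * cosFT χ k = 0)
    (a b : W) : g (a + b) + g (a - b) = 2 * g a + 2 * g b := by
  obtain ⟨C, hC, hb⟩ := exists_bound_of_homog_two hc hom
  have hge : ∀ x, g (-x) = g x := fun x => by simpa using hom (-1) x
  have hcs : ∀ η, Continuous fun x => g (x + η) := fun η => by fun_prop
  set φ : W → ℝ := cosFT plateau with hφ
  have hφc : Continuous φ := cosFT_continuous contDiff_plateau hasCompactSupport_plateau
  have shift : ∀ η v : W, Integrable (fun x => g (x + η) * φ (x + v)) ∧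
      ∫ x, g (x + η) * φ (x + v) = g (η - v) := by
    intro η v
    have e : ∀ x, g (x + η) * φ (x + v) = (fun x => g (x + (η - v)) * φ x) (x + v) := fun x => by
      dsimp only
      congr 2
      abel
    simp only [e]
    refine ⟨(integrable_mul_cosFT contDiff_plateau hasCompactSupport_plateau (hcs _)
      (shift_bound hC hb _)).comp_add_right v, ?_⟩
    rw [integral_add_right_eq_self (fun x => g (x + (η - v)) * φ x) v]
    exact integral_shift_mul_cosFT_plateau hc hom horth _
  obtain ⟨F, hF, hFr⟩ := exists_schwartz (contDiff_plateau (W := W)) hasCompactSupport_plateau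
  obtain ⟨Cs, hCs, hsec⟩ := schwartz_second_difference (FourierTransform.fourier F) a
    (Module.finrank ℝ W + 3)
  set B : ℝ → W → ℝ := fun r x => φ (x + r • a) + φ (x - r • a) - 2 * φ x with hB
  have hBb : ∀ r, 0 < r → r ≤ 1 → ∀ x, |B r x / r ^ 2| ≤
      Cs * ((1 + ‖x‖) ^ (Module.finrank ℝ W + 3))⁻¹ := by
    intro r h0 h1 x
    rw [abs_div, abs_of_pos (pow_pos h0 2), div_le_iff₀ (pow_pos h0 2), mul_comm]
    refine le_trans ?_ (hsec r h0 h1 x)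
    refine le_trans (le_of_eq ?_) (Complex.abs_re_le_norm _)
    simp [hB, hφ, hFr]
  set Δ := g (a + b) + g (a - b) - 2 * g a - 2 * g b with hΔ
  have hint : ∀ r, 0 < r → ∫ x, (g (x + r • b) - g x) * (B r x / r ^ 2) = Δ := by
    intro r h0
    have one : ∀ η : W, Integrable (fun x => g (x + η) * B r x) ∧
        ∫ x, g (x + η) * B r x = g (η - r • a) + g (η + r • a) - 2 * g η := by
      intro η
      have e : ∀ x, g (x + η) * B r x = (g (x + η) * φ (x + r • a) + g (x + η) * φ (x + -(r • a)))
          - 2 * (g (x + η) * φ (x + 0)) := fun x => by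
        simp only [hB, add_zero, sub_eq_add_neg]
        ring
      have i1 := shift η (r • a)
      have i2 := shift η (-(r • a))
      have i3 := shift η 0
      have i12 : Integrable fun x => g (x + η) * φ (x + r • a) + g (x + η) * φ (x + -(r • a)) :=
        i1.1.add i2.1
      simp only [e]
      refine ⟨i12.sub (i3.1.const_mul 2), ?_⟩
      rw [integral_sub i12 (i3.1.const_mul 2), integral_add i1.1 i2.1, integral_const_mul,
        i1.2, i2.2, i3.2, sub_neg_eq_add, sub_zero]
    have e : ∀ x, (g (x + r • b) - g x) * (B r x / r ^ 2) =
        (r ^ 2)⁻¹ * (g (x + r • b) * B r x - g (x + 0) * B r x) := fun x => by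
      rw [add_zero]; ring
    simp only [e]
    rw [integral_const_mul, integral_sub (one _).1 (one _).1, (one _).2, (one _).2,
      ← smul_sub, ← smul_add, hom, hom, hom, zero_sub, zero_add, hge, hom,
      show g 0 = 0 by simpa using hom 0 0, inv_mul_eq_iff_eq_mul₀ (pow_pos h0 2).ne', hΔ,
      ← hge (b - a), neg_sub, add_comm b a]
    ring
  have hlim : Tendsto (fun n : ℕ => ∫ x, (g (x + ((n : ℝ) + 1)⁻¹ • b) - g x) *
      (B ((n : ℝ) + 1)⁻¹ x / ((n : ℝ) + 1)⁻¹ ^ 2)) atTop (𝓝 (∫ x : W, (0 : ℝ))) := by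
    have hr0 : ∀ n : ℕ, (0 : ℝ) < ((n : ℝ) + 1)⁻¹ := fun n => by positivity
    have hr1 : ∀ n : ℕ, ((n : ℝ) + 1)⁻¹ ≤ 1 := fun n =>
      inv_le_one_of_one_le₀ (by linarith [Nat.cast_nonneg (α := ℝ) n])
    refine tendsto_integral_of_dominated_convergence
      (fun x => (1 + ‖x‖) ^ 2 * ((4 * C * (1 + ‖b‖ ^ 2) * Cs) *
        ((1 + ‖x‖) ^ (Module.finrank ℝ W + 3))⁻¹)) (fun n => ?_)
      (integrable_one_add_norm_inv_pow _)
      (fun n => Eventually.of_forall fun x => ?_) (Eventually.of_forall fun x => ?_)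
    · refine Continuous.aestronglyMeasurable ?_
      simp only [hB]
      fun_prop
    · rw [norm_mul, Real.norm_eq_abs, Real.norm_eq_abs]
      have h1 : |g (x + ((n : ℝ) + 1)⁻¹ • b) - g x| ≤ (1 + ‖x‖) ^ 2 * (4 * C * (1 + ‖b‖ ^ 2)) := by
        have s1 := shift_bound hC hb (((n : ℝ) + 1)⁻¹ • b) x
        have s2 := hb x
        have s3 : ‖((n : ℝ) + 1)⁻¹ • b‖ ≤ ‖b‖ := by
          rw [norm_smul, Real.norm_eq_abs, abs_of_pos (hr0 n)]
          exact mul_le_of_le_one_left (norm_nonneg _) (hr1 n)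
        have s4 : 2 * C * (1 + ‖((n : ℝ) + 1)⁻¹ • b‖ ^ 2) * (‖x‖ ^ 2 + 1) ≤
            2 * C * (1 + ‖b‖ ^ 2) * (1 + ‖x‖) ^ 2 := by
          gcongr
          nlinarith [norm_nonneg x]
        have s5 : C * ‖x‖ ^ 2 ≤ 2 * C * (1 + ‖b‖ ^ 2) * (1 + ‖x‖) ^ 2 := by
          have : ‖x‖ ^ 2 ≤ (1 + ‖x‖) ^ 2 := by nlinarith [norm_nonneg x]
          have h : C * 1 ≤ 2 * C * (1 + ‖b‖ ^ 2) := by nlinarith [mul_nonneg hC (sq_nonneg ‖b‖)]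
          rw [mul_one] at h
          gcongr
        refine (abs_sub _ _).trans ?_
        linarith
      refine (mul_le_mul h1 (hBb _ (hr0 n) (hr1 n) x) (abs_nonneg _) (by positivity)).trans
        (le_of_eq (by ring))
    · have h1 : Tendsto (fun n : ℕ => ((n : ℝ) + 1)⁻¹) atTop (𝓝 0) := by
        simpa using tendsto_one_div_add_atTop_nhds_zero_nat (𝕜 := ℝ)
      have h2 : Tendsto (fun n : ℕ => x + ((n : ℝ) + 1)⁻¹ • b) atTop (𝓝 x) := by
        simpa using (h1.smul_const b).const_add x
      have h3 : Tendsto (fun n : ℕ => |g (x + ((n : ℝ) + 1)⁻¹ • b) - g x| *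
          (Cs * ((1 + ‖x‖) ^ (Module.finrank ℝ W + 3))⁻¹)) atTop (𝓝 0) := by
        have h4 : Tendsto (fun n : ℕ => g (x + ((n : ℝ) + 1)⁻¹ • b) - g x) atTop (𝓝 0) := by
          simpa using ((hc.tendsto x).comp h2).sub_const (g x)
        simpa using h4.abs.mul_const (Cs * ((1 + ‖x‖) ^ (Module.finrank ℝ W + 3))⁻¹)
      refine squeeze_zero_norm (fun n => ?_) h3
      rw [norm_mul, Real.norm_eq_abs, Real.norm_eq_abs]
      exact mul_le_mul_of_nonneg_left (hBb _ (hr0 n) (hr1 n) x) (abs_nonneg _)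
  have hconst : ∀ n : ℕ, ∫ x, (g (x + ((n : ℝ) + 1)⁻¹ • b) - g x) *
      (B ((n : ℝ) + 1)⁻¹ x / ((n : ℝ) + 1)⁻¹ ^ 2) = Δ := fun n => hint _ (by positivity)
  simp only [hconst, integral_zero] at hlim
  have := tendsto_nhds_unique hlim tendsto_const_nhds
  linarith

end Parallelogram

section Abel

open Set Filter Topology in
/-- Injectivity of the Abel transform. -/
theorem eq_zero_of_integral_add_sq {N : ℝ → ℝ} (hc : ContinuousOn N (Ioi 0))
    (h1 : ∀ τ, 1 ≤ τ → N τ = 0) (h : ∀ σ, 0 < σ → ∫ t : ℝ, N (σ + t ^ 2) = 0) (τ : ℝ)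
    (hτ : 0 < τ) : N τ = 0 := by
  have H1 : ∀ σ, 0 < σ → ∫ z : ℂ, N (σ + ‖z‖ ^ 2) = 0 := by
    intro σ hσ
    have cz : Continuous fun z : ℂ => N (σ + ‖z‖ ^ 2) :=
      hc.comp_continuous (by fun_prop) fun z => by
        have := sq_nonneg ‖z‖
        exact mem_Ioi.2 (by linarith)
    have sz : HasCompactSupport fun z : ℂ => N (σ + ‖z‖ ^ 2) := by
      refine HasCompactSupport.intro (isCompact_closedBall (0 : ℂ) 1) fun z hz => h1 _ ?_
      rw [mem_closedBall_zero_iff, not_le] at hz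
      nlinarith
    have iz := cz.integrable_of_hasCompactSupport (μ := volume) sz
    have mp := Complex.volume_preserving_equiv_real_prod.symm
    have e1 := mp.integral_comp' (fun z : ℂ => N (σ + ‖z‖ ^ 2))
    have i2 := (mp.integrable_comp_emb (MeasurableEquiv.measurableEmbedding _)).2 iz
    rw [← e1]
    have e2 := integral_prod _ i2
    simp only [Function.comp_def] at e2
    refine (e2.trans ?_)
    have e3 : ∀ x y : ℝ, N (σ + ‖Complex.measurableEquivRealProd.symm (x, y)‖ ^ 2) =
        N (σ + x ^ 2 + y ^ 2) := fun x y => by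
      rw [Complex.sq_norm, Complex.normSq_apply, Complex.measurableEquivRealProd_symm_apply]
      simp only
      congr 1
      ring
    simp only [e3]
    have e4 : ∀ x : ℝ, ∫ y : ℝ, N (σ + x ^ 2 + y ^ 2) = 0 := fun x =>
      h _ (by have := sq_nonneg x; linarith)
    simp only [e4, integral_zero]
  have H2 : ∀ σ, 0 < σ → ∫ u in σ..(σ + 1), N u = 0 := by
    intro σ hσ
    have e1 := integral_fun_norm_addHaar (volume : Measure ℂ) (fun y => N (σ + y ^ 2))
    rw [H1 σ hσ, Complex.finrank_real_complex] at e1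
    have hb : (volume : Measure ℂ).real (Metric.ball 0 1) ≠ 0 :=
      (ENNReal.toReal_pos (Metric.measure_ball_pos volume 0 one_pos).ne'
        measure_ball_lt_top.ne).ne'
    have e2 : ∫ y in Ioi (0 : ℝ), y ^ (2 - 1) • N (σ + y ^ 2) = 0 := by
      rw [eq_comm, smul_eq_zero, smul_eq_zero] at e1
      rcases e1 with e1 | e1 | e1
      · norm_num at e1
      · exact absurd e1 hb
      · exact e1
    rw [setIntegral_eq_of_subset_of_forall_sdiff_eq_zero (s := Ioc (0 : ℝ) 1) measurableSet_Ioi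
      (fun x hx => hx.1) (fun x hx => ?_)] at e2
    · rw [← intervalIntegral.integral_of_le zero_le_one] at e2
      have e3 := intervalIntegral.integral_comp_mul_deriv' (a := 0) (b := 1)
        (f := fun y : ℝ => σ + y ^ 2) (f' := fun y => 2 * y) (g := N)
        (fun x _ => by simpa using (hasDerivAt_pow 2 x).const_add σ) (by fun_prop)
        (hc.mono (by
          rintro _ ⟨x, hx, rfl⟩
          have := sq_nonneg x
          exact mem_Ioi.2 (by linarith)))
      norm_num at e3
      rw [← e3]
      have e4 : ∀ x : ℝ, N (σ + x ^ 2) * (2 * x) = 2 * (x ^ (2 - 1) • N (σ + x ^ 2)) := fun x => by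
        simp only [smul_eq_mul, Nat.add_one_sub_one, pow_one]; ring
      simp only [e4]
      rw [intervalIntegral.integral_const_mul, e2, mul_zero]
    · have hx1 : 1 < x := by
        by_contra hx1
        exact hx.2 ⟨hx.1, not_lt.1 hx1⟩
      rw [h1 _ (by nlinarith), smul_zero]
  rcases le_or_gt 1 τ with hτ1 | hτ1
  · exact h1 τ hτ1
  have ii : ∀ a b : ℝ, 0 < a → 0 < b → IntervalIntegrable N volume a b := fun a b ha hb =>
    (hc.mono fun x hx => mem_Ioi.2 ((lt_min ha hb).trans_le hx.1)).intervalIntegrable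
  have H3 : ∀ σ, 0 < σ → ∫ u in σ..2, N u = 0 := by
    intro σ hσ
    rw [← intervalIntegral.integral_add_adjacent_intervals (ii σ (σ + 1) hσ (by linarith))
      (ii (σ + 1) 2 (by linarith) two_pos), H2 σ hσ, zero_add]
    have : EqOn N (fun _ => 0) (uIcc (σ + 1) 2) := fun x hx =>
      h1 x ((le_min (by linarith) (by norm_num)).trans hx.1)
    rw [intervalIntegral.integral_congr this, intervalIntegral.integral_zero]
  have hd := intervalIntegral.integral_hasDerivAt_left (ii τ 2 hτ two_pos)
    (hc.stronglyMeasurableAtFilter isOpen_Ioi τ hτ) (hc.continuousAt (Ioi_mem_nhds hτ))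
  have h0 : (fun u => ∫ x in u..2, N x) =ᶠ[𝓝 τ] fun _ => 0 :=
    (Ioi_mem_nhds hτ : Ioi (0 : ℝ) ∈ 𝓝 τ) |> fun hm => by
      filter_upwards [hm] with σ hσ using H3 σ hσ
  have := (hd.congr_of_eventuallyEq h0.symm).unique (hasDerivAt_const τ (0 : ℝ))
  linarith

end Abel

section Rotation

variable {V W : Type*} [NormedAddCommGroup V] [InnerProductSpace ℝ V] [FiniteDimensional ℝ V]
  [MeasurableSpace V] [BorelSpace V] [NormedAddCommGroup W] [InnerProductSpace ℝ W]
  [FiniteDimensional ℝ W] [MeasurableSpace W] [BorelSpace W]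

/-- The functional `ψ` is invariant under the linear isometry `u`. -/
def PresBy (ψ : ConvexBody V → ℝ) (u : V ≃ₗᵢ[ℝ] V) : Prop :=
  ∀ K, ψ (mapBody (u.toContinuousLinearEquiv : V →L[ℝ] V) K) = ψ K

variable {ψ : ConvexBody V → ℝ} {u : V ≃ₗᵢ[ℝ] V}

theorem PresBy.diffOp (h : PresBy ψ u) (ξ : V) (K : ConvexBody V) :
    _root_.diffOp (u ξ) ψ (mapBody (u.toContinuousLinearEquiv : V →L[ℝ] V) K) =
      _root_.diffOp ξ ψ K := by
  have : segBody (u ξ) = mapBody (u.toContinuousLinearEquiv : V →L[ℝ] V) (segBody ξ) := by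
    rw [mapBody_segBody]; rfl
  rw [_root_.diffOp, this, ← mapBody_add, h, h, _root_.diffOp]

theorem mapBody_spikeBody (u : V ≃ₗᵢ[ℝ] V) (w : V) :
    mapBody (u.toContinuousLinearEquiv : V →L[ℝ] V) (spikeBody w) = spikeBody (u w) := by
  refine body_ext fun x => ?_
  have h : ∀ x y, inner ℝ ((u.toContinuousLinearEquiv : V →L[ℝ] V) x) y =
      inner ℝ x ((u.symm.toContinuousLinearEquiv : V →L[ℝ] V) y) := fun x y => by
    have := u.inner_map_map x (u.symm y)
    rw [u.apply_symm_apply] at this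
    exact this
  rw [suppFn_mapBody h, suppFn_spikeBody, suppFn_spikeBody, ← h]
  congr 1
  exact u.symm.norm_map x

theorem PresBy.spikeDiff (h : PresBy ψ u) (w ξ : V) :
    _root_.spikeDiff ψ (u w) (u ξ) = _root_.spikeDiff ψ w ξ := by
  have h0 := mapBody_spikeBody u 0
  rw [map_zero] at h0
  rw [_root_.spikeDiff, _root_.spikeDiff, ← h.diffOp ξ (spikeBody w), ← h.diffOp ξ (spikeBody 0),
    mapBody_spikeBody, h0]

theorem CVal.spikeDiff_of_norm_le (hψ : CVal ψ) {w : V} (hw : ‖w‖ ≤ 1) (ξ : V) :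
    _root_.spikeDiff ψ w ξ = 0 :=
  hψ.spikeDiff_eq_zero fun u _ => (abs_real_inner_le_norm _ _).trans
    (mul_le_of_le_one_left (norm_nonneg _) hw)

theorem CVal.spikeDiff_rotate (hψ : CVal ψ) (h : PresBy ψ u) {p k : V} {τ : ℝ}
    (h1 : √(1 + τ ^ 2) • u k = k + τ • p) (h2 : √(1 + τ ^ 2) • u p = p - τ • k) (ρ : ℝ) :
    _root_.spikeDiff ψ (ρ • p) (k + τ • p) =
      √(1 + τ ^ 2) * _root_.spikeDiff ψ ((ρ / √(1 + τ ^ 2)) • p) k := by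
  have hR : 0 < √(1 + τ ^ 2) := Real.sqrt_pos.2 (by positivity)
  have hRR : √(1 + τ ^ 2) * √(1 + τ ^ 2) = 1 + τ ^ 2 := Real.mul_self_sqrt (by positivity)
  set R := √(1 + τ ^ 2) with hRdef
  have e1 : u (p + τ • k) = R • p := by
    have h3 : R • u (p + τ • k) = R • R • p := by
      rw [map_add, map_smul, smul_add, h2, smul_comm R τ, h1, smul_smul, hRR]
      module
    exact smul_right_injective V hR.ne' h3
  have e2 : ρ • p = u ((ρ / R) • (p + τ • k)) := by
    rw [map_smul, e1, smul_smul, div_mul_cancel₀ _ hR.ne']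
  rw [← h1, hψ.absHom_spikeDiff, abs_of_pos hR, e2, h.spikeDiff]
  congr 1
  rw [_root_.spikeDiff, _root_.spikeDiff]
  congr 1
  refine hψ.diffOp_congr_of_suppFn k fun x hx => ?_
  rw [suppFn_spikeBody, suppFn_spikeBody, real_inner_smul_left, inner_add_left,
    real_inner_smul_left, hx, mul_zero, add_zero, real_inner_smul_left]

open Filter Topology in
theorem CVal.tendsto_spikeDiff_div (hψ : CVal ψ) (h2 : Homog 2 ψ) (p k : V) :
    Tendsto (fun n : ℕ => _root_.spikeDiff ψ (((n : ℝ) + 1) • p) k / ((n : ℝ) + 1)) atTop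
      (𝓝 (_root_.diffOp p (_root_.diffOp k ψ) 0)) := by
  have hD := hψ.diffOp k
  have hH : Homog 1 (_root_.diffOp k ψ) := hψ.homog_diffOp h2 k
  have h0 : _root_.diffOp k ψ 0 = 0 := homog_succ_zero hH
  have hn : ∀ n : ℕ, (0 : ℝ) < ((n : ℝ) + 1)⁻¹ := fun n => by positivity
  have hlim0 : Tendsto (fun n : ℕ => ((n : ℝ) + 1)⁻¹) atTop (𝓝 0) := by
    simpa using tendsto_one_div_add_atTop_nhds_zero_nat (𝕜 := ℝ)
  have hbody : Tendsto (fun n : ℕ => ConvexBody.dilate ((n : ℝ) + 1)⁻¹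
      (spikeBody (((n : ℝ) + 1) • p))) atTop (𝓝 (segBody p)) := by
    rw [tendsto_iff_dist_tendsto_zero]
    refine squeeze_zero (fun _ => dist_nonneg) (fun n => ?_) hlim0
    refine dist_le_of_suppFn (hn n).le fun u => ?_
    rw [suppFn_dilate (hn n).le, suppFn_spikeBody, suppFn_segBody, real_inner_smul_left, abs_mul,
      abs_of_pos (show (0 : ℝ) < (n : ℝ) + 1 by positivity), mul_max_of_nonneg _ _ (hn n).le,
      inv_mul_cancel_left₀ (by positivity)]
    have := mul_nonneg (hn n).le (norm_nonneg u)
    rw [abs_of_nonneg (sub_nonneg.2 (le_max_right _ _)), sub_le_iff_le_add]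
    exact max_le (le_add_of_nonneg_right (abs_nonneg _)) (le_add_of_nonneg_left this)
  have hc : Continuous (_root_.diffOp k ψ) := hD.cont
  have e : ∀ n : ℕ, _root_.spikeDiff ψ (((n : ℝ) + 1) • p) k / ((n : ℝ) + 1) =
      _root_.diffOp k ψ (ConvexBody.dilate ((n : ℝ) + 1)⁻¹ (spikeBody (((n : ℝ) + 1) • p))) -
        ((n : ℝ) + 1)⁻¹ * _root_.diffOp k ψ (spikeBody 0) := fun n => by
    rw [hH _ _ (hn n), _root_.spikeDiff, pow_one]
    ring
  simp only [e]
  have e2 : _root_.diffOp p (_root_.diffOp k ψ) 0 = _root_.diffOp k ψ (segBody p) - 0 := by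
    rw [← h0, ← zero_add (segBody p)]
    rfl
  rw [e2]
  have h3 := ((hc.tendsto _).comp hbody).sub (hlim0.mul_const (_root_.diffOp k ψ (spikeBody 0)))
  rw [zero_mul] at h3
  exact h3

variable {p : V} {ι : W →L[ℝ] V} {P : V →L[ℝ] W}

open Set Filter Topology in
/-- If `ψ` is invariant under sufficiently many rotations, the mixed second difference in the
directions `p` and `c • k₁ + s • k₂` depends quadratically on the angle. -/
theorem OrthoSplit.diffOp_diffOp_eq (S : OrthoSplit p ι P) (hψ : CVal ψ) (h2 : Homog 2 ψ)
    {k₁ k₂ : W}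
    (hrot : ∀ c s : ℝ, c ^ 2 + s ^ 2 = 1 → ∀ τ : ℝ, ∃ u : V ≃ₗᵢ[ℝ] V, PresBy ψ u ∧
      √(1 + τ ^ 2) • u (ι (c • k₁ + s • k₂)) = ι (c • k₁ + s • k₂) + τ • p ∧
      √(1 + τ ^ 2) • u p = p - τ • ι (c • k₁ + s • k₂))
    (href : ∃ r : V ≃ₗᵢ[ℝ] V, PresBy ψ r ∧ r p = p ∧ r (ι k₁) = ι k₁ ∧ r (ι k₂) = -ι k₂)
    {c s : ℝ} (hcs : c ^ 2 + s ^ 2 = 1) :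
    diffOp p (diffOp (ι (c • k₁ + s • k₂)) ψ) 0 =
      c ^ 2 * diffOp p (diffOp (ι k₁) ψ) 0 + s ^ 2 * diffOp p (diffOp (ι k₂) ψ) 0 := by
  set γ : W → ℝ → ℝ := fun k a => spikeDiff ψ (a • p) (ι k) with hγ
  have γc : ∀ k, Continuous (γ k) := fun k => by
    have h : Continuous fun a : ℝ => ((a • p, ι k) : V × V) := by fun_prop
    have := hψ.continuous_spikeDiff.comp h
    simpa only [Function.comp_def] using this
  have γ1 : ∀ k a, 0 ≤ a → a ≤ 1 → γ k a = 0 := fun k a h0 h1 =>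
    hψ.spikeDiff_of_norm_le (by rwa [norm_smul, S.norm_p, mul_one, Real.norm_eq_abs,
      abs_of_nonneg h0]) _
  have hline : ∀ c s : ℝ, c ^ 2 + s ^ 2 = 1 → ∀ ρ τ : ℝ,
      spikeDiff ψ (ρ • p) (ι (c • k₁ + s • k₂) + τ • p) =
        √(1 + τ ^ 2) * γ (c • k₁ + s • k₂) (ρ / √(1 + τ ^ 2)) := by
    intro c s hcs ρ τ
    obtain ⟨u, hu, hu1, hu2⟩ := hrot c s hcs τ
    exact hψ.spikeDiff_rotate hu hu1 hu2 ρ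
  obtain ⟨r, hr, hrp, hr1, hr2⟩ := href
  have hquad : ∀ ρ, 0 < ρ → sliceFn ψ ρ p ι (c • k₁ + s • k₂) =
      c ^ 2 * sliceFn ψ ρ p ι k₁ + s ^ 2 * sliceFn ψ ρ p ι k₂ := by
    intro ρ hρ
    have hpar := parallelogram_of_homog_two (S.continuous_sliceFn hψ hρ)
      (S.sliceFn_smul hψ hρ) (fun χ h hs he hp r hr h0 =>
        S.integral_sliceFn_mul hψ h2 hρ h hs he hp hr h0) (c • k₁) (s • k₂)
    have hsym : sliceFn ψ ρ p ι (c • k₁ - s • k₂) = sliceFn ψ ρ p ι (c • k₁ + s • k₂) := by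
      refine integral_congr_ae (Eventually.of_forall fun τ => ?_)
      dsimp only
      rw [← hr.spikeDiff (ρ • p) (ι (c • k₁ + s • k₂) + τ • p)]
      simp [hrp, hr1, hr2, sub_eq_add_neg]
    rw [hsym, S.sliceFn_smul hψ hρ, S.sliceFn_smul hψ hρ] at hpar
    linarith
  set k := c • k₁ + s • k₂ with hk
  set G : ℝ → ℝ := fun a => γ k a - c ^ 2 * γ k₁ a - s ^ 2 * γ k₂ a with hG
  have Gc : Continuous G := ((γc k).sub ((γc k₁).const_mul _)).sub ((γc k₂).const_mul _)
  have hGint : ∀ ρ, 0 < ρ → ∫ τ : ℝ, √(1 + τ ^ 2) * G (ρ / √(1 + τ ^ 2)) = 0 := by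
    intro ρ hρ
    have hk1 : ∀ τ, spikeDiff ψ (ρ • p) (ι k₁ + τ • p) =
        √(1 + τ ^ 2) * γ k₁ (ρ / √(1 + τ ^ 2)) := fun τ => by
      have := hline 1 0 (by norm_num) ρ τ
      simpa using this
    have hk2 : ∀ τ, spikeDiff ψ (ρ • p) (ι k₂ + τ • p) =
        √(1 + τ ^ 2) * γ k₂ (ρ / √(1 + τ ^ 2)) := fun τ => by
      have := hline 0 1 (by norm_num) ρ τ
      simpa using this
    have e : ∀ τ : ℝ, √(1 + τ ^ 2) * G (ρ / √(1 + τ ^ 2)) =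
        spikeDiff ψ (ρ • p) (ι k + τ • p) - c ^ 2 * spikeDiff ψ (ρ • p) (ι k₁ + τ • p)
          - s ^ 2 * spikeDiff ψ (ρ • p) (ι k₂ + τ • p) := fun τ => by
      rw [hline c s hcs, hk1, hk2, hG]
      ring
    simp only [e]
    have i0 := S.integrable_slice hψ hρ k
    have i1 := (S.integrable_slice hψ hρ k₁).const_mul (c ^ 2)
    have i2 := (S.integrable_slice hψ hρ k₂).const_mul (s ^ 2)
    have i01 : Integrable fun τ : ℝ => spikeDiff ψ (ρ • p) (ι k + τ • p) -
        c ^ 2 * spikeDiff ψ (ρ • p) (ι k₁ + τ • p) := i0.sub i1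
    rw [integral_sub i01 i2, integral_sub i0 i1, integral_const_mul, integral_const_mul]
    have := hquad ρ hρ
    simp only [sliceFn] at this
    linarith
  have G1 : ∀ a, 0 ≤ a → a ≤ 1 → G a = 0 := fun a h0 h1 => by
    simp only [hG, γ1 _ a h0 h1, mul_zero, sub_zero]
  have hN : ∀ τ : ℝ, 0 < τ → √τ * G (√τ)⁻¹ = 0 := by
    refine eq_zero_of_integral_add_sq (N := fun τ => √τ * G (√τ)⁻¹) ?_ (fun τ hτ => ?_)
      fun σ hσ => ?_
    · refine Real.continuous_sqrt.continuousOn.mul (Gc.comp_continuousOn ?_)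
      exact Real.continuous_sqrt.continuousOn.inv₀ fun τ hτ => (Real.sqrt_pos.2 hτ).ne'
    · rw [G1 _ (by positivity) (inv_le_one_of_one_le₀ (Real.one_le_sqrt.2 hτ)), mul_zero]
    · have hs : 0 < √σ := Real.sqrt_pos.2 hσ
      have h1 := Measure.integral_comp_mul_left
        (fun t : ℝ => √(σ + t ^ 2) * G (√(σ + t ^ 2))⁻¹) (√σ)
      have e : ∀ τ : ℝ, √(σ + (√σ * τ) ^ 2) * G (√(σ + (√σ * τ) ^ 2))⁻¹ =
          √σ * (√(1 + τ ^ 2) * G ((√σ)⁻¹ / √(1 + τ ^ 2))) := fun τ => by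
        have : √(σ + (√σ * τ) ^ 2) = √σ * √(1 + τ ^ 2) := by
          rw [← Real.sqrt_mul hσ.le, mul_pow, Real.sq_sqrt hσ.le, mul_add, mul_one]
        rw [this, mul_inv, mul_assoc, div_eq_mul_inv]
      simp only [e, integral_const_mul, hGint _ (inv_pos.2 hs), mul_zero] at h1
      rw [eq_comm, smul_eq_zero, abs_eq_zero, inv_eq_zero] at h1
      exact h1.resolve_left hs.ne'
  have hG0 : ∀ a, 0 < a → G a = 0 := fun a ha => by
    have := hN ((a⁻¹) ^ 2) (by positivity)
    rw [Real.sqrt_sq (by positivity), inv_inv] at this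
    exact (mul_eq_zero.1 this).resolve_left (by positivity)
  have hl := ((hψ.tendsto_spikeDiff_div h2 p (ι k₁)).const_mul (c ^ 2)).add
    ((hψ.tendsto_spikeDiff_div h2 p (ι k₂)).const_mul (s ^ 2))
  refine tendsto_nhds_unique (hψ.tendsto_spikeDiff_div h2 p (ι k)) (hl.congr fun n => ?_)
  have := hG0 ((n : ℝ) + 1) (by positivity)
  simp only [hG, hγ] at this
  rw [← mul_div_assoc, ← mul_div_assoc, ← add_div]
  congr 1
  linarith

end Rotation

section IteratedDifference

variable {V : Type*} [NormedAddCommGroup V] [InnerProductSpace ℝ V] [FiniteDimensional ℝ V]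

instance : LeftCommutative (diffOp : V → (ConvexBody V → ℝ) → ConvexBody V → ℝ) :=
  ⟨fun v w ψ => diffOp_comm v w ψ⟩

variable {ι : Type*}

/-- The iterated difference of `ψ` in the directions `w i`, `i ∈ s`. -/
def iterD (w : ι → V) (s : Finset ι) (ψ : ConvexBody V → ℝ) : ConvexBody V → ℝ :=
  (s.val.map w).foldr diffOp ψ

variable {w : ι → V} {s : Finset ι} {ψ : ConvexBody V → ℝ}

theorem iterD_empty : iterD w ∅ ψ = ψ := rfl

theorem iterD_cons {i : ι} (h : i ∉ s) :
    iterD w (Finset.cons i s h) ψ = diffOp (w i) (iterD w s ψ) := by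
  rw [iterD, Finset.cons_val, Multiset.map_cons, Multiset.foldr_cons, iterD]

theorem iterD_insert [DecidableEq ι] {i : ι} (h : i ∉ s) :
    iterD w (insert i s) ψ = diffOp (w i) (iterD w s ψ) := by
  rw [← Finset.cons_eq_insert i s h, iterD_cons]

theorem iterD_congr {w' : ι → V} (h : ∀ i ∈ s, w i = w' i) : iterD w s ψ = iterD w' s ψ := by
  rw [iterD, iterD, Multiset.map_congr rfl h]

theorem CVal.iterD (hψ : CVal ψ) (w : ι → V) (s : Finset ι) : CVal (_root_.iterD w s ψ) := by
  induction s using Finset.cons_induction with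
  | empty => exact hψ
  | cons i s hi ih => rw [iterD_cons]; exact ih.diffOp _

theorem CVal.homog_iterD (hψ : CVal ψ) {r : ℕ} (w : ι → V) (s : Finset ι)
    (h : Homog (r + s.card) ψ) : Homog r (_root_.iterD w s ψ) := by
  induction s using Finset.cons_induction generalizing r with
  | empty => exact h
  | cons i s hi ih =>
    rw [iterD_cons]
    refine (hψ.iterD w s).homog_diffOp (ih ?_) _
    rwa [Finset.card_cons, ← add_assoc, add_right_comm] at h

theorem iterD_diffOp (w : ι → V) (s : Finset ι) (v : V) :
    iterD w s (diffOp v ψ) = diffOp v (iterD w s ψ) := by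
  induction s using Finset.cons_induction with
  | empty => rfl
  | cons i s hi ih => rw [iterD_cons, iterD_cons, ih, diffOp_comm]

theorem CVal.iterD_smul (hψ : CVal ψ) (c : ι → ℝ) (w : ι → V) (s : Finset ι) (K : ConvexBody V) :
    _root_.iterD (fun i => c i • w i) s ψ K = (∏ i ∈ s, |c i|) * _root_.iterD w s ψ K := by
  induction s using Finset.cons_induction generalizing K with
  | empty => simp [iterD_empty]
  | cons i s hi ih =>
    rw [iterD_cons, iterD_cons, (hψ.iterD _ s).diffOp_smul, Finset.prod_cons, mul_assoc]
    congr 1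
    rw [_root_.diffOp, ih, ih, ← mul_sub, _root_.diffOp]

theorem iterD_comp_equiv {κ : Type*} [Fintype ι] [Fintype κ] (e : κ ≃ ι) (w : ι → V) :
    iterD (w ∘ e) Finset.univ ψ = iterD w Finset.univ ψ := by
  rw [iterD, iterD, ← Multiset.map_map, Multiset.map_univ_val_equiv]

theorem iterD_option [Fintype ι] (w : Option ι → V) :
    iterD w Finset.univ ψ = diffOp (w none) (iterD (fun i => w (some i)) Finset.univ ψ) := by
  rw [iterD, univ_option, Finset.insertNone, iterD]
  simp

/-- Iterated differences are multiplied by `|det A|` under a linear substitution `A`. -/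
theorem CVal.iterD_matrix [Fintype ι] [DecidableEq ι] (hψ : CVal ψ) (A : Matrix ι ι ℝ)
    (w : ι → V) (K : ConvexBody V) :
    _root_.iterD (fun i => ∑ j, A i j • w j) Finset.univ ψ K =
      |A.det| * _root_.iterD w Finset.univ ψ K := by
  revert w
  refine Matrix.diagonal_transvection_induction
    (fun A => ∀ w : ι → V, _root_.iterD (fun i => ∑ j, A i j • w j) Finset.univ ψ K =
      |A.det| * _root_.iterD w Finset.univ ψ K) A (fun D _ w => ?_) (fun t w => ?_)
    fun A B hA hB w => ?_
  · rw [Matrix.det_diagonal, Finset.abs_prod, ← hψ.iterD_smul D w Finset.univ K]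
    refine congrFun (iterD_congr fun i _ => ?_) K
    simp [Matrix.diagonal_apply]
  · obtain ⟨i, j, hij, c⟩ := t
    rw [Matrix.TransvectionStruct.det, abs_one, one_mul]
    have h1 : ∀ k, ∑ l, (Matrix.TransvectionStruct.toMatrix ⟨i, j, hij, c⟩) k l • w l =
        if k = i then w i + c • w j else w k := fun k => by
      simp only [Matrix.TransvectionStruct.toMatrix_mk, Matrix.transvection, Matrix.add_apply,
        add_smul, Finset.sum_add_distrib, Matrix.one_apply, ite_smul, one_smul, zero_smul,
        Finset.sum_ite_eq, Finset.mem_univ, if_true, Matrix.single_apply]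
      by_cases hk : k = i
      · subst hk
        simp
      · simp [hk, Ne.symm hk]
    simp only [h1]
    set r : Finset ι := (Finset.univ.erase i).erase j with hr
    have hj : j ∉ r := Finset.notMem_erase _ _
    have hi : i ∉ insert j r := by simp [hr, hij]
    have hu : (Finset.univ : Finset ι) = insert i (insert j r) := by
      rw [hr, Finset.insert_erase (by simp [Ne.symm hij]), Finset.insert_erase (by simp)]
    have hE : ∀ φ : ConvexBody V → ℝ, CVal φ → _root_.diffOp (w i + c • w j)
        (_root_.diffOp (w j) φ) = _root_.diffOp (w i) (_root_.diffOp (w j) φ) :=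
      fun φ hφ => hφ.diffOp_shear _ _ _
    have hr' : _root_.iterD (fun k => if k = i then w i + c • w j else w k) r ψ =
        _root_.iterD w r ψ := iterD_congr fun k hk => if_neg (by
      rintro rfl
      exact hi (Finset.mem_insert_of_mem hk))
    rw [hu, iterD_insert hi, iterD_insert hj, iterD_insert hi, iterD_insert hj, if_pos rfl,
      if_neg (Ne.symm hij), hr', hE _ (hψ.iterD _ _)]
  · rw [Matrix.det_mul, abs_mul, mul_assoc, ← hB, ← hA]
    refine congrFun (iterD_congr fun i _ => ?_) K
    simp only [Matrix.mul_apply, Finset.sum_smul, Finset.smul_sum, smul_smul]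
    exact Finset.sum_comm

theorem CVal.iterD_eq_zero_of_span [Fintype ι] (hψ : CVal ψ) {b w : ι → V}
    (hw : ∀ i, w i ∈ Submodule.span ℝ (Set.range b)) {K : ConvexBody V}
    (h : _root_.iterD b Finset.univ ψ K = 0) : _root_.iterD w Finset.univ ψ K = 0 := by
  classical
  choose A hA using fun i => (Submodule.mem_span_range_iff_exists_fun ℝ).1 (hw i)
  have := hψ.iterD_matrix (Matrix.of A) b K
  rw [h, mul_zero] at this
  rw [← this]
  exact congrFun (iterD_congr fun i _ => (hA i).symm) K

/-- All top-degree iterated differences of `ψ` along the subspace `E` vanish. -/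
def KilledBy (ψ : ConvexBody V → ℝ) (E : Submodule ℝ V) : Prop :=
  ∀ (ι : Type) [Fintype ι] (w : ι → V), Fintype.card ι = Module.finrank ℝ E →
    (∀ i, w i ∈ E) → iterD w Finset.univ ψ 0 = 0

theorem finrank_inf_orthogonal_singleton {E : Submodule ℝ V} {v : V} (hv : v ∈ E) (hv0 : v ≠ 0) :
    Module.finrank ℝ (E ⊓ (Submodule.span ℝ {v})ᗮ : Submodule ℝ V) + 1 = Module.finrank ℝ E := by
  have h1 : Submodule.span ℝ {v} ≤ E := by simpa using hv
  have := Submodule.finrank_add_inf_finrank_orthogonal h1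
  rw [finrank_span_singleton hv0] at this
  rw [← this, inf_comm]
  ring

theorem CVal.killedBy_of_diffOp (hψ : CVal ψ) {E : Submodule ℝ V} {v : V} (hv : v ∈ E)
    (hv0 : v ≠ 0) (h : KilledBy (_root_.diffOp v ψ) (E ⊓ (Submodule.span ℝ {v})ᗮ)) :
    KilledBy ψ E := by
  intro ι _ w hc hw
  set E' : Submodule ℝ V := E ⊓ (Submodule.span ℝ {v})ᗮ with hE'
  let b := Module.finBasis ℝ E'
  have hcard : Fintype.card (Option (Fin (Module.finrank ℝ E'))) = Fintype.card ι := by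
    rw [Fintype.card_option, Fintype.card_fin, hc, finrank_inf_orthogonal_singleton hv hv0]
  let e := Fintype.equivOfCardEq hcard
  let B : Option (Fin (Module.finrank ℝ E')) → V := fun o => o.elim v fun i => b i
  rw [← iterD_comp_equiv e w]
  have hvv : inner ℝ v v ≠ 0 := inner_self_ne_zero.2 hv0
  refine hψ.iterD_eq_zero_of_span (b := B) (fun o => ?_) ?_
  · set x := (w ∘ e) o with hx
    have hxE : x ∈ E := hw _
    set t := inner ℝ v x / inner ℝ v v with ht
    have h1 : x - t • v ∈ E' := by
      refine Submodule.mem_inf.2 ⟨E.sub_mem hxE (E.smul_mem _ hv),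
        Submodule.mem_orthogonal_singleton_iff_inner_right.2 ?_⟩
      rw [inner_sub_right, real_inner_smul_right, ht, div_mul_cancel₀ _ hvv, sub_self]
    have h2 : x - t • v ∈ Submodule.span ℝ (Set.range B) := by
      have h3 := b.sum_repr ⟨x - t • v, h1⟩
      have h4 := congrArg (Subtype.val) h3
      simp only [AddSubmonoidClass.coe_finsetSum, SetLike.val_smul] at h4
      rw [← h4]
      exact Submodule.sum_mem _ fun i _ => Submodule.smul_mem _ _
        (Submodule.subset_span ⟨some i, rfl⟩)
    have h3 : t • v ∈ Submodule.span ℝ (Set.range B) :=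
      Submodule.smul_mem _ _ (Submodule.subset_span ⟨none, rfl⟩)
    simpa using Submodule.add_mem _ h2 h3
  · rw [iterD_option, ← iterD_diffOp]
    exact h _ _ (by simp) fun i => (b i).2

variable [MeasurableSpace V] [BorelSpace V]

theorem PresBy.diffOp_fixed {u : V ≃ₗᵢ[ℝ] V} (h : PresBy ψ u) {v : V} (hv : u v = v) :
    PresBy (_root_.diffOp v ψ) u := fun K => by
  have := h.diffOp v K
  rwa [hv] at this

theorem PresBy.iterD {u : V ≃ₗᵢ[ℝ] V} (h : PresBy ψ u) (hw : ∀ i ∈ s, u (w i) = w i) :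
    PresBy (_root_.iterD w s ψ) u := by
  induction s using Finset.cons_induction with
  | empty => exact h
  | cons i s hi ih =>
    rw [iterD_cons]
    exact (ih fun j hj => hw j (Finset.mem_cons_of_mem hj)).diffOp_fixed
      (hw i (Finset.mem_cons_self i s))

end IteratedDifference

section Unitary

variable {n : ℕ}

theorem inner_eq_re (x y : Ecl n) : inner ℝ x y = (inner ℂ x y).re := by
  simp [PiLp.inner_apply, Complex.inner]

theorem inner_I_smul_I_smul (x y : Ecl n) :
    inner ℝ (Complex.I • x) (Complex.I • y) = inner ℝ x y := by
  rw [inner_eq_re, inner_eq_re, inner_smul_left, inner_smul_right, ← mul_assoc]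
  simp

theorem inner_I_smul_left (x y : Ecl n) :
    inner ℝ (Complex.I • x) y = -inner ℝ x (Complex.I • y) := by
  rw [inner_eq_re, inner_eq_re, inner_smul_left, inner_smul_right]
  simp

theorem inner_I_smul_self (x : Ecl n) : inner ℝ (Complex.I • x) x = 0 := by
  have h1 := inner_I_smul_left x x
  rw [real_inner_comm] at h1
  rw [real_inner_comm]
  linarith

theorem I_smul_I_smul (x : Ecl n) : Complex.I • Complex.I • x = -x := by
  rw [smul_smul, Complex.I_mul_I, neg_one_smul]

theorem inner_complex_eq (x y : Ecl n) :
    inner ℂ x y = (inner ℝ x y : ℝ) + (inner ℝ (Complex.I • x) y : ℝ) * Complex.I := by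
  apply Complex.ext
  · simp [inner_eq_re]
  · simp [inner_eq_re]

theorem inner_complex_eq_zero {x y : Ecl n} (h1 : inner ℝ x y = 0)
    (h2 : inner ℝ (Complex.I • x) y = 0) : inner ℂ x y = 0 := by
  rw [inner_complex_eq, h1, h2]
  simp

/-- A complex linear isometry, regarded as a real linear isometry. -/
def realIso (e : Ecl n ≃ₗᵢ[ℂ] Ecl n) : Ecl n ≃ₗᵢ[ℝ] Ecl n where
  toLinearEquiv := e.toLinearEquiv.restrictScalars ℝ
  norm_map' := e.norm_map

theorem realIso_apply (e : Ecl n ≃ₗᵢ[ℂ] Ecl n) (x : Ecl n) : realIso e x = e x := rfl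

theorem exists_unitary_matrix (e : Ecl n ≃ₗᵢ[ℂ] Ecl n) :
    ∃ A ∈ Matrix.unitaryGroup (Fin n) ℂ, ∀ x, Matrix.toEuclideanLin A x = e x := by
  set f : Ecl n →ₗ[ℂ] Ecl n := e.toLinearEquiv.toLinearMap with hf
  refine ⟨Matrix.toEuclideanLin.symm f, ?_, fun x => by rw [LinearEquiv.apply_symm_apply]; rfl⟩
  set A := Matrix.toEuclideanLin.symm f with hA
  have hAf : Matrix.toEuclideanLin A = f := LinearEquiv.apply_symm_apply _ _
  rw [Matrix.mem_unitaryGroup_iff', Matrix.star_eq_conjTranspose]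
  apply Matrix.toEuclideanLin.injective
  have h1 : Matrix.toEuclideanLin (A.conjTranspose * A) =
      Matrix.toEuclideanLin A.conjTranspose ∘ₗ Matrix.toEuclideanLin A := by
    ext1 x
    simp [Matrix.toLpLin_apply, Matrix.mulVec_mulVec]
  rw [h1, Matrix.toEuclideanLin_conjTranspose_eq_adjoint, hAf]
  ext1 x
  refine ext_inner_right ℂ fun y => ?_
  rw [LinearMap.comp_apply, LinearMap.adjoint_inner_left]
  simp only [Matrix.toLpLin_apply, Matrix.one_mulVec]
  exact e.inner_map_map x y

theorem UInv.presBy {μ : ConvexBody (Ecl n) → ℝ} (h : UInv μ) (e : Ecl n ≃ₗᵢ[ℂ] Ecl n) :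
    PresBy μ (realIso e) := by
  obtain ⟨A, hA, hAe⟩ := exists_unitary_matrix e
  intro K
  rw [← h A hA K]
  congr 1
  refine ConvexBody.ext ?_
  change _ '' _ = _ '' _
  exact Set.image_congr fun x _ => (hAe x).symm

/-- A unitary map acting by a given `2 × 2` unitary matrix on the span of two orthonormal vectors
and trivially on their complement. -/
theorem exists_rotation {p e : Ecl n} (hp : inner ℂ p p = 1) (he : inner ℂ e e = 1)
    (hpe : inner ℂ p e = 0) {a b c d : ℂ}
    (h1 : star a * a + star c * c = 1) (h2 : star b * b + star d * d = 1)
    (h3 : star a * b + star c * d = 0) :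
    ∃ u : Ecl n ≃ₗᵢ[ℂ] Ecl n, u p = a • p + c • e ∧ u e = b • p + d • e ∧
      ∀ x, inner ℂ p x = 0 → inner ℂ e x = 0 → u x = x := by
  have hep : inner ℂ e p = 0 := by rw [← inner_conj_symm, hpe, map_zero]
  let f : Ecl n →ₗ[ℂ] Ecl n :=
    { toFun := fun x => x + ((a - 1) * inner ℂ p x + b * inner ℂ e x) • p +
        (c * inner ℂ p x + (d - 1) * inner ℂ e x) • e
      map_add' := fun x y => by
        simp only [inner_add_right]
        module
      map_smul' := fun t x => by
        simp only [inner_smul_right, RingHom.id_apply]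
        module }
  have hf : ∀ x, f x = x + ((a - 1) * inner ℂ p x + b * inner ℂ e x) • p +
        (c * inner ℂ p x + (d - 1) * inner ℂ e x) • e := fun x => rfl
  have h4 : star b * a + star d * c = 0 := by
    have := congrArg star h3
    simpa [mul_comm] using this
  have hin : ∀ x, inner ℂ (f x) (f x) = inner ℂ x x := fun x => by
    rw [hf]
    simp only [inner_add_left, inner_add_right, inner_smul_left, inner_smul_right, hp, he, hpe,
      hep]
    rw [← inner_conj_symm x p, ← inner_conj_symm x e]
    set X := inner ℂ p x
    set Y := inner ℂ e x
    simp only [← starRingEnd_apply] at h1 h2 h3 h4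
    simp only [map_add, map_sub, map_mul, map_one]
    linear_combination (starRingEnd ℂ) X * X * h1 + (starRingEnd ℂ) Y * Y * h2 +
      (starRingEnd ℂ) X * Y * h3 + (starRingEnd ℂ) Y * X * h4
  have hnorm : ∀ x, ‖f x‖ = ‖x‖ := fun x => by
    have := hin x
    rw [inner_self_eq_norm_sq_to_K, inner_self_eq_norm_sq_to_K] at this
    norm_cast at this
    exact (sq_eq_sq₀ (norm_nonneg _) (norm_nonneg _)).1 (by exact_mod_cast this)
  let u : Ecl n →ₗᵢ[ℂ] Ecl n := ⟨f, hnorm⟩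
  refine ⟨u.toLinearIsometryEquiv rfl, ?_, ?_, fun x hx hx' => ?_⟩
  · change f p = _
    rw [hf, hp, hep]
    module
  · change f e = _
    rw [hf, he, hpe]
    module
  · change f x = _
    rw [hf, hx, hx']
    simp

end Unitary

section HermitianRotation

variable {n : ℕ} {ψ : ConvexBody (Ecl n) → ℝ}

/-- A second mixed difference in the directions `p` and `c • I • p + s • e` for a Hermitian
orthonormal pair `p, e`. -/
theorem CVal.diffOp_kaehler (hψ : CVal ψ) (h2 : Homog 2 ψ) {p e : Ecl n}
    (hp : inner ℂ p p = 1) (he : inner ℂ e e = 1) (hpe : inner ℂ p e = 0)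
    (hinv : ∀ u : Ecl n ≃ₗᵢ[ℂ] Ecl n,
      (∀ x, inner ℂ p x = 0 → inner ℂ e x = 0 → u x = x) → PresBy ψ (realIso u))
    {c s : ℝ} (hcs : c ^ 2 + s ^ 2 = 1) :
    _root_.diffOp p (_root_.diffOp (c • Complex.I • p + s • e) ψ) 0 =
      c ^ 2 * _root_.diffOp p (_root_.diffOp (Complex.I • p) ψ) 0 +
        s ^ 2 * _root_.diffOp p (_root_.diffOp e ψ) 0 := by
  have hnp : ‖p‖ = 1 := by
    have := inner_self_eq_norm_sq_to_K (𝕜 := ℂ) p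
    rw [hp] at this
    have h1 : ‖p‖ ^ 2 = 1 := by apply Complex.ofReal_injective; push_cast; exact this.symm
    nlinarith [norm_nonneg p]
  set U : Submodule ℝ (Ecl n) := (Submodule.span ℝ {p})ᗮ with hU
  have hS : OrthoSplit p U.subtypeL U.orthogonalProjectionOnto :=
    { norm_p := hnp
      adj := fun k x => by
        rw [Submodule.subtypeL_apply]
        exact (Submodule.inner_orthogonalProjectionOnto_eq_of_mem_left k x).symm
      norm_ι := fun k => rfl
      norm_sq := fun x => by
        have h1 := Submodule.norm_sq_eq_add_norm_sq_projection x U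
        have h3 : Uᗮ = Submodule.span ℝ {p} := Submodule.orthogonal_orthogonal _
        have h4 : ‖Uᗮ.orthogonalProjectionOnto x‖ ^ 2 = inner ℝ x p ^ 2 := by
          have h5 : ((Uᗮ.orthogonalProjectionOnto x : Uᗮ) : Ecl n) = (inner ℝ p x) • p := by
            have h6 : ∀ A B : Submodule ℝ (Ecl n), A = B → A.starProjection x = B.starProjection x := by
              rintro A _ rfl
              rfl
            rw [← Submodule.starProjection_unit_singleton ℝ hnp, ← h6 _ _ h3,
              Submodule.starProjection_apply]
          rw [← Submodule.norm_coe, h5, norm_smul, hnp, mul_one, Real.norm_eq_abs, sq_abs,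
            real_inner_comm]
        rw [h1, h4] }
  have hIpU : Complex.I • p ∈ U := by
    rw [hU, Submodule.mem_orthogonal_singleton_iff_inner_right, real_inner_comm]
    exact inner_I_smul_self p
  have heU : e ∈ U := by
    rw [hU, Submodule.mem_orthogonal_singleton_iff_inner_right, inner_eq_re, hpe, Complex.zero_re]
  have := hS.diffOp_diffOp_eq hψ h2 (k₁ := ⟨_, hIpU⟩) (k₂ := ⟨_, heU⟩) ?_ ?_ hcs
  · simpa using this
  · intro c s hcs τ
    set r : ℝ := √(1 + τ ^ 2) with hr
    have hr0 : r ≠ 0 := (Real.sqrt_pos.2 (by positivity)).ne'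
    have hr2 : r ^ 2 = 1 + τ ^ 2 := Real.sq_sqrt (by positivity)
    have hrC : (r : ℂ) ≠ 0 := by exact_mod_cast hr0
    have hr2C : (r : ℂ) ^ 2 = 1 + τ ^ 2 := by exact_mod_cast hr2
    have hcsC : (c : ℂ) ^ 2 + s ^ 2 = 1 := by exact_mod_cast hcs
    have hI : Complex.I ^ 2 = -1 := Complex.I_sq
    obtain ⟨u, hu1, hu2, hu3⟩ := exists_rotation hp he hpe
      (a := (1 - Complex.I * τ * c) / r) (b := τ * s / r) (c := -(τ * s) / r)
      (d := (1 + Complex.I * τ * c) / r)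
      (by
        simp
        field_simp
        rw [hr2C]
        linear_combination (τ : ℂ) ^ 2 * hcsC - (τ : ℂ) ^ 2 * c ^ 2 * hI)
      (by
        simp
        field_simp
        rw [hr2C]
        linear_combination (τ : ℂ) ^ 2 * hcsC - (τ : ℂ) ^ 2 * c ^ 2 * hI)
      (by
        simp
        field_simp
        ring)
    refine ⟨realIso u, hinv u hu3, ?_, ?_⟩
    · rw [realIso_apply]
      simp only [map_add, map_smul, Submodule.subtypeL_apply]
      rw [← Complex.coe_smul, ← Complex.coe_smul c, ← Complex.coe_smul s, ← Complex.coe_smul τ,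
        map_smul, map_smul, map_smul, hu1, hu2]
      simp only [smul_add, smul_smul, ← add_assoc]
      match_scalars
      · field_simp
        linear_combination (τ : ℂ) * hcsC - (τ : ℂ) * c ^ 2 * hI
      · field_simp
        ring
    · rw [realIso_apply]
      simp only [map_add, map_smul, Submodule.subtypeL_apply]
      rw [← Complex.coe_smul, ← Complex.coe_smul c, ← Complex.coe_smul s, ← Complex.coe_smul τ,
        hu1]
      match_scalars
      · field_simp
        try ring
      · field_simp
  · obtain ⟨u, hu1, hu2, hu3⟩ := exists_rotation hp he hpe (a := 1) (b := 0) (c := 0) (d := -1)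
      (by simp) (by simp) (by simp)
    refine ⟨realIso u, hinv u hu3, ?_, ?_, ?_⟩
    · rw [realIso_apply, hu1]; simp
    · rw [realIso_apply, Submodule.subtypeL_apply, map_smul, hu1]; simp
    · rw [realIso_apply, Submodule.subtypeL_apply, hu2]; simp

/-- An eigenvector of the restricted Kähler form of a subspace. -/
theorem exists_kaehler_vector {E : Submodule ℝ (Ecl n)} (hE : 0 < Module.finrank ℝ E) :
    ∃ p ∈ E, ∃ t ∈ E, ‖p‖ = 1 ∧ (∀ y ∈ E, inner ℝ (Complex.I • p) y = inner ℝ t y) ∧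
      ∀ y ∈ E, inner ℝ (Complex.I • t) y = -‖t‖ ^ 2 * inner ℝ p y := by
  have : Nontrivial E := Module.finrank_pos_iff.1 hE
  let J : Ecl n →ₗ[ℝ] Ecl n := (LinearMap.lsmul ℂ (Ecl n) Complex.I).restrictScalars ℝ
  let T : E →ₗ[ℝ] E := (E.orthogonalProjectionOnto : Ecl n →ₗ[ℝ] E) ∘ₗ J ∘ₗ E.subtype
  have hT : ∀ x y : E, inner ℝ (T x : Ecl n) y = inner ℝ (Complex.I • (x : Ecl n)) (y : Ecl n) :=
    fun x y => Submodule.inner_orthogonalProjectionOnto_eq_of_mem_right y _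
  let S : E →ₗ[ℝ] E := -(T ∘ₗ T)
  have hST : ∀ x y : E, inner ℝ (S x) y = inner ℝ (T x) (T y) := fun x y => by
    change inner ℝ (-(T (T x)) : Ecl n) y = inner ℝ (T x : Ecl n) (T y)
    rw [inner_neg_left, hT, inner_I_smul_left, neg_neg, real_inner_comm, ← hT, real_inner_comm]
  have hS : LinearMap.IsSymmetric (𝕜 := ℝ) (E := E) S := fun x y =>
    (hST x y).trans ((real_inner_comm _ _).trans ((hST y x).symm.trans (real_inner_comm _ _)))
  have hex : ∃ μ, Module.End.HasEigenvalue S μ := by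
    by_contra hno
    push Not at hno
    have := hS.subsingleton_of_no_eigenvalue_finiteDimensional
      (fun μ => not_not.1 fun h => hno μ h)
    exact not_subsingleton E this
  obtain ⟨μ, hμ⟩ := hex
  obtain ⟨v, hv⟩ := hμ.exists_hasEigenvector
  have hv0 : ‖v‖ ≠ 0 := norm_ne_zero_iff.2 hv.2
  have hv1 : S v = μ • v := hv.apply_eq_smul
  set p : E := ‖v‖⁻¹ • v with hp
  have hp1 : ‖p‖ = 1 := by rw [hp, norm_smul, norm_inv, norm_norm, inv_mul_cancel₀ hv0]
  have hpS : ∀ y : E, inner ℝ (T p) (T y) = μ * inner ℝ p y := fun y => by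
    have h1 : S p = μ • p := by rw [hp, map_smul, hv1, smul_comm]
    rw [← hST, h1]
    exact real_inner_smul_left p y μ
  have hμ2 : μ = ‖T p‖ ^ 2 := by
    rw [← real_inner_self_eq_norm_sq, hpS, real_inner_self_eq_norm_sq, hp1]
    simp
  refine ⟨p, p.2, T p, (T p).2, hp1, fun y hy => (hT p ⟨y, hy⟩).symm, fun y hy => ?_⟩
  have h1 := hpS ⟨y, hy⟩
  have h2 := hT ⟨y, hy⟩ (T p)
  rw [inner_I_smul_left, real_inner_comm, ← h2, ← Submodule.coe_inner, real_inner_comm, h1, hμ2]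
  simp

end HermitianRotation

section HermitianFrame

variable {n : ℕ} {μ : ConvexBody (Ecl n) → ℝ}

theorem finrank_sup_span_singleton {V : Type*} [NormedAddCommGroup V] [InnerProductSpace ℝ V]
    [FiniteDimensional ℝ V] {W : Submodule ℝ V} {p : V} (h : ∀ x ∈ W, inner ℝ x p = 0)
    (hp : p ≠ 0) :
    Module.finrank ℝ (W ⊔ Submodule.span ℝ {p} : Submodule ℝ V) = Module.finrank ℝ W + 1 := by
  have h1 := Submodule.finrank_sup_add_finrank_inf_eq W (Submodule.span ℝ {p})
  have h2 : W ⊓ Submodule.span ℝ {p} = ⊥ := by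
    rw [← disjoint_iff]
    refine Submodule.IsOrtho.disjoint ?_
    rw [Submodule.isOrtho_iff_inner_eq]
    intro x hx y hy
    obtain ⟨c, rfl⟩ := Submodule.mem_span_singleton.1 hy
    rw [inner_smul_right, h x hx, mul_zero]
  rw [h2, finrank_bot, finrank_span_singleton hp] at h1
  exact h1

theorem inner_real_eq_zero {x y : Ecl n} (h : inner ℂ x y = 0) : inner ℝ x y = 0 := by
  rw [inner_eq_re, h, Complex.zero_re]

/-- A list of vectors lying in a subspace `F ⊕ W` of type `(length, a)`. -/
structure HermFrame (G : List (Ecl n)) (F W : Submodule ℝ (Ecl n)) (a : ℕ) : Prop where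
  complex : IsComplexSubspace F
  isotropic : IsIsotropicSubspace W
  ortho : ∀ v ∈ F, ∀ w ∈ W, inner ℝ v w = 0
  finrank_left : Module.finrank ℝ F = 2 * a
  finrank_add : 2 * a + Module.finrank ℝ W = G.length
  mem : ∀ g ∈ G, g ∈ F ⊔ W

theorem HermFrame.nil : HermFrame (n := n) [] ⊥ ⊥ 0 where
  complex := fun v hv => by rw [Submodule.mem_bot] at *; rw [hv, smul_zero]
  isotropic := fun v hv w hw => by rw [(Submodule.mem_bot ℝ).1 hw, inner_zero_right]
  ortho := fun v hv w hw => by rw [(Submodule.mem_bot ℝ).1 hw, inner_zero_right]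
  finrank_left := by simp
  finrank_add := by simp
  mem := by simp

variable {G : List (Ecl n)} {F W : Submodule ℝ (Ecl n)} {a : ℕ}

theorem HermFrame.single (h : HermFrame G F W a) {p : Ecl n} (hp : p ≠ 0)
    (hF : ∀ x ∈ F, inner ℂ x p = 0) (hW : ∀ x ∈ W, inner ℂ x p = 0) :
    HermFrame (p :: G) F (W ⊔ Submodule.span ℝ {p}) a where
  complex := h.complex
  isotropic := by
    have hW' : ∀ x ∈ W, inner ℝ (Complex.I • x) p = 0 := fun x hx =>
      inner_real_eq_zero (by rw [inner_smul_left, hW x hx, mul_zero])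
    intro v hv w hw
    obtain ⟨v₁, hv₁, v₂, hv₂, rfl⟩ := Submodule.mem_sup.1 hv
    obtain ⟨w₁, hw₁, w₂, hw₂, rfl⟩ := Submodule.mem_sup.1 hw
    obtain ⟨c, rfl⟩ := Submodule.mem_span_singleton.1 hv₂
    obtain ⟨d, rfl⟩ := Submodule.mem_span_singleton.1 hw₂
    rw [smul_add, smul_comm Complex.I c, inner_add_left, inner_add_right, inner_add_right,
      real_inner_smul_left, real_inner_smul_left, real_inner_smul_right, real_inner_smul_right,
      h.isotropic _ hv₁ _ hw₁, hW' _ hv₁, inner_I_smul_self, inner_I_smul_left, real_inner_comm,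
      hW' _ hw₁]
    simp
  ortho := fun v hv w hw => by
    obtain ⟨w₁, hw₁, w₂, hw₂, rfl⟩ := Submodule.mem_sup.1 hw
    obtain ⟨d, rfl⟩ := Submodule.mem_span_singleton.1 hw₂
    rw [inner_add_right, real_inner_smul_right, h.ortho _ hv _ hw₁, inner_real_eq_zero (hF _ hv)]
    simp
  finrank_left := h.finrank_left
  finrank_add := by
    rw [finrank_sup_span_singleton (fun x hx => inner_real_eq_zero (hW x hx)) hp, ← add_assoc,
      h.finrank_add, List.length_cons]
  mem := fun g hg => by
    rw [← sup_assoc]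
    rcases List.mem_cons.1 hg with rfl | hg
    · exact Submodule.mem_sup_right (Submodule.mem_span_singleton_self _)
    · exact Submodule.mem_sup_left (h.mem g hg)

theorem HermFrame.pair (h : HermFrame G F W a) {p : Ecl n} (hp : p ≠ 0)
    (hF : ∀ x ∈ F, inner ℂ x p = 0) (hW : ∀ x ∈ W, inner ℂ x p = 0) :
    HermFrame (Complex.I • p :: p :: G)
      (F ⊔ Submodule.span ℝ {p} ⊔ Submodule.span ℝ {Complex.I • p}) W (a + 1) where
  complex := fun v hv => by
    obtain ⟨v', hv', v₃, hv₃, rfl⟩ := Submodule.mem_sup.1 hv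
    obtain ⟨v₁, hv₁, v₂, hv₂, rfl⟩ := Submodule.mem_sup.1 hv'
    obtain ⟨c, rfl⟩ := Submodule.mem_span_singleton.1 hv₂
    obtain ⟨d, rfl⟩ := Submodule.mem_span_singleton.1 hv₃
    rw [smul_add, smul_add, smul_comm Complex.I c, smul_comm Complex.I d, I_smul_I_smul]
    refine add_mem (add_mem ?_ ?_) ?_
    · exact Submodule.mem_sup_left (Submodule.mem_sup_left (h.complex _ hv₁))
    · exact Submodule.mem_sup_right (Submodule.smul_mem _ _ (Submodule.mem_span_singleton_self _))
    · exact Submodule.mem_sup_left (Submodule.mem_sup_right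
        (Submodule.smul_mem _ _ (neg_mem (Submodule.mem_span_singleton_self _))))
  isotropic := h.isotropic
  ortho := fun v hv w hw => by
    obtain ⟨v', hv', v₃, hv₃, rfl⟩ := Submodule.mem_sup.1 hv
    obtain ⟨v₁, hv₁, v₂, hv₂, rfl⟩ := Submodule.mem_sup.1 hv'
    obtain ⟨c, rfl⟩ := Submodule.mem_span_singleton.1 hv₂
    obtain ⟨d, rfl⟩ := Submodule.mem_span_singleton.1 hv₃
    have h1 : inner ℝ (Complex.I • p) w = 0 := by
      rw [real_inner_comm]
      exact inner_real_eq_zero (by rw [inner_smul_right, hW _ hw, mul_zero])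
    have h2 : inner ℝ p w = 0 := by
      rw [real_inner_comm]
      exact inner_real_eq_zero (hW _ hw)
    rw [inner_add_left, inner_add_left, h.ortho _ hv₁ _ hw, real_inner_smul_left,
      real_inner_smul_left, h1, h2]
    simp
  finrank_left := by
    rw [finrank_sup_span_singleton, finrank_sup_span_singleton _ hp, h.finrank_left]
    · ring
    · exact fun x hx => inner_real_eq_zero (hF x hx)
    · intro x hx
      obtain ⟨v₁, hv₁, v₂, hv₂, rfl⟩ := Submodule.mem_sup.1 hx
      obtain ⟨c, rfl⟩ := Submodule.mem_span_singleton.1 hv₂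
      rw [inner_add_left, real_inner_smul_left, inner_real_eq_zero (x := v₁), real_inner_comm,
        inner_I_smul_self]
      · simp
      · rw [inner_smul_right, hF _ hv₁, mul_zero]
    · exact smul_ne_zero Complex.I_ne_zero hp
  finrank_add := by
    rw [List.length_cons, List.length_cons, ← h.finrank_add]
    ring
  mem := fun g hg => by
    rcases List.mem_cons.1 hg with rfl | hg
    · exact Submodule.mem_sup_left
        (Submodule.mem_sup_right (Submodule.mem_span_singleton_self _))
    rcases List.mem_cons.1 hg with rfl | hg
    · exact Submodule.mem_sup_left (Submodule.mem_sup_left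
        (Submodule.mem_sup_right (Submodule.mem_span_singleton_self _)))
    · have h1 : F ⊔ W ≤ F ⊔ Submodule.span ℝ {p} ⊔ Submodule.span ℝ {Complex.I • p} ⊔ W :=
        sup_le_sup_right (le_sup_left.trans le_sup_left) _
      exact h1 (h.mem g hg)

theorem finrank_ecl : Module.finrank ℝ (Ecl n) = 2 * n := by
  rw [← Module.finrank_mul_finrank ℝ ℂ (Ecl n), Complex.finrank_real_complex,
    finrank_euclideanSpace_fin]

theorem HermFrame.finrank_sup (h : HermFrame G F W a) :
    Module.finrank ℝ (F ⊔ W : Submodule ℝ (Ecl n)) = G.length := by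
  have h1 := Submodule.finrank_sup_add_finrank_inf_eq F W
  have h2 : F ⊓ W = ⊥ := by
    rw [← disjoint_iff]
    exact Submodule.IsOrtho.disjoint (Submodule.isOrtho_iff_inner_eq.2 h.ortho)
  rw [h2, finrank_bot, h.finrank_left, h.finrank_add] at h1
  exact h1

theorem HermFrame.two_mul_finrank_le (h : HermFrame G F W a) :
    G.length + Module.finrank ℝ W ≤ 2 * n := by
  let J : Ecl n →ₗ[ℝ] Ecl n := (LinearMap.lsmul ℂ (Ecl n) Complex.I).restrictScalars ℝ
  have hJ : ∀ x, J x = Complex.I • x := fun x => rfl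
  have hJi : Function.Injective J := smul_right_injective _ Complex.I_ne_zero
  have h1 := Submodule.finrank_sup_add_finrank_inf_eq (F ⊔ W) (W.map J)
  have h2 : (F ⊔ W) ⊓ W.map J = ⊥ := by
    rw [← disjoint_iff]
    refine Submodule.IsOrtho.disjoint (Submodule.isOrtho_iff_inner_eq.2 fun x hx y hy => ?_)
    obtain ⟨v, hv, w, hw, rfl⟩ := Submodule.mem_sup.1 hx
    obtain ⟨z, hz, rfl⟩ := Submodule.mem_map.1 hy
    rw [hJ, ← neg_inj, ← inner_I_smul_left, smul_add, inner_add_left, h.isotropic _ hw _ hz,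
      h.ortho _ (h.complex _ hv) _ hz]
    simp
  rw [h2, finrank_bot, h.finrank_sup,
    ← (Submodule.equivMapOfInjective J hJi W).finrank_eq] at h1
  rw [← finrank_ecl, ← h1]
  exact Submodule.finrank_le _

theorem HermFrame.isTypeSubspace (h : HermFrame G F W a) : IsTypeSubspace G.length a (F ⊔ W) :=
  ⟨h.finrank_sup, F, W, h.complex, h.finrank_left, h.isotropic,
    by rw [← h.finrank_add, Nat.add_sub_cancel_left], h.ortho, rfl⟩

theorem foldr_diffOp_eq_zero {E : Submodule ℝ (Ecl n)}
    (h0 : ∀ K : ConvexBody (Ecl n), (K : Set (Ecl n)) ⊆ E → μ K = 0) (hG : ∀ g ∈ G, g ∈ E)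
    {K : ConvexBody (Ecl n)} (hK : (K : Set (Ecl n)) ⊆ E) : G.foldr diffOp μ K = 0 := by
  induction G generalizing K with
  | nil => exact h0 K hK
  | cons g G ih =>
    have ih' := fun {K} hK => ih (fun g hg => hG g (List.mem_cons_of_mem _ hg)) (K := K) hK
    rw [List.foldr_cons, diffOp, ih' hK, ih', sub_zero]
    intro x hx
    rw [ConvexBody.coe_add] at hx
    obtain ⟨y, hy, z, hz, rfl⟩ := hx
    refine E.add_mem (hK hy) ?_
    have hg : g ∈ E := hG g List.mem_cons_self
    exact E.convex.segment_subset (E.neg_mem hg) hg hz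

end HermitianFrame

section HermitianInduction

variable {n k : ℕ} {μ : ConvexBody (Ecl n) → ℝ}

theorem CVal.foldr (hμ : CVal μ) (G : List (Ecl n)) : CVal (G.foldr _root_.diffOp μ) := by
  induction G with
  | nil => exact hμ
  | cons g G ih => exact ih.diffOp g

theorem CVal.homog_foldr (hμ : CVal μ) : ∀ (G : List (Ecl n)) {r : ℕ}, Homog (r + G.length) μ →
    Homog r (G.foldr _root_.diffOp μ)
  | [], r, h => h
  | g :: G, r, h => by
    have h1 : Homog (r + 1) (G.foldr _root_.diffOp μ) := hμ.homog_foldr G (by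
      rwa [add_assoc, add_comm 1])
    exact (hμ.foldr G).homog_diffOp h1 g

theorem PresBy.foldr {u : Ecl n ≃ₗᵢ[ℝ] Ecl n} (h : PresBy μ u) {G : List (Ecl n)}
    (hG : ∀ g ∈ G, u g = g) : PresBy (G.foldr _root_.diffOp μ) u := by
  induction G with
  | nil => exact h
  | cons g G ih =>
    exact (ih fun x hx => hG x (List.mem_cons_of_mem _ hx)).diffOp_fixed (hG g List.mem_cons_self)

theorem inner_self_of_norm_eq_one {x : Ecl n} (h : ‖x‖ = 1) : inner ℂ x x = 1 := by
  rw [inner_self_eq_norm_sq_to_K, h]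
  simp

theorem killedBy_mixed {ψ : ConvexBody (Ecl n) → ℝ} (hψ : CVal ψ) {m : ℕ} (h : Homog (2 + m) ψ)
    {p e : Ecl n} (hp : inner ℂ p p = 1) (he : inner ℂ e e = 1) (hpe : inner ℂ p e = 0)
    (hinv : ∀ u : Ecl n ≃ₗᵢ[ℂ] Ecl n,
      (∀ x, inner ℂ p x = 0 → inner ℂ e x = 0 → u x = x) → PresBy ψ (realIso u))
    {E : Submodule ℝ (Ecl n)} (hE : Module.finrank ℝ E = m) (hEp : ∀ x ∈ E, inner ℂ p x = 0)
    (hEe : ∀ x ∈ E, inner ℂ e x = 0)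
    (h1 : KilledBy (diffOp (Complex.I • p) (diffOp p ψ)) E)
    (h2 : KilledBy (diffOp e (diffOp p ψ)) E) {c s : ℝ} (hcs : c ^ 2 + s ^ 2 = 1) :
    KilledBy (diffOp (c • Complex.I • p + s • e) (diffOp p ψ)) E := by
  intro ι _ w hc hw
  have h1' := h1 ι w hc hw
  have h2' := h2 ι w hc hw
  rw [iterD_diffOp, iterD_diffOp, diffOp_comm] at h1' h2' ⊢
  rw [(hψ.iterD w Finset.univ).diffOp_kaehler _ hp he hpe _ hcs, h1', h2', mul_zero, mul_zero,
    add_zero]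
  · exact hψ.homog_iterD w _ (by rwa [Finset.card_univ, hc, hE])
  · exact fun u hu => (hinv u hu).iterD fun i _ => hu _ (hEp _ (hw i)) (hEe _ (hw i))

theorem killedBy_of_frame (hμ : CVal μ) (hH : Homog k μ) (hU : UInv μ)
    (h0 : ∀ a, k - n ≤ a → a ≤ k / 2 → ∀ E : Submodule ℝ (Ecl n), IsTypeSubspace k a E →
      ∀ K : ConvexBody (Ecl n), (K : Set (Ecl n)) ⊆ E → μ K = 0) (m : ℕ) :
    ∀ (G : List (Ecl n)) (F W : Submodule ℝ (Ecl n)) (a : ℕ) (E : Submodule ℝ (Ecl n)),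
      HermFrame G F W a → Module.finrank ℝ E = m → G.length + m = k →
      (∀ x ∈ F, ∀ y ∈ E, inner ℂ x y = 0) → (∀ x ∈ W, ∀ y ∈ E, inner ℂ x y = 0) →
      KilledBy (G.foldr diffOp μ) E := by
  induction m using Nat.strong_induction_on with
  | _ m ih =>
  intro G F W a E hG hE hk hFE hWE
  have hψ := hμ.foldr G
  rcases Nat.eq_zero_or_pos m with rfl | hm
  · intro ι _ w hc hw
    have : IsEmpty ι := Fintype.card_eq_zero_iff.1 (hc.trans hE)
    rw [Finset.univ_eq_empty, iterD_empty]
    have hlen : G.length = k := by omega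
    have h1 := hG.two_mul_finrank_le
    have h2 := hG.finrank_add
    refine foldr_diffOp_eq_zero (h0 a (by omega) (by omega) (F ⊔ W) (hlen ▸ hG.isTypeSubspace))
      hG.mem ?_
    rw [ConvexBody.coe_zero]
    exact Set.singleton_subset_iff.2 (Submodule.zero_mem _)
  obtain ⟨p, hpE, t, htE, hp1, hpt, htp⟩ := exists_kaehler_vector (E := E) (hE.symm ▸ hm)
  have hp0 : p ≠ 0 := fun h => by simp [h] at hp1
  have hpp := real_inner_self_eq_norm_sq p
  rw [hp1, one_pow] at hpp
  refine hψ.killedBy_of_diffOp hpE hp0 ?_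
  set E₁ : Submodule ℝ (Ecl n) := E ⊓ (Submodule.span ℝ {p})ᗮ with hE₁
  have hE₁f := finrank_inf_orthogonal_singleton hpE hp0
  rw [← hE₁, hE] at hE₁f
  have hpE₁ : ∀ y ∈ E₁, inner ℝ p y = 0 := fun y hy =>
    Submodule.mem_orthogonal_singleton_iff_inner_right.1 hy.2
  rcases eq_or_ne t 0 with ht0 | ht0
  · refine ih (m - 1) (by omega) (p :: G) F _ a E₁ (hG.single hp0 (fun x hx => hFE x hx p hpE)
      fun x hx => hWE x hx p hpE) (by omega) (by rw [List.length_cons]; omega)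
      (fun x hx y hy => hFE x hx y hy.1) fun x hx y hy => ?_
    obtain ⟨x₁, hx₁, x₂, hx₂, rfl⟩ := Submodule.mem_sup.1 hx
    obtain ⟨c, rfl⟩ := Submodule.mem_span_singleton.1 hx₂
    have h1 : inner ℂ p y = 0 := inner_complex_eq_zero (hpE₁ y hy) (by
      rw [hpt y hy.1, ht0, inner_zero_left])
    rw [inner_add_left, hWE _ hx₁ _ hy.1, ← Complex.coe_smul, inner_smul_left, h1, mul_zero,
      add_zero]
  set c : ℝ := ‖t‖ with hc
  have hc0 : c ≠ 0 := norm_ne_zero_iff.2 ht0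
  have hcpos : 0 < c := norm_pos_iff.2 ht0
  have htt := real_inner_self_eq_norm_sq t
  rw [← hc] at htt
  have hIpt : inner ℝ (Complex.I • p) t = c ^ 2 := by rw [hpt t htE, htt]
  have hpIp : inner ℝ p (Complex.I • p) = 0 := by rw [real_inner_comm]; exact inner_I_smul_self p
  have hIpIp : inner ℝ (Complex.I • p) (Complex.I • p) = 1 := by
    rw [inner_I_smul_I_smul, hpp]
  have hpt0 : inner ℝ p t = 0 := by
    rw [real_inner_comm, ← hpt p hpE, inner_I_smul_self]
  set v : Ecl n := c⁻¹ • t with hv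
  have hvE₁ : v ∈ E₁ := by
    refine ⟨E.smul_mem _ htE, Submodule.mem_orthogonal_singleton_iff_inner_right.2 ?_⟩
    rw [real_inner_smul_right, hpt0, mul_zero]
  have hv0 : v ≠ 0 := smul_ne_zero (inv_ne_zero hc0) ht0
  refine (hψ.diffOp p).killedBy_of_diffOp hvE₁ hv0 ?_
  set E₂ : Submodule ℝ (Ecl n) := E₁ ⊓ (Submodule.span ℝ {v})ᗮ with hE₂
  have hE₂f := finrank_inf_orthogonal_singleton hvE₁ hv0
  rw [← hE₂] at hE₂f
  have hvE₂ : ∀ y ∈ E₂, inner ℝ v y = 0 := fun y hy =>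
    Submodule.mem_orthogonal_singleton_iff_inner_right.1 hy.2
  have htE₂ : ∀ y ∈ E₂, inner ℝ t y = 0 := fun y hy => by
    have := hvE₂ y hy
    rw [hv, real_inner_smul_left] at this
    exact (mul_eq_zero.1 this).resolve_left (inv_ne_zero hc0)
  have hpE₂ : ∀ y ∈ E₂, inner ℂ p y = 0 := fun y hy =>
    inner_complex_eq_zero (hpE₁ y hy.1) (by rw [hpt y hy.1.1, htE₂ y hy])
  have hpair : KilledBy (diffOp (Complex.I • p) (diffOp p (G.foldr diffOp μ))) E₂ := by
    refine ih (m - 2) (by omega) (Complex.I • p :: p :: G) _ W (a + 1) E₂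
      (hG.pair hp0 (fun x hx => hFE x hx p hpE) fun x hx => hWE x hx p hpE) (by omega)
      (by rw [List.length_cons, List.length_cons]; omega) (fun x hx y hy => ?_)
      fun x hx y hy => hWE x hx y hy.1.1
    obtain ⟨x', hx', x₃, hx₃, rfl⟩ := Submodule.mem_sup.1 hx
    obtain ⟨x₁, hx₁, x₂, hx₂, rfl⟩ := Submodule.mem_sup.1 hx'
    obtain ⟨b, rfl⟩ := Submodule.mem_span_singleton.1 hx₂
    obtain ⟨d, rfl⟩ := Submodule.mem_span_singleton.1 hx₃
    rw [inner_add_left, inner_add_left, hFE _ hx₁ _ hy.1.1, ← Complex.coe_smul,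
      ← Complex.coe_smul d, inner_smul_left, inner_smul_left, inner_smul_left, hpE₂ y hy]
    simp
  have hdiff : ‖Complex.I • p - t‖ ^ 2 = 1 - c ^ 2 := by
    rw [← real_inner_self_eq_norm_sq, inner_sub_left, inner_sub_right, inner_sub_right, hIpIp,
      real_inner_comm (Complex.I • p) t, hIpt, htt]
    ring
  rcases eq_or_ne (1 - c ^ 2) 0 with hc1 | hc1
  · have hc1' : c = 1 := by nlinarith
    have h1 : Complex.I • p = t := by
      rw [hc1] at hdiff
      exact sub_eq_zero.1 (norm_eq_zero.1 (pow_eq_zero_iff two_ne_zero |>.1 hdiff))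
    rw [hv, hc1', inv_one, one_smul, ← h1]
    exact hpair
  have hpos : 0 < 1 - c ^ 2 := lt_of_le_of_ne (hdiff ▸ sq_nonneg _) hc1.symm
  set s : ℝ := √(1 - c ^ 2) with hs
  have hs2 : s ^ 2 = 1 - c ^ 2 := Real.sq_sqrt hpos.le
  have hs0 : s ≠ 0 := (Real.sqrt_pos.2 hpos).ne'
  set e : Ecl n := s⁻¹ • (v - c • Complex.I • p) with he
  have hvdec : v = c • Complex.I • p + s • e := by
    rw [he, smul_inv_smul₀ hs0, add_sub_cancel]
  have he1 : ‖e‖ = 1 := by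
    have h1 : ‖v - c • Complex.I • p‖ ^ 2 = s ^ 2 := by
      rw [← real_inner_self_eq_norm_sq, inner_sub_left, inner_sub_right, inner_sub_right]
      simp only [hv, real_inner_smul_left, real_inner_smul_right]
      rw [hIpIp, real_inner_comm (Complex.I • p) t, hIpt, htt, hs2]
      field_simp
      ring
    rw [he, norm_smul, norm_inv, Real.norm_eq_abs, ← abs_of_nonneg (norm_nonneg (v - _)),
      sq_eq_sq_iff_abs_eq_abs .. |>.1 h1, inv_mul_cancel₀ (abs_ne_zero.2 hs0)]
  have hpe : inner ℂ p e = 0 := by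
    apply inner_complex_eq_zero
    · rw [he, real_inner_smul_right, inner_sub_right, hv, real_inner_smul_right,
        real_inner_smul_right, hpt0, hpIp]
      simp
    · rw [he, real_inner_smul_right, inner_sub_right, hv, real_inner_smul_right,
        real_inner_smul_right, hIpt, hIpIp]
      field_simp
      simp
  have heE₂ : ∀ y ∈ E₂, inner ℂ e y = 0 := fun y hy => by
    have hy1 : inner ℂ (Complex.I • p) y = 0 := by rw [inner_smul_left, hpE₂ y hy, mul_zero]
    have hy2 : inner ℂ t y = 0 := inner_complex_eq_zero (htE₂ y hy) (by
      rw [htp y hy.1.1, hpE₁ y hy.1, mul_zero])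
    rw [he, hv, ← Complex.coe_smul, ← Complex.coe_smul c⁻¹, ← Complex.coe_smul c, inner_smul_left,
      inner_sub_left, inner_smul_left, inner_smul_left, hy1, hy2]
    simp
  have hxe : ∀ x, (∀ y ∈ E, inner ℂ x y = 0) → inner ℂ x e = 0 := fun x hx => by
    rw [he, hv, ← Complex.coe_smul, ← Complex.coe_smul c⁻¹, ← Complex.coe_smul c, inner_smul_right,
      inner_sub_right, inner_smul_right, inner_smul_right, inner_smul_right, hx _ htE, hx _ hpE]
    simp
  have hxp : ∀ x, (∀ y ∈ E, inner ℂ x y = 0) → inner ℂ x p = 0 := fun x hx => hx _ hpE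
  have hsingle : KilledBy (diffOp e (diffOp p (G.foldr diffOp μ))) E₂ := by
    have he0 : e ≠ 0 := fun h => by simp [h] at he1
    refine ih (m - 2) (by omega) (e :: p :: G) F _ a E₂
      ((hG.single hp0 (fun x hx => hFE x hx p hpE) fun x hx => hWE x hx p hpE).single he0
        (fun x hx => hxe x (hFE x hx)) fun x hx => ?_) (by omega)
      (by rw [List.length_cons, List.length_cons]; omega) (fun x hx y hy => hFE x hx y hy.1.1)
      (fun x hx y hy => ?_)
    · obtain ⟨x₁, hx₁, x₂, hx₂, rfl⟩ := Submodule.mem_sup.1 hx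
      obtain ⟨b, rfl⟩ := Submodule.mem_span_singleton.1 hx₂
      rw [inner_add_left, hxe _ (hWE _ hx₁), ← Complex.coe_smul, inner_smul_left, hpe]
      simp
    · obtain ⟨x', hx', x₃, hx₃, rfl⟩ := Submodule.mem_sup.1 hx
      obtain ⟨x₁, hx₁, x₂, hx₂, rfl⟩ := Submodule.mem_sup.1 hx'
      obtain ⟨b, rfl⟩ := Submodule.mem_span_singleton.1 hx₂
      obtain ⟨d, rfl⟩ := Submodule.mem_span_singleton.1 hx₃
      rw [inner_add_left, inner_add_left, hWE _ hx₁ _ hy.1.1, ← Complex.coe_smul,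
        ← Complex.coe_smul d, inner_smul_left, inner_smul_left, hpE₂ y hy, heE₂ y hy]
      simp
  rw [hvdec]
  refine killedBy_mixed hψ (m := Module.finrank ℝ E₂) (hμ.homog_foldr G ?_)
    (inner_self_of_norm_eq_one hp1) (inner_self_of_norm_eq_one he1) hpe (fun u hu => ?_) rfl hpE₂
    heE₂ hpair hsingle (by rw [hs2]; ring)
  · convert hH using 1
    omega
  · refine (hU.presBy u).foldr fun g hg => ?_
    have hgE : ∀ y ∈ E, inner ℂ g y = 0 := fun y hy => by
      obtain ⟨x₁, hx₁, x₂, hx₂, rfl⟩ := Submodule.mem_sup.1 (hG.mem g hg)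
      rw [inner_add_left, hFE _ hx₁ _ hy, hWE _ hx₂ _ hy, add_zero]
    refine hu g ?_ ?_
    · rw [← inner_conj_symm, hxp g hgE, map_zero]
    · rw [← inner_conj_symm, hxe g hgE, map_zero]

theorem exists_superspace_finrank {V : Type*} [NormedAddCommGroup V] [InnerProductSpace ℝ V]
    [FiniteDimensional ℝ V] (S : Submodule ℝ V) (j : ℕ)
    (hj : Module.finrank ℝ S + j ≤ Module.finrank ℝ V) :
    ∃ E : Submodule ℝ V, S ≤ E ∧ Module.finrank ℝ E = Module.finrank ℝ S + j := by
  induction j with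
  | zero => exact ⟨S, le_rfl, rfl⟩
  | succ j ih =>
    obtain ⟨E, hSE, hE⟩ := ih (by omega)
    have h1 := E.finrank_add_finrank_orthogonal
    have h2 : Eᗮ ≠ ⊥ := fun h => by
      rw [h, finrank_bot] at h1
      omega
    obtain ⟨p, hp, hp0⟩ := Submodule.exists_mem_ne_zero_of_ne_bot h2
    refine ⟨E ⊔ Submodule.span ℝ {p}, hSE.trans le_sup_left, ?_⟩
    rw [finrank_sup_span_singleton (fun x hx => (Submodule.mem_orthogonal _ _).1 hp x hx) hp0, hE,
      add_assoc]

/-- A unitarily invariant valuation vanishing on all subspaces of pure type vanishes. -/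
theorem eq_zero_of_isTypeSubspace (hk : k ≤ 2 * n) (hμ : CVal μ) (hH : Homog k μ) (hU : UInv μ)
    (h0 : ∀ a, k - n ≤ a → a ≤ k / 2 → ∀ E : Submodule ℝ (Ecl n), IsTypeSubspace k a E →
      ∀ K : ConvexBody (Ecl n), (K : Set (Ecl n)) ⊆ E → μ K = 0) : μ = 0 := by
  have heven : EvenVal μ := fun K => by
    rw [← hU (-1) (by rw [Matrix.mem_unitaryGroup_iff]; simp) K]
    congr 1
    refine ConvexBody.ext ?_
    change -(K : Set (Ecl n)) = _ '' _
    rw [← Set.image_neg_eq_neg]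
    refine Set.image_congr fun x _ => ?_
    simp
  refine hμ.eq_zero_of_foldr k μ heven hH fun l hl => ?_
  have hspan : Module.finrank ℝ (Submodule.span ℝ (Set.range l.get)) ≤ k := by
    refine (finrank_range_le_card l.get).trans ?_
    rw [Fintype.card_fin, hl]
  obtain ⟨E, hE1, hE2⟩ : ∃ E : Submodule ℝ (Ecl n),
      Submodule.span ℝ (Set.range l.get) ≤ E ∧ Module.finrank ℝ E = k := by
    obtain ⟨j, hj⟩ := Nat.exists_eq_add_of_le hspan
    rw [hj]
    exact exists_superspace_finrank _ j (by rw [finrank_ecl]; omega)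
  have hkill := killedBy_of_frame hμ hH hU h0 k [] ⊥ ⊥ 0 E HermFrame.nil hE2 (by simp)
    (fun x hx y hy => by rw [(Submodule.mem_bot ℝ).1 hx, inner_zero_left])
    (fun x hx y hy => by rw [(Submodule.mem_bot ℝ).1 hx, inner_zero_left])
  have h1 := hkill (Fin l.length) l.get (by rw [Fintype.card_fin, hE2, hl])
    fun i => hE1 (Submodule.subset_span ⟨i, rfl⟩)
  rw [iterD] at h1
  have h2 : (Finset.univ : Finset (Fin l.length)).val.map l.get = (l : Multiset (Ecl n)) := by
    rw [Fin.univ_val_map, List.ofFn_get]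
  rw [h2] at h1
  exact h1

end HermitianInduction

section HermitianUniqueness

variable {n k q : ℕ}

theorem hermKlain_unique (hk : k ≤ 2 * n) {μ ν : ConvexBody (Ecl n) → ℝ} (hμ : CVal μ)
    (hν : CVal ν) (hμU : UInv μ) (hνU : UInv ν) (hμH : Homog k μ) (hνH : Homog k ν)
    (hμK : HermKlainCond k q μ) (hνK : HermKlainCond k q ν) : μ = ν := by
  have h := eq_zero_of_isTypeSubspace (μ := fun K => μ K - ν K) hk (hμ.sub hν)
    (fun K t ht => by beta_reduce; rw [hμH K t ht, hνH K t ht, mul_sub])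
    (fun A hA K => by beta_reduce; rw [hμU A hA, hνU A hA])
    (fun a h1 h2 E hE K hK => by rw [hμK a h1 h2 E hE K hK, hνK a h1 h2 E hE K hK, sub_self])
  funext K
  exact sub_eq_zero.1 (congrFun h K)

end HermitianUniqueness

section NormalBundle

variable {V : Type*} [NormedAddCommGroup V] [InnerProductSpace ℝ V]

/-- `ξ` is an outer normal vector of `K` at the point `p`. -/
def IsNormalAt (K : ConvexBody V) (p ξ : V) : Prop :=
  p ∈ K ∧ ∀ x ∈ K, inner ℝ ξ (x - p) ≤ 0

/-- The disc bundle of outer normal vectors of length at most one. -/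
def normalDisc (K : ConvexBody V) : Set (V × V) := {z | IsNormalAt K z.1 z.2 ∧ ‖z.2‖ ≤ 1}

/-- The set of all `p + A ξ`, for `ξ` an outer normal vector of `K` at `p` with `‖ξ‖ ≤ 1`. -/
def tube (A : V →L[ℝ] V) (K : ConvexBody V) : Set V :=
  (fun z : V × V => z.1 + A z.2) '' normalDisc K

variable [FiniteDimensional ℝ V]

theorem isNormalAt_union_inter {K L M I : ConvexBody V} (hM : (M : Set V) = (K : Set V) ∪ L)
    (hI : (I : Set V) = (K : Set V) ∩ L) (p ξ : V) :
    (IsNormalAt K p ξ ∨ IsNormalAt L p ξ ↔ IsNormalAt M p ξ ∨ IsNormalAt I p ξ) ∧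
      (IsNormalAt K p ξ ∧ IsNormalAt L p ξ ↔ IsNormalAt M p ξ ∧ IsNormalAt I p ξ) := by
  have hmM : ∀ x, x ∈ M ↔ x ∈ K ∨ x ∈ L := fun x => by
    rw [← SetLike.mem_coe, hM]
    exact Iff.rfl
  have hmI : ∀ x, x ∈ I ↔ x ∈ K ∧ x ∈ L := fun x => by
    rw [← SetLike.mem_coe, hI]
    exact Iff.rfl
  have key : ∀ {K' L' : ConvexBody V}, (M : Set V) = (K' : Set V) ∪ L' →
      (I : Set V) = (K' : Set V) ∩ L' → IsNormalAt K' p ξ → IsNormalAt M p ξ ∨ IsNormalAt I p ξ := by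
    intro K' L' hM' hI' hp
    have hmI' : ∀ x, x ∈ I ↔ x ∈ K' ∧ x ∈ L' := fun x => by
      rw [← SetLike.mem_coe, hI']
      exact Iff.rfl
    have hmM' : ∀ x, x ∈ M ↔ x ∈ K' ∨ x ∈ L' := fun x => by
      rw [← SetLike.mem_coe, hM']
      exact Iff.rfl
    by_cases hpL : p ∈ L'
    · exact Or.inr ⟨(hmI' p).2 ⟨hp.1, hpL⟩, fun x hx => hp.2 x ((hmI' x).1 hx).1⟩
    · refine Or.inl ⟨(hmM' p).2 (Or.inl hp.1), fun x hx => ?_⟩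
      rcases (hmM' x).1 hx with hx | hx
      · exact hp.2 x hx
      obtain ⟨z, hz, hzK, hzL⟩ := exists_mem_inter_segment hM' hp.1 hx
      rw [segment_eq_image'] at hz
      obtain ⟨s, hs, rfl⟩ := hz
      have hs0 : 0 < s := lt_of_le_of_ne hs.1 fun h => hpL (by simpa [← h] using hzL)
      have := hp.2 _ hzK
      rw [add_sub_cancel_left, real_inner_smul_right] at this
      exact nonpos_of_mul_nonpos_right this hs0
  refine ⟨⟨?_, ?_⟩, ?_, ?_⟩
  · rintro (h | h)
    · exact key hM hI h
    · exact key (hM.trans (Set.union_comm _ _)) (hI.trans (Set.inter_comm _ _)) h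
  · rintro (h | h)
    · rcases (hmM p).1 h.1 with hp | hp
      · exact Or.inl ⟨hp, fun x hx => h.2 x ((hmM x).2 (Or.inl hx))⟩
      · exact Or.inr ⟨hp, fun x hx => h.2 x ((hmM x).2 (Or.inr hx))⟩
    · by_contra hno
      push Not at hno
      obtain ⟨h1, h2⟩ := hno
      have hp := (hmI p).1 h.1
      simp only [IsNormalAt, hp.1, hp.2, true_and] at h1 h2
      push Not at h1 h2
      obtain ⟨x, hx, hx'⟩ := h1
      obtain ⟨y, hy, hy'⟩ := h2
      obtain ⟨z, ⟨a, b, ha, hb, hab, rfl⟩, hzK, hzL⟩ := exists_mem_inter_segment hM hx hy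
      have h3 := h.2 _ ((hmI _).2 ⟨hzK, hzL⟩)
      have h4 : a • x + b • y - p = a • (x - p) + b • (y - p) := by
        rw [smul_sub, smul_sub, sub_add_sub_comm, ← add_smul, hab, one_smul]
      rw [h4, inner_add_right, real_inner_smul_right, real_inner_smul_right] at h3
      rcases eq_or_lt_of_le ha with h0 | h0
      · have : b = 1 := by rw [← hab, ← h0, zero_add]
        rw [← h0, this] at h3
        linarith
      · have := mul_pos h0 hx'
        have := mul_nonneg hb hy'.le
        linarith
  · rintro ⟨h1, h2⟩
    refine ⟨⟨(hmM p).2 (Or.inl h1.1), fun x hx => ?_⟩, (hmI p).2 ⟨h1.1, h2.1⟩, fun x hx => ?_⟩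
    · rcases (hmM x).1 hx with hx | hx
      exacts [h1.2 x hx, h2.2 x hx]
    · exact h1.2 x ((hmI x).1 hx).1
  · rintro ⟨h1, h2⟩
    have hp := (hmI p).1 h2.1
    exact ⟨⟨hp.1, fun x hx => h1.2 x ((hmM x).2 (Or.inl hx))⟩,
      hp.2, fun x hx => h1.2 x ((hmM x).2 (Or.inr hx))⟩

theorem normalDisc_union {K L M I : ConvexBody V} (hM : (M : Set V) = (K : Set V) ∪ L)
    (hI : (I : Set V) = (K : Set V) ∩ L) :
    normalDisc K ∪ normalDisc L = normalDisc M ∪ normalDisc I := by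
  ext ⟨p, ξ⟩
  have := (isNormalAt_union_inter hM hI p ξ).1
  simp only [normalDisc, Set.mem_union, Set.mem_ofPred_eq]
  tauto

theorem normalDisc_inter {K L M I : ConvexBody V} (hM : (M : Set V) = (K : Set V) ∪ L)
    (hI : (I : Set V) = (K : Set V) ∩ L) :
    normalDisc K ∩ normalDisc L = normalDisc M ∩ normalDisc I := by
  ext ⟨p, ξ⟩
  have := (isNormalAt_union_inter hM hI p ξ).2
  simp only [normalDisc, Set.mem_inter_iff, Set.mem_ofPred_eq]
  tauto

theorem IsNormalAt.inner_sub_nonneg {K : ConvexBody V} {p q ξ η : V} (h : IsNormalAt K p ξ)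
    (h' : IsNormalAt K q η) : 0 ≤ inner ℝ (ξ - η) (p - q) := by
  have h1 := h.2 q h'.1
  have h2 := h'.2 p h.1
  rw [← neg_sub, inner_neg_right] at h1
  rw [inner_sub_left]
  linarith

theorem IsNormalAt.eq_of_add_eq {A : V →L[ℝ] V} (hA : ∀ v, v ≠ 0 → 0 < inner ℝ v (A v))
    {K : ConvexBody V} {p q ξ η : V} (h : IsNormalAt K p ξ) (h' : IsNormalAt K q η)
    (heq : p + A ξ = q + A η) : p = q ∧ ξ = η := by
  have h1 : p - q = -A (ξ - η) := by
    rw [map_sub, eq_sub_of_add_eq heq]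
    abel
  have h2 := h.inner_sub_nonneg h'
  rw [h1, inner_neg_right] at h2
  have h3 : ξ = η := by
    by_contra hne
    have := hA (ξ - η) (sub_ne_zero.2 hne)
    linarith
  exact ⟨by simpa [h3] using heq, h3⟩

theorem isCompact_normalDisc (K : ConvexBody V) : IsCompact (normalDisc K) := by
  refine (K.isCompact.prod (isCompact_closedBall (0 : V) 1)).of_isClosed_subset ?_ fun z hz =>
    ⟨hz.1.1, mem_closedBall_zero_iff.2 hz.2⟩
  have : normalDisc K = ((Prod.fst ⁻¹' (K : Set V)) ∩
      ⋂ x ∈ K, {z : V × V | inner ℝ z.2 (x - z.1) ≤ 0}) ∩ {z : V × V | ‖z.2‖ ≤ 1} := by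
    ext z
    simp [normalDisc, IsNormalAt]
  rw [this]
  refine ((K.isClosed.preimage continuous_fst).inter ?_).inter
    (isClosed_le (by fun_prop) continuous_const)
  exact isClosed_biInter fun x _ => isClosed_le (by fun_prop) continuous_const

variable [MeasurableSpace V] [BorelSpace V]

/-- The Euclidean volume, normalized as a Hausdorff measure. -/
def euclVol (V : Type*) [NormedAddCommGroup V] [InnerProductSpace ℝ V] [FiniteDimensional ℝ V]
    [MeasurableSpace V] [BorelSpace V] : Measure V := μH[Module.finrank ℝ V]

instance : (euclVol V).IsAddHaarMeasure := isAddHaarMeasure_hausdorffMeasure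

/-- The volume of the tube of `K`. -/
def tubeVol (A : V →L[ℝ] V) (K : ConvexBody V) : ℝ := (euclVol V).real (tube A K)

theorem isCompact_tube (A : V →L[ℝ] V) (K : ConvexBody V) : IsCompact (tube A K) :=
  (isCompact_normalDisc K).image (by fun_prop)

theorem isValuation_tubeVol {A : V →L[ℝ] V} (hA : ∀ v, v ≠ 0 → 0 < inner ℝ v (A v)) :
    IsValuation (tubeVol A) := by
  intro K L M I hM hI
  set f : V × V → V := fun z => z.1 + A z.2 with hf
  have hfc : Continuous f := by fun_prop
  have hinj : ∀ K : ConvexBody V, Set.InjOn f (normalDisc K) := fun K x hx y hy hxy => by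
    obtain ⟨h1, h2⟩ := hx.1.eq_of_add_eq hA hy.1 hxy
    exact Prod.ext h1 h2
  set v : Set (V × V) → ℝ := fun S => (euclVol V).real (f '' S) with hv
  have hadd : ∀ (K : ConvexBody V) (S T : Set (V × V)), IsCompact S → IsCompact T →
      S ∪ T = normalDisc K → v (normalDisc K) + v (S ∩ T) = v S + v T := by
    intro K S T hS hT hST
    have h1 : f '' (S ∩ T) = f '' S ∩ f '' T :=
      (hinj K).image_inter (hST ▸ Set.subset_union_left) (hST ▸ Set.subset_union_right)
    simp only [hv]
    rw [h1, ← hST, Set.image_union]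
    exact measureReal_union_add_inter (hT.image hfc).measurableSet
      (hS.image hfc).measure_lt_top.ne (hT.image hfc).measure_lt_top.ne
  have hU := normalDisc_union hM hI
  have hN := normalDisc_inter hM hI
  have hc := fun K L : ConvexBody V => (isCompact_normalDisc K).inter (isCompact_normalDisc L)
  set NK := normalDisc K
  set NL := normalDisc L
  set NM := normalDisc M
  set NI := normalDisc I
  have e1 := hadd K (NK ∩ NM) (NK ∩ NI) (hc _ _) (hc _ _) (by
    rw [← Set.inter_union_distrib_left, ← hU, Set.inter_eq_left]; exact Set.subset_union_left)
  have e2 := hadd L (NL ∩ NM) (NL ∩ NI) (hc _ _) (hc _ _) (by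
    rw [← Set.inter_union_distrib_left, ← hU, Set.inter_eq_left]; exact Set.subset_union_right)
  have e3 := hadd M (NK ∩ NM) (NL ∩ NM) (hc _ _) (hc _ _) (by
    rw [← Set.union_inter_distrib_right, hU, Set.inter_eq_right]; exact Set.subset_union_left)
  have e4 := hadd I (NK ∩ NI) (NL ∩ NI) (hc _ _) (hc _ _) (by
    rw [← Set.union_inter_distrib_right, hU, Set.inter_eq_right]; exact Set.subset_union_right)
  have s1 : NK ∩ NM ∩ (NK ∩ NI) = NK ∩ NL := by
    rw [← Set.inter_inter_distrib_left, ← hN, ← Set.inter_assoc, Set.inter_self]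
  have s2 : NL ∩ NM ∩ (NL ∩ NI) = NK ∩ NL := by
    rw [← Set.inter_inter_distrib_left, ← hN, Set.inter_comm NK, ← Set.inter_assoc, Set.inter_self]
  have s3 : NK ∩ NM ∩ (NL ∩ NM) = NK ∩ NL := by
    rw [← Set.inter_inter_distrib_right, hN, Set.inter_right_comm, Set.inter_self]
  have s4 : NK ∩ NI ∩ (NL ∩ NI) = NK ∩ NL := by
    rw [← Set.inter_inter_distrib_right, hN, Set.inter_assoc, Set.inter_self]
  rw [s1] at e1
  rw [s2] at e2
  rw [s3] at e3
  rw [s4] at e4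
  change v NM + v NI = v NK + v NL
  linarith

theorem transInv_tubeVol (A : V →L[ℝ] V) : TransInv (tubeVol A) := by
  intro K x
  have h : tube A (K.translate x) = (fun y => y + x) '' tube A K := by
    have hm : ∀ y, y ∈ K.translate x ↔ y - x ∈ K := fun y => by
      rw [← SetLike.mem_coe]
      change y ∈ (K : Set V) + {x} ↔ _
      rw [Set.add_singleton]
      simp [sub_eq_add_neg]
    ext y
    constructor
    · rintro ⟨⟨p, ξ⟩, ⟨⟨h1, h2⟩, h3⟩, rfl⟩
      refine ⟨_, ⟨(p - x, ξ), ⟨⟨(hm p).1 h1, fun z hz => ?_⟩, h3⟩, rfl⟩, ?_⟩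
      · have := h2 (z + x) ((hm _).2 (by simpa using hz))
        convert this using 2
        simp only
        abel
      · simp only
        abel
    · rintro ⟨_, ⟨⟨p, ξ⟩, ⟨⟨h1, h2⟩, h3⟩, rfl⟩, rfl⟩
      refine ⟨(p + x, ξ), ⟨⟨(hm _).2 (by simpa using h1), fun z hz => ?_⟩, h3⟩, ?_⟩
      · have := h2 (z - x) ((hm _).1 hz)
        convert this using 2
        simp only
        abel
      · simp only
        abel
  rw [tubeVol, tubeVol, h]
  simp [Measure.real]

theorem tube_dilate (A : V →L[ℝ] V) (K : ConvexBody V) {t : ℝ} (ht : 0 < t) :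
    tube A (ConvexBody.dilate t K) = t • tube (t⁻¹ • A) K := by
  have hm : ∀ y, y ∈ ConvexBody.dilate t K ↔ ∃ x ∈ K, t • x = y := fun y => Iff.rfl
  ext y
  rw [Set.mem_smul_set]
  constructor
  · rintro ⟨⟨p, ξ⟩, ⟨⟨h1, h2⟩, h3⟩, rfl⟩
    obtain ⟨x, hx, rfl⟩ := (hm _).1 h1
    refine ⟨_, ⟨(x, ξ), ⟨⟨hx, fun z hz => ?_⟩, h3⟩, rfl⟩, ?_⟩
    · have := h2 (t • z) ((hm _).2 ⟨z, hz, rfl⟩)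
      simp only at this ⊢
      rw [← smul_sub, real_inner_smul_right] at this
      exact nonpos_of_mul_nonpos_right this ht
    · simp [smul_inv_smul₀ ht.ne']
  · rintro ⟨_, ⟨⟨p, ξ⟩, ⟨⟨h1, h2⟩, h3⟩, rfl⟩, rfl⟩
    refine ⟨(t • p, ξ), ⟨⟨(hm _).2 ⟨p, h1, rfl⟩, fun z hz => ?_⟩, h3⟩, ?_⟩
    · obtain ⟨x, hx, rfl⟩ := (hm _).1 hz
      simp only
      rw [← smul_sub, real_inner_smul_right]
      exact mul_nonpos_of_nonneg_of_nonpos ht.le (h2 x hx)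
    · simp [smul_inv_smul₀ ht.ne']

theorem tubeVol_dilate (A : V →L[ℝ] V) (K : ConvexBody V) {t : ℝ} (ht : 0 < t) :
    tubeVol A (ConvexBody.dilate t K) = t ^ Module.finrank ℝ V * tubeVol (t⁻¹ • A) K := by
  rw [tubeVol, tubeVol, tube_dilate A K ht, Measure.real, Measure.addHaar_smul, ENNReal.toReal_mul,
    ENNReal.toReal_ofReal (abs_nonneg _), abs_of_pos (pow_pos ht _)]
  rfl

theorem euclVol_image (u : V ≃ₗᵢ[ℝ] V) (S : Set V) : euclVol V (u '' S) = euclVol V S :=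
  u.toIsometryEquiv.hausdorffMeasure_image _ S

theorem presBy_tubeVol {A : V →L[ℝ] V} {u : V ≃ₗᵢ[ℝ] V} (h : ∀ x, u (A x) = A (u x)) :
    PresBy (tubeVol A) u := by
  intro K
  have ht : tube A (mapBody (u.toContinuousLinearEquiv : V →L[ℝ] V) K) = u '' tube A K := by
    have hm : ∀ y, y ∈ mapBody (u.toContinuousLinearEquiv : V →L[ℝ] V) K ↔ ∃ x ∈ K, u x = y :=
      fun y => Iff.rfl
    ext y
    constructor
    · rintro ⟨⟨p, ξ⟩, ⟨⟨h1, h2⟩, h3⟩, rfl⟩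
      obtain ⟨x, hx, rfl⟩ := (hm _).1 h1
      refine ⟨_, ⟨(x, u.symm ξ), ⟨⟨hx, fun z hz => ?_⟩, ?_⟩, rfl⟩, ?_⟩
      · have := h2 (u z) ((hm _).2 ⟨z, hz, rfl⟩)
        simp only at this ⊢
        rwa [← map_sub, ← u.apply_symm_apply ξ, u.inner_map_map] at this
      · simpa using h3
      · simp [h]
    · rintro ⟨_, ⟨⟨p, ξ⟩, ⟨⟨h1, h2⟩, h3⟩, rfl⟩, rfl⟩
      refine ⟨(u p, u ξ), ⟨⟨(hm _).2 ⟨p, h1, rfl⟩, fun z hz => ?_⟩, ?_⟩, ?_⟩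
      · obtain ⟨x, hx, rfl⟩ := (hm _).1 hz
        simp only
        rw [← map_sub, u.inner_map_map]
        exact h2 x hx
      · simpa using h3
      · simp [h]
  rw [tubeVol, tubeVol, ht, Measure.real, euclVol_image]
  rfl

end NormalBundle

section NearestPoint

variable {V : Type*} [NormedAddCommGroup V] [InnerProductSpace ℝ V] [FiniteDimensional ℝ V]

theorem exists_isNormalAt_sub (K : ConvexBody V) (w : V) : ∃ p, IsNormalAt K p (w - p) := by
  obtain ⟨p, hp, h⟩ := exists_norm_eq_iInf_of_complete_convex K.nonempty
    K.isCompact.isComplete K.convex w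
  exact ⟨p, hp, (norm_eq_iInf_iff_real_inner_le_zero K.convex hp).1 h⟩

/-- The metric projection onto a convex body. -/
def nearest (K : ConvexBody V) (w : V) : V := (exists_isNormalAt_sub K w).choose

theorem isNormalAt_nearest (K : ConvexBody V) (w : V) :
    IsNormalAt K (nearest K w) (w - nearest K w) := (exists_isNormalAt_sub K w).choose_spec

theorem nearest_add {K : ConvexBody V} {p ξ : V} (h : IsNormalAt K p ξ) :
    nearest K (p + ξ) = p :=
  ((isNormalAt_nearest K (p + ξ)).eq_of_add_eq (A := ContinuousLinearMap.id ℝ V)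
    (fun v hv => real_inner_self_pos.2 hv) h (by simp)).1

theorem inner_nearest_nonneg (K : ConvexBody V) (x y : V) :
    0 ≤ inner ℝ ((x - y) - (nearest K x - nearest K y)) (nearest K x - nearest K y) := by
  have := (isNormalAt_nearest K x).inner_sub_nonneg (isNormalAt_nearest K y)
  rwa [sub_sub_sub_comm] at this

theorem lipschitzWith_nearest (K : ConvexBody V) : LipschitzWith 1 (nearest K) := by
  refine LipschitzWith.of_dist_le_mul fun x y => ?_
  rw [dist_eq_norm, dist_eq_norm, NNReal.coe_one, one_mul]
  have h := inner_nearest_nonneg K x y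
  rw [inner_sub_left, real_inner_self_eq_norm_sq] at h
  have h2 := real_inner_le_norm (x - y) (nearest K x - nearest K y)
  by_contra hlt
  nlinarith [norm_nonneg (x - y)]

theorem lipschitzWith_sub_nearest (K : ConvexBody V) : LipschitzWith 1 fun w => w - nearest K w := by
  refine LipschitzWith.of_dist_le_mul fun x y => ?_
  rw [dist_eq_norm, dist_eq_norm, NNReal.coe_one, one_mul, sub_sub_sub_comm]
  have h := inner_nearest_nonneg K x y
  set a := (x - y) - (nearest K x - nearest K y)
  set b := nearest K x - nearest K y
  have h1 : x - y = a + b := by simp [a, b]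
  have h2 : ‖x - y‖ ^ 2 = ‖a‖ ^ 2 + 2 * inner ℝ a b + ‖b‖ ^ 2 := by
    rw [h1, norm_add_sq_real]
  by_contra hlt
  nlinarith [norm_nonneg (x - y), sq_nonneg ‖b‖]

theorem inner_fderiv_nearest_nonneg (K : ConvexBody V) {w : V} {P : V →L[ℝ] V}
    (hP : HasFDerivAt (nearest K) P w) (v : V) : 0 ≤ inner ℝ (v - P v) (P v) := by
  have h1 : HasDerivAt (fun t : ℝ => w + t • v) v 0 := by
    simpa using ((hasDerivAt_id (0 : ℝ)).smul_const v).const_add w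
  have h2 : HasDerivAt (fun t : ℝ => nearest K (w + t • v)) (P v) 0 := by
    have hP' : HasFDerivAt (nearest K) P (w + (0 : ℝ) • v) := by simpa using hP
    exact hP'.comp_hasDerivAt (0 : ℝ) h1
  have h3 := h1.tendsto_slope_zero
  have h4 := h2.tendsto_slope_zero
  refine ge_of_tendsto' ((h3.sub h4).inner h4) fun t => ?_
  rw [← smul_sub, real_inner_smul_left, real_inner_smul_right, ← mul_assoc]
  refine mul_nonneg (mul_self_nonneg _) ?_
  exact inner_nearest_nonneg K _ _

theorem det_nearest_pos {A : V →L[ℝ] V} (hA : ∀ v, v ≠ 0 → 0 < inner ℝ v (A v)) {P : V →L[ℝ] V}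
    (hP : ∀ v, 0 ≤ inner ℝ (v - P v) (P v)) :
    0 < (P + A.comp (ContinuousLinearMap.id ℝ V - P)).det := by
  set Q : ℝ → V →L[ℝ] V := fun s =>
    P + ((1 - s) • ContinuousLinearMap.id ℝ V + s • A).comp (ContinuousLinearMap.id ℝ V - P)
  have hQc : Continuous fun s => (Q s).det :=
    ContinuousLinearMap.continuous_det.comp (by fun_prop)
  have hQ0 : (Q 0).det = 1 := by
    have : Q 0 = ContinuousLinearMap.id ℝ V := by
      ext v
      simp [Q]
    rw [this]
    exact LinearMap.det_id
  have hQ1 : Q 1 = P + A.comp (ContinuousLinearMap.id ℝ V - P) := by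
    ext v
    simp [Q]
  have hne : ∀ s ∈ Set.Icc (0 : ℝ) 1, (Q s).det ≠ 0 := by
    intro s hs h0
    obtain ⟨v, hv, hv0⟩ := (Submodule.ne_bot_iff _).1
      (LinearMap.bot_lt_ker_of_det_eq_zero (f := (Q s : V →ₗ[ℝ] V)) h0).ne'
    have hv1 : P v = -((1 - s) • (v - P v) + s • A (v - P v)) := by
      have : P v + ((1 - s) • (v - P v) + s • A (v - P v)) = 0 :=
        LinearMap.mem_ker.1 hv
      exact eq_neg_of_add_eq_zero_left this
    have h1 := hP v
    by_cases hη : v - P v = 0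
    · rw [hη] at hv1
      apply hv0
      have : P v = 0 := by simpa using hv1
      rw [← sub_add_cancel v (P v), hη, this, add_zero]
    · rw [show inner ℝ (v - P v) (P v) = inner ℝ (v - P v) _ from congrArg _ hv1, inner_neg_right, inner_add_right, real_inner_smul_right,
        real_inner_smul_right] at h1
      have h2 := hA _ hη
      have h3 : 0 < inner ℝ (v - P v) (v - P v) := real_inner_self_pos.2 hη
      rcases eq_or_lt_of_le hs.1 with h | h
      · rw [← h] at h1
        linarith
      · nlinarith [mul_pos h h2, mul_nonneg (sub_nonneg.2 hs.2) h3.le]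
  rw [← hQ1]
  by_contra hle
  push Not at hle
  obtain ⟨s, hs, h0⟩ := intermediate_value_Icc' (zero_le_one (α := ℝ)) hQc.continuousOn
    (show (0 : ℝ) ∈ Set.Icc (Q 1).det (Q 0).det from ⟨hle, by rw [hQ0]; exact zero_le_one⟩)
  exact hne s hs h0

end NearestPoint

section TubePolynomial

variable {V : Type*} [NormedAddCommGroup V] [InnerProductSpace ℝ V] [FiniteDimensional ℝ V]
  [MeasurableSpace V] [BorelSpace V]

theorem tube_eq_image (A : V →L[ℝ] V) (K : ConvexBody V) :
    tube A K = (fun w => nearest K w + A (w - nearest K w)) '' {w | ‖w - nearest K w‖ ≤ 1} := by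
  ext y
  constructor
  · rintro ⟨⟨p, ξ⟩, ⟨h1, h2⟩, rfl⟩
    refine ⟨p + ξ, ?_, ?_⟩
    · simpa [nearest_add h1] using h2
    · simp [nearest_add h1]
  · rintro ⟨w, hw, rfl⟩
    exact ⟨(nearest K w, w - nearest K w), ⟨isNormalAt_nearest K w, hw⟩, rfl⟩

theorem euclVol_image_eq_zero {f : V → V} {C : ℝ≥0} (hf : LipschitzWith C f) {S : Set V}
    (hS : euclVol V S = 0) : euclVol V (f '' S) = 0 := by
  refine le_antisymm ((hf.hausdorffMeasure_image_le (Nat.cast_nonneg _) S).trans ?_) zero_le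
  rw [show μH[(Module.finrank ℝ V : ℝ)] S = 0 from hS, mul_zero]

/-- The points at distance at most one where the metric projection is differentiable. -/
def tubeDom (K : ConvexBody V) : Set V :=
  {w | ‖w - nearest K w‖ ≤ 1} ∩ {w | DifferentiableAt ℝ (nearest K) w}

theorem tubeVol_eq_integral {A : V →L[ℝ] V} (hA : ∀ v, v ≠ 0 → 0 < inner ℝ v (A v))
    (K : ConvexBody V) :
    IntegrableOn (fun w => (fderiv ℝ (nearest K) w +
      A.comp (ContinuousLinearMap.id ℝ V - fderiv ℝ (nearest K) w)).det) (tubeDom K) (euclVol V) ∧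
    tubeVol A K = ∫ w in tubeDom K, (fderiv ℝ (nearest K) w +
      A.comp (ContinuousLinearMap.id ℝ V - fderiv ℝ (nearest K) w)).det ∂(euclVol V) := by
  set S : V → V := fun w => nearest K w + A (w - nearest K w) with hS
  set S' : V → V →L[ℝ] V := fun w => fderiv ℝ (nearest K) w +
      A.comp (ContinuousLinearMap.id ℝ V - fderiv ℝ (nearest K) w) with hS'
  have hclosed : IsClosed {w | ‖w - nearest K w‖ ≤ 1} :=
    isClosed_le (lipschitzWith_sub_nearest K).continuous.norm continuous_const
  have hm : MeasurableSet (tubeDom K) :=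
    hclosed.measurableSet.inter (measurableSet_of_differentiableAt ℝ _)
  have hd : ∀ w ∈ tubeDom K, HasFDerivWithinAt S (S' w) (tubeDom K) w := by
    intro w hw
    have h1 := hw.2.hasFDerivAt
    exact (h1.add (A.hasFDerivAt.comp w ((hasFDerivAt_id w).sub h1))).hasFDerivWithinAt
  have hinj : Set.InjOn S (tubeDom K) := by
    intro x _ y _ hxy
    obtain ⟨h1, h2⟩ := (isNormalAt_nearest K x).eq_of_add_eq hA (isNormalAt_nearest K y) hxy
    rw [h1] at h2
    exact sub_left_injective h2
  have hpos : ∀ w ∈ tubeDom K, |(S' w).det| = (S' w).det := fun w hw =>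
    abs_of_pos (det_nearest_pos hA fun v => inner_fderiv_nearest_nonneg K hw.2.hasFDerivAt v)
  have hlip : LipschitzWith (1 + ‖A‖₊ * 1) S :=
    (lipschitzWith_nearest K).add (A.lipschitz.comp (lipschitzWith_sub_nearest K))
  have hvol : euclVol V (tube A K) = euclVol V (S '' tubeDom K) := by
    rw [tube_eq_image]
    refine le_antisymm ?_ (measure_mono (Set.image_mono Set.inter_subset_left))
    have h0 : euclVol V (S '' {w | ¬DifferentiableAt ℝ (nearest K) w}) = 0 :=
      euclVol_image_eq_zero hlip ((lipschitzWith_nearest K).ae_differentiableAt)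
    calc _ ≤ euclVol V (S '' tubeDom K ∪ S '' {w | ¬DifferentiableAt ℝ (nearest K) w}) := by
          rw [← Set.image_union]
          refine measure_mono (Set.image_mono fun w hw => ?_)
          by_cases h : DifferentiableAt ℝ (nearest K) w
          exacts [Or.inl ⟨hw, h⟩, Or.inr h]
      _ ≤ _ := (measure_union_le _ _).trans (by rw [h0, add_zero])
  constructor
  · have h1 : IntegrableOn (fun _ : V => (1 : ℝ)) (S '' tubeDom K) (euclVol V) := by
      refine integrableOn_const ?_ 
      rw [← hvol]
      exact (isCompact_tube A K).measure_lt_top.ne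
    refine ((integrableOn_image_iff_integrableOn_abs_det_fderiv_smul (euclVol V) hm hd hinj
      (fun _ => (1 : ℝ))).1 h1).congr_fun (fun w hw => ?_) hm
    simp only [smul_eq_mul, mul_one]
    exact hpos w hw
  · have h2 := integral_image_eq_integral_abs_det_fderiv_smul (euclVol V) hm hd hinj
      (fun _ => (1 : ℝ))
    rw [setIntegral_const, smul_eq_mul, mul_one] at h2
    rw [tubeVol, Measure.real, hvol]
    refine h2.trans (setIntegral_congr_fun hm fun w hw => ?_)
    simp only [smul_eq_mul, mul_one]
    exact hpos w hw

theorem exists_polynomial_det (P Q : V →L[ℝ] V) : ∃ p : Polynomial ℝ,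
    p.natDegree ≤ Module.finrank ℝ V ∧ ∀ r : ℝ, (P + r • Q).det = p.eval r := by
  set b := Module.finBasis ℝ V
  set M := LinearMap.toMatrix b b (P : V →ₗ[ℝ] V)
  set N := LinearMap.toMatrix b b (Q : V →ₗ[ℝ] V)
  refine ⟨_, (Polynomial.natDegree_det_X_add_C_le N M).trans (Fintype.card_fin _).le, fun r => ?_⟩
  rw [ContinuousLinearMap.det, ← LinearMap.det_toMatrix b, ← Polynomial.coe_evalRingHom,
    RingHom.map_det]
  congr 1
  ext i j
  simp [M, N, LinearMap.toMatrix_apply, add_comm]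
  exact mul_comm _ _

/-- The interpolation nodes. -/
def tubeNode (i : ℕ) : ℝ := i + 1

theorem tubeNode_pos (i : ℕ) : 0 < tubeNode i := Nat.cast_add_one_pos i

theorem tubeNode_injective : Function.Injective tubeNode := fun i j h =>
  Nat.cast_injective (add_right_cancel (b := (1 : ℝ)) h)

/-- The polynomial whose values are the volumes of the tubes of `K`. -/
def tubePoly (A : V →L[ℝ] V) (K : ConvexBody V) : Polynomial ℝ :=
  Lagrange.interpolate (Finset.range (Module.finrank ℝ V + 1)) tubeNode
    fun i => tubeVol (tubeNode i • A) K

theorem eval_tubePoly {A : V →L[ℝ] V} (hA : ∀ v, v ≠ 0 → 0 < inner ℝ v (A v)) (K : ConvexBody V)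
    {r : ℝ} (hr : 0 < r) : (tubePoly A K).eval r = tubeVol (r • A) K := by
  have hA' : ∀ {s : ℝ}, 0 < s → ∀ v, v ≠ 0 → 0 < inner ℝ v ((s • A) v) := fun hs v hv => by
    rw [_root_.smul_apply, real_inner_smul_right]
    exact mul_pos hs (hA v hv)
  set s := Finset.range (Module.finrank ℝ V + 1)
  have hinj : Set.InjOn tubeNode (s : Set ℕ) := tubeNode_injective.injOn
  have key : ∀ w, (fderiv ℝ (nearest K) w +
      (r • A).comp (ContinuousLinearMap.id ℝ V - fderiv ℝ (nearest K) w)).det =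
      ∑ i ∈ s, (Lagrange.basis s tubeNode i).eval r * (fderiv ℝ (nearest K) w +
      (tubeNode i • A).comp (ContinuousLinearMap.id ℝ V - fderiv ℝ (nearest K) w)).det := by
    intro w
    obtain ⟨p, hp, hpe⟩ := exists_polynomial_det (fderiv ℝ (nearest K) w)
      (A.comp (ContinuousLinearMap.id ℝ V - fderiv ℝ (nearest K) w))
    have hdeg : p.degree < s.card := by
      rw [Finset.card_range]
      exact (Polynomial.degree_le_of_natDegree_le hp).trans_lt (by exact_mod_cast Nat.lt_succ_self _)
    have h1 := congrArg (Polynomial.eval r) (Lagrange.eq_interpolate hinj hdeg)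
    rw [Lagrange.interpolate_apply, Polynomial.eval_finsetSum] at h1
    simp only [ContinuousLinearMap.smul_comp, hpe]
    rw [h1]
    refine Finset.sum_congr rfl fun i _ => ?_
    rw [Polynomial.eval_mul, Polynomial.eval_C, mul_comm]
  rw [(tubeVol_eq_integral (hA' hr) K).2]
  simp_rw [key]
  rw [integral_finsetSum _ fun i _ =>
    ((tubeVol_eq_integral (hA' (tubeNode_pos i)) K).1).const_mul _]
  rw [tubePoly, Lagrange.interpolate_apply, Polynomial.eval_finsetSum]
  refine Finset.sum_congr rfl fun i _ => ?_
  rw [Polynomial.eval_mul, Polynomial.eval_C, mul_comm, integral_const_mul,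
    (tubeVol_eq_integral (hA' (tubeNode_pos i)) K).2]

end TubePolynomial

section TubeContinuity

variable {V : Type*} [NormedAddCommGroup V] [InnerProductSpace ℝ V] [FiniteDimensional ℝ V]
  {B : V →L[ℝ] V}

theorem inner_id_add (hB : ∀ v, inner ℝ v (B v) = 0) (v : V) :
    inner ℝ v ((ContinuousLinearMap.id ℝ V + B) v) = ‖v‖ ^ 2 := by
  rw [_root_.add_apply, ContinuousLinearMap.id_apply, inner_add_right, hB,
    real_inner_self_eq_norm_sq, add_zero]

theorem inner_id_add_pos (hB : ∀ v, inner ℝ v (B v) = 0) (v : V) (hv : v ≠ 0) :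
    0 < inner ℝ v ((ContinuousLinearMap.id ℝ V + B) v) := by
  rw [inner_id_add hB]
  positivity

theorem exists_isNormalAt_add (hB1 : ‖B‖ < 1) (K : ConvexBody V) (y : V) :
    ∃ p ξ, IsNormalAt K p ξ ∧ p + (ContinuousLinearMap.id ℝ V + B) ξ = y := by
  set f : V → V := fun ξ => (y - B ξ) - nearest K (y - B ξ)
  have hf : ContractingWith ‖B‖₊ f := by
    refine ⟨by exact_mod_cast hB1, ?_⟩
    have h1 : LipschitzWith ‖B‖₊ fun ξ => y - B ξ := by
      simpa using (LipschitzWith.const y).sub B.lipschitz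
    simpa only [Function.comp_def, one_mul] using (lipschitzWith_sub_nearest K).comp h1
  obtain ⟨ξ, hξ⟩ : ∃ ξ, f ξ = ξ := ⟨_, hf.fixedPoint_isFixedPt⟩
  refine ⟨nearest K (y - B ξ), ξ, ?_, ?_⟩
  · have := isNormalAt_nearest K (y - B ξ)
    rwa [show y - B ξ - nearest K (y - B ξ) = ξ from hξ] at this
  · have : (ContinuousLinearMap.id ℝ V + B) ξ = ξ + B ξ := rfl
    rw [this, ← add_assoc]
    nth_rewrite 2 [← hξ]
    simp [f]

theorem IsNormalAt.inner_le_of_dist_lt {K L : ConvexBody V} {ε : ℝ} (h : dist K L < ε) {p ξ q : V}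
    (hp : IsNormalAt K p ξ) (hq : q ∈ L) : inner ℝ ξ (q - p) ≤ ε * ‖ξ‖ := by
  obtain ⟨x, hx, hxq⟩ : ∃ x ∈ (K : Set V), dist q x < ε :=
    Metric.exists_dist_lt_of_hausdorffDist_lt hq (by
      rw [Metric.hausdorffDist_comm]; exact h)
      (Metric.hausdorffEDist_ne_top_of_nonempty_of_bounded L.nonempty K.nonempty L.isBounded
        K.isBounded)
  have h1 := hp.2 x hx
  have h2 := real_inner_le_norm ξ (q - x)
  rw [← dist_eq_norm] at h2
  have h3 : q - p = (q - x) + (x - p) := by abel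
  rw [h3, inner_add_right]
  nlinarith [norm_nonneg ξ]

theorem IsNormalAt.norm_sub_le (hB : ∀ v, inner ℝ v (B v) = 0) {K L : ConvexBody V} {δ : ℝ}
    (hδ : 0 < δ) (hδ1 : δ ≤ 1) (h : dist K L < δ ^ 2 / 4) {p q ξ η : V} (hp : IsNormalAt K p ξ)
    (hq : IsNormalAt L q η) (hη : ‖η‖ ≤ 1) (heq : p + (ContinuousLinearMap.id ℝ V + B) ξ =
      q + (ContinuousLinearMap.id ℝ V + B) η) : ‖ξ - η‖ ≤ δ := by
  have h1 := hp.inner_le_of_dist_lt h hq.1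
  have h2 := hq.inner_le_of_dist_lt ((dist_comm L K).trans_lt h) hp.1
  have h3 : q - p = (ContinuousLinearMap.id ℝ V + B) (ξ - η) := by
    rw [map_sub, sub_eq_sub_iff_add_eq_add, ← heq, add_comm]
  have h4 := inner_id_add hB (ξ - η)
  rw [← h3, inner_sub_left] at h4
  rw [← neg_sub q p, inner_neg_right] at h2
  have h5 : ‖ξ‖ ≤ ‖ξ - η‖ + ‖η‖ := by simpa using norm_add_le (ξ - η) η
  have h6 : ‖ξ - η‖ ^ 2 ≤ δ ^ 2 / 4 * (2 + ‖ξ - η‖) := by nlinarith [norm_nonneg ξ]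
  have h7 := norm_nonneg (ξ - η)
  by_contra hlt
  push Not at hlt
  have h8 : δ ^ 2 < ‖ξ - η‖ ^ 2 := by gcongr
  have h9 : δ ^ 2 ≤ ‖ξ - η‖ := by nlinarith
  nlinarith [mul_le_mul_of_nonneg_right h9 h7]

theorem mem_tube_smul {A : V →L[ℝ] V} {K : ConvexBody V} {s : ℝ} (hs : 0 < s) {y : V} :
    y ∈ tube (s • A) K ↔ ∃ p ξ, IsNormalAt K p ξ ∧ ‖ξ‖ ≤ s ∧ p + A ξ = y := by
  constructor
  · rintro ⟨⟨p, ξ⟩, ⟨h1, h2⟩, rfl⟩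
    refine ⟨p, s • ξ, ⟨h1.1, fun x hx => ?_⟩, ?_, ?_⟩
    · rw [real_inner_smul_left]
      exact mul_nonpos_of_nonneg_of_nonpos hs.le (h1.2 x hx)
    · rw [norm_smul, Real.norm_of_nonneg hs.le]
      exact mul_le_of_le_one_right hs.le h2
    · simp
  · rintro ⟨p, ξ, h1, h2, rfl⟩
    refine ⟨(p, s⁻¹ • ξ), ⟨⟨h1.1, fun x hx => ?_⟩, ?_⟩, ?_⟩
    · simp only
      rw [real_inner_smul_left]
      exact mul_nonpos_of_nonneg_of_nonpos (inv_pos.2 hs).le (h1.2 x hx)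
    · simp only
      rw [norm_smul, Real.norm_of_nonneg (inv_pos.2 hs).le, inv_mul_le_one₀ hs]
      exact h2
    · simp only [_root_.smul_apply, map_smul]
      rw [inv_smul_smul₀ hs.ne']

theorem tube_subset_tube (hB : ∀ v, inner ℝ v (B v) = 0) (hB1 : ‖B‖ < 1) {K L : ConvexBody V}
    {δ : ℝ} (hδ : 0 < δ) (hδ1 : δ ≤ 1) (h : dist K L < δ ^ 2 / 4) {s : ℝ} (hs : 0 < s)
    (hs1 : s ≤ 1) : tube (s • (ContinuousLinearMap.id ℝ V + B)) L ⊆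
      tube ((s + δ) • (ContinuousLinearMap.id ℝ V + B)) K := by
  intro y hy
  obtain ⟨q, η, hq, hη, hqy⟩ := (mem_tube_smul hs).1 hy
  obtain ⟨p, ξ, hp, hpy⟩ := exists_isNormalAt_add hB1 K y
  refine (mem_tube_smul (by positivity)).2 ⟨p, ξ, hp, ?_, hpy⟩
  have h1 := hp.norm_sub_le hB hδ hδ1 h hq (hη.trans hs1) (hpy.trans hqy.symm)
  have h5 : ‖ξ‖ ≤ ‖ξ - η‖ + ‖η‖ := by simpa using norm_add_le (ξ - η) η
  linarith

variable [MeasurableSpace V] [BorelSpace V]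

theorem continuous_tubeVol (hB : ∀ v, inner ℝ v (B v) = 0) (hB1 : ‖B‖ < 1) :
    Continuous (tubeVol (ContinuousLinearMap.id ℝ V + B)) := by
  set A := ContinuousLinearMap.id ℝ V + B with hAdef
  have hA := inner_id_add_pos hB
  refine continuous_iff_continuousAt.2 fun K => Metric.tendsto_nhds.2 fun ε hε => ?_
  obtain ⟨δ₀, hδ₀, hP⟩ := Metric.continuousAt_iff.1
    ((tubePoly A K).continuous.continuousAt (x := 1)) ε hε
  set δ := min (δ₀ / 2) (1 / 2)
  have hδ : 0 < δ := by positivity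
  have hδ1 : δ ≤ 1 / 2 := min_le_right _ _
  have hδ2 : δ < δ₀ := (min_le_left _ _).trans_lt (by linarith)
  have hmono : ∀ {S T : V →L[ℝ] V} {L M : ConvexBody V}, tube S L ⊆ tube T M →
      tubeVol S L ≤ tubeVol T M := fun {S T L M} h =>
    measureReal_mono h (isCompact_tube T M).measure_lt_top.ne
  have h1 : ∀ L, tubeVol ((1 : ℝ) • A) L = tubeVol A L := fun L => by rw [one_smul]
  filter_upwards [Metric.ball_mem_nhds K (show 0 < δ ^ 2 / 4 by positivity)] with L hL
  have hLK : dist L K < δ ^ 2 / 4 := hL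
  have hKL : dist K L < δ ^ 2 / 4 := (dist_comm K L).trans_lt hL
  have hup := hmono (tube_subset_tube hB hB1 hδ (by linarith) hKL one_pos le_rfl)
  have hlo := hmono (tube_subset_tube hB hB1 hδ (by linarith) hLK
    (show 0 < 1 - δ by linarith) (by linarith))
  rw [sub_add_cancel, ← hAdef, h1, ← eval_tubePoly hA K (by linarith)] at hlo
  rw [← hAdef, h1, ← eval_tubePoly hA K (by linarith)] at hup
  have e1 := hP (x := 1 + δ) (by rw [Real.dist_eq, add_sub_cancel_left, abs_of_pos hδ]; exact hδ2)
  have e2 := hP (x := 1 - δ) (by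
    rw [Real.dist_eq, sub_sub_cancel_left, abs_neg, abs_of_pos hδ]; exact hδ2)
  rw [eval_tubePoly hA K one_pos, h1, Real.dist_eq, abs_lt] at e1 e2
  rw [Real.dist_eq, abs_lt]
  constructor <;> linarith [e1.1, e1.2, e2.1, e2.2]

end TubeContinuity

section TubeCoefficients

variable {V : Type*} [NormedAddCommGroup V] [InnerProductSpace ℝ V] [FiniteDimensional ℝ V]

theorem continuous_dilate {t : ℝ} (ht : 0 ≤ t) :
    Continuous (ConvexBody.dilate t : ConvexBody V → ConvexBody V) := by
  refine (LipschitzWith.of_dist_le_mul (K := ⟨t, ht⟩) fun K L => ?_).continuous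
  refine dist_le_of_suppFn (mul_nonneg ht dist_nonneg) fun u => ?_
  rw [suppFn_dilate ht, suppFn_dilate ht, ← mul_sub, abs_mul, abs_of_nonneg ht, mul_assoc]
  exact mul_le_mul_of_nonneg_left (abs_suppFn_sub_le K L u) ht

theorem CVal.sum {ι : Type*} (s : Finset ι) {f : ι → ConvexBody V → ℝ} (c : ι → ℝ)
    (h : ∀ i, CVal (f i)) : CVal fun K => ∑ i ∈ s, c i * f i K := by
  classical
  induction s using Finset.induction_on with
  | empty =>
    refine ⟨fun K L M I _ _ => ?_, ?_, fun K x => ?_⟩ <;> simp [continuous_const]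
  | insert a s ha ih =>
    simp only [Finset.sum_insert ha]
    exact ((h a).const_mul (c a)).add ih

variable [MeasurableSpace V] [BorelSpace V]

theorem CVal.tubeVol_smul {B : V →L[ℝ] V} (hB : ∀ v, inner ℝ v (B v) = 0) (hB1 : ‖B‖ < 1) {s : ℝ}
    (hs : 0 < s) : CVal (_root_.tubeVol (s • (ContinuousLinearMap.id ℝ V + B))) := by
  refine ⟨isValuation_tubeVol fun v hv => ?_, ?_, transInv_tubeVol _⟩
  · rw [_root_.smul_apply, real_inner_smul_right]
    exact mul_pos hs (inner_id_add_pos hB v hv)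
  · have h := ((continuous_tubeVol hB hB1).comp
      (continuous_dilate (V := V) (inv_pos.2 hs).le)).const_mul (s ^ Module.finrank ℝ V)
    convert h using 2 with K
    rw [Function.comp_apply, tubeVol_dilate _ _ (inv_pos.2 hs), inv_inv, ← mul_assoc, ← mul_pow,
      mul_inv_cancel₀ hs.ne', one_pow, one_mul]

/-- The part of degree `k` of the tube volume. -/
def tubeCoeff (k : ℕ) (A : V →L[ℝ] V) (K : ConvexBody V) : ℝ :=
  (tubePoly A K).coeff (Module.finrank ℝ V - k)

theorem tubeCoeff_eq_sum (k : ℕ) (A : V →L[ℝ] V) : ∃ (s : Finset ℕ) (c : ℕ → ℝ),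
    tubeCoeff k A = fun K => ∑ i ∈ s, c i * tubeVol (tubeNode i • A) K := by
  refine ⟨Finset.range (Module.finrank ℝ V + 1), fun i =>
    (Lagrange.basis (Finset.range (Module.finrank ℝ V + 1)) tubeNode i).coeff
      (Module.finrank ℝ V - k), ?_⟩
  funext K
  rw [tubeCoeff, tubePoly, Lagrange.interpolate_apply, Polynomial.finsetSum_coeff]
  refine Finset.sum_congr rfl fun i _ => ?_
  rw [Polynomial.coeff_C_mul, mul_comm]

theorem CVal.tubeCoeff (k : ℕ) {B : V →L[ℝ] V} (hB : ∀ v, inner ℝ v (B v) = 0) (hB1 : ‖B‖ < 1) :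
    CVal (_root_.tubeCoeff k (ContinuousLinearMap.id ℝ V + B)) := by
  obtain ⟨s, c, h⟩ := tubeCoeff_eq_sum k (ContinuousLinearMap.id ℝ V + B)
  rw [h]
  exact CVal.sum s c fun i => CVal.tubeVol_smul hB hB1 (tubeNode_pos i)

theorem presBy_tubeCoeff (k : ℕ) {A : V →L[ℝ] V} {u : V ≃ₗᵢ[ℝ] V} (h : ∀ x, u (A x) = A (u x)) :
    PresBy (tubeCoeff k A) u := by
  obtain ⟨s, c, h'⟩ := tubeCoeff_eq_sum k A
  rw [h']
  intro K
  refine Finset.sum_congr rfl fun i _ => ?_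
  rw [presBy_tubeVol (A := tubeNode i • A) (u := u) fun x => by
    rw [_root_.smul_apply, _root_.smul_apply, map_smul, h]]

theorem homog_tubeCoeff {k : ℕ} (hk : k ≤ Module.finrank ℝ V) {A : V →L[ℝ] V}
    (hA : ∀ v, v ≠ 0 → 0 < inner ℝ v (A v)) : Homog k (tubeCoeff k A) := by
  intro K t ht
  have h : tubePoly A (ConvexBody.dilate t K) =
      Polynomial.C (t ^ Module.finrank ℝ V) *
        (tubePoly A K).comp (Polynomial.C t⁻¹ * Polynomial.X) := by
    refine Polynomial.eq_of_infinite_eval_eq _ _ ((Set.Ioi_infinite (0 : ℝ)).mono fun r hr => ?_)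
    have hr : 0 < r := hr
    rw [Set.mem_ofPred_eq, Polynomial.eval_mul, Polynomial.eval_C, Polynomial.eval_comp,
      Polynomial.eval_mul, Polynomial.eval_C, Polynomial.eval_X, eval_tubePoly hA _ hr,
      eval_tubePoly hA _ (mul_pos (inv_pos.2 ht) hr), tubeVol_dilate _ _ ht, smul_smul]
  rw [tubeCoeff, tubeCoeff, h, Polynomial.coeff_C_mul, Polynomial.comp_C_mul_X_coeff]
  obtain ⟨m, hm⟩ := Nat.exists_eq_add_of_le hk
  rw [hm, Nat.add_sub_cancel_left, pow_add, inv_pow]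
  field_simp

end TubeCoefficients

section ProductScaling

theorem coeff_eq_of_tendsto {p : Polynomial ℝ} {m : ℕ} {L : ℝ}
    (h : Filter.Tendsto (fun r : ℝ => p.eval r / r ^ m) (nhdsWithin 0 (Set.Ioi 0)) (nhds L)) :
    p.coeff m = L := by
  have hc : ∀ q : Polynomial ℝ, Filter.Tendsto (fun r : ℝ => q.eval r) (nhdsWithin 0 (Set.Ioi 0))
      (nhds (q.coeff 0)) := fun q => by
    rw [Polynomial.coeff_zero_eq_eval_zero]
    exact q.continuous.continuousAt.tendsto.mono_left nhdsWithin_le_nhds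
  induction m generalizing p with
  | zero => exact tendsto_nhds_unique (hc p) (by simpa using h)
  | succ m ih =>
    have h0 : p.coeff 0 = 0 := by
      have h1 := h.mul (((continuous_pow (M := ℝ) (m + 1)).tendsto 0).mono_left
        (nhdsWithin_le_nhds (s := Set.Ioi 0)))
      rw [zero_pow m.succ_ne_zero, mul_zero] at h1
      refine tendsto_nhds_unique ((hc p).congr' ?_) h1
      filter_upwards [self_mem_nhdsWithin] with r hr
      have hr : 0 < r := hr
      field_simp
    rw [← Polynomial.coeff_divX]
    refine ih (h.congr' ?_)
    filter_upwards [self_mem_nhdsWithin] with r hr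
    have hr : 0 < r := hr
    have h2 := congrArg (Polynomial.eval r) p.divX_mul_X_add
    rw [h0, map_zero, add_zero, Polynomial.eval_mul, Polynomial.eval_X] at h2
    rw [← h2, pow_succ]
    field_simp

variable {V E F : Type*} [NormedAddCommGroup V] [InnerProductSpace ℝ V] [FiniteDimensional ℝ V]
  [MeasurableSpace V] [BorelSpace V]
  [NormedAddCommGroup E] [InnerProductSpace ℝ E] [FiniteDimensional ℝ E]
  [MeasurableSpace E] [BorelSpace E]
  [NormedAddCommGroup F] [InnerProductSpace ℝ F] [FiniteDimensional ℝ F]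
  [MeasurableSpace F] [BorelSpace F]

theorem exists_euclVol_prod (E F : Type*)
    [NormedAddCommGroup E] [InnerProductSpace ℝ E] [FiniteDimensional ℝ E]
    [MeasurableSpace E] [BorelSpace E]
    [NormedAddCommGroup F] [InnerProductSpace ℝ F] [FiniteDimensional ℝ F]
    [MeasurableSpace F] [BorelSpace F] : ∃ c : ℝ, 0 < c ∧ ∀ (S : Set E) (T : Set F),
      (euclVol (WithLp 2 (E × F))).real (WithLp.toLp 2 '' (S ×ˢ T)) =
        c * ((euclVol E).real S * (euclVol F).real T) := by
  set e := WithLp.prodContinuousLinearEquiv 2 ℝ E F with he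
  set μ := (euclVol (WithLp 2 (E × F))).map e with hμ
  have : μ.IsAddHaarMeasure := e.isAddHaarMeasure_map _
  set ν := (euclVol E).prod (euclVol F) with hν
  have h := Measure.isAddLeftInvariant_eq_smul μ ν
  set c := Measure.addHaarScalarFactor μ ν
  refine ⟨c, Measure.addHaarScalarFactor_pos_of_isAddHaarMeasure μ ν, fun S T => ?_⟩
  have h1 : μ (S ×ˢ T) = euclVol (WithLp 2 (E × F)) (WithLp.toLp 2 '' (S ×ˢ T)) := by
    have h2 := e.toHomeomorph.toMeasurableEquiv.map_apply (μ := euclVol (WithLp 2 (E × F)))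
      (S ×ˢ T)
    rw [hμ]
    refine h2.trans (congrArg _ ?_)
    exact (e.toEquiv.image_symm_eq_preimage _).symm
  rw [Measure.real, ← h1, h, Measure.smul_apply, hν, Measure.prod_prod, ENNReal.smul_def, smul_eq_mul,
    ENNReal.toReal_mul, ENNReal.toReal_mul]
  rfl

/-- The orthogonal sum of two linear isometries with orthogonal ranges. -/
def sumIso (i : E →ₗᵢ[ℝ] V) (j : F →ₗᵢ[ℝ] V) (h : ∀ a b, inner ℝ (i a) (j b) = 0) :
    WithLp 2 (E × F) →ₗᵢ[ℝ] V where
  toLinearMap := (i.toLinearMap.coprod j.toLinearMap) ∘ₗ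
    (WithLp.linearEquiv 2 ℝ (E × F)).toLinearMap
  norm_map' x := by
    change ‖i x.fst + j x.snd‖ = ‖x‖
    rw [← sq_eq_sq₀ (norm_nonneg _) (norm_nonneg _), WithLp.prod_norm_sq_eq_of_L2,
      norm_add_sq_real, h, i.norm_map, j.norm_map]
    ring

theorem euclVol_image_sumIso (i : E →ₗᵢ[ℝ] V) (j : F →ₗᵢ[ℝ] V)
    (h : ∀ a b, inner ℝ (i a) (j b) = 0)
    (hd : Module.finrank ℝ V = Module.finrank ℝ E + Module.finrank ℝ F) (S : Set E) (T : Set F) :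
    (euclVol V).real ((fun z : E × F => i z.1 + j z.2) '' (S ×ˢ T)) =
      (euclVol (WithLp 2 (E × F))).real (WithLp.toLp 2 '' (S ×ˢ T)) := by
  have hd' : Module.finrank ℝ (WithLp 2 (E × F)) = Module.finrank ℝ V := by
    rw [hd, ← Module.finrank_prod]
    exact (WithLp.linearEquiv 2 ℝ (E × F)).finrank_eq
  have h1 : (fun z : E × F => i z.1 + j z.2) '' (S ×ˢ T) =
      sumIso i j h '' (WithLp.toLp 2 '' (S ×ˢ T)) := by
    rw [Set.image_image]
    rfl
  rw [h1, Measure.real, Measure.real, euclVol, euclVol, ← hd',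
    (sumIso i j h).isometry.hausdorffMeasure_image (Or.inl (Nat.cast_nonneg _))]

theorem exists_euclVol_image_prod (V E F : Type*)
    [NormedAddCommGroup V] [InnerProductSpace ℝ V] [FiniteDimensional ℝ V]
    [MeasurableSpace V] [BorelSpace V]
    [NormedAddCommGroup E] [InnerProductSpace ℝ E] [FiniteDimensional ℝ E]
    [MeasurableSpace E] [BorelSpace E]
    [NormedAddCommGroup F] [InnerProductSpace ℝ F] [FiniteDimensional ℝ F]
    [MeasurableSpace F] [BorelSpace F]
    (hd : Module.finrank ℝ V = Module.finrank ℝ E + Module.finrank ℝ F) : ∃ c : ℝ, 0 < c ∧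
      ∀ (i : E →ₗᵢ[ℝ] V) (j : F →ₗᵢ[ℝ] V), (∀ a b, inner ℝ (i a) (j b) = 0) →
      ∀ (A : V →L[ℝ] V) (D : V →ₗ[ℝ] V), (∀ a, D (i a) = i a) → (∀ b, D (j b) = A (j b)) →
      ∀ (S : Set E) (T : Set F), (euclVol V).real ((fun z : E × F => i z.1 + A (j z.2)) '' (S ×ˢ T)) =
        c * |LinearMap.det D| * ((euclVol E).real S * (euclVol F).real T) := by
  obtain ⟨c, hc, h⟩ := exists_euclVol_prod E F
  refine ⟨c, hc, fun i j hij A D hDi hDj S T => ?_⟩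
  have h1 : (fun z : E × F => i z.1 + A (j z.2)) '' (S ×ˢ T) =
      D '' ((fun z : E × F => i z.1 + j z.2) '' (S ×ˢ T)) := by
    rw [Set.image_image]
    simp only [map_add, hDi, hDj]
  rw [h1, Measure.real, Measure.addHaar_image_linearMap, ENNReal.toReal_mul,
    ENNReal.toReal_ofReal (abs_nonneg _), mul_right_comm, ← h, ← euclVol_image_sumIso i j hij hd,
    mul_comm]
  rfl

end ProductScaling

section FlatEvaluation

variable {V E F : Type*} [NormedAddCommGroup V] [InnerProductSpace ℝ V] [FiniteDimensional ℝ V]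
  [NormedAddCommGroup E] [InnerProductSpace ℝ E] [FiniteDimensional ℝ E]
  [NormedAddCommGroup F] [InnerProductSpace ℝ F] [FiniteDimensional ℝ F]

theorem exists_splitting (hd : Module.finrank ℝ V = Module.finrank ℝ E + Module.finrank ℝ F)
    {i : E →ₗᵢ[ℝ] V} {j : F →ₗᵢ[ℝ] V} (h : ∀ a b, inner ℝ (i a) (j b) = 0) {A : V →L[ℝ] V}
    (hA : ∀ v, v ≠ 0 → 0 < inner ℝ v (A v)) :
    ∃ L : V →L[ℝ] E × F, ∀ v, i (L v).1 + A (j (L v).2) = v := by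
  set G : E × F →ₗ[ℝ] V := i.toLinearMap.coprod ((A : V →ₗ[ℝ] V) ∘ₗ j.toLinearMap)
  have hG : ∀ z, G z = i z.1 + A (j z.2) := fun z => rfl
  have hinj : Function.Injective G := by
    refine (injective_iff_map_eq_zero G).2 fun z hz => ?_
    rw [hG] at hz
    have h2 : z.2 = 0 := by
      by_contra hne
      have h3 := hA (j z.2) fun h0 => hne (j.injective (by rw [h0, map_zero]))
      rw [eq_neg_of_add_eq_zero_right hz, inner_neg_right, real_inner_comm, h, neg_zero] at h3
      exact lt_irrefl _ h3
    rw [h2, map_zero, map_zero, add_zero] at hz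
    exact Prod.ext (i.injective (hz.trans (map_zero i).symm)) h2
  set e := LinearEquiv.ofInjectiveOfFinrankEq G hinj (by rw [Module.finrank_prod, hd])
  refine ⟨LinearMap.toContinuousLinearMap e.symm.toLinearMap, fun v => ?_⟩
  exact (hG _).symm.trans (e.apply_symm_apply v)

theorem mem_frontier_of_isNormalAt {i : E →ₗᵢ[ℝ] V} {j : F →ₗᵢ[ℝ] V}
    (h : ∀ a b, inner ℝ (i a) (j b) = 0) {K : ConvexBody V} {a g : E} {f : F}
    (hn : IsNormalAt K (i a) (i g + j f)) (hg : g ≠ 0) : a ∈ frontier (i ⁻¹' (K : Set V)) := by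
  refine ⟨subset_closure hn.1, fun hint => ?_⟩
  have hc : Filter.Tendsto (fun t : ℝ => a + t • g) (nhdsWithin 0 (Set.Ioi 0)) (nhds a) := by
    have : Continuous fun t : ℝ => a + t • g := by fun_prop
    simpa using (this.tendsto 0).mono_left (nhdsWithin_le_nhds (s := Set.Ioi 0))
  obtain ⟨t, ht, ht0⟩ := ((hc.eventually (p := fun x => x ∈ i ⁻¹' (K : Set V))
    (mem_interior_iff_mem_nhds.1 hint)).and
    (Filter.eventually_of_mem self_mem_nhdsWithin fun t (ht : t ∈ Set.Ioi (0 : ℝ)) => ht)).exists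
  have h1 := hn.2 (i (a + t • g)) ht
  rw [map_add, add_sub_cancel_left, map_smul, real_inner_smul_right, inner_add_left,
    real_inner_comm, real_inner_comm (i g) (j f), h, add_zero, i.inner_map_map] at h1
  have : 0 < inner ℝ g g := real_inner_self_pos.2 hg
  have ht0 : 0 < t := ht0
  nlinarith [mul_pos ht0 this]

theorem tube_subset_flat (hd : Module.finrank ℝ V = Module.finrank ℝ E + Module.finrank ℝ F)
    {i : E →ₗᵢ[ℝ] V} {j : F →ₗᵢ[ℝ] V} (h : ∀ a b, inner ℝ (i a) (j b) = 0) {A : V →L[ℝ] V}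
    (hA : ∀ v, v ≠ 0 → 0 < inner ℝ v (A v)) : ∃ C : ℝ, 0 ≤ C ∧ ∀ (K : ConvexBody V),
      (K : Set V) ⊆ Set.range i → ∀ r : ℝ, 0 < r → tube (r • A) K ⊆
        (fun z : E × F => i z.1 + A (j z.2)) ''
          ((i ⁻¹' (K : Set V)) ×ˢ Metric.closedBall 0 (r * 1)) ∪
        (fun z : E × F => i z.1 + A (j z.2)) ''
          (Metric.cthickening (r * C) (frontier (i ⁻¹' (K : Set V))) ×ˢ
            Metric.closedBall 0 (r * (C + 1))) := by
  obtain ⟨L, hL⟩ := exists_splitting hd h hA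
  obtain ⟨L₁, hL₁⟩ := exists_splitting hd h (A := ContinuousLinearMap.id ℝ V)
    (fun v hv => real_inner_self_pos.2 hv)
  set R := L.comp A with hR
  refine ⟨‖R‖, R.opNorm_nonneg, fun K hK r hr y hy => ?_⟩
  obtain ⟨p, ξ, hn, hξ, rfl⟩ := (mem_tube_smul hr).1 hy
  obtain ⟨a, rfl⟩ := hK hn.1
  obtain ⟨g, f, rfl⟩ : ∃ g f, ξ = i g + j f := ⟨_, _, (hL₁ ξ).symm⟩
  have hsq : ‖i g + j f‖ ^ 2 = ‖g‖ ^ 2 + ‖f‖ ^ 2 := by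
    rw [norm_add_sq_real, h, i.norm_map, j.norm_map]
    ring
  have hg : ‖g‖ ≤ r := (pow_le_pow_iff_left₀ (norm_nonneg _) hr.le two_ne_zero).1
    (by nlinarith [norm_nonneg (i g + j f), sq_nonneg ‖f‖])
  have hf : ‖f‖ ≤ r := (pow_le_pow_iff_left₀ (norm_nonneg _) hr.le two_ne_zero).1
    (by nlinarith [norm_nonneg (i g + j f), sq_nonneg ‖g‖])
  by_cases hg0 : g = 0
  · refine Or.inl ⟨(a, f), ⟨hn.1, ?_⟩, ?_⟩
    · simpa using hf
    · simp [hg0]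
  · have hRg : ‖R (i g)‖ ≤ r * ‖R‖ := by
      refine (R.le_opNorm _).trans ?_
      rw [i.norm_map, mul_comm]
      gcongr
    refine Or.inr ⟨(a + (R (i g)).1, f + (R (i g)).2), ⟨?_, ?_⟩, ?_⟩
    · refine Metric.mem_cthickening_of_dist_le _ a _ _ (mem_frontier_of_isNormalAt h hn hg0) ?_
      simpa using (norm_fst_le _).trans hRg
    · rw [mem_closedBall_zero_iff]
      refine (norm_add_le _ _).trans ?_
      have := (norm_snd_le (R (i g))).trans hRg
      linarith
    · have := hL (A (i g))
      calc i (a + (R (i g)).1) + A (j (f + (R (i g)).2))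
          = i a + (i (R (i g)).1 + A (j (R (i g)).2)) + A (j f) := by
            simp only [map_add]
            abel
        _ = i a + A (i g) + A (j f) := congrArg (fun x => i a + x + A (j f)) this
        _ = i a + A (i g + j f) := by rw [map_add, add_assoc]

theorem flat_subset_tube {i : E →ₗᵢ[ℝ] V} {j : F →ₗᵢ[ℝ] V} (h : ∀ a b, inner ℝ (i a) (j b) = 0)
    (A : V →L[ℝ] V) {K : ConvexBody V} (hK : (K : Set V) ⊆ Set.range i) {r : ℝ} (hr : 0 < r) :
    (fun z : E × F => i z.1 + A (j z.2)) ''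
      ((i ⁻¹' (K : Set V)) ×ˢ Metric.closedBall 0 (r * 1)) ⊆ tube (r • A) K := by
  rintro _ ⟨⟨a, b⟩, ⟨ha, hb⟩, rfl⟩
  refine (mem_tube_smul hr).2 ⟨i a, j b, ⟨ha, fun x hx => ?_⟩, ?_, rfl⟩
  · obtain ⟨a', rfl⟩ := hK hx
    rw [← map_sub, real_inner_comm, h]
  · simpa using hb

variable [MeasurableSpace V] [BorelSpace V] [MeasurableSpace E] [BorelSpace E]
  [MeasurableSpace F] [BorelSpace F]

theorem euclVol_closedBall (F : Type*) [NormedAddCommGroup F] [InnerProductSpace ℝ F]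
    [FiniteDimensional ℝ F] [MeasurableSpace F] [BorelSpace F] {r s : ℝ} (hr : 0 < r) :
    (euclVol F).real (Metric.closedBall 0 (r * s)) =
      r ^ Module.finrank ℝ F * (euclVol F).real (Metric.closedBall 0 s) := by
  rw [Measure.real, Measure.addHaar_closedBall_mul_of_pos (euclVol F) 0 hr s, ENNReal.toReal_mul,
    ENNReal.toReal_ofReal (by positivity)]
  rfl

theorem exists_tubeCoeff_eq (V E F : Type*)
    [NormedAddCommGroup V] [InnerProductSpace ℝ V] [FiniteDimensional ℝ V]
    [MeasurableSpace V] [BorelSpace V]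
    [NormedAddCommGroup E] [InnerProductSpace ℝ E] [FiniteDimensional ℝ E]
    [MeasurableSpace E] [BorelSpace E]
    [NormedAddCommGroup F] [InnerProductSpace ℝ F] [FiniteDimensional ℝ F]
    [MeasurableSpace F] [BorelSpace F]
    (hd : Module.finrank ℝ V = Module.finrank ℝ E + Module.finrank ℝ F) : ∃ κ : ℝ, 0 < κ ∧
      ∀ (i : E →ₗᵢ[ℝ] V) (j : F →ₗᵢ[ℝ] V), (∀ a b, inner ℝ (i a) (j b) = 0) →
      ∀ A : V →L[ℝ] V, (∀ v, v ≠ 0 → 0 < inner ℝ v (A v)) →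
      ∀ D : V →ₗ[ℝ] V, (∀ a, D (i a) = i a) → (∀ b, D (j b) = A (j b)) →
      ∀ K : ConvexBody V, (K : Set V) ⊆ Set.range i → tubeCoeff (Module.finrank ℝ E) A K =
        κ * |LinearMap.det D| * (euclVol E).real (i ⁻¹' (K : Set V)) := by
  obtain ⟨c, hc, hvol⟩ := exists_euclVol_image_prod V E F hd
  set β := (euclVol F).real (Metric.closedBall 0 1) with hβ
  have hβ0 : 0 < β := ENNReal.toReal_pos (Metric.measure_closedBall_pos _ _ one_pos).ne'
    measure_closedBall_lt_top.ne
  refine ⟨c * β, mul_pos hc hβ0, fun i j hij A hA D hDi hDj K hK => ?_⟩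
  obtain ⟨C, hC, hsub⟩ := tube_subset_flat hd hij hA
  specialize hvol i j hij A D hDi hDj
  specialize hsub K hK
  set δ := c * |LinearMap.det D|
  set G : E × F → V := fun z => i z.1 + A (j z.2)
  have hGc : Continuous G := by fun_prop
  set K₁ := i ⁻¹' (K : Set V)
  have hK₁ : IsCompact K₁ := i.isometry.isClosedEmbedding.isCompact_preimage K.isCompact
  have hK₁c : Convex ℝ K₁ := K.convex.linear_preimage i.toLinearMap
  have hfc : IsCompact (frontier K₁) := hK₁.of_isClosed_subset isClosed_frontier
    hK₁.isClosed.frontier_subset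
  set v := (euclVol E).real K₁
  set w : ℝ → ℝ := fun r => (euclVol E).real (Metric.cthickening (r * C) (frontier K₁))
  have hw : Filter.Tendsto w (nhdsWithin 0 (Set.Ioi 0)) (nhds 0) := by
    have h1 := tendsto_measure_cthickening_of_isCompact (μ := euclVol E) hfc
    rw [hK₁c.addHaar_frontier (euclVol E)] at h1
    have h2 : Filter.Tendsto (fun r : ℝ => r * C) (nhdsWithin 0 (Set.Ioi 0)) (nhds 0) := by
      have : Continuous fun r : ℝ => r * C := by fun_prop
      simpa using (this.tendsto 0).mono_left (nhdsWithin_le_nhds (s := Set.Ioi 0))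
    simpa [w, Function.comp_def, Measure.real] using
      (ENNReal.tendsto_toReal ENNReal.zero_ne_top).comp (h1.comp h2)
  set β' := (euclVol F).real (Metric.closedBall 0 (C + 1))
  have hm : Module.finrank ℝ V - Module.finrank ℝ E = Module.finrank ℝ F := by omega
  refine coeff_eq_of_tendsto ?_
  rw [hm]
  have hlow : ∀ r, 0 < r → c * β * |LinearMap.det D| * v ≤
      (tubePoly A K).eval r / r ^ Module.finrank ℝ F := fun r hr => by
    rw [le_div_iff₀ (by positivity), eval_tubePoly hA K hr]
    have h1 := measureReal_mono (μ := euclVol V) (flat_subset_tube hij A hK hr)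
      (isCompact_tube (r • A) K).measure_lt_top.ne
    rw [hvol, euclVol_closedBall F hr] at h1
    refine le_trans (le_of_eq ?_) h1
    simp only [δ, v, K₁, hβ]
    ring
  have hup : ∀ r, 0 < r → (tubePoly A K).eval r / r ^ Module.finrank ℝ F ≤
      c * β * |LinearMap.det D| * v + δ * (w r * β') := fun r hr => by
    rw [div_le_iff₀ (by positivity), eval_tubePoly hA K hr]
    have hcomp : ∀ {S : Set E} (s : ℝ), IsCompact S →
        euclVol V (G '' (S ×ˢ Metric.closedBall (0 : F) s)) ≠ ⊤ := fun s hS =>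
      ((hS.prod (isCompact_closedBall _ _)).image hGc).measure_lt_top.ne
    have h1 := (measureReal_mono (μ := euclVol V) (hsub r hr)
      (measure_union_ne_top (hcomp _ hK₁) (hcomp _ hfc.cthickening))).trans
      (measureReal_union_le _ _)
    rw [hvol, hvol, euclVol_closedBall F hr, euclVol_closedBall F hr] at h1
    refine h1.trans (le_of_eq ?_)
    simp only [δ, v, w, β', hβ]
    ring
  refine tendsto_of_tendsto_of_tendsto_of_le_of_le' tendsto_const_nhds ?_
    (Filter.eventually_of_mem self_mem_nhdsWithin hlow)
    (Filter.eventually_of_mem self_mem_nhdsWithin hup)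
  simpa using ((hw.mul_const β').const_mul δ).const_add (c * β * |LinearMap.det D| * v)

end FlatEvaluation

section Determinants

theorem det_one_add_of_mapsTo {K V : Type*} [Field K] [AddCommGroup V] [Module K V]
    [FiniteDimensional K V] (U : Submodule K V) {N : V →ₗ[K] V} {c : K} (h1 : ∀ v, N v ∈ U)
    (h2 : ∀ u ∈ U, N u = c • u) : LinearMap.det (1 + N) = (1 + c) ^ Module.finrank K U := by
  have he : U ≤ U.comap (1 + N) := fun u hu => U.add_mem hu (h1 u)
  have hr : (1 + N).restrict he = (1 + c) • LinearMap.id := by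
    ext u
    change (u : V) + N u = (1 + c) • (u : V)
    rw [h2 u u.2, add_smul, one_smul]
  have hq : U.mapQ U (1 + N) he = LinearMap.id := by
    refine U.linearMap_qext (LinearMap.ext fun v => ?_)
    change U.mkQ (v + N v) = U.mkQ v
    rw [map_add, show U.mkQ (N v) = 0 from (Submodule.Quotient.mk_eq_zero U).2 (h1 v),
      add_zero]
  rw [LinearMap.det_eq_det_mul_det U (1 + N) he, hr, hq, LinearMap.det_smul, LinearMap.det_id,
    LinearMap.det_id, mul_one, mul_one]

variable {n k q : ℕ} {E F W : Submodule ℝ (Ecl n)}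

theorem inner_I_smul_isotropic (hF : IsComplexSubspace F) (hW : IsIsotropicSubspace W)
    (hFW : ∀ v ∈ F, ∀ w ∈ W, inner ℝ v w = 0) (hE : E = F ⊔ W) {w e : Ecl n} (hw : w ∈ W)
    (he : e ∈ E) : inner ℝ (Complex.I • w) e = 0 := by
  subst hE
  obtain ⟨f, hf, w', hw', rfl⟩ := Submodule.mem_sup.1 he
  rw [inner_add_right, hW w hw w' hw', inner_I_smul_left, real_inner_comm, hFW _ (hF f hf) w hw]
  simp

theorem exists_of_mem_span_complex (hF : IsComplexSubspace F) (hE : E = F ⊔ W) {x : Ecl n}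
    (hx : x ∈ Submodule.span ℂ (E : Set (Ecl n))) :
    ∃ e ∈ E, ∃ w ∈ W, x = e + Complex.I • w := by
  have hFE : F ≤ E := hE ▸ le_sup_left
  have hWE : W ≤ E := hE ▸ le_sup_right
  induction hx using Submodule.span_induction with
  | mem x hx => exact ⟨x, hx, 0, W.zero_mem, by simp⟩
  | zero => exact ⟨0, E.zero_mem, 0, W.zero_mem, by simp⟩
  | add x y _ _ hx hy =>
    obtain ⟨e, he, w, hw, rfl⟩ := hx
    obtain ⟨e', he', w', hw', rfl⟩ := hy
    exact ⟨e + e', E.add_mem he he', w + w', W.add_mem hw hw', by rw [smul_add]; abel⟩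
  | smul a x _ hx =>
    obtain ⟨e, he, w, hw, rfl⟩ := hx
    obtain ⟨f, hf, w', hw', rfl⟩ := Submodule.mem_sup.1 (hE ▸ he)
    refine ⟨a.re • (f + w') + (a.im • Complex.I • f - a.im • w),
      E.add_mem (E.smul_mem _ (E.add_mem (hFE hf) (hWE hw')))
        (E.sub_mem (E.smul_mem _ (hFE (hF f hf))) (E.smul_mem _ (hWE hw))),
      a.re • w + a.im • w', W.add_mem (W.smul_mem _ hw) (W.smul_mem _ hw'), ?_⟩
    have hI : Complex.I • Complex.I • w = -w := by
      rw [smul_smul, Complex.I_mul_I, neg_one_smul]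
    have ha : ∀ y : Ecl n, a • y = a.re • y + a.im • Complex.I • y := fun y => by
      conv_lhs => rw [← Complex.re_add_im a]
      rw [add_smul, mul_smul, Complex.coe_smul, Complex.coe_smul]
    rw [ha]
    have hr : ∀ (r : ℝ) (y : Ecl n), Complex.I • r • y = r • Complex.I • y :=
      fun r y => smul_comm _ _ _
    simp only [smul_add, hr, hI, smul_neg]
    abel

theorem finrank_span_complex (hk : Module.finrank ℝ E = k) (hF : IsComplexSubspace F)
    (hW : IsIsotropicSubspace W) (hWk : Module.finrank ℝ W = k - 2 * q)
    (hFW : ∀ v ∈ F, ∀ w ∈ W, inner ℝ v w = 0) (hE : E = F ⊔ W) (hq : q ≤ k / 2) :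
    Module.finrank ℂ (Submodule.span ℂ (E : Set (Ecl n))) = k - q := by
  set S := Submodule.span ℂ (E : Set (Ecl n)) with hS
  set J : Ecl n →ₗ[ℝ] Ecl n := (Complex.I • (LinearMap.id : Ecl n →ₗ[ℂ] Ecl n)).restrictScalars ℝ
  have hJ : ∀ x, J x = Complex.I • x := fun x => rfl
  have hJi : Function.Injective J := fun x y h => smul_right_injective _ Complex.I_ne_zero h
  have hSE : S.restrictScalars ℝ = E ⊔ W.map J := by
    apply le_antisymm
    · intro x hx
      obtain ⟨e, he, w, hw, rfl⟩ := exists_of_mem_span_complex hF hE hx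
      exact Submodule.add_mem_sup he ⟨w, hw, rfl⟩
    · refine sup_le (fun x hx => Submodule.subset_span hx) ?_
      rintro _ ⟨w, hw, rfl⟩
      exact S.smul_mem _ (Submodule.subset_span ((hE ▸ le_sup_right : W ≤ E) hw))
  have hinf : E ⊓ W.map J = ⊥ := by
    refine (Submodule.eq_bot_iff _).2 ?_
    rintro _ ⟨hx, w, hw, rfl⟩
    exact inner_self_eq_zero.1 (inner_I_smul_isotropic hF hW hFW hE hw hx)
  have h1 := Submodule.finrank_sup_add_finrank_inf_eq E (W.map J)
  rw [hinf, finrank_bot, ← hSE, hk, (Submodule.equivMapOfInjective J hJi W).symm.finrank_eq, hWk]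
    at h1
  have h2 := Module.finrank_mul_finrank ℝ ℂ S
  rw [Complex.finrank_real_complex] at h2
  have h3 : Module.finrank ℝ (S.restrictScalars ℝ) = Module.finrank ℝ S := rfl
  omega

set_option maxHeartbeats 1000000 in
theorem abs_det_of_isTypeSubspace (hE : IsTypeSubspace k q E) (hq1 : k - n ≤ q) (hq : q ≤ k / 2)
    {b : ℝ} {D : Ecl n →ₗ[ℝ] Ecl n} (hD1 : ∀ e ∈ E, D e = e)
    (hD2 : ∀ x ∈ Eᗮ, D x = x + b • Complex.I • x) :
    |LinearMap.det D| = (1 + b ^ 2) ^ (n + q - k) := by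
  obtain ⟨hk, F, W, hF, -, hW, hWk, hFW, hEFW⟩ := hE
  have hWE : W ≤ E := hEFW ▸ le_sup_right
  set S := Submodule.span ℂ (E : Set (Ecl n)) with hS
  have hES : ∀ e ∈ E, e ∈ S := fun e he => Submodule.subset_span he
  set M : Ecl n →ₗ[ℂ] Ecl n := ((b : ℂ) * Complex.I) • (Sᗮ.starProjection : Ecl n →ₗ[ℂ] Ecl n)
  have hM : ∀ x, M x = b • Complex.I • Sᗮ.starProjection x := fun x => by
    rw [← Complex.coe_smul, smul_smul]
    rfl
  have hMS : ∀ x ∈ S, M x = 0 := fun x hx => by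
    rw [hM, (Submodule.starProjection_apply_eq_zero_iff Sᗮ).2 (S.le_orthogonal_orthogonal hx),
      smul_zero, smul_zero]
  have hSperp : ∀ g ∈ Sᗮ, g ∈ Eᗮ := fun g hg e he =>
    inner_real_eq_zero (hg e (hES e he))
  have hMG : ∀ x ∈ Sᗮ, M x = ((b : ℂ) * Complex.I) • x := fun x hx => by
    rw [hM, Submodule.starProjection_eq_self_iff.2 hx, mul_smul, Complex.coe_smul]
  set N : Ecl n →ₗ[ℝ] Ecl n := D - 1 - M.restrictScalars ℝ
  have hN : ∀ x, N x = D x - x - M x := fun x => rfl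
  have hNE : ∀ e ∈ E, N e = 0 := fun e he => by rw [hN, hD1 e he, hMS e (hES e he)]; simp
  have hNG : ∀ g ∈ Sᗮ, N g = 0 := fun g hg => by
    rw [hN, hD2 g (hSperp g hg), hMG g hg, mul_smul, Complex.coe_smul]
    simp
  have hNW : ∀ v, N v ∈ W := fun v => by
    obtain ⟨e, he, x, hx, rfl⟩ := Submodule.mem_sup.1
      ((Submodule.sup_orthogonal_of_hasOrthogonalProjection (K := E)).ge (Submodule.mem_top (x := v)))
    rw [map_add, hNE e he, zero_add, hN, hD2 x hx, hM, add_sub_cancel_left, ← smul_sub, ← smul_sub]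
    have h1 : x - Sᗮ.starProjection x ∈ Sᗮᗮ := Submodule.sub_starProjection_mem_orthogonal x
    rw [S.orthogonal_orthogonal] at h1
    have h2 : x - Sᗮ.starProjection x ∈ Eᗮ :=
      Eᗮ.sub_mem hx (hSperp _ (Submodule.starProjection_apply_mem _ _))
    obtain ⟨e', he', w, hw, hxw⟩ := exists_of_mem_span_complex hF hEFW h1
    rw [hxw] at h2 ⊢
    have h3 := h2 e' he'
    rw [inner_add_right, real_inner_comm, real_inner_comm (Complex.I • w) e',
      inner_I_smul_isotropic hF hW hFW hEFW hw he', add_zero, inner_self_eq_zero] at h3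
    rw [h3, zero_add, smul_smul Complex.I, Complex.I_mul_I, neg_one_smul]
    exact W.smul_mem _ (W.neg_mem hw)
  have hDec : D = (1 + N) * (1 + M).restrictScalars ℝ := by
    ext1 v
    change D v = (v + M v) + N (v + M v)
    have : N (M v) = 0 := hNG _ (Sᗮ.smul_mem _ (Submodule.starProjection_apply_mem _ _))
    rw [map_add, this, hN]
    abel
  have hdim : Module.finrank ℂ Sᗮ = n + q - k := by
    have h1 := S.finrank_add_finrank_orthogonal
    rw [finrank_span_complex hk hF hW hWk hFW hEFW hq, finrank_euclideanSpace_fin] at h1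
    omega
  rw [hDec, map_mul, det_one_add_of_mapsTo W (c := 0) hNW
      (fun u hu => by rw [hNE u (hWE hu), zero_smul]), LinearMap.det_restrictScalars,
    det_one_add_of_mapsTo Sᗮ (fun v => Sᗮ.smul_mem _ (Submodule.starProjection_apply_mem _ _)) hMG,
    hdim, add_zero, one_pow, one_mul, map_pow, Algebra.norm_complex_apply, Complex.normSq_apply]
  simp only [Complex.add_re, Complex.one_re, Complex.mul_re, Complex.ofReal_re, Complex.I_re,
    Complex.ofReal_im, Complex.I_im, Complex.add_im, Complex.one_im, Complex.mul_im]
  rw [abs_of_nonneg (by apply pow_nonneg; nlinarith [sq_nonneg b])]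
  ring

end Determinants

section Existence

theorem exists_weights_pow_eq {n : ℕ} {v : Fin n → ℝ} (hv : Function.Injective v) (m : Fin n) :
    ∃ c : Fin n → ℝ, ∀ x : Fin n, ∑ s, c s * v s ^ (x : ℕ) = if x = m then 1 else 0 := by
  have hdet : IsUnit (Matrix.vandermonde v).det :=
    (Matrix.det_vandermonde_ne_zero_iff.2 hv).isUnit
  refine ⟨Matrix.vecMul (Pi.single m 1) (Matrix.vandermonde v)⁻¹, fun x => ?_⟩
  have h := congrFun (Matrix.vecMul_vecMul (Pi.single m 1) (Matrix.vandermonde v)⁻¹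
    (Matrix.vandermonde v)) x
  rw [Matrix.nonsing_inv_mul _ hdet, Matrix.vecMul_one, Pi.single_apply] at h
  exact h

variable {n k q : ℕ}

/-- Multiplication by the imaginary number `b * I`. -/
def mulI (n : ℕ) (b : ℝ) : Ecl n →L[ℝ] Ecl n :=
  LinearMap.toContinuousLinearMap
    ((((b : ℂ) * Complex.I) • (LinearMap.id : Ecl n →ₗ[ℂ] Ecl n)).restrictScalars ℝ)

theorem mulI_apply (b : ℝ) (x : Ecl n) : mulI n b x = b • Complex.I • x := by
  rw [← Complex.coe_smul, smul_smul]
  rfl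

theorem inner_mulI (b : ℝ) (x : Ecl n) : inner ℝ x (mulI n b x) = 0 := by
  rw [mulI_apply, real_inner_smul_right, real_inner_comm, inner_I_smul_self, mul_zero]

theorem norm_mulI_lt {b : ℝ} (h0 : 0 < b) (h1 : b < 1) : ‖mulI n b‖ < 1 := by
  refine lt_of_le_of_lt (ContinuousLinearMap.opNorm_le_bound _ h0.le fun x => ?_) h1
  rw [mulI_apply, norm_smul, norm_smul, Complex.norm_I, one_mul, Real.norm_of_nonneg h0.le]

theorem uInv_of_presBy {μ : ConvexBody (Ecl n) → ℝ}
    (h : ∀ e : Ecl n ≃ₗᵢ[ℂ] Ecl n, PresBy μ (realIso e)) : UInv μ := by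
  intro A hA K
  have hAA : A.conjTranspose * A = 1 := (Matrix.mem_unitaryGroup_iff').1 hA
  have hinner : ∀ x y, inner ℂ (Matrix.toEuclideanLin A x) (Matrix.toEuclideanLin A y) =
      inner ℂ x y := fun x y => by
    rw [← LinearMap.adjoint_inner_right, ← Matrix.toEuclideanLin_conjTranspose_eq_adjoint]
    congr 1
    rw [Matrix.toLpLin_apply, Matrix.toLpLin_apply, Matrix.mulVec_mulVec, hAA, Matrix.one_mulVec]
  set e := ((Matrix.toEuclideanLin A).isometryOfInner hinner).toLinearIsometryEquiv rfl
  rw [← h e K]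
  congr 1

theorem uInv_tubeCoeff_mulI (b : ℝ) :
    UInv (tubeCoeff k (ContinuousLinearMap.id ℝ (Ecl n) + mulI n b)) :=
  uInv_of_presBy fun e => presBy_tubeCoeff k fun x => by
    simp only [_root_.add_apply, ContinuousLinearMap.id_apply, mulI_apply, map_add, map_smul,
      realIso_apply]

theorem euclVol_preimage_isometry {V : Type*} [NormedAddCommGroup V] [InnerProductSpace ℝ V]
    [MeasurableSpace V] [BorelSpace V] (i : EuclideanSpace ℝ (Fin k) →ₗᵢ[ℝ] V) {S : Set V}
    (hS : S ⊆ Set.range i) :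
    (euclVol (EuclideanSpace ℝ (Fin k))).real (i ⁻¹' S) = (μH[(k : ℝ)] S).toReal := by
  conv_rhs => rw [← Set.image_preimage_eq_of_subset hS]
  rw [i.isometry.hausdorffMeasure_image (Or.inl (Nat.cast_nonneg k)), Measure.real, euclVol,
    finrank_euclideanSpace_fin]

/-- An isometry from the model euclidean space onto a given subspace. -/
theorem exists_isometry_range_eq {V : Type*} [NormedAddCommGroup V] [InnerProductSpace ℝ V]
    [FiniteDimensional ℝ V] (E : Submodule ℝ V) (hE : Module.finrank ℝ E = k) :
    ∃ i : EuclideanSpace ℝ (Fin k) →ₗᵢ[ℝ] V, Set.range i = E := by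
  refine ⟨E.subtypeₗᵢ.comp
    ((stdOrthonormalBasis ℝ E).reindex (finCongr hE)).repr.symm.toLinearIsometry, ?_⟩
  ext x
  constructor
  · rintro ⟨y, rfl⟩
    exact Submodule.coe_mem _
  · intro hx
    exact ⟨((stdOrthonormalBasis ℝ E).reindex (finCongr hE)).repr ⟨x, hx⟩, by simp⟩

theorem exists_tubeCoeff_mulI_eq (hk : k ≤ 2 * n) : ∃ κ : ℝ, 0 < κ ∧ ∀ b : ℝ,
    ∀ q : ℕ, k - n ≤ q → q ≤ k / 2 → ∀ E : Submodule ℝ (Ecl n), IsTypeSubspace k q E →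
      ∀ K : ConvexBody (Ecl n), (K : Set (Ecl n)) ⊆ E →
        tubeCoeff k (ContinuousLinearMap.id ℝ (Ecl n) + mulI n b) K =
          κ * (1 + b ^ 2) ^ (n + q - k) * (μH[(k : ℝ)] (K : Set (Ecl n))).toReal := by
  obtain ⟨κ, hκ, h⟩ := exists_tubeCoeff_eq (Ecl n) (EuclideanSpace ℝ (Fin k))
    (EuclideanSpace ℝ (Fin (2 * n - k)))
    (by rw [finrank_ecl, finrank_euclideanSpace_fin, finrank_euclideanSpace_fin]; omega)
  rw [finrank_euclideanSpace_fin] at h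
  refine ⟨κ, hκ, fun b q hq1 hq2 E hE K hK => ?_⟩
  obtain ⟨i, hi⟩ := exists_isometry_range_eq E hE.1
  obtain ⟨j, hj⟩ := exists_isometry_range_eq (k := 2 * n - k) Eᗮ (by
    have := E.finrank_add_finrank_orthogonal
    rw [hE.1, finrank_ecl] at this
    omega)
  have hiE : ∀ a, i a ∈ E := fun a => hi.subset ⟨a, rfl⟩
  have hjE : ∀ a, j a ∈ Eᗮ := fun a => hj.subset ⟨a, rfl⟩
  set D : Ecl n →ₗ[ℝ] Ecl n :=
    LinearMap.id + (mulI n b : Ecl n →ₗ[ℝ] Ecl n) ∘ₗ (Eᗮ.starProjection : Ecl n →ₗ[ℝ] Ecl n)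
  have hD : ∀ x, D x = x + mulI n b (Eᗮ.starProjection x) := fun x => rfl
  have hD1 : ∀ e ∈ E, D e = e := fun e he => by
    rw [hD, (Submodule.starProjection_apply_eq_zero_iff Eᗮ).2 (E.le_orthogonal_orthogonal he),
      map_zero, add_zero]
  have hD2 : ∀ x ∈ Eᗮ, D x = x + mulI n b x := fun x hx => by
    rw [hD, Submodule.starProjection_eq_self_iff.2 hx]
  rw [h i j (fun a c => Submodule.inner_right_of_mem_orthogonal (hiE a) (hjE c)) _
    (inner_id_add_pos (inner_mulI b)) D (fun a => hD1 _ (hiE a)) (fun c => hD2 _ (hjE c)) K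
    (hi ▸ hK), abs_det_of_isTypeSubspace hE hq1 hq2 hD1 (fun x hx => by rw [hD2 x hx, mulI_apply]),
    euclVol_preimage_isometry i (hi ▸ hK)]

theorem exists_hermKlainCond (hk : k ≤ 2 * n) (hq1 : k - n ≤ q) (hq2 : q ≤ k / 2) :
    ∃ μ : ConvexBody (Ecl n) → ℝ, CVal μ ∧ UInv μ ∧ Homog k μ ∧ HermKlainCond k q μ := by
  obtain ⟨κ, hκ, h⟩ := exists_tubeCoeff_mulI_eq hk
  let b : Fin (n + 1) → ℝ := fun s => ((s : ℝ) + 2)⁻¹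
  have hb0 : ∀ s, 0 < b s := fun s => by positivity
  have hb1 : ∀ s, b s < 1 := fun s => inv_lt_one_of_one_lt₀ (by
    have : (0 : ℝ) ≤ (s : ℕ) := Nat.cast_nonneg _
    linarith)
  have hinj : Function.Injective fun s => 1 + b s ^ 2 := fun s t hst => by
    have h1 : b s = b t := (pow_left_inj₀ (hb0 s).le (hb0 t).le two_ne_zero).1 (add_left_cancel hst)
    have h2 : (s : ℝ) + 2 = (t : ℝ) + 2 := inv_injective h1
    exact Fin.ext (by exact_mod_cast add_right_cancel h2)
  obtain ⟨c, hc⟩ := exists_weights_pow_eq hinj ⟨n + q - k, by omega⟩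
  let f : Fin (n + 1) → ConvexBody (Ecl n) → ℝ := fun s =>
    tubeCoeff k (ContinuousLinearMap.id ℝ (Ecl n) + mulI n (b s))
  refine ⟨fun K => ∑ s, (κ⁻¹ * c s) * f s K, CVal.sum _ _ fun s =>
    CVal.tubeCoeff k (inner_mulI _) (norm_mulI_lt (hb0 s) (hb1 s)), fun A hA K => ?_,
    fun K t ht => ?_, fun q' h1 h2 E hE K hK => ?_⟩
  · exact Finset.sum_congr rfl fun s _ => congrArg _ (uInv_tubeCoeff_mulI (b s) A hA K)
  · beta_reduce
    rw [Finset.mul_sum]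
    refine Finset.sum_congr rfl fun s _ => ?_
    have h1 : f s (ConvexBody.dilate t K) = t ^ k * f s K :=
      homog_tubeCoeff (hk.trans_eq finrank_ecl.symm) (inner_id_add_pos (inner_mulI (b s))) K t ht
    rw [h1]
    ring
  · have hc' := hc ⟨n + q' - k, by omega⟩
    have hiff : ((⟨n + q' - k, by omega⟩ : Fin (n + 1)) = ⟨n + q - k, by omega⟩) ↔ q' = q := by
      rw [Fin.mk.injEq]
      omega
    simp only [hiff] at hc'
    have hs : ∀ s, (κ⁻¹ * c s) * f s K =
        (μH[(k : ℝ)] (K : Set (Ecl n))).toReal * (c s * (1 + b s ^ 2) ^ (n + q' - k)) := fun s => by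
      simp only [f]
      rw [h (b s) q' h1 h2 E hE K hK]
      field_simp
    simp only [hs]
    rw [← Finset.mul_sum, hc', mul_ite, mul_one, mul_zero]

end Existence

/-- **Existence and uniqueness of the hermitian intrinsic volumes.** For
`max(0, k−n) ≤ q ≤ ⌊k/2⌋ ≤ n` there is a unique continuous, translation invariant,
`U(n)`-invariant valuation `μ_{k,q}` on `ℂⁿ`, homogeneous of degree `k`, whose restriction
to convex bodies inside any subspace of type `(k,q')` is `δ_{qq'}` times the
`k`-dimensional Hausdorff measure. -/
theorem hermitian_intrinsic_volume_exists_unique (n k q : ℕ) (hn : 1 ≤ n) (hk : k ≤ 2 * n)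
    (hq1 : k - n ≤ q) (hq2 : q ≤ k / 2) :
    ∃! μ : ConvexBody (Ecl n) → ℝ,
      (IsValuation μ ∧ Continuous μ ∧ TransInv μ ∧ UInv μ ∧ Homog k μ) ∧
        HermKlainCond k q μ := by
  obtain ⟨μ, hμ, hU, hH, hK⟩ := exists_hermKlainCond hk hq1 hq2
  refine ⟨μ, ⟨⟨hμ.val, hμ.cont, hμ.trans, hU, hH⟩, hK⟩, ?_⟩
  rintro ν ⟨⟨h1, h2, h3, h4, h5⟩, h6⟩
  exact hermKlain_unique hk ⟨h1, h2, h3⟩ hμ h4 hU h5 hH h6 hK
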